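/- Let (u, p) be a weak solution of the HHMO model with u* < Ψ(α), and assume p satisfies condition (P). Then for every γ ≥ 0 the following statements are equivalent: (i) lim_{x→∞} (1/x)·∫₀ˣ ξ²·p*(ξ) dξ = γ; (ii) lim_{x→∞} x·∫_x^∞ p*(ξ) dξ = γ; (iii) u converges uniformly to Φ_γ, with Φ_γ(α) = u* if γ > 0 and 0 < Φ_γ(α) ≤ u* if γ = 0. Moreover, these statements hold for some γ ≥ 0 if and only if (iv) there exists a function V such that u(η√t, t) → V(η) as t → ∞ for almost every η ≥ 0. -/

import Mathlib

open MeasureTheory Filter Set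

noncomputable section

/-- The precipitation-free self-similar solution `ψ(x,t)`. -/
def psi (α β x t : ℝ) : ℝ :=
  if 0 < t then
    (α * β / 2) * Real.exp (α ^ 2 / 4) *
      ∫ ζ in Set.Ioi (max (|x| / Real.sqrt t) α), Real.exp (-ζ ^ 2 / 4)
  else 0

/-- The profile `Ψ(η)` in similarity coordinates. -/
def PsiP (α β η : ℝ) : ℝ :=
  (α * β / 2) * Real.exp (α ^ 2 / 4) * ∫ ζ in Set.Ioi (max η α), Real.exp (-ζ ^ 2 / 4)

/-- Regularity of a weak solution: `w` is the spatial derivative of `u - ψ`;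
both are continuous on `ℝ × [0,∞)` and bounded on `ℝ × [0,T]` for every `T > 0`. -/
def AuxReg (α β : ℝ) (u w : ℝ → ℝ → ℝ) : Prop :=
  (∀ t ∈ Set.Ici (0:ℝ), ∀ x : ℝ, HasDerivAt (fun y => u y t - psi α β y t) (w x t) x) ∧
  ContinuousOn (fun q : ℝ × ℝ => u q.1 q.2 - psi α β q.1 q.2) (Set.univ ×ˢ Set.Ici 0) ∧
  ContinuousOn (fun q : ℝ × ℝ => w q.1 q.2) (Set.univ ×ˢ Set.Ici 0) ∧
  ∀ T > (0:ℝ), ∃ C : ℝ, ∀ x : ℝ, ∀ t ∈ Set.Icc (0:ℝ) T,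
    |u x t - psi α β x t| ≤ C ∧ |w x t| ≤ C

/-- A test function of class `C^{1,1}(ℝ × [0,T])`, vanishing for large `|x|` and at `t = T`,
together with its partial derivatives `φt`, `φx`. -/
def IsTestFun (T : ℝ) (φ φt φx : ℝ → ℝ → ℝ) : Prop :=
  (∀ x : ℝ, ∀ t ∈ Set.Icc (0:ℝ) T,
    HasDerivWithinAt (fun s => φ x s) (φt x t) (Set.Icc 0 T) t) ∧
  (∀ x : ℝ, ∀ t ∈ Set.Icc (0:ℝ) T, HasDerivAt (fun y => φ y t) (φx x t) x) ∧
  ContinuousOn (fun q : ℝ × ℝ => φ q.1 q.2) (Set.univ ×ˢ Set.Icc 0 T) ∧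
  ContinuousOn (fun q : ℝ × ℝ => φt q.1 q.2) (Set.univ ×ˢ Set.Icc 0 T) ∧
  ContinuousOn (fun q : ℝ × ℝ => φx q.1 q.2) (Set.univ ×ˢ Set.Icc 0 T) ∧
  (∃ R : ℝ, ∀ x : ℝ, ∀ t ∈ Set.Icc (0:ℝ) T, R ≤ |x| → φ x t = 0) ∧
  (∀ x : ℝ, φ x T = 0)

/-- The weak form of the equation, relative to a given precipitation function `p` and
the spatial derivative `w` of `u - ψ`. -/
def WeakForm (α β : ℝ) (u p w : ℝ → ℝ → ℝ) : Prop :=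
  ∀ T > (0:ℝ), ∀ φ φt φx : ℝ → ℝ → ℝ, IsTestFun T φ φt φx →
    (∫ t in Set.Ioc (0:ℝ) T, ∫ x : ℝ, φt x t * (u x t - psi α β x t))
      = ∫ t in Set.Ioc (0:ℝ) T, ∫ x : ℝ, (φx x t * w x t + p x t * u x t * φ x t)

/-- A weak solution of the linear auxiliary problem with given precipitation function `p`. -/
def IsAuxSolution (α β : ℝ) (p u : ℝ → ℝ → ℝ) : Prop :=
  (∀ x t : ℝ, u (-x) t = u x t) ∧
  ∃ w : ℝ → ℝ → ℝ, AuxReg α β u w ∧ WeakForm α β u p w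

/-- A weak solution `(u, p)` of the HHMO model. -/
def IsWeakSolution (α β ustar : ℝ) (u p : ℝ → ℝ → ℝ) : Prop :=
  (∀ x t : ℝ, u (-x) t = u x t) ∧
  (∀ x t : ℝ, p (-x) t = p x t) ∧
  Measurable (fun q : ℝ × ℝ => p q.1 q.2) ∧
  (∀ x : ℝ, ∀ t ∈ Set.Ici (0:ℝ),
    (sSup ((fun s => u x s) '' Set.Icc 0 t) < ustar → p x t = 0) ∧
    (sSup ((fun s => u x s) '' Set.Icc 0 t) = ustar → p x t ∈ Set.Icc (0:ℝ) 1) ∧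
    (ustar < sSup ((fun s => u x s) '' Set.Icc 0 t) → p x t = 1)) ∧
  (∀ x : ℝ, MonotoneOn (fun t => p x t) (Set.Ici (0:ℝ))) ∧
  ∃ w : ℝ → ℝ → ℝ, AuxReg α β u w ∧ WeakForm α β u p w

/-- Condition (P): the precipitation function depends only on `x` beyond the parabola
`t = x²/α²`. -/
def CondP (α : ℝ) (p : ℝ → ℝ → ℝ) (pstar : ℝ → ℝ) : Prop :=
  Measurable pstar ∧
  ∀ᵐ x ∂(volume.restrict (Set.Ioi (0:ℝ))), ∀ t : ℝ, x ^ 2 / α ^ 2 < t → p x t = pstar x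

/-- The admissible class `𝒜` of precipitation functions. -/
def IsAdmissible (p : ℝ → ℝ → ℝ) : Prop :=
  (∀ x t : ℝ, p (-x) t = p x t) ∧
  MeasureTheory.LocallyIntegrableOn (fun q : ℝ × ℝ => p q.1 q.2) (Set.Ioi 0 ×ˢ Set.Ici 0) ∧
  ∀ T > (0:ℝ), ∃ R : ℝ, ∀ x ≥ R, ∀ t ∈ Set.Icc (0:ℝ) T, p x t = 0

/-- `u` converges uniformly, in parabolic similarity coordinates, to the profile `Φ`. -/
def ConvUnif (u : ℝ → ℝ → ℝ) (Φ : ℝ → ℝ) : Prop :=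
  ∀ ε > (0:ℝ), ∃ T : ℝ, ∀ t ≥ T, ∀ η ≥ (0:ℝ), |u (η * Real.sqrt t) t - Φ η| < ε

/-- The error function. -/
def erf (x : ℝ) : ℝ := (2 / Real.sqrt Real.pi) * ∫ s in (0:ℝ)..x, Real.exp (-s ^ 2)

/-- The complementary error function. -/
def erfc (x : ℝ) : ℝ := (2 / Real.sqrt Real.pi) * ∫ s in Set.Ioi x, Real.exp (-s ^ 2)

/-- Kummer's confluent hypergeometric function `M(a,b,z)` (real arguments). -/
def kummerM (a b z : ℝ) : ℝ :=
  ∑' n : ℕ, (Polynomial.eval a (ascPochhammer ℝ n) / Polynomial.eval b (ascPochhammer ℝ n))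
    * z ^ n / (n.factorial : ℝ)

/-- `κ = (1 + √(4γ+1))/2`, the positive root of `κ(κ-1) = γ`. -/
def kappaOf (γ : ℝ) : ℝ := (1 + Real.sqrt (4 * γ + 1)) / 2

/-- The value `u*_γ` determined by the derivative matching condition. -/
def ustarGamma (α β γ : ℝ) : ℝ :=
  (α * β / 2) *
    (kappaOf γ * kummerM (kappaOf γ / 2 + 1) (kappaOf γ + 1 / 2) (-α ^ 2 / 4) /
        (α * kummerM (kappaOf γ / 2) (kappaOf γ + 1 / 2) (-α ^ 2 / 4)) +
      Real.exp (-α ^ 2 / 4) / (Real.sqrt Real.pi * erfc (α / 2)))⁻¹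

/-- The self-similar profile `Φ_γ`. -/
def Phi (α β γ η : ℝ) : ℝ :=
  if η < α then
    ustarGamma α β γ * η ^ kappaOf γ *
      kummerM (kappaOf γ / 2) (kappaOf γ + 1 / 2) (-η ^ 2 / 4) /
      (α ^ kappaOf γ * kummerM (kappaOf γ / 2) (kappaOf γ + 1 / 2) (-α ^ 2 / 4))
  else ustarGamma α β γ * erfc (η / 2) / erfc (α / 2)

/-- Integration by parts for two indefinite integrals. -/
lemma integral_mul_primitive {a c : ℝ → ℝ} {y z : ℝ}
    (ha : IntervalIntegrable a volume y z) (hc : IntervalIntegrable c volume y z) :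
    ∫ x in y..z, a x * ∫ s in y..x, c s
      = (∫ x in y..z, a x) * (∫ x in y..z, c x) - ∫ x in y..z, c x * ∫ s in y..x, a s := by
  have hA := ha.absolutelyContinuousOnInterval_intervalIntegral (c := y) (by simp)
  have hC := hc.absolutelyContinuousOnInterval_intervalIntegral (c := y) (by simp)
  have key := hC.integral_mul_deriv_eq_deriv_mul hA
  simp only [intervalIntegral.integral_same, mul_zero, sub_zero] at key
  have e1 : ∫ x in y..z, (∫ s in y..x, c s) * deriv (fun x => ∫ s in y..x, a s) x
      = ∫ x in y..z, a x * ∫ s in y..x, c s := by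
    apply intervalIntegral.integral_congr_ae
    filter_upwards [ha.ae_hasDerivAt_integral] with x hx hx2
    rw [(hx (uIoc_subset_uIcc hx2) y (by simp)).deriv, mul_comm]
  have e2 : ∫ x in y..z, deriv (fun x => ∫ s in y..x, c s) x * (∫ s in y..x, a s)
      = ∫ x in y..z, c x * ∫ s in y..x, a s := by
    apply intervalIntegral.integral_congr_ae
    filter_upwards [hc.ae_hasDerivAt_integral] with x hx hx2
    rw [(hx (uIoc_subset_uIcc hx2) y (by simp)).deriv]
  rw [e1, e2] at key
  rw [key]; ring

lemma eq_zero_of_integral_sq {f : ℝ → ℝ} {y z : ℝ} (hyz : y < z)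
    (hf : ContinuousOn f (Icc y z)) (h0 : ∫ x in y..z, f x * f x = 0) :
    ∀ x ∈ Icc y z, f x = 0 := by
  intro x hx
  by_contra hne
  have := intervalIntegral.integral_pos hyz (hf.mul hf) (fun x _ => mul_self_nonneg _)
    ⟨x, hx, mul_self_pos.2 hne⟩
  simp only [Pi.mul_apply] at this
  linarith

/-- A du Bois-Reymond lemma in integrated form. -/
lemma eq_neg_primitive {b a : ℝ → ℝ} {T : ℝ} (hT : 0 < T) (hb : ContinuousOn b (Icc 0 T))
    (ha : IntervalIntegrable a volume 0 T)
    (h : ∀ η : ℝ → ℝ, Continuous η →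
      ∫ t in (0:ℝ)..T, η t * b t = ∫ t in (0:ℝ)..T, (-∫ s in t..T, η s) * a t) :
    ∀ t ∈ Icc 0 T, b t = -∫ s in (0:ℝ)..t, a s := by
  have hAc : ContinuousOn (fun t => ∫ s in (0:ℝ)..t, a s) (Icc 0 T) := by
    have := intervalIntegral.continuousOn_primitive_interval (μ := volume) (f := a) (a := 0) (b := T)
      (by rw [uIcc_of_le hT.le, integrableOn_Icc_iff_integrableOn_Ioc]; exact (intervalIntegrable_iff_integrableOn_Ioc_of_le hT.le).1 ha)
    rwa [uIcc_of_le hT.le] at this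
  have hcont := hb.add hAc
  set η : ℝ → ℝ := fun t => IccExtend hT.le (fun s : Icc 0 T => b s + ∫ r in (0:ℝ)..s, a r) t with hη
  have hηc : Continuous η := (hcont.domRestrict).Icc_extend'
  have hηe : ∀ t ∈ Icc 0 T, η t = b t + ∫ r in (0:ℝ)..t, a r := fun t ht => by
    simp [hη, IccExtend_of_mem hT.le _ ht]
  have h1 := h η hηc
  have hηi : ∀ s t, IntervalIntegrable η volume s t := fun s t => hηc.intervalIntegrable s t
  have h2 := integral_mul_primitive ha (hηi 0 T)
  have h3 : ∫ t in (0:ℝ)..T, (-∫ s in t..T, η s) * a t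
      = -∫ t in (0:ℝ)..T, η t * ∫ s in (0:ℝ)..t, a s := by
    have : ∀ t, (-∫ s in t..T, η s) * a t = a t * (∫ s in (0:ℝ)..t, η s) - a t * ∫ s in (0:ℝ)..T, η s := by
      intro t
      rw [← intervalIntegral.integral_add_adjacent_intervals (hηi 0 t) (hηi t T)]; ring
    simp_rw [this]
    rw [intervalIntegral.integral_sub, h2, intervalIntegral.integral_mul_const]
    · ring
    · exact ha.mul_continuousOn (intervalIntegral.continuous_primitive hηi 0).continuousOn
    · exact ha.mul_const _
  have h4 : ∫ t in (0:ℝ)..T, η t * η t = 0 := by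
    have : ∫ t in (0:ℝ)..T, η t * η t = ∫ t in (0:ℝ)..T, (η t * b t + η t * ∫ s in (0:ℝ)..t, a s) := by
      apply intervalIntegral.integral_congr
      intro t ht
      rw [uIcc_of_le hT.le] at ht
      simp only []
      rw [← mul_add, ← hηe t ht]
    rw [this, intervalIntegral.integral_add, h1, h3]
    · ring
    · apply ContinuousOn.intervalIntegrable
      rw [uIcc_of_le hT.le]; exact hηc.continuousOn.mul hb
    · apply ContinuousOn.intervalIntegrable
      rw [uIcc_of_le hT.le]; exact hηc.continuousOn.mul hAc
  intro t ht
  have := eq_zero_of_integral_sq hT hηc.continuousOn h4 t ht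
  rw [hηe t ht] at this
  linarith

/-- If `∫ χ' h = 0` for every mean-zero bump `χ'`, then `h` takes equal values at the endpoints. -/
lemma eq_endpoints_of_integral_eq_zero {h : ℝ → ℝ} {y z : ℝ} (hyz : y < z) (hh : Continuous h)
    (H : ∀ g : ℝ → ℝ, Continuous g → (∀ x, x ∉ Ioo y z → g x = 0) → ∫ x in y..z, g x = 0 →
      ∫ x in y..z, g x * h x = 0) : h y = h z := by
  set ω : ℝ → ℝ := fun x => max 0 ((x - y) * (z - x)) with hω
  have hωc : Continuous ω := by fun_prop
  have hωpos : 0 < ∫ x in y..z, ω x := by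
    apply intervalIntegral.integral_pos hyz hωc.continuousOn (fun x _ => le_max_left _ _)
    refine ⟨(y+z)/2, ⟨by linarith, by linarith⟩, lt_max_of_lt_right ?_⟩
    apply mul_pos <;> linarith
  set c := (∫ x in y..z, ω x * h x) / ∫ x in y..z, ω x with hc
  have hi : ∀ f : ℝ → ℝ, Continuous f → IntervalIntegrable f volume y z :=
    fun f hf => hf.intervalIntegrable _ _
  have hz : ∫ x in y..z, ω x * (h x - c) = 0 := by
    simp_rw [mul_sub]
    rw [intervalIntegral.integral_sub (hi _ (by fun_prop)) (hi _ (by fun_prop)),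
      intervalIntegral.integral_mul_const, hc]
    field_simp; ring
  have h1 := H (fun x => ω x * (h x - c)) (by fun_prop) (by
    intro x hx
    have : ω x = 0 := by
      simp only [hω]
      apply max_eq_left
      simp only [mem_Ioo, not_and_or, not_lt] at hx
      rcases hx with hx | hx
      · exact mul_nonpos_of_nonpos_of_nonneg (by linarith) (by linarith)
      · exact mul_nonpos_of_nonneg_of_nonpos (by linarith) (by linarith)
    simp [this]) hz
  have h2 : ∫ x in y..z, ω x * (h x - c) ^ 2 = 0 := by
    have : ∀ x, ω x * (h x - c)^2 = ω x * (h x - c) * h x - c * (ω x * (h x - c)) := fun x => by ring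
    simp_rw [this]
    rw [intervalIntegral.integral_sub (hi _ (by fun_prop)) (hi _ (by fun_prop)),
      intervalIntegral.integral_const_mul, hz, h1]; simp
  have h3 : ∀ x ∈ Ioo y z, h x = c := by
    intro x hx
    by_contra hne
    have := intervalIntegral.integral_pos (f := fun x => ω x * (h x - c)^2) hyz
      (by fun_prop) (fun x _ => mul_nonneg (le_max_left _ _) (sq_nonneg _))
      ⟨x, ⟨hx.1.le, hx.2.le⟩, mul_pos (lt_max_of_lt_right (mul_pos (by linarith [hx.1]) (by linarith [hx.2])))
        (by have : h x - c ≠ 0 := sub_ne_zero.2 hne; positivity)⟩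
    linarith
  have h4 : EqOn h (fun _ => c) (closure (Ioo y z)) :=
    EqOn.closure (fun x hx => h3 x hx) hh continuous_const
  rw [closure_Ioo hyz.ne] at h4
  rw [h4 (left_mem_Icc.2 hyz.le), h4 (right_mem_Icc.2 hyz.le)]

/-- The Gaussian tail `∫_η^∞ e^{-ζ²/4} dζ`. -/
def gaussTail (η : ℝ) : ℝ := ∫ ζ in Ioi η, Real.exp (-ζ ^ 2 / 4)

lemma integrable_gauss : Integrable (fun ζ : ℝ => Real.exp (-ζ ^ 2 / 4)) := by
  have := integrable_exp_neg_mul_sq (b := 1/4) (by norm_num)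
  refine this.congr (ae_of_all _ fun x => ?_)
  simp only []; congr 1; ring

lemma gaussTail_sub (a b : ℝ) :
    gaussTail a - gaussTail b = ∫ ζ in a..b, Real.exp (-ζ ^ 2 / 4) :=
  (intervalIntegral.integral_Ioi_sub_Ioi' integrable_gauss.integrableOn
    integrable_gauss.integrableOn)

lemma hasDerivAt_gaussTail (η : ℝ) : HasDerivAt gaussTail (-Real.exp (-η ^ 2 / 4)) η := by
  have h : gaussTail = fun x => gaussTail 0 - ∫ ζ in (0:ℝ)..x, Real.exp (-ζ ^ 2 / 4) := by
    funext x; rw [← gaussTail_sub]; ring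
  rw [h]
  have hc : Continuous fun ζ : ℝ => Real.exp (-ζ ^ 2 / 4) := by fun_prop
  exact (intervalIntegral.integral_hasDerivAt_right (hc.intervalIntegrable _ _)
    (hc.stronglyMeasurableAtFilter _ _) hc.continuousAt).const_sub _

lemma continuous_gaussTail : Continuous gaussTail :=
  continuous_iff_continuousAt.2 fun x => (hasDerivAt_gaussTail x).continuousAt

lemma strictAnti_gaussTail : StrictAnti gaussTail :=
  strictAnti_of_deriv_neg fun x => by
    rw [(hasDerivAt_gaussTail x).deriv]; exact neg_neg_of_pos (Real.exp_pos _)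

lemma gaussTail_nonneg (η : ℝ) : 0 ≤ gaussTail η :=
  setIntegral_nonneg measurableSet_Ioi fun _ _ => (Real.exp_pos _).le

lemma gaussTail_pos (η : ℝ) : 0 < gaussTail η :=
  (gaussTail_nonneg (η + 1)).trans_lt (strictAnti_gaussTail (by linarith))

/-- The amplitude of `ψ`. -/
def ampl (α β : ℝ) : ℝ := (α * β / 2) * Real.exp (α ^ 2 / 4)

lemma ampl_pos {α β : ℝ} (hα : 0 < α) (hβ : 0 < β) : 0 < ampl α β := by
  unfold ampl; positivity

lemma PsiP_eq (α β η : ℝ) : PsiP α β η = ampl α β * gaussTail (max η α) := rfl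

lemma psi_eq (α β x : ℝ) {t : ℝ} (ht : 0 < t) :
    psi α β x t = ampl α β * gaussTail (max (|x| / Real.sqrt t) α) := by
  simp [psi, ht, ampl, gaussTail]

lemma psi_zero (α β x : ℝ) : psi α β x 0 = 0 := by simp [psi]

lemma PsiP_self (α β : ℝ) : PsiP α β α = ampl α β * gaussTail α := by simp [PsiP_eq]

lemma PsiP_self_pos {α β : ℝ} (hα : 0 < α) (hβ : 0 < β) : 0 < PsiP α β α := by
  rw [PsiP_self]; exact mul_pos (ampl_pos hα hβ) (gaussTail_pos _)

lemma psi_nonneg {α β : ℝ} (hα : 0 < α) (hβ : 0 < β) (x t : ℝ) : 0 ≤ psi α β x t := by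
  by_cases ht : 0 < t
  · rw [psi_eq _ _ _ ht]; exact mul_nonneg (ampl_pos hα hβ).le (gaussTail_nonneg _)
  · simp [psi, ht]

lemma psi_le {α β : ℝ} (hα : 0 < α) (hβ : 0 < β) (x t : ℝ) : psi α β x t ≤ PsiP α β α := by
  by_cases ht : 0 < t
  · rw [psi_eq _ _ _ ht, PsiP_self]
    exact mul_le_mul_of_nonneg_left (strictAnti_gaussTail.antitone (le_max_right _ _)) (ampl_pos hα hβ).le
  · simp only [psi, ht, if_false]; exact (PsiP_self_pos hα hβ).le

lemma psi_eq_of_le {α β x t : ℝ} (ht : 0 < t) (h : |x| ≤ α * Real.sqrt t) :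
    psi α β x t = PsiP α β α := by
  rw [psi_eq _ _ _ ht, PsiP_self, max_eq_right]
  rwa [div_le_iff₀ (Real.sqrt_pos.2 ht)]

lemma psi_eq_of_ge {α β x t : ℝ} (ht : 0 < t) (h : α * Real.sqrt t ≤ |x|) :
    psi α β x t = ampl α β * gaussTail (|x| / Real.sqrt t) := by
  rw [psi_eq _ _ _ ht, max_eq_left]
  rwa [le_div_iff₀ (Real.sqrt_pos.2 ht)]

lemma psi_mono {α β : ℝ} (hα : 0 < α) (hβ : 0 < β) (x : ℝ) {s t : ℝ} (hst : s ≤ t) :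
    psi α β x s ≤ psi α β x t := by
  by_cases hs : 0 < s
  · rw [psi_eq _ _ _ hs, psi_eq _ _ _ (hs.trans_le hst)]
    apply mul_le_mul_of_nonneg_left _ (ampl_pos hα hβ).le
    apply strictAnti_gaussTail.antitone
    apply max_le_max_right
    have := Real.sqrt_pos.2 hs
    gcongr
  · simpa [psi, hs] using psi_nonneg hα hβ x t

lemma continuousOn_psi (α β : ℝ) :
    ContinuousOn (fun q : ℝ × ℝ => psi α β q.1 q.2) (univ ×ˢ Ioi 0) := by
  have : ContinuousOn (fun q : ℝ × ℝ => ampl α β * gaussTail (max (|q.1| / Real.sqrt q.2) α))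
      (univ ×ˢ Ioi 0) := by
    apply continuousOn_const.mul
    apply continuous_gaussTail.comp_continuousOn
    apply ContinuousOn.sup _ continuousOn_const
    apply ContinuousOn.div (by fun_prop) (by fun_prop)
    rintro ⟨x, t⟩ ⟨_, ht⟩
    exact (Real.sqrt_pos.2 ht).ne'
  exact this.congr fun q hq => psi_eq _ _ _ hq.2

lemma measurable_psi (α β : ℝ) : Measurable (fun q : ℝ × ℝ => psi α β q.1 q.2) := by
  have : (fun q : ℝ × ℝ => psi α β q.1 q.2) = fun q : ℝ × ℝ => if 0 < q.2 then
      ampl α β * gaussTail (max (|q.1| / Real.sqrt q.2) α) else 0 := by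
    funext q
    by_cases h : 0 < q.2
    · simp [h, psi_eq]
    · simp [h, psi]
  rw [this]
  apply Measurable.ite (measurableSet_lt measurable_const measurable_snd) _ measurable_const
  apply measurable_const.mul
  apply continuous_gaussTail.measurable.comp
  exact ((measurable_fst.abs).div (Real.continuous_sqrt.measurable.comp measurable_snd)).max measurable_const

/-- The standing data extracted from a weak solution. -/
structure Sol (α β : ℝ) (u p w : ℝ → ℝ → ℝ) : Prop where
  hα : 0 < α
  hβ : 0 < β
  u_even : ∀ x t, u (-x) t = u x t
  p_meas : Measurable (fun q : ℝ × ℝ => p q.1 q.2)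
  p_mem : ∀ x t, 0 ≤ t → p x t ∈ Icc (0:ℝ) 1
  p_mono : ∀ x, MonotoneOn (fun t => p x t) (Ici (0:ℝ))
  reg : AuxReg α β u w
  weak : WeakForm α β u p w

lemma IsWeakSolution.sol {α β ustar : ℝ} (hα : 0 < α) (hβ : 0 < β) {u p : ℝ → ℝ → ℝ}
    (h : IsWeakSolution α β ustar u p) : ∃ w, Sol α β u p w := by
  obtain ⟨h1, -, h3, h4, h5, w, h6, h7⟩ := h
  refine ⟨w, hα, hβ, h1, h3, ?_, h5, h6, h7⟩
  intro x t ht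
  obtain ⟨a, b, c⟩ := h4 x t ht
  rcases lt_trichotomy (sSup ((fun s => u x s) '' Icc 0 t)) ustar with h | h | h
  · simp [a h]
  · exact b h
  · simp [c h]

namespace Sol
variable {α β : ℝ} {u p w : ℝ → ℝ → ℝ}

/-- `v = u - ψ` extended to negative times by its initial value. -/
lemma continuous_v (S : Sol α β u p w) :
    Continuous (fun q : ℝ × ℝ => u q.1 (max q.2 0) - psi α β q.1 (max q.2 0)) := by
  have := S.reg.2.1.comp_continuous (f := fun q : ℝ × ℝ => (q.1, max q.2 0)) (by fun_prop)
    (fun q => mk_mem_prod (mem_univ _) (mem_Ici.2 (le_max_right _ _)))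
  exact this

lemma continuous_w (S : Sol α β u p w) : Continuous (fun q : ℝ × ℝ => w q.1 (max q.2 0)) := by
  have := S.reg.2.2.1.comp_continuous (f := fun q : ℝ × ℝ => (q.1, max q.2 0)) (by fun_prop)
    (fun q => mk_mem_prod (mem_univ _) (mem_Ici.2 (le_max_right _ _)))
  exact this

lemma measurable_u (S : Sol α β u p w) : Measurable (fun q : ℝ × ℝ => u q.1 (max q.2 0)) := by
  have h1 := S.continuous_v.measurable
  have h2 : Measurable (fun q : ℝ × ℝ => psi α β q.1 (max q.2 0)) :=
    (measurable_psi α β).comp (measurable_fst.prodMk (measurable_snd.max measurable_const))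
  have h3 := h1.add h2
  simpa [Pi.add_def] using h3

lemma measurable_p (S : Sol α β u p w) : Measurable (fun q : ℝ × ℝ => p q.1 (max q.2 0)) :=
  S.p_meas.comp (measurable_fst.prodMk (measurable_snd.max measurable_const))

lemma exists_bound (S : Sol α β u p w) (T : ℝ) : ∃ C : ℝ, 0 ≤ C ∧ ∀ x : ℝ, ∀ t ∈ Icc (0:ℝ) T,
    |u x t - psi α β x t| ≤ C ∧ |w x t| ≤ C ∧ |u x t| ≤ C ∧ |p x t * u x t| ≤ C := by
  obtain ⟨C, hC⟩ := S.reg.2.2.2 (max T 1) (by positivity)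
  have hPsi := PsiP_self_pos S.hα S.hβ
  have hC0 : 0 ≤ C := (abs_nonneg _).trans (hC 0 0 ⟨le_rfl, by positivity⟩).1
  refine ⟨C + PsiP α β α, by linarith, fun x t ht => ?_⟩
  obtain ⟨h1, h2⟩ := hC x t ⟨ht.1, ht.2.trans (le_max_left _ _)⟩
  have h3 : |u x t| ≤ C + PsiP α β α := by
    have h4 := psi_nonneg S.hα S.hβ x t
    have h5 := psi_le S.hα S.hβ x t
    rw [abs_le] at *
    constructor <;> linarith
  refine ⟨by linarith, by linarith, h3, ?_⟩
  obtain ⟨h4, h5⟩ := S.p_mem x t ht.1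
  rw [abs_mul, abs_of_nonneg h4]
  calc p x t * |u x t| ≤ 1 * |u x t| := by gcongr
    _ ≤ _ := by simpa using h3

/-- The source term `p u`, joint integrability on boxes. -/
lemma integrable_source (S : Sol α β u p w) {a b t₁ t₂ : ℝ} (ht : 0 ≤ t₁) :
    Integrable (fun q : ℝ × ℝ => p q.1 q.2 * u q.1 q.2)
      ((volume.restrict (Ioc a b)).prod (volume.restrict (Ioc t₁ t₂))) := by
  obtain ⟨C, -, hC⟩ := S.exists_bound t₂
  have hm : MeasurableSet (Ioc a b ×ˢ Ioc t₁ t₂) := measurableSet_Ioc.prod measurableSet_Ioc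
  have hi : Integrable (fun q : ℝ × ℝ => p q.1 (max q.2 0) * u q.1 (max q.2 0) )
      ((volume.restrict (Ioc a b)).prod (volume.restrict (Ioc t₁ t₂))) := by
    apply Integrable.of_bound (C := max C 0) (S.measurable_p.mul S.measurable_u).aestronglyMeasurable
    rw [Measure.prod_restrict]
    filter_upwards [ae_restrict_mem hm] with q hq
    have h0 : 0 ≤ q.2 := ht.trans hq.2.1.le
    simp only [Pi.mul_apply, max_eq_left h0, Real.norm_eq_abs]
    exact (hC q.1 q.2 ⟨h0, hq.2.2⟩).2.2.2.trans (le_max_left _ _)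
  refine hi.congr ?_
  rw [Measure.prod_restrict]
  filter_upwards [ae_restrict_mem hm] with q hq
  simp [max_eq_left (ht.trans hq.2.1.le)]

end Sol

namespace Sol
variable {α β : ℝ} {u p w : ℝ → ℝ → ℝ}

lemma cont_v_slice (S : Sol α β u p w) {t : ℝ} (ht : 0 ≤ t) :
    Continuous (fun x => u x t - psi α β x t) := by
  have := S.continuous_v.comp (f := fun x : ℝ => (x, t)) (by fun_prop)
  simpa [Function.comp_def, max_eq_left ht] using this

lemma contOn_w_time (S : Sol α β u p w) (x : ℝ) : ContinuousOn (fun t => w x t) (Ici 0) :=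
  S.reg.2.2.1.comp (f := fun t : ℝ => (x, t)) (by fun_prop)
    (fun q hq => mk_mem_prod (mem_univ _) hq)

lemma contOn_v_time (S : Sol α β u p w) (x : ℝ) :
    ContinuousOn (fun t => u x t - psi α β x t) (Ici 0) :=
  S.reg.2.1.comp (f := fun t : ℝ => (x, t)) (by fun_prop)
    (fun q hq => mk_mem_prod (mem_univ _) hq)

lemma intervalIntegrable_w (S : Sol α β u p w) (x : ℝ) {s t : ℝ} (hs : 0 ≤ s) (ht : 0 ≤ t) :
    IntervalIntegrable (fun t => w x t) volume s t :=
  ((S.contOn_w_time x).mono fun _ hr => (le_min hs ht).trans hr.1).intervalIntegrable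

/-- Time-integrated source. -/
lemma intervalIntegrable_Z (S : Sol α β u p w) (a b : ℝ) {s t : ℝ} (hs : 0 ≤ s) (hst : s ≤ t) :
    IntervalIntegrable (fun x => ∫ r in s..t, p x r * u x r) volume a b := by
  rw [intervalIntegrable_iff]
  have := (S.integrable_source (a := min a b) (b := max a b) (t₂ := t) hs).integral_prod_left
  simpa [intervalIntegral.integral_of_le hst, uIoc, IntegrableOn] using this

lemma aux_weak (S : Sol α β u p w) {y z : ℝ} (hyz : y < z) {g : ℝ → ℝ} (hg : Continuous g)
    (hg0 : ∀ x, x ∉ Ioo y z → g x = 0) (hgi : ∫ x in y..z, g x = 0) {T : ℝ} (hT : 0 < T) :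
    ∀ t ∈ Icc 0 T, ∫ x in y..z, (∫ r in y..x, g r) * (u x t - psi α β x t)
      = -∫ s in (0:ℝ)..t, ∫ x in y..z, (g x * w x s + p x s * u x s * ∫ r in y..x, g r) := by
  set χ : ℝ → ℝ := fun x => ∫ r in y..x, g r with hχ
  have hχc : Continuous χ := intervalIntegral.continuous_primitive (fun a b => hg.intervalIntegrable a b) y
  have hχd : ∀ x, HasDerivAt χ (g x) x := fun x => intervalIntegral.integral_hasDerivAt_right
    (hg.intervalIntegrable _ _) (hg.stronglyMeasurableAtFilter _ _) hg.continuousAt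
  have hχ0 : ∀ x, x ∉ Ioo y z → χ x = 0 := by
    intro x hx
    simp only [mem_Ioo, not_and_or, not_lt] at hx
    rcases hx with hx | hx
    · simp only [hχ]
      rw [intervalIntegral.integral_congr (g := fun _ => (0:ℝ))]
      · simp
      · intro r hr
        rw [uIcc_comm, uIcc_of_le hx] at hr
        exact hg0 r fun h => by linarith [h.1, hr.2]
    · simp only [hχ]
      rw [← intervalIntegral.integral_add_adjacent_intervals (hg.intervalIntegrable y z)
        (hg.intervalIntegrable z x), hgi, zero_add,
        intervalIntegral.integral_congr (g := fun _ => (0:ℝ))]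
      · simp
      · intro r hr
        rw [uIcc_of_le hx] at hr
        exact hg0 r fun h => by linarith [h.2, hr.1]
  have hset : ∀ f : ℝ → ℝ, (∀ x, x ∉ Ioo y z → f x = 0) → ∫ x, f x = ∫ x in y..z, f x := by
    intro f hf
    rw [intervalIntegral.integral_of_le hyz.le, setIntegral_eq_integral_of_forall_compl_eq_zero]
    intro x hx
    exact hf x fun h => hx ⟨h.1, h.2.le⟩
  apply eq_neg_primitive hT
  · have : Continuous fun t : ℝ => ∫ x in y..z, χ x * (u x (max t 0) - psi α β x (max t 0)) := by
      apply intervalIntegral.continuous_parametric_intervalIntegral_of_continuous'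
      have := S.continuous_v.comp (f := fun q : ℝ × ℝ => (q.2, q.1)) (by fun_prop)
      exact (hχc.comp continuous_snd).mul this
    refine this.continuousOn.congr fun t ht => ?_
    simp [max_eq_left ht.1, hχ]
  · rw [intervalIntegrable_iff_integrableOn_Ioc_of_le hT.le]
    have hA : Integrable (fun q : ℝ × ℝ => g q.1 * w q.1 q.2 + p q.1 q.2 * u q.1 q.2 * χ q.1)
        ((volume.restrict (Ioc y z)).prod (volume.restrict (Ioc 0 T))) := by
      apply Integrable.add
      · rw [Measure.prod_restrict]
        have : ContinuousOn (fun q : ℝ × ℝ => g q.1 * w q.1 q.2) (Icc y z ×ˢ Icc 0 T) := by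
          apply ContinuousOn.mul (by fun_prop)
          exact S.reg.2.2.1.mono (fun q hq => ⟨mem_univ _, hq.2.1⟩)
        exact (this.integrableOn_compact (isCompact_Icc.prod isCompact_Icc)).mono_set
          (prod_mono Ioc_subset_Icc_self Ioc_subset_Icc_self)
      · obtain ⟨C, hC⟩ := (isCompact_Icc (a := y) (b := z)).exists_bound_of_continuousOn hχc.continuousOn
        refine Integrable.mul_bdd (c := C) (S.integrable_source le_rfl) (by fun_prop) ?_
        rw [Measure.prod_restrict]
        filter_upwards [ae_restrict_mem (measurableSet_Ioc.prod measurableSet_Ioc)] with q hq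
        exact hC q.1 (Ioc_subset_Icc_self hq.1)
    have := hA.integral_prod_right
    simpa [IntegrableOn, intervalIntegral.integral_of_le hyz.le] using this
  · intro η hη
    set θ : ℝ → ℝ := fun t => -∫ s in t..T, η s with hθ
    have hθd : ∀ t, HasDerivAt θ (η t) t := fun t => by
      have := intervalIntegral.integral_hasDerivAt_left (hη.intervalIntegrable t T)
        (hη.stronglyMeasurableAtFilter _ _) hη.continuousAt
      exact (neg_neg (η t)) ▸ this.neg
    have hθc : Continuous θ := continuous_iff_continuousAt.2 fun t => (hθd t).continuousAt
    have key := S.weak T hT (fun x t => θ t * χ x) (fun x t => η t * χ x) (fun x t => θ t * g x)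
      ⟨fun x t _ => ((hθd t).mul_const _).hasDerivWithinAt, fun x t _ => (hχd x).const_mul _,
        by fun_prop, by fun_prop, by fun_prop,
        ⟨max |y| |z|, fun x t _ hx => by
          have : χ x = 0 := hχ0 x fun h => by
            have h1 := abs_le.1 (le_refl |y|)
            have : |x| < max |y| |z| := by
              rcases le_total 0 x with h0 | h0
              · rw [abs_of_nonneg h0]
                exact (h.2.trans_le (le_abs_self z)).trans_le (le_max_right _ _)
              · rw [abs_of_nonpos h0]
                exact ((neg_lt_neg h.1).trans_le (neg_le_abs y)).trans_le (le_max_left _ _)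
            linarith
          simp [this]⟩, fun x => by simp [hθ]⟩
    rw [intervalIntegral.integral_of_le hT.le, intervalIntegral.integral_of_le hT.le]
    have e1 : ∀ t, ∫ x, η t * χ x * (u x t - psi α β x t)
        = η t * ∫ x in y..z, χ x * (u x t - psi α β x t) := fun t => by
      rw [hset _ (fun x hx => by simp [hχ0 x hx]), ← intervalIntegral.integral_const_mul]
      simp_rw [mul_assoc]
    have e2 : ∀ t, ∫ x, (θ t * g x * w x t + p x t * u x t * (θ t * χ x))
        = θ t * ∫ x in y..z, (g x * w x t + p x t * u x t * χ x) := fun t => by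
      rw [hset _ (fun x hx => by simp [hχ0 x hx, hg0 x hx]), ← intervalIntegral.integral_const_mul]
      congr 1; funext x; ring
    simp_rw [e1, e2] at key
    exact key

/-- The equation integrated over a rectangle `[a,b] × [0,t]`. -/
lemma rect_zero (S : Sol α β u p w) {a b : ℝ} (hab : a ≤ b) {t : ℝ} (ht : 0 ≤ t) :
    ∫ x in a..b, (u x t - psi α β x t)
      = (∫ s in (0:ℝ)..t, (w b s - w a s)) - ∫ x in a..b, ∫ s in (0:ℝ)..t, p x s * u x s := by
  rcases hab.eq_or_lt with rfl | hab
  · simp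
  set Z : ℝ → ℝ := fun x => ∫ s in (0:ℝ)..t, p x s * u x s with hZ
  set W : ℝ → ℝ := fun x => ∫ s in (0:ℝ)..t, w x s with hW
  set N : ℝ → ℝ := fun x => (u x t - psi α β x t) + Z x with hN
  have hvc := S.cont_v_slice ht
  have hZi : ∀ c d, IntervalIntegrable Z volume c d := fun c d => S.intervalIntegrable_Z c d le_rfl ht
  have hNi : ∀ c d, IntervalIntegrable N volume c d := fun c d => (hvc.intervalIntegrable c d).add (hZi c d)
  have hWc : Continuous W := by
    have : Continuous fun x : ℝ => ∫ s in (0:ℝ)..t, w x (max s 0) :=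
      intervalIntegral.continuous_parametric_intervalIntegral_of_continuous' (by exact S.continuous_w) _ _
    convert this using 2 with x
    apply intervalIntegral.integral_congr
    intro s hs
    rw [uIcc_of_le ht] at hs
    simp [max_eq_left hs.1]
  have key := eq_endpoints_of_integral_eq_zero (h := fun x => W x - ∫ r in a..x, N r) hab
    (hWc.sub (intervalIntegral.continuous_primitive hNi a)) ?_
  · simp only [intervalIntegral.integral_same, sub_zero] at key
    have h1 : ∫ x in a..b, N x = (∫ x in a..b, (u x t - psi α β x t)) + ∫ x in a..b, Z x :=
      intervalIntegral.integral_add (hvc.intervalIntegrable _ _) (hZi _ _)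
    rw [intervalIntegral.integral_sub (S.intervalIntegrable_w _ le_rfl ht) (S.intervalIntegrable_w _ le_rfl ht)]
    simp only [hW] at key
    linarith
  · intro g hg hg0 hgi
    set χ : ℝ → ℝ := fun x => ∫ r in a..x, g r with hχ
    have hχc : Continuous χ := intervalIntegral.continuous_primitive (fun a b => hg.intervalIntegrable a b) a
    have h1 := S.aux_weak hab hg hg0 hgi (T := t + 1) (by linarith) t ⟨ht, by linarith⟩
    have hgw : Integrable (fun q : ℝ × ℝ => g q.1 * w q.1 q.2)
        ((volume.restrict (Ioc a b)).prod (volume.restrict (Ioc 0 t))) := by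
      rw [Measure.prod_restrict]
      have : ContinuousOn (fun q : ℝ × ℝ => g q.1 * w q.1 q.2) (Icc a b ×ˢ Icc 0 t) := by
        apply ContinuousOn.mul (by fun_prop)
        exact S.reg.2.2.1.mono (fun q hq => ⟨mem_univ _, hq.2.1⟩)
      exact (this.integrableOn_compact (isCompact_Icc.prod isCompact_Icc)).mono_set
        (prod_mono Ioc_subset_Icc_self Ioc_subset_Icc_self)
    have hkχ : Integrable (fun q : ℝ × ℝ => p q.1 q.2 * u q.1 q.2 * χ q.1)
        ((volume.restrict (Ioc a b)).prod (volume.restrict (Ioc 0 t))) := by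
      obtain ⟨C, hC⟩ := (isCompact_Icc (a := a) (b := b)).exists_bound_of_continuousOn hχc.continuousOn
      refine Integrable.mul_bdd (c := C) (S.integrable_source le_rfl) (by fun_prop) ?_
      rw [Measure.prod_restrict]
      filter_upwards [ae_restrict_mem (measurableSet_Ioc.prod measurableSet_Ioc)] with q hq
      exact hC q.1 (Ioc_subset_Icc_self hq.1)
    have sw1 : ∫ x in a..b, g x * W x = ∫ s in (0:ℝ)..t, ∫ x in a..b, g x * w x s := by
      simp only [hW, intervalIntegral.integral_of_le ht, intervalIntegral.integral_of_le hab.le]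
      rw [← integral_integral_swap (f := fun x s => g x * w x s) hgw]
      simp_rw [integral_const_mul]
    have sw2 : ∫ x in a..b, Z x * χ x
        = ∫ s in (0:ℝ)..t, ∫ x in a..b, p x s * u x s * χ x := by
      simp only [hZ, intervalIntegral.integral_of_le ht, intervalIntegral.integral_of_le hab.le]
      rw [← integral_integral_swap (f := fun x s => p x s * u x s * χ x) hkχ]
      simp_rw [integral_mul_const]
    have h2 := integral_mul_primitive (hg.intervalIntegrable a b) (hNi a b)
    rw [hgi, zero_mul, zero_sub] at h2
    have h3 : ∫ x in a..b, N x * χ x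
        = (∫ x in a..b, χ x * (u x t - psi α β x t)) + ∫ x in a..b, Z x * χ x := by
      have hc : Continuous fun x => χ x * (u x t - psi α β x t) := hχc.mul hvc
      rw [← intervalIntegral.integral_add (hc.intervalIntegrable _ _)
        ((hZi a b).mul_continuousOn hχc.continuousOn)]
      congr 1; funext x; simp only [hN]; ring
    have h4 : ∫ s in (0:ℝ)..t, ∫ x in a..b, (g x * w x s + p x s * u x s * χ x)
        = (∫ x in a..b, g x * W x) + ∫ x in a..b, Z x * χ x := by
      rw [sw1, sw2, ← intervalIntegral.integral_add]
      · rw [intervalIntegral.integral_of_le ht, intervalIntegral.integral_of_le ht]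
        apply integral_congr_ae
        filter_upwards [hgw.prod_left_ae, hkχ.prod_left_ae] with s hs1 hs2
        apply intervalIntegral.integral_add
        · rw [intervalIntegrable_iff_integrableOn_Ioc_of_le hab.le]; exact hs1
        · rw [intervalIntegrable_iff_integrableOn_Ioc_of_le hab.le]; exact hs2
      · rw [intervalIntegrable_iff_integrableOn_Ioc_of_le ht]
        simpa [IntegrableOn, intervalIntegral.integral_of_le hab.le] using hgw.integral_prod_right
      · rw [intervalIntegrable_iff_integrableOn_Ioc_of_le ht]
        simpa [IntegrableOn, intervalIntegral.integral_of_le hab.le] using hkχ.integral_prod_right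
    simp_rw [mul_sub]
    have hc : Continuous fun x => g x * W x := hg.mul hWc
    rw [intervalIntegral.integral_sub (hc.intervalIntegrable _ _)
      ((hg.intervalIntegrable _ _).mul_continuousOn (intervalIntegral.continuous_primitive hNi a).continuousOn), h2]
    change _ = - ∫ s in (0:ℝ)..t, ∫ x in a..b, (g x * w x s + p x s * u x s * χ x) at h1
    rw [h4] at h1
    simp only [hχ] at h1 h3 ⊢
    linarith

lemma v_zero (S : Sol α β u p w) (x : ℝ) : u x 0 - psi α β x 0 = 0 := by
  have hvc := S.cont_v_slice le_rfl
  have h := fun b (hb : x ≤ b) => S.rect_zero hb le_rfl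
  simp only [intervalIntegral.integral_same, intervalIntegral.integral_zero, sub_zero] at h
  have hd := (intervalIntegral.integral_hasDerivAt_right (hvc.intervalIntegrable x x)
    (hvc.stronglyMeasurableAtFilter _ _) hvc.continuousAt).hasDerivWithinAt (s := Ici x)
  have h0 : HasDerivWithinAt (fun b => ∫ y in x..b, (u y 0 - psi α β y 0)) 0 (Ici x) x :=
    (hasDerivWithinAt_const x (Ici x) (0:ℝ)).congr (fun b hb => h b hb) (h x le_rfl)
  exact (uniqueDiffWithinAt_Ici x).eq_deriv _ hd h0

/-- The equation integrated over a rectangle `[a,b] × [s,t]`. -/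
lemma rect (S : Sol α β u p w) {a b : ℝ} (hab : a ≤ b) {s t : ℝ} (hs : 0 ≤ s) (hst : s ≤ t) :
    ∫ x in a..b, ((u x t - psi α β x t) - (u x s - psi α β x s))
      = (∫ r in s..t, (w b r - w a r)) - ∫ x in a..b, ∫ r in s..t, p x r * u x r := by
  have ht := hs.trans hst
  have h1 := S.rect_zero hab ht
  have h2 := S.rect_zero hab hs
  rw [intervalIntegral.integral_sub ((S.cont_v_slice ht).intervalIntegrable _ _)
    ((S.cont_v_slice hs).intervalIntegrable _ _), h1, h2]
  have hwi : ∀ s t, 0 ≤ s → 0 ≤ t → IntervalIntegrable (fun r => w b r - w a r) volume s t :=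
    fun s t hs ht => (S.intervalIntegrable_w _ hs ht).sub (S.intervalIntegrable_w _ hs ht)
  have h3 := intervalIntegral.integral_add_adjacent_intervals (hwi 0 s le_rfl hs) (hwi s t hs ht)
  have h4 : ∫ x in a..b, ∫ r in (0:ℝ)..t, p x r * u x r = (∫ x in a..b, ∫ r in (0:ℝ)..s, p x r * u x r)
      + ∫ x in a..b, ∫ r in s..t, p x r * u x r := by
    rw [← intervalIntegral.integral_add (S.intervalIntegrable_Z _ _ le_rfl hs) (S.intervalIntegrable_Z _ _ hs hst)]
    rw [intervalIntegral.integral_of_le hab, intervalIntegral.integral_of_le hab]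
    apply integral_congr_ae
    filter_upwards [(S.integrable_source (a := a) (b := b) (t₂ := t) le_rfl).prod_right_ae] with x hx
    have hx' : IntervalIntegrable (fun r => p x r * u x r) volume 0 t := by
      rw [intervalIntegrable_iff_integrableOn_Ioc_of_le ht]; exact hx
    rw [intervalIntegral.integral_add_adjacent_intervals
      (hx'.mono_set (by rw [uIcc_of_le hs, uIcc_of_le ht]; exact Icc_subset_Icc le_rfl hst))
      (hx'.mono_set (by rw [uIcc_of_le hst, uIcc_of_le ht]; exact Icc_subset_Icc hs le_rfl))]
  rw [h4, ← h3]; ring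

end Sol

lemma left_max_deriv {g : ℝ → ℝ} {D a : ℝ} (hd : HasDerivWithinAt g D (Iic a) a)
    (h : ∀ᶠ t in nhdsWithin a (Iio a), g t ≤ g a) : 0 ≤ D := by
  have h1 := hd.mono Iio_subset_Iic_self
  rw [hasDerivWithinAt_iff_tendsto_slope' (by simp)] at h1
  refine ge_of_tendsto h1 ?_
  filter_upwards [h, self_mem_nhdsWithin] with t ht hta
  rw [slope_def_field]
  exact div_nonneg_of_nonpos (by linarith) (by linarith [mem_Iio.1 hta])

lemma right_max_deriv {g : ℝ → ℝ} {D a : ℝ} (hd : HasDerivWithinAt g D (Ici a) a)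
    (h : ∀ᶠ t in nhdsWithin a (Ioi a), g t ≤ g a) : D ≤ 0 := by
  have h1 := hd.mono Ioi_subset_Ici_self
  rw [hasDerivWithinAt_iff_tendsto_slope' (by simp)] at h1
  refine le_of_tendsto h1 ?_
  filter_upwards [h, self_mem_nhdsWithin] with t ht hta
  rw [slope_def_field]
  exact div_nonpos_of_nonpos_of_nonneg (by linarith) (by linarith [mem_Ioi.1 hta])

lemma hasDerivAt_integral_of_continuous {q qx : ℝ → ℝ → ℝ}
    (hq : Continuous (fun z : ℝ × ℝ => q z.1 z.2)) (hqx : Continuous (fun z : ℝ × ℝ => qx z.1 z.2))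
    (hd : ∀ x t, HasDerivAt (fun y => q y t) (qx x t) x) (a b x : ℝ) :
    HasDerivAt (fun y => ∫ s in a..b, q y s) (∫ s in a..b, qx x s) x := by
  obtain ⟨C, hC⟩ := ((isCompact_Icc (a := x - 1) (b := x + 1)).prod
    (isCompact_uIcc (a := a) (b := b))).exists_bound_of_continuousOn hqx.continuousOn
  have hs : ∀ y, Continuous fun s => q y s := fun y => hq.comp (by fun_prop : Continuous fun s => (y, s))
  have hsx : ∀ y, Continuous fun s => qx y s := fun y => hqx.comp (by fun_prop : Continuous fun s => (y, s))
  refine (intervalIntegral.hasDerivAt_integral_of_dominated_loc_of_deriv_le (bound := fun _ => C)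
    (F := q) (F' := qx) (Icc_mem_nhds (by linarith : x - 1 < x) (by linarith : x < x + 1))
    (Eventually.of_forall fun y => (hs y).aestronglyMeasurable) ((hs x).intervalIntegrable _ _)
    (hsx x).aestronglyMeasurable (ae_of_all _ fun s hs y hy => ?_) (by simp)
    (ae_of_all _ fun s _ y _ => hd y s)).2
  exact hC (y, s) ⟨hy, uIoc_subset_uIcc hs⟩

/-- A strict integrated subsolution has no strict backward local maximum. -/
lemma no_strict_max {q qx : ℝ → ℝ → ℝ} {x0 t0 r e : ℝ} (hr : 0 < r) (he : 0 < e)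
    (hq : Continuous (fun z : ℝ × ℝ => q z.1 z.2)) (hqx : Continuous (fun z : ℝ × ℝ => qx z.1 z.2))
    (hd : ∀ x t, HasDerivAt (fun y => q y t) (qx x t) x)
    (rect : ∀ y z s t, x0 - r ≤ y → y ≤ z → z ≤ x0 + r → t0 - r ≤ s → s ≤ t → t ≤ t0 →
      ∫ x in y..z, (q x t - q x s) ≤ (∫ τ in s..t, (qx z τ - qx y τ)) - e * ((z - y) * (t - s)))
    (h0 : q x0 t0 = 0)
    (hmax : ∀ x t, x0 - r ≤ x → x ≤ x0 + r → t0 - r ≤ t → t ≤ t0 →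
      q x t ≤ -e * ((x - x0) ^ 2 + (t0 - t))) : False := by
  set m := e * min (r ^ 2) (r / 2) with hm
  have hmpos : 0 < m := mul_pos he (lt_min (by positivity) (by positivity))
  have hs : ∀ y, Continuous fun s => q y s := fun y => hq.comp (by fun_prop : Continuous fun s => (y, s))
  have hsx : ∀ y, Continuous fun s => qx y s := fun y => hqx.comp (by fun_prop : Continuous fun s => (y, s))
  obtain ⟨ε, hε, hεr, hεm⟩ : ∃ ε, 0 < ε ∧ ε < r / 2 ∧ ∀ s ∈ Icc 0 ε, -(m / 2) < q x0 (t0 - s) := by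
    have h1 : ContinuousAt (fun s => q x0 (t0 - s)) 0 := by
      have : Continuous fun s => q x0 (t0 - s) := (hs x0).comp (by fun_prop)
      exact this.continuousAt
    have h2 : ∀ᶠ s in nhds (0:ℝ), -(m/2) < q x0 (t0 - s) :=
      h1.eventually_const_lt (by simp [h0]; linarith)
    obtain ⟨δ, hδ, hδ2⟩ := Metric.eventually_nhds_iff.1 h2
    refine ⟨min (δ/2) (r/4), by positivity, lt_of_le_of_lt (min_le_right _ _) (by linarith), fun s hs => hδ2 ?_⟩
    rw [Real.dist_eq, sub_zero, abs_of_nonneg hs.1]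
    exact lt_of_le_of_lt (hs.2.trans (min_le_left _ _)) (by linarith)
  set j : ℝ → ℝ → ℝ := fun x t => ∫ s in (0:ℝ)..ε, q x (t - s) with hj
  have hjc : Continuous (fun z : ℝ × ℝ => j z.1 z.2) := by
    apply intervalIntegral.continuous_parametric_intervalIntegral_of_continuous'
    exact hq.comp (by fun_prop : Continuous fun z : (ℝ × ℝ) × ℝ => (z.1.1, z.1.2 - z.2))
  have hsub : ∀ x t, Continuous fun s => q x (t - s) := fun x t => (hs x).comp (by fun_prop)
  obtain ⟨⟨x1, t1⟩, hmem, hx1⟩ := ((isCompact_Icc (a := x0 - r) (b := x0 + r)).prod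
    (isCompact_Icc (a := t0 - r / 2) (b := t0))).exists_isMaxOn
      ⟨(x0, t0), ⟨⟨by linarith, by linarith⟩, ⟨by linarith, le_rfl⟩⟩⟩ hjc.continuousOn
  obtain ⟨⟨hx1a, hx1b⟩, ht1a, ht1b⟩ := hmem
  simp only at hx1a hx1b ht1a ht1b
  have hjmax : ∀ x t, x0 - r ≤ x → x ≤ x0 + r → t0 - r / 2 ≤ t → t ≤ t0 → j x t ≤ j x1 t1 :=
    fun x t h1 h2 h3 h4 => hx1 (show (x, t) ∈ _ from ⟨⟨h1, h2⟩, ⟨h3, h4⟩⟩)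
  have hj0 : -(ε * (m / 2)) ≤ j x1 t1 := by
    refine le_trans ?_ (hjmax x0 t0 (by linarith) (by linarith) (by linarith) le_rfl)
    have := intervalIntegral.integral_mono_on (μ := volume) (a := 0) (b := ε) hε.le
      (f := fun _ => -(m/2)) (g := fun s => q x0 (t0 - s)) intervalIntegrable_const
      ((hsub _ _).intervalIntegrable _ _) (fun s hs => (hεm s hs).le)
    simp only [intervalIntegral.integral_const, smul_eq_mul, sub_zero] at this
    simp only [hj]; linarith
  have hjlow : ∀ x t, (∀ s ∈ Icc 0 ε, q x (t - s) ≤ -m) → j x t ≤ -(ε * m) := by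
    intro x t h
    have := intervalIntegral.integral_mono_on (μ := volume) (a := 0) (b := ε) hε.le
      (f := fun s => q x (t - s)) (g := fun s => -m) ((hsub _ _).intervalIntegrable _ _)
      intervalIntegrable_const h
    simp only [intervalIntegral.integral_const, smul_eq_mul, sub_zero] at this
    simp only [hj]; linarith
  have hεm' : 0 < ε * m := mul_pos hε hmpos
  have hxint : (x1 - x0) ^ 2 < r ^ 2 := by
    by_contra hcon
    push Not at hcon
    have := hjlow x1 t1 fun s hs => by
      refine (hmax x1 (t1 - s) hx1a hx1b (by linarith [hs.2]) (by linarith [hs.1])).trans ?_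
      have h1 : min (r^2) (r/2) ≤ r^2 := min_le_left _ _
      have h2 : 0 ≤ t0 - (t1 - s) := by linarith [hs.1]
      have : e * min (r^2) (r/2) ≤ e * ((x1 - x0)^2 + (t0 - (t1 - s))) := by gcongr; linarith
      rw [hm]; linarith
    linarith
  have htint : t0 - r / 2 < t1 := by
    by_contra hcon
    push Not at hcon
    have := hjlow x1 t1 fun s hs => by
      refine (hmax x1 (t1 - s) hx1a hx1b (by linarith [hs.2]) (by linarith [hs.1])).trans ?_
      have h1 : min (r^2) (r/2) ≤ r/2 := min_le_right _ _
      have h2 : r/2 ≤ t0 - (t1 - s) := by linarith [hs.1]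
      have : e * min (r^2) (r/2) ≤ e * ((x1 - x0)^2 + (t0 - (t1 - s))) := by
        gcongr; nlinarith [sq_nonneg (x1 - x0)]
      rw [hm]; linarith
    linarith
  have hxabs := abs_lt_of_sq_lt_sq hxint hr.le
  rw [abs_lt] at hxabs
  have hchange : ∀ (f : ℝ → ℝ) t, ∫ s in (0:ℝ)..ε, f (t - s) = ∫ s in (t - ε)..t, f s := fun f t => by
    rw [intervalIntegral.integral_comp_sub_left (fun s => f s) t]; simp
  have htime : 0 ≤ q x1 t1 - q x1 (t1 - ε) := by
    have hP : ∀ t, HasDerivAt (fun t => ∫ s in (0:ℝ)..t, q x1 s) (q x1 t) t := fun t =>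
      intervalIntegral.integral_hasDerivAt_right ((hs x1).intervalIntegrable _ _)
        ((hs x1).stronglyMeasurableAtFilter _ _) (hs x1).continuousAt
    have hD : HasDerivAt (fun t => j x1 t) (q x1 t1 - q x1 (t1 - ε)) t1 := by
      have h1 := (hP t1).sub ((hP (t1 - ε)).comp_sub_const t1 ε)
      refine h1.congr_of_eventuallyEq (Eventually.of_forall fun t => ?_)
      simp only [hj, Pi.sub_apply]
      rw [hchange (q x1) t, intervalIntegral.integral_interval_sub_left ((hs x1).intervalIntegrable _ _)
        ((hs x1).intervalIntegrable _ _)]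
    refine left_max_deriv hD.hasDerivWithinAt ?_
    filter_upwards [Ioo_mem_nhdsLT htint] with t ht
    exact hjmax x1 t hx1a hx1b ht.1.le (ht.2.le.trans ht1b)
  obtain ⟨ρ, hρ, hρr, hρq⟩ : ∃ ρ > 0, (x0 - r ≤ x1 - ρ ∧ x1 + ρ ≤ x0 + r) ∧
      ∀ z ∈ Icc (x1 - ρ) (x1 + ρ), -(e * ε / 2) ≤ q z t1 - q z (t1 - ε) := by
    have hc : Continuous fun z => q z t1 - q z (t1 - ε) :=
      (hq.comp (by fun_prop : Continuous fun z : ℝ => (z, t1))).sub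
        (hq.comp (by fun_prop : Continuous fun z : ℝ => (z, t1 - ε)))
    have h2 : ∀ᶠ z in nhds x1, -(e * ε / 2) < q z t1 - q z (t1 - ε) :=
      hc.continuousAt.eventually_const_lt (by have := mul_pos he hε; linarith)
    obtain ⟨δ, hδ, hδ2⟩ := Metric.eventually_nhds_iff.1 h2
    refine ⟨min (δ/2) (min (x1 - (x0 - r)) (x0 + r - x1)), by
      refine lt_min (by linarith) (lt_min (by linarith) (by linarith)), ⟨?_, ?_⟩, fun z hz => (hδ2 ?_).le⟩
    · linarith [(min_le_right (δ/2) (min (x1 - (x0 - r)) (x0 + r - x1))).trans (min_le_left _ _)]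
    · linarith [(min_le_right (δ/2) (min (x1 - (x0 - r)) (x0 + r - x1))).trans (min_le_right _ _)]
    · rw [Real.dist_eq, abs_lt]
      have := min_le_left (δ/2) (min (x1 - (x0 - r)) (x0 + r - x1))
      constructor <;> linarith [hz.1, hz.2]
  have hjd : ∀ x, HasDerivAt (fun x => j x t1) (∫ s in (t1 - ε)..t1, qx x s) x := fun x => by
    have := hasDerivAt_integral_of_continuous hq hqx hd (t1 - ε) t1 x
    refine this.congr_of_eventuallyEq (Eventually.of_forall fun y => ?_)
    simp only [hj]; rw [hchange (q y) t1]
  set k : ℝ → ℝ := fun σ => j (x1 + σ) t1 - j (x1 + σ - ρ) t1 with hk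
  have hkd : ∀ σ, HasDerivAt k ((∫ s in (t1 - ε)..t1, qx (x1 + σ) s)
      - ∫ s in (t1 - ε)..t1, qx (x1 + σ - ρ) s) σ := fun σ => by
    have h1 := (hjd (x1 + σ)).comp_const_add x1 σ
    have h2 : HasDerivAt (fun σ => j (x1 + σ - ρ) t1) (∫ s in (t1 - ε)..t1, qx (x1 + σ - ρ) s) σ := by
      have := (hjd (x1 - ρ + σ)).comp_const_add (x1 - ρ) σ
      have e : ∀ σ, x1 - ρ + σ = x1 + σ - ρ := fun σ => by ring
      simpa only [e] using this
    exact h1.sub h2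
  have hmono : StrictMonoOn k (Icc 0 ρ) := by
    apply strictMonoOn_of_deriv_pos (convex_Icc _ _)
    · exact (continuous_iff_continuousAt.2 fun σ => (hkd σ).continuousAt).continuousOn
    · intro σ hσ
      rw [interior_Icc] at hσ
      rw [(hkd σ).deriv]
      have h1 := rect (x1 + σ - ρ) (x1 + σ) (t1 - ε) t1 (by linarith [hσ.1]) (by linarith)
        (by linarith [hσ.2]) (by linarith) (by linarith) ht1b
      have h2 := intervalIntegral.integral_mono_on (μ := volume) (a := x1 + σ - ρ) (b := x1 + σ) (by linarith)
        (f := fun _ => -(e * ε / 2)) (g := fun z => q z t1 - q z (t1 - ε)) intervalIntegrable_const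
        (Continuous.intervalIntegrable ((hq.comp (by fun_prop : Continuous fun z : ℝ => (z, t1))).sub
          (hq.comp (by fun_prop : Continuous fun z : ℝ => (z, t1 - ε)))) _ _)
        (fun z hz => hρq z ⟨by linarith [hz.1, hσ.1], by linarith [hz.2, hσ.2]⟩)
      rw [intervalIntegral.integral_sub ((hsx _).intervalIntegrable _ _) ((hsx _).intervalIntegrable _ _)] at h1
      simp only [intervalIntegral.integral_const, smul_eq_mul] at h2
      have h3 : 0 < ρ * (e * ε) := by positivity
      nlinarith
  have hfin := hmono (left_mem_Icc.2 hρ.le) (right_mem_Icc.2 hρ.le) hρ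
  simp only [hk, add_zero, add_sub_cancel_right] at hfin
  have h1 := hjmax (x1 - ρ) t1 (by linarith) (by linarith) ht1a ht1b
  have h2 := hjmax (x1 + ρ) t1 (by linarith) (by linarith) ht1a ht1b
  linarith

open Asymptotics in
/-- Second-order Taylor expansion at a point. -/
def Taylor2 (g : ℝ → ℝ) (y g1 g2 : ℝ) : Prop :=
  (fun z => g z - g y - g1 * (z - y) - g2 / 2 * (z - y) ^ 2) =o[nhds y] (fun z => (z - y) ^ 2)

open Asymptotics in
/-- Parabolic second-order expansion at a point: `b = ∂ₓζ`, `c = ∂ₓₓζ`, `d = ∂ₜζ`. -/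
def Jet (ζ : ℝ → ℝ → ℝ) (x t b c d : ℝ) : Prop :=
  (fun z : ℝ × ℝ => ζ z.1 z.2 - ζ x t - b * (z.1 - x) - c / 2 * (z.1 - x) ^ 2 - d * (z.2 - t))
    =o[nhds (x, t)] (fun z : ℝ × ℝ => (z.1 - x) ^ 2 + |z.2 - t|)

lemma taylor2_of_hasDerivAt {g g' : ℝ → ℝ} {y g2 : ℝ}
    (h : ∀ᶠ z in nhds y, HasDerivAt g (g' z) z) (h2 : HasDerivAt g' g2 y) :
    Taylor2 g y (g' y) g2 := by
  unfold Taylor2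
  rw [Asymptotics.isLittleO_iff]
  intro ε hε
  have h3 := (hasDerivAt_iff_isLittleO.1 h2)
  rw [Asymptotics.isLittleO_iff] at h3
  have h4 := (h3 hε).and h
  obtain ⟨δ, hδ, hball⟩ := Metric.eventually_nhds_iff_ball.1 h4
  filter_upwards [Metric.ball_mem_nhds y hδ] with z hz
  have hseg : ∀ ξ ∈ segment ℝ y z, ξ ∈ Metric.ball y δ ∧ |ξ - y| ≤ |z - y| := by
    intro ξ hξ
    refine ⟨(convex_ball y δ).segment_subset (Metric.mem_ball_self hδ) hz hξ, ?_⟩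
    rw [segment_eq_uIcc] at hξ
    exact abs_sub_left_of_mem_uIcc hξ
  have key := (convex_segment y z).norm_image_sub_le_of_norm_hasDerivWithin_le
    (f := fun ξ => g ξ - g y - g' y * (ξ - y) - g2 / 2 * (ξ - y) ^ 2)
    (f' := fun ξ => g' ξ - g' y - g2 * (ξ - y)) (C := ε * |z - y|) (x := y) (y := z)
    (fun ξ hξ => by
      have h5 := (hball ξ (hseg ξ hξ).1).2
      have h6 : HasDerivAt (fun ξ : ℝ => ξ - y) 1 ξ := (hasDerivAt_id ξ).sub_const y
      have h7 := ((h5.sub_const (g y)).sub (h6.const_mul (g' y))).sub ((h6.pow 2).const_mul (g2/2))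
      exact (h7.congr_deriv (by simp; ring)).hasDerivWithinAt)
    (fun ξ hξ => by
      have h5 := (hball ξ (hseg ξ hξ).1).1
      simp only [smul_eq_mul, Real.norm_eq_abs] at h5 ⊢
      rw [mul_comm g2]
      exact h5.trans (mul_le_mul_of_nonneg_left (hseg ξ hξ).2 hε.le))
    (left_mem_segment ℝ y z) (right_mem_segment ℝ y z)
  simp only [sub_self, mul_zero, ne_eq, OfNat.ofNat_ne_zero, not_false_eq_true, zero_pow, sub_zero,
    Real.norm_eq_abs] at key ⊢
  have hsq : |(z - y) ^ 2| = |z - y| * |z - y| := by rw [abs_pow, pow_two]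
  rw [hsq]
  linarith

namespace Jet
open Asymptotics
variable {ζ ξ : ℝ → ℝ → ℝ} {x t b c d b' c' d' : ℝ}

lemma dx_isBigO (x t : ℝ) : (fun z : ℝ × ℝ => (z.1 - x) ^ 2) =O[nhds (x, t)]
    (fun z : ℝ × ℝ => (z.1 - x) ^ 2 + |z.2 - t|) :=
  IsBigO.of_bound 1 (Eventually.of_forall fun z => by
    rw [Real.norm_of_nonneg (by positivity), Real.norm_of_nonneg (by positivity)]
    linarith [abs_nonneg (z.2 - t)])

lemma dt_isBigO (x t : ℝ) : (fun z : ℝ × ℝ => z.2 - t) =O[nhds (x, t)]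
    (fun z : ℝ × ℝ => (z.1 - x) ^ 2 + |z.2 - t|) :=
  IsBigO.of_bound 1 (Eventually.of_forall fun z => by
    rw [Real.norm_eq_abs, Real.norm_of_nonneg (by positivity)]
    linarith [sq_nonneg (z.1 - x)])

lemma tendsto_dx (x t : ℝ) : Tendsto (fun z : ℝ × ℝ => z.1 - x) (nhds (x, t)) (nhds 0) := by
  have : Continuous (fun z : ℝ × ℝ => z.1 - x) := by fun_prop
  simpa using this.tendsto (x, t)

lemma tendsto_N (x t : ℝ) :
    Tendsto (fun z : ℝ × ℝ => (z.1 - x) ^ 2 + |z.2 - t|) (nhds (x, t)) (nhds 0) := by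
  have : Continuous (fun z : ℝ × ℝ => (z.1 - x) ^ 2 + |z.2 - t|) := by fun_prop
  simpa using this.tendsto (x, t)

lemma rem_isBigO (h : Jet ζ x t b c d) :
    (fun z : ℝ × ℝ => ζ z.1 z.2 - ζ x t - b * (z.1 - x)) =O[nhds (x, t)]
      (fun z : ℝ × ℝ => (z.1 - x) ^ 2 + |z.2 - t|) := by
  have := (h.isBigO.add ((dx_isBigO x t).const_mul_left (c/2))).add ((dt_isBigO x t).const_mul_left d)
  refine this.congr_left fun z => ?_
  ring

lemma mul_rem (h : Jet ζ x t b c d) (h' : Jet ξ x t b' c' d') :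
    (fun z : ℝ × ℝ => (ζ z.1 z.2 - ζ x t) * (ξ z.1 z.2 - ξ x t) - b * b' * (z.1 - x) ^ 2)
      =o[nhds (x, t)] (fun z : ℝ × ℝ => (z.1 - x) ^ 2 + |z.2 - t|) := by
  have hdx : (fun z : ℝ × ℝ => z.1 - x) =o[nhds (x, t)] (fun _ => (1:ℝ)) :=
    (isLittleO_one_iff ℝ).2 (tendsto_dx x t)
  have hE : (fun z : ℝ × ℝ => ζ z.1 z.2 - ζ x t - b * (z.1 - x)) =o[nhds (x, t)] (fun _ => (1:ℝ)) :=
    h.rem_isBigO.trans_isLittleO ((isLittleO_one_iff ℝ).2 (tendsto_N x t))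
  have h1 := (hdx.mul_isBigO h'.rem_isBigO).const_mul_left b
  have h2 := (hdx.mul_isBigO h.rem_isBigO).const_mul_left b'
  have h3 := hE.mul_isBigO h'.rem_isBigO
  have := (h1.add h2).add h3
  simp only [one_mul] at this
  refine this.congr_left fun z => ?_
  ring

lemma congr_eventually (h : Jet ζ x t b c d) (he : ∀ᶠ z : ℝ × ℝ in nhds (x, t), ξ z.1 z.2 = ζ z.1 z.2) :
    Jet ξ x t b c d := by
  have h0 : ξ x t = ζ x t := he.self_of_nhds
  refine IsLittleO.congr' h ?_ EventuallyEq.rfl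
  filter_upwards [he] with z hz
  rw [hz, h0]

protected lemma const (k x t : ℝ) : Jet (fun _ _ => k) x t 0 0 0 := by
  unfold Jet; simp

protected lemma fst (x t : ℝ) : Jet (fun x _ => x) x t 1 0 0 := by
  unfold Jet; simp

lemma of_time {g : ℝ → ℝ} {g' : ℝ} (x : ℝ) (h : HasDerivAt g g' t) : Jet (fun _ t => g t) x t 0 0 g' := by
  have h1 := (hasDerivAt_iff_isLittleO.1 h).comp_tendsto
    (k := fun z : ℝ × ℝ => z.2) (l' := nhds (x, t)) continuous_snd.continuousAt
  have := h1.trans_isBigO (dt_isBigO x t)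
  refine this.congr_left fun z => ?_
  simp; ring

lemma comp {g : ℝ → ℝ} {g1 g2 : ℝ} (h : Jet ζ x t b c d) (hg : Taylor2 g (ζ x t) g1 g2) :
    Jet (fun x t => g (ζ x t)) x t (g1 * b) (g1 * c + g2 * b ^ 2) (g1 * d) := by
  have hcont : Tendsto (fun z : ℝ × ℝ => ζ z.1 z.2) (nhds (x, t)) (nhds (ζ x t)) := by
    have h1 : Tendsto (fun z : ℝ × ℝ => ζ z.1 z.2 - ζ x t - b * (z.1 - x)) (nhds (x, t)) (nhds 0) :=
      h.rem_isBigO.trans_tendsto (tendsto_N x t)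
    have h2 := (h1.add ((tendsto_dx x t).const_mul b)).add_const (ζ x t)
    simpa using h2
  have hm := h.mul_rem h
  have hsq : (fun z : ℝ × ℝ => (ζ z.1 z.2 - ζ x t) ^ 2) =O[nhds (x, t)]
      (fun z : ℝ × ℝ => (z.1 - x) ^ 2 + |z.2 - t|) := by
    refine (hm.isBigO.add ((dx_isBigO x t).const_mul_left (b * b))).congr_left fun z => ?_
    ring
  have h1 := (hg.comp_tendsto hcont).trans_isBigO hsq
  have h2 := (h1.add (IsLittleO.const_mul_left h g1)).add (hm.const_mul_left (g2 / 2))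
  refine h2.congr_left fun z => ?_
  simp only [Function.comp]; ring

lemma add (h : Jet ζ x t b c d) (h' : Jet ξ x t b' c' d') :
    Jet (fun x t => ζ x t + ξ x t) x t (b + b') (c + c') (d + d') :=
  (IsLittleO.add h h').congr_left fun z => by ring

lemma const_mul (h : Jet ζ x t b c d) (k : ℝ) :
    Jet (fun x t => k * ζ x t) x t (k * b) (k * c) (k * d) :=
  (IsLittleO.const_mul_left h k).congr_left fun z => by ring

lemma sub (h : Jet ζ x t b c d) (h' : Jet ξ x t b' c' d') :
    Jet (fun x t => ζ x t - ξ x t) x t (b - b') (c - c') (d - d') :=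
  (IsLittleO.sub h h').congr_left fun z => by ring

lemma mul (h : Jet ζ x t b c d) (h' : Jet ξ x t b' c' d') :
    Jet (fun x t => ζ x t * ξ x t) x t (b * ξ x t + ζ x t * b')
      (c * ξ x t + 2 * (b * b') + ζ x t * c') (d * ξ x t + ζ x t * d') := by
  have := ((h.mul_rem h').add (IsLittleO.const_mul_left h (ξ x t))).add
    (IsLittleO.const_mul_left h' (ζ x t))
  exact this.congr_left fun z => by ring

lemma congr_coeff (h : Jet ζ x t b c d) (hb : b = b') (hc : c = c') (hd : d = d') :
    Jet ζ x t b' c' d' := by subst hb hc hd; exact h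

end Jet

/-- Touching principle: an integrated subsolution `f_t - f_xx ≤ G` touched from above by `ζ`. -/
lemma touch_above {f fx : ℝ → ℝ → ℝ} {ζ : ℝ → ℝ → ℝ} {x0 t0 r G b c d : ℝ} (hr : 0 < r)
    (hf : Continuous (fun z : ℝ × ℝ => f z.1 z.2)) (hfx : Continuous (fun z : ℝ × ℝ => fx z.1 z.2))
    (hd : ∀ x t, HasDerivAt (fun y => f y t) (fx x t) x)
    (rect : ∀ y z s t, x0 - r ≤ y → y ≤ z → z ≤ x0 + r → t0 - r ≤ s → s ≤ t → t ≤ t0 →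
      ∫ x in y..z, (f x t - f x s) ≤ (∫ τ in s..t, (fx z τ - fx y τ)) + G * ((z - y) * (t - s)))
    (hζ : Jet ζ x0 t0 b c d)
    (hmax : ∀ᶠ z : ℝ × ℝ in nhds (x0, t0), z.2 ≤ t0 → f z.1 z.2 - ζ z.1 z.2 ≤ f x0 t0 - ζ x0 t0) :
    d - c ≤ G := by
  by_contra hcon
  push Not at hcon
  set e := (d - c - G) / 7 with he
  have hepos : 0 < e := by rw [he]; linarith
  unfold Jet at hζ
  rw [Asymptotics.isLittleO_iff] at hζ
  obtain ⟨δ, hδ, hball⟩ := Metric.eventually_nhds_iff_ball.1 ((hζ hepos).and hmax)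
  set R := min r (δ / 2) with hR
  have hRpos : 0 < R := lt_min hr (by linarith)
  have hRr : R ≤ r := min_le_left _ _
  have hRδ : R < δ := (min_le_right r (δ/2)).trans_lt (by linarith)
  refine no_strict_max (q := fun x t => f x t - f x0 t0 - b * (x - x0) - c / 2 * (x - x0) ^ 2
      - d * (t - t0) - 2 * e * ((x - x0) ^ 2 + (t0 - t)))
    (qx := fun x t => fx x t - b - (c + 4 * e) * (x - x0)) (x0 := x0) (t0 := t0) hRpos hepos
    (by fun_prop) (by fun_prop) ?_ ?_ (by simp) ?_
  · intro x t
    have h1 : HasDerivAt (fun ξ : ℝ => ξ - x0) 1 x := (hasDerivAt_id x).sub_const x0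
    have h2 := ((((hd x t).sub_const (f x0 t0)).sub (h1.const_mul b)).sub ((h1.pow 2).const_mul (c/2))
      |>.sub_const (d * (t - t0))).sub (((h1.pow 2).add_const (t0 - t)).const_mul (2 * e))
    refine h2.congr_deriv ?_
    simp; ring
  · intro y z s t h1 h2 h3 h4 h5 h6
    have key := rect y z s t (by linarith) h2 (by linarith) (by linarith) h5 h6
    have e1 : ∀ x, (f x t - f x0 t0 - b * (x - x0) - c / 2 * (x - x0) ^ 2 - d * (t - t0)
        - 2 * e * ((x - x0) ^ 2 + (t0 - t))) - (f x s - f x0 t0 - b * (x - x0) - c / 2 * (x - x0) ^ 2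
        - d * (s - t0) - 2 * e * ((x - x0) ^ 2 + (t0 - s))) = (f x t - f x s) - (d - 2 * e) * (t - s) :=
      fun x => by ring
    have e2 : ∀ τ, (fx z τ - b - (c + 4 * e) * (z - x0)) - (fx y τ - b - (c + 4 * e) * (y - x0))
        = (fx z τ - fx y τ) - (c + 4 * e) * (z - y) := fun τ => by ring
    have c1 : ∀ t, Continuous fun x => f x t := fun t => hf.comp (by fun_prop : Continuous fun x : ℝ => (x, t))
    have c2 : ∀ x, Continuous fun t => fx x t := fun x => hfx.comp (by fun_prop : Continuous fun t : ℝ => (x, t))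
    have c3 : Continuous fun x => f x t - f x s := (c1 t).sub (c1 s)
    have c4 : Continuous fun τ => fx z τ - fx y τ := (c2 z).sub (c2 y)
    simp_rw [e1, e2]
    rw [intervalIntegral.integral_sub (c3.intervalIntegrable y z) intervalIntegrable_const,
      intervalIntegral.integral_sub (c4.intervalIntegrable s t) intervalIntegrable_const]
    simp only [intervalIntegral.integral_const, smul_eq_mul]
    have : (d - c - G) = 7 * e := by rw [he]; ring
    have h7 : G = d - c - 7 * e := by linarith
    rw [h7] at key
    linarith
  · intro x t h1 h2 h3 h4
    obtain ⟨k1, k2⟩ := hball (x, t) (by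
      rw [Metric.mem_ball, Prod.dist_eq, Real.dist_eq, Real.dist_eq]
      exact max_lt (abs_lt.2 ⟨by linarith, by linarith⟩) (abs_lt.2 ⟨by linarith, by linarith⟩))
    have k2 := k2 h4
    simp only at k1 k2
    have h8 : |t - t0| = t0 - t := by rw [abs_of_nonpos (by linarith)]; ring
    rw [Real.norm_eq_abs, Real.norm_of_nonneg (by positivity), h8] at k1
    have := (abs_le.1 k1).2
    linarith

lemma hasDerivAt_inv_sqrt {t : ℝ} (ht : 0 < t) :
    HasDerivAt (fun t => (Real.sqrt t)⁻¹) (-(Real.sqrt t)⁻¹ / (2 * t)) t := by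
  have h1 := (Real.hasDerivAt_sqrt ht.ne').inv (Real.sqrt_pos.2 ht).ne'
  refine h1.congr_deriv ?_
  have := Real.sqrt_pos.2 ht
  have h2 := Real.sq_sqrt ht.le
  field_simp
  rw [h2]

/-- Expansion of a function of the similarity variable `x / √t`. -/
lemma Jet.similarity {φ : ℝ → ℝ} {x t φ1 φ2 : ℝ} (ht : 0 < t)
    (hφ : Taylor2 φ (x / Real.sqrt t) φ1 φ2) :
    Jet (fun x t => φ (x / Real.sqrt t)) x t (φ1 / Real.sqrt t) (φ2 / t)
      (-(φ1 * (x / Real.sqrt t) / (2 * t))) := by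
  have h1 := (Jet.fst x t).mul (Jet.of_time x (hasDerivAt_inv_sqrt ht))
  rw [div_eq_mul_inv] at hφ
  have h2 := h1.comp hφ
  have hs := Real.sqrt_pos.2 ht
  have hs2 := Real.sq_sqrt ht.le
  simp only [← div_eq_mul_inv] at h2
  refine h2.congr_coeff ?_ ?_ ?_
  · field_simp; ring
  · calc _ = φ2 * (1 / Real.sqrt t) ^ 2 := by ring
      _ = _ := by rw [div_pow, hs2]; ring
  · field_simp; ring

lemma Jet.reflect {ζ : ℝ → ℝ → ℝ} {x t b c d : ℝ} (h : Jet ζ x t b c d) :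
    Jet (fun x t => ζ (-x) t) (-x) t (-b) c d := by
  have hk : Tendsto (fun z : ℝ × ℝ => (-z.1, z.2)) (nhds (-x, t)) (nhds (x, t)) := by
    have : Continuous (fun z : ℝ × ℝ => (-z.1, z.2)) := by fun_prop
    simpa using this.tendsto (-x, t)
  have := Asymptotics.IsLittleO.comp_tendsto h hk
  refine (this.congr_left fun z => ?_).congr_right fun z => ?_
  · simp only [Function.comp, neg_neg]; ring
  · simp only [Function.comp]; ring

lemma taylor2_gaussTail (η : ℝ) :
    Taylor2 gaussTail η (-Real.exp (-η ^ 2 / 4)) (η / 2 * Real.exp (-η ^ 2 / 4)) := by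
  refine taylor2_of_hasDerivAt (g' := fun η => -Real.exp (-η ^ 2 / 4))
    (Eventually.of_forall hasDerivAt_gaussTail) ?_
  have := ((((hasDerivAt_id η).pow 2).neg.div_const 4).exp).neg
  refine this.congr_deriv ?_
  simp; ring

lemma psi_jet {α : ℝ} (hα : 0 < α) (β : ℝ) {x t : ℝ} (ht : 0 < t) (hx : |x| ≠ α * Real.sqrt t) :
    ∃ b c, Jet (psi α β) x t b c c := by
  have hpos : ∀ᶠ z : ℝ × ℝ in nhds (x, t), 0 < z.2 :=
    continuousAt_snd.eventually (lt_mem_nhds ht)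
  have hcl : ContinuousAt (fun z : ℝ × ℝ => |z.1|) (x, t) := by fun_prop
  have hcr : ContinuousAt (fun z : ℝ × ℝ => α * Real.sqrt z.2) (x, t) := by fun_prop
  rcases hx.lt_or_gt with h | h
  · refine ⟨0, 0, (Jet.const (PsiP α β α) x t).congr_eventually ?_⟩
    filter_upwards [hpos, hcl.eventually_lt hcr h] with z h1 h2
    exact psi_eq_of_le h1 h2.le
  · have hev := hcr.eventually_lt hcl h
    have h1 : ∀ x : ℝ, Jet (fun x t => ampl α β * gaussTail (x / Real.sqrt t)) x t
        (ampl α β * (-Real.exp (-(x / Real.sqrt t) ^ 2 / 4) / Real.sqrt t))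
        (ampl α β * ((x / Real.sqrt t) / 2 * Real.exp (-(x / Real.sqrt t) ^ 2 / 4) / t))
        (ampl α β * ((x / Real.sqrt t) / 2 * Real.exp (-(x / Real.sqrt t) ^ 2 / 4) / t)) := fun x =>
      ((Jet.similarity ht (taylor2_gaussTail _)).const_mul (ampl α β)).congr_coeff rfl rfl
        (by ring)
    have hx0 : x ≠ 0 := by
      rintro rfl
      rw [abs_zero] at h
      exact (mul_pos hα (Real.sqrt_pos.2 ht)).not_gt h
    rcases hx0.lt_or_gt with h0 | h0
    · have h2 := (h1 (-x)).reflect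
      rw [neg_neg] at h2
      refine ⟨_, _, h2.congr_eventually ?_⟩
      filter_upwards [hpos, hev, continuousAt_fst.eventually (gt_mem_nhds h0)] with z h3 h4 h5
      rw [psi_eq_of_ge h3 h4.le, abs_of_neg h5]
    · refine ⟨_, _, (h1 x).congr_eventually ?_⟩
      filter_upwards [hpos, hev, continuousAt_fst.eventually (lt_mem_nhds h0)] with z h3 h4 h5
      rw [psi_eq_of_ge h3 h4.le, abs_of_pos h5]

namespace Sol
variable {α β : ℝ} {u p w : ℝ → ℝ → ℝ}

lemma intervalIntegrable_pu (S : Sol α β u p w) (x : ℝ) {s t : ℝ} (hs : 0 ≤ s) (hst : s ≤ t) :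
    IntervalIntegrable (fun r => p x r * u x r) volume s t := by
  obtain ⟨C, -, hC⟩ := S.exists_bound t
  have hm : Measurable fun r => p x (max r 0) * u x (max r 0) :=
    (S.measurable_p.comp (measurable_prodMk_left (x := x))).mul
      (S.measurable_u.comp (measurable_prodMk_left (x := x)))
  have h1 : IntegrableOn (fun r => p x (max r 0) * u x (max r 0)) (Ioc s t) := by
    refine Measure.integrableOn_of_bounded (M := C) (by simp) hm.aestronglyMeasurable ?_
    refine (ae_restrict_iff' measurableSet_Ioc).2 (ae_of_all _ fun r hr => ?_)
    rw [max_eq_left (hs.trans hr.1.le), Real.norm_eq_abs]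
    exact (hC x r ⟨hs.trans hr.1.le, hr.2⟩).2.2.2
  rw [intervalIntegrable_iff_integrableOn_Ioc_of_le hst]
  refine h1.congr_fun (fun r hr => ?_) measurableSet_Ioc
  simp only [max_eq_left (hs.trans hr.1.le)]

lemma touch (S : Sol α β u p w) {s x0 t0 r G b c d : ℝ} {Θ Θ' θ : ℝ → ℝ} {ζ : ℝ → ℝ → ℝ}
    (ht0 : 0 < t0) (hx0 : |x0| ≠ α * Real.sqrt t0) (hr : 0 < r)
    (hΘ : ∀ x, HasDerivAt Θ (Θ' x) x) (hΘc : Continuous Θ')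
    (hθ : ∀ y z, x0 - r ≤ y → y ≤ z → z ≤ x0 + r → Θ' z - Θ' y = ∫ x in y..z, θ x)
    (hθi : IntervalIntegrable θ volume (x0 - r) (x0 + r))
    (hsrc : ∀ᵐ x, |x - x0| ≤ r → ∀ t ∈ Icc (t0 - r) t0, -s * (p x t * u x t) + θ x ≤ G)
    (hζ : Jet ζ x0 t0 b c d)
    (hmax : ∀ᶠ z : ℝ × ℝ in nhds (x0, t0), z.2 ≤ t0 →
      s * u z.1 z.2 - Θ z.1 - ζ z.1 z.2 ≤ s * u x0 t0 - Θ x0 - ζ x0 t0) :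
    d - c ≤ G := by
  obtain ⟨pb, pc, hpsi⟩ := psi_jet S.hα β ht0 hx0
  have hζ' := hζ.sub (hpsi.const_mul s)
  set r' := min r (t0 / 2) with hr'
  have hr'0 : 0 < r' := lt_min hr (by linarith)
  have hr'r : r' ≤ r := min_le_left _ _
  have hr't : r' ≤ t0 / 2 := min_le_right _ _
  have hΘcont : Continuous Θ := continuous_iff_continuousAt.2 fun x => (hΘ x).continuousAt
  have key := touch_above (f := fun x t => s * (u x (max t 0) - psi α β x (max t 0)) - Θ x)
    (fx := fun x t => s * w x (max t 0) - Θ' x) (G := G) hr'0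
    ((S.continuous_v.const_mul s |>.sub (hΘcont.comp continuous_fst)))
    ((S.continuous_w.const_mul s |>.sub (hΘc.comp continuous_fst)))
    (fun x t => ((S.reg.1 (max t 0) (mem_Ici.2 (le_max_right _ _)) x).const_mul s).sub (hΘ x))
    ?_ hζ' ?_
  · linarith
  · intro y z τ t h1 h2 h3 h4 h5 h6
    have hτ : 0 ≤ τ := by linarith
    have ht : 0 ≤ t := hτ.trans h5
    have e1 : ∫ x in y..z, ((s * (u x (max t 0) - psi α β x (max t 0)) - Θ x) -
        (s * (u x (max τ 0) - psi α β x (max τ 0)) - Θ x))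
        = s * ∫ x in y..z, ((u x t - psi α β x t) - (u x τ - psi α β x τ)) := by
      rw [← intervalIntegral.integral_const_mul]
      refine intervalIntegral.integral_congr fun x _ => ?_
      simp only [max_eq_left hτ, max_eq_left ht]; ring
    have e2 : ∫ σ in τ..t, ((s * w z (max σ 0) - Θ' z) - (s * w y (max σ 0) - Θ' y))
        = s * (∫ σ in τ..t, (w z σ - w y σ)) - (t - τ) * ∫ x in y..z, θ x := by
      rw [← hθ y z (by linarith) h2 (by linarith), ← intervalIntegral.integral_const_mul,
        ← smul_eq_mul (t - τ), ← intervalIntegral.integral_const,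
        ← intervalIntegral.integral_sub]
      · refine intervalIntegral.integral_congr fun σ hσ => ?_
        rw [uIcc_of_le h5] at hσ
        simp only [max_eq_left (hτ.trans hσ.1)]; ring
      · exact ((S.intervalIntegrable_w z hτ ht).sub (S.intervalIntegrable_w y hτ ht)).const_mul s
      · exact intervalIntegrable_const
    rw [e1, e2, S.rect h2 hτ h5]
    have e3 : -s * (∫ x in y..z, ∫ r in τ..t, p x r * u x r) + (t - τ) * (∫ x in y..z, θ x)
        ≤ G * ((z - y) * (t - τ)) := by
      have hθi' : IntervalIntegrable θ volume y z := hθi.mono_set (by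
        rw [uIcc_of_le h2, uIcc_of_le (by linarith)]
        exact Icc_subset_Icc (by linarith) (by linarith))
      have hZ := S.intervalIntegrable_Z y z hτ h5
      rw [← intervalIntegral.integral_const_mul, ← intervalIntegral.integral_const_mul,
        ← intervalIntegral.integral_add (hZ.const_mul _) (hθi'.const_mul _)]
      have : G * ((z - y) * (t - τ)) = ∫ x in y..z, G * (t - τ) := by
        rw [intervalIntegral.integral_const, smul_eq_mul]; ring
      rw [this]
      refine intervalIntegral.integral_mono_ae_restrict h2 ((hZ.const_mul _).add (hθi'.const_mul _))
        intervalIntegrable_const ?_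
      refine (ae_restrict_iff' measurableSet_Icc).2 ?_
      filter_upwards [hsrc] with x hx hxm
      have hx' := hx (abs_le.2 ⟨by linarith [hxm.1], by linarith [hxm.2]⟩)
      have hpu := S.intervalIntegrable_pu x hτ h5
      have h7 : ∫ r in τ..t, (-s * (p x r * u x r) + θ x) ≤ ∫ r in τ..t, G :=
        intervalIntegral.integral_mono_on (μ := volume) h5
          ((hpu.const_mul _).add intervalIntegrable_const) intervalIntegrable_const
          fun r hr => hx' r ⟨by linarith [hr.1], hr.2.trans h6⟩
      rw [intervalIntegral.integral_add (hpu.const_mul _) intervalIntegrable_const,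
        intervalIntegral.integral_const_mul] at h7
      simp only [intervalIntegral.integral_const, smul_eq_mul] at h7 ⊢
      linarith
    linarith
  · have hpos : ∀ᶠ z : ℝ × ℝ in nhds (x0, t0), 0 < z.2 :=
      continuousAt_snd.eventually (lt_mem_nhds ht0)
    filter_upwards [hmax, hpos] with z h1 h2 h3
    have := h1 h3
    simp only [max_eq_left h2.le, max_eq_left ht0.le]
    linarith

/-- Touching without a frozen part. -/
lemma touch' (S : Sol α β u p w) {s x0 t0 r G b c d : ℝ} {ζ : ℝ → ℝ → ℝ}
    (ht0 : 0 < t0) (hx0 : |x0| ≠ α * Real.sqrt t0) (hr : 0 < r)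
    (hsrc : ∀ᵐ x, |x - x0| ≤ r → ∀ t ∈ Icc (t0 - r) t0, -s * (p x t * u x t) ≤ G)
    (hζ : Jet ζ x0 t0 b c d)
    (hmax : ∀ᶠ z : ℝ × ℝ in nhds (x0, t0), z.2 ≤ t0 →
      s * u z.1 z.2 - ζ z.1 z.2 ≤ s * u x0 t0 - ζ x0 t0) :
    d - c ≤ G := by
  refine S.touch (s := s) (Θ := fun _ => 0) (Θ' := fun _ => 0) (θ := fun _ => 0) ht0 hx0 hr
    (fun x => hasDerivAt_const x 0) continuous_const (by simp) (by simp) ?_ hζ ?_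
  · simpa using hsrc
  · simpa using hmax

lemma psi_deriv_left {x t : ℝ} (ht : 0 < t) (hx0 : 0 < x) (hx : x = α * Real.sqrt t) :
    HasDerivWithinAt (fun x => psi α β x t) 0 (Iic x) x := by
  have h : (fun x => psi α β x t) =ᶠ[nhdsWithin x (Iic x)] fun _ => PsiP α β α := by
    filter_upwards [self_mem_nhdsWithin, mem_nhdsWithin_of_mem_nhds (lt_mem_nhds hx0)] with y hy hy0
    exact psi_eq_of_le ht (by rw [abs_of_pos hy0, ← hx]; exact hy)
  exact (hasDerivWithinAt_const x _ _).congr_of_eventuallyEq h (h.self_of_nhdsWithin self_mem_Iic)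

lemma psi_deriv_right {x t : ℝ} (ht : 0 < t) (hx0 : 0 < x) (hx : x = α * Real.sqrt t) :
    HasDerivWithinAt (fun x => psi α β x t) (-(α * β / (2 * Real.sqrt t))) (Ici x) x := by
  have h : (fun x => psi α β x t) =ᶠ[nhdsWithin x (Ici x)]
      fun x => ampl α β * gaussTail (x / Real.sqrt t) := by
    filter_upwards [self_mem_nhdsWithin, mem_nhdsWithin_of_mem_nhds (lt_mem_nhds hx0)] with y hy hy0
    rw [psi_eq_of_ge ht (by rw [abs_of_pos hy0, ← hx]; exact hy), abs_of_pos hy0]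
  have hs := Real.sqrt_pos.2 ht
  have h1 : x / Real.sqrt t = α := by rw [hx]; field_simp
  have h2 := (((hasDerivAt_gaussTail (x / Real.sqrt t)).comp x
    ((hasDerivAt_id x).div_const (Real.sqrt t))).const_mul (ampl α β)).hasDerivWithinAt (s := Ici x)
  refine (h2.congr_deriv ?_).congr_of_eventuallyEq h (h.self_of_nhdsWithin self_mem_Ici)
  have h3 : Real.exp (α ^ 2 / 4) * Real.exp (-α ^ 2 / 4) = 1 := by
    rw [← Real.exp_add]; ring_nf; simp
  rw [h1, ampl]
  calc _ = -(α * β / 2) * (Real.exp (α ^ 2 / 4) * Real.exp (-α ^ 2 / 4)) / Real.sqrt t := by ring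
    _ = _ := by rw [h3]; field_simp

/-- Kink condition at a point of the right half of the parabola. -/
lemma kink (S : Sol α β u p w) {s x0 t0 l r : ℝ} {B : ℝ → ℝ} (ht0 : 0 < t0)
    (hx0 : x0 = α * Real.sqrt t0) (hl : HasDerivWithinAt B l (Iic x0) x0)
    (hr : HasDerivWithinAt B r (Ici x0) x0)
    (hmax : ∀ᶠ x in nhds x0, s * u x t0 - B x ≤ s * u x0 t0 - B x0) :
    l - r ≤ s * (α * β / (2 * Real.sqrt t0)) := by
  have hx0p : 0 < x0 := by rw [hx0]; exact mul_pos S.hα (Real.sqrt_pos.2 ht0)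
  have hw := S.reg.1 t0 (mem_Ici.2 ht0.le) x0
  have h1 := ((hw.hasDerivWithinAt (s := Iic x0)).add (psi_deriv_left (β := β) ht0 hx0p hx0))
  have h2 := ((hw.hasDerivWithinAt (s := Ici x0)).add (psi_deriv_right (β := β) ht0 hx0p hx0))
  have e : (fun y => u y t0 - psi α β y t0) + (fun x => psi α β x t0) = fun y => u y t0 := by
    funext y; simp
  rw [e] at h1 h2
  have h3 := left_max_deriv ((h1.const_mul s).sub hl) (mem_nhdsWithin_of_mem_nhds hmax)
  have h4 := right_max_deriv ((h2.const_mul s).sub hr) (mem_nhdsWithin_of_mem_nhds hmax)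
  linarith

lemma psi_differentiableAt (hα : 0 < α) {x t : ℝ} (ht : 0 < t) (hx : |x| ≠ α * Real.sqrt t) :
    DifferentiableAt ℝ (fun x => psi α β x t) x := by
  obtain ⟨b, c, h⟩ := psi_jet hα β ht hx
  have hk : Tendsto (fun y : ℝ => (y, t)) (nhds x) (nhds (x, t)) := by
    have : Continuous (fun y : ℝ => (y, t)) := by fun_prop
    exact this.tendsto x
  have h1 := h.rem_isBigO.comp_tendsto hk
  refine HasDerivAt.differentiableAt (f' := b) ?_
  rw [hasDerivAt_iff_isLittleO]
  have h2 : (fun y : ℝ => psi α β y t - psi α β x t - b * (y - x)) =O[nhds x] (fun y => (y - x) ^ 2) := by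
    refine (h1.congr_left fun y => ?_).congr_right fun y => ?_ <;> simp
  have h3 : (fun y : ℝ => (y - x) ^ 2) =o[nhds x] (fun y => y - x) := by
    have h4 : Tendsto (fun y : ℝ => y - x) (nhds x) (nhds 0) := by
      have : Continuous (fun y : ℝ => y - x) := by fun_prop
      simpa using this.tendsto x
    have := ((Asymptotics.isLittleO_one_iff ℝ).2 h4).mul_isBigO (Asymptotics.isBigO_refl (fun y : ℝ => y - x) (nhds x))
    simpa [pow_two] using this
  refine (h2.trans_isLittleO h3).congr_left fun y => ?_
  simp; ring

/-- Away from the parabola only concave kinks of the barrier are excluded. -/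
lemma kink' (S : Sol α β u p w) {s x0 t0 l r : ℝ} {B : ℝ → ℝ} (ht0 : 0 < t0)
    (hx0 : |x0| ≠ α * Real.sqrt t0) (hl : HasDerivWithinAt B l (Iic x0) x0)
    (hr : HasDerivWithinAt B r (Ici x0) x0)
    (hmax : ∀ᶠ x in nhds x0, s * u x t0 - B x ≤ s * u x0 t0 - B x0) :
    l - r ≤ 0 := by
  have hw := S.reg.1 t0 (mem_Ici.2 ht0.le) x0
  have h1 := hw.add (psi_differentiableAt (β := β) S.hα ht0 hx0).hasDerivAt
  have e : (fun y => u y t0 - psi α β y t0) + (fun x => psi α β x t0) = fun y => u y t0 := by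
    funext y; simp
  rw [e] at h1
  have h3 := left_max_deriv ((h1.hasDerivWithinAt.const_mul s).sub hl) (mem_nhdsWithin_of_mem_nhds hmax)
  have h4 := right_max_deriv ((h1.hasDerivWithinAt.const_mul s).sub hr) (mem_nhdsWithin_of_mem_nhds hmax)
  linarith

lemma continuousAt_u (S : Sol α β u p w) (x : ℝ) {t : ℝ} (ht : 0 < t) :
    ContinuousAt (fun q : ℝ × ℝ => u q.1 q.2) (x, t) := by
  have h1 := S.reg.2.1.continuousAt (x := (x, t)) (prod_mem_nhds univ_mem (Ici_mem_nhds ht))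
  have h2 := (continuousOn_psi α β).continuousAt (x := (x, t)) (prod_mem_nhds univ_mem (Ioi_mem_nhds ht))
  have := h1.add h2
  refine this.congr (Eventually.of_forall fun q => by simp)

end Sol

/-- First touching: a continuous function negative on the parabolic boundary and with no first zero
is negative. -/
lemma neg_of_no_first_zero_on {D : ℝ → ℝ → ℝ} {l r : ℝ → ℝ} {T T1 : ℝ} (hl : Continuous l) (hr : Continuous r)
    (hD : ∀ x t, T ≤ t → t ≤ T1 → l t ≤ x → x ≤ r t → ContinuousAt (fun q : ℝ × ℝ => D q.1 q.2) (x, t))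
    (h0 : ∀ x, l T ≤ x → x ≤ r T → D x T < 0)
    (hbl : ∀ t, T ≤ t → t ≤ T1 → l t ≤ r t → D (l t) t < 0) (hbr : ∀ t, T ≤ t → t ≤ T1 → l t ≤ r t → D (r t) t < 0)
    (hno : ∀ x t, T < t → t ≤ T1 → l t < x → x < r t → D x t = 0 →
      (∀ y τ, T ≤ τ → τ ≤ t → l τ ≤ y → y ≤ r τ → D y τ ≤ 0) → False) :
    ∀ x t, T ≤ t → t ≤ T1 → l t ≤ x → x ≤ r t → D x t < 0 := by
  intro x1 t1 ht1 htT hx1 hx1'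
  by_contra hcon
  push Not at hcon
  obtain ⟨m, hm⟩ := (isCompact_Icc (a := T) (b := t1)).exists_bound_of_continuousOn hl.continuousOn
  obtain ⟨m', hm'⟩ := (isCompact_Icc (a := T) (b := t1)).exists_bound_of_continuousOn hr.continuousOn
  set K : Set (ℝ × ℝ) := {q | q.2 ∈ Icc T t1 ∧ l q.2 ≤ q.1 ∧ q.1 ≤ r q.2} with hK
  have hKc : IsCompact K := by
    refine Metric.isCompact_of_isClosed_isBounded ?_ ?_
    · have h1 : IsClosed {q : ℝ × ℝ | q.2 ∈ Icc T t1} := isClosed_Icc.preimage continuous_snd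
      have h2 : IsClosed {q : ℝ × ℝ | l q.2 ≤ q.1} := isClosed_le (hl.comp continuous_snd) continuous_fst
      have h3 : IsClosed {q : ℝ × ℝ | q.1 ≤ r q.2} := isClosed_le continuous_fst (hr.comp continuous_snd)
      exact h1.inter (h2.inter h3)
    · refine (((isCompact_Icc (a := -m) (b := m')).prod (isCompact_Icc (a := T) (b := t1))).isBounded).subset ?_
      rintro ⟨x, t⟩ ⟨h1, h2, h3⟩
      have h4 := hm t h1
      have h5 := hm' t h1
      rw [Real.norm_eq_abs, abs_le] at h4 h5
      simp only [] at h2 h3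
      exact ⟨⟨by linarith, by linarith⟩, h1⟩
  have hDK : ContinuousOn (fun q : ℝ × ℝ => D q.1 q.2) K := fun q hq =>
    (hD q.1 q.2 hq.1.1 (hq.1.2.trans htT) hq.2.1 hq.2.2).continuousWithinAt
  have hK' : IsCompact (K ∩ {q | 0 ≤ D q.1 q.2}) := by
    have := hDK.preimage_isClosed_of_isClosed hKc.isClosed (isClosed_Ici (a := (0:ℝ)))
    exact hKc.of_isClosed_subset this inter_subset_left
  obtain ⟨⟨x0, t0⟩, ⟨⟨hA, hB, hC⟩, hge⟩, hmin⟩ := hK'.exists_isMinOn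
    ⟨(x1, t1), ⟨⟨⟨ht1, le_rfl⟩, hx1, hx1'⟩, hcon⟩⟩ (continuous_snd.continuousOn)
  simp only [mem_ofPred_eq] at hA hB hC hge
  have hneg : ∀ y τ, T ≤ τ → τ < t0 → l τ ≤ y → y ≤ r τ → D y τ < 0 := by
    intro y τ h1 h2 h3 h4
    by_contra h5
    push Not at h5
    have : t0 ≤ τ := hmin (a := (y, τ)) ⟨⟨⟨h1, (h2.trans_le hA.2).le⟩, h3, h4⟩, h5⟩
    linarith
  have hTt : T < t0 := by
    rcases hA.1.eq_or_lt with h | h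
    · subst h; exact absurd (h0 x0 hB hC) (not_lt.2 hge)
    · exact h
  have hle : ∀ y τ, T ≤ τ → τ ≤ t0 → l τ ≤ y → y ≤ r τ → D y τ ≤ 0 := by
    intro y τ h1 h2 h3 h4
    rcases h2.lt_or_eq with h | h
    · exact (hneg y τ h1 h h3 h4).le
    by_contra h5
    push Not at h5
    subst h
    have h6 : l τ < y := lt_of_le_of_ne h3 fun h => by
      subst h; exact absurd (hbl τ h1 (hA.2.trans htT) h4) (not_lt.2 h5.le)
    have h7 : y < r τ := lt_of_le_of_ne h4 fun h => by
      subst h; exact absurd (hbr τ h1 (hA.2.trans htT) h3) (not_lt.2 h5.le)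
    have hk : Tendsto (fun σ : ℝ => (y, σ)) (nhdsWithin τ (Iio τ)) (nhds (y, τ)) := by
      have : Continuous (fun σ : ℝ => (y, σ)) := by fun_prop
      exact (this.tendsto τ).mono_left nhdsWithin_le_nhds
    have e1 := hk.eventually ((hD y τ h1 (hA.2.trans htT) h3 h4).eventually (lt_mem_nhds h5))
    have e2 : ∀ᶠ σ in nhdsWithin τ (Iio τ), l σ < y :=
      (hl.continuousAt.eventually (gt_mem_nhds h6)).filter_mono nhdsWithin_le_nhds
    have e3 : ∀ᶠ σ in nhdsWithin τ (Iio τ), y < r σ :=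
      (hr.continuousAt.eventually (lt_mem_nhds h7)).filter_mono nhdsWithin_le_nhds
    have e4 : ∀ᶠ σ in nhdsWithin τ (Iio τ), T < σ :=
      mem_nhdsWithin_of_mem_nhds (lt_mem_nhds hTt)
    obtain ⟨σ, ⟨⟨⟨k1, k2⟩, k3⟩, k4⟩, k5⟩ :=
      ((((e1.and e2).and e3).and e4).and self_mem_nhdsWithin).exists
    exact absurd (hneg y σ k4.le k5 k2.le k3.le) (not_lt.2 k1.le)
  refine hno x0 t0 hTt (hA.2.trans htT) ?_ ?_ (le_antisymm (hle x0 t0 hA.1 le_rfl hB hC) hge) hle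
  · exact lt_of_le_of_ne hB fun h => by
      subst h; exact absurd (hbl t0 hA.1 (hA.2.trans htT) hC) (not_lt.2 hge)
  · exact lt_of_le_of_ne hC fun h => by
      subst h; exact absurd (hbr t0 hA.1 (hA.2.trans htT) hB) (not_lt.2 hge)

lemma neg_of_no_first_zero {D : ℝ → ℝ → ℝ} {l r : ℝ → ℝ} {T : ℝ} (hl : Continuous l) (hr : Continuous r)
    (hD : ∀ x t, T ≤ t → l t ≤ x → x ≤ r t → ContinuousAt (fun q : ℝ × ℝ => D q.1 q.2) (x, t))
    (h0 : ∀ x, l T ≤ x → x ≤ r T → D x T < 0)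
    (hbl : ∀ t, T ≤ t → l t ≤ r t → D (l t) t < 0) (hbr : ∀ t, T ≤ t → l t ≤ r t → D (r t) t < 0)
    (hno : ∀ x t, T < t → l t < x → x < r t → D x t = 0 →
      (∀ y τ, T ≤ τ → τ ≤ t → l τ ≤ y → y ≤ r τ → D y τ ≤ 0) → False) :
    ∀ x t, T ≤ t → l t ≤ x → x ≤ r t → D x t < 0 := fun x t ht =>
  neg_of_no_first_zero_on (T1 := t) hl hr (fun x t h _ => hD x t h) h0 (fun t h _ => hbl t h)
    (fun t h _ => hbr t h) (fun x t h _ => hno x t h) x t ht le_rfl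

lemma Jet.quad (ε x t : ℝ) : Jet (fun x t => ε * (x * x + 3 * t + 1)) x t (ε * (2 * x)) (ε * 2) (ε * 3) := by
  have h1 := (Jet.fst x t).mul (Jet.fst x t)
  have h2 := Jet.of_time (t := t) x (((hasDerivAt_id t).const_mul 3).add_const 1)
  refine (((h1.add h2).const_mul ε).congr_eventually (Eventually.of_forall fun z => ?_)).congr_coeff ?_ ?_ ?_
  · show ε * (z.1 * z.1 + 3 * z.2 + 1) = ε * (z.1 * z.1 + (3 * z.2 + 1))
    ring
  · ring
  · ring
  · ring

/-- Local form of backward maximum extracted from a global one-sided bound on a moving region. -/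
lemma eventually_backward {D : ℝ → ℝ → ℝ} {l r : ℝ → ℝ} {T x0 t0 : ℝ} (hl : Continuous l) (hr : Continuous r)
    (hT : T < t0) (h1 : l t0 < x0) (h2 : x0 < r t0)
    (hle : ∀ y τ, T ≤ τ → τ ≤ t0 → l τ ≤ y → y ≤ r τ → D y τ ≤ 0) :
    ∀ᶠ z : ℝ × ℝ in nhds (x0, t0), z.2 ≤ t0 → D z.1 z.2 ≤ 0 := by
  have a1 : ∀ᶠ z : ℝ × ℝ in nhds (x0, t0), T < z.2 := continuousAt_snd.eventually (lt_mem_nhds hT)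
  have a2 : ∀ᶠ z : ℝ × ℝ in nhds (x0, t0), l z.2 < z.1 :=
    ((hl.comp continuous_snd).continuousAt (x := (x0, t0))).eventually_lt continuousAt_fst h1
  have a3 : ∀ᶠ z : ℝ × ℝ in nhds (x0, t0), z.1 < r z.2 :=
    (continuousAt_fst (p := (x0, t0))).eventually_lt ((hr.comp continuous_snd).continuousAt) h2
  filter_upwards [a1, a2, a3] with z b1 b2 b3 b4
  exact hle _ _ b1.le b4 b2.le b3.le

lemma eventually_slice {P : ℝ × ℝ → Prop} {x t : ℝ} (h : ∀ᶠ z in nhds (x, t), P z) :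
    ∀ᶠ y in nhds x, P (y, t) := by
  have hk : Tendsto (fun y : ℝ => (y, t)) (nhds x) (nhds (x, t)) := by
    have : Continuous (fun y : ℝ => (y, t)) := by fun_prop
    exact this.tendsto x
  exact hk.eventually h

/-- A neighbourhood property holds on a small closed box. -/
lemma exists_box {P : ℝ × ℝ → Prop} {x t : ℝ} (h : ∀ᶠ z in nhds (x, t), P z) :
    ∃ r > 0, ∀ y τ, |y - x| ≤ r → |τ - t| ≤ r → P (y, τ) := by
  obtain ⟨δ, hδ, hb⟩ := Metric.eventually_nhds_iff_ball.1 h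
  refine ⟨δ / 2, by linarith, fun y τ h1 h2 => hb _ ?_⟩
  rw [Metric.mem_ball, Prod.dist_eq, Real.dist_eq, Real.dist_eq]
  exact max_lt (by simp only; linarith) (by simp only; linarith)

lemma global_le_zero {f fx : ℝ → ℝ → ℝ} {T C : ℝ}
    (hf : Continuous (fun z : ℝ × ℝ => f z.1 z.2)) (hfx : Continuous (fun z : ℝ × ℝ => fx z.1 z.2))
    (hd : ∀ x t, HasDerivAt (fun y => f y t) (fx x t) x)
    (hb : ∀ x, ∀ t ∈ Icc 0 T, f x t ≤ C) (h0 : ∀ x, f x 0 ≤ 0)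
    (loc : ∀ x0 t0, 0 < t0 → t0 ≤ T → 0 < f x0 t0 → ∃ r > 0,
      ∀ y z s t, x0 - r ≤ y → y ≤ z → z ≤ x0 + r → t0 - r ≤ s → s ≤ t → t ≤ t0 →
      ∫ x in y..z, (f x t - f x s) ≤ (∫ τ in s..t, (fx z τ - fx y τ))) :
    ∀ x, ∀ t ∈ Icc 0 T, f x t ≤ 0 := by
  intro x t ht
  have main : ∀ ε > 0, f x t - ε * (x * x + 3 * t + 1) < 0 := by
    intro ε hε
    set R := max |x| (Real.sqrt (|C| / ε)) with hR
    have hRx : |x| ≤ R := le_max_left _ _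
    have hR0 : 0 ≤ R := (abs_nonneg x).trans hRx
    have hRC : |C| ≤ ε * (R * R) := by
      have h1 : Real.sqrt (|C| / ε) ≤ R := le_max_right _ _
      have h2 : |C| / ε ≤ R ^ 2 := (Real.sqrt_le_left hR0).1 h1
      rw [div_le_iff₀ hε] at h2; linarith
    have hbd : ∀ y τ, y * y = R * R → 0 ≤ τ → τ ≤ T → f y τ - ε * (y * y + 3 * τ + 1) < 0 := by
      intro y τ hy h1 h2
      rw [hy]
      have := hb y τ ⟨h1, h2⟩
      have := le_abs_self C
      have : 0 ≤ ε * τ := mul_nonneg hε.le h1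
      linarith
    refine neg_of_no_first_zero_on (D := fun x t => f x t - ε * (x * x + 3 * t + 1))
      (l := fun _ => -R) (r := fun _ => R) (T := 0) (T1 := T) continuous_const continuous_const
      ?_ ?_ ?_ ?_ ?_ x t ht.1 ht.2 (abs_le.1 hRx).1 (abs_le.1 hRx).2
    · intro x t _ _ _ _
      exact (hf.sub (by fun_prop)).continuousAt
    · intro x _ _
      have := h0 x
      have : 0 ≤ ε * (x * x) := mul_nonneg hε.le (mul_self_nonneg x)
      linarith
    · intro τ h1 h2 _; exact hbd _ _ (by ring) h1 h2
    · intro τ h1 h2 _; exact hbd _ _ (by ring) h1 h2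
    · intro x0 t0 ht0 ht0T hx1 hx2 hz hle
      have hpos : 0 < f x0 t0 := by
        have : 0 < ε * (x0 * x0 + 3 * t0 + 1) := by have := mul_self_nonneg x0; positivity
        linarith
      obtain ⟨r, hr, hrect⟩ := loc x0 t0 ht0 ht0T hpos
      have hev := eventually_backward (l := fun _ => -R) (r := fun _ => R) continuous_const continuous_const
        ht0 hx1 hx2 hle
      have := touch_above (f := f) (fx := fx) (G := 0) hr hf hfx hd
        (fun y z s t a1 a2 a3 a4 a5 a6 => by simpa using hrect y z s t a1 a2 a3 a4 a5 a6)
        (Jet.quad ε x0 t0) (hev.mono fun z h h' => by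
          have := h h'
          linarith)
      linarith
  refine le_of_forall_pos_le_add fun δ hδ => ?_
  have hq : 0 < x * x + 3 * t + 1 := by have := mul_self_nonneg x; have := ht.1; positivity
  have := main (δ / (x * x + 3 * t + 1)) (by positivity)
  rw [div_mul_cancel₀ _ hq.ne'] at this
  linarith

namespace Sol
variable {α β : ℝ} {u p w : ℝ → ℝ → ℝ}

lemma hasDerivAt_ext (S : Sol α β u p w) (x t : ℝ) :
    HasDerivAt (fun y => u y (max t 0) - psi α β y (max t 0)) (w x (max t 0)) x :=
  S.reg.1 (max t 0) (mem_Ici.2 (le_max_right _ _)) x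

lemma v_nonpos (S : Sol α β u p w) (x : ℝ) {t : ℝ} (ht : 0 ≤ t) : u x t - psi α β x t ≤ 0 := by
  obtain ⟨C, hC0, hC⟩ := S.exists_bound t
  have := global_le_zero (f := fun x t => u x (max t 0) - psi α β x (max t 0))
    (fx := fun x t => w x (max t 0)) (T := t) (C := C) S.continuous_v S.continuous_w S.hasDerivAt_ext
    (fun x s hs => by
      simp only [max_eq_left hs.1]; exact (le_abs_self _).trans (hC x s hs).1)
    (fun x => by simpa using (S.v_zero x).le) ?_ x t ⟨ht, le_rfl⟩
  · simpa [max_eq_left ht] using this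
  · intro x0 t0 ht0 ht0t hpos
    obtain ⟨r, hr, hbox⟩ := exists_box (x := x0) (t := t0)
      (S.continuous_v.continuousAt.eventually (lt_mem_nhds hpos))
    refine ⟨min r (t0 / 2), lt_min hr (by linarith), ?_⟩
    intro y z s τ h1 h2 h3 h4 h5 h6
    have hrr := min_le_left r (t0 / 2)
    have hrt := min_le_right r (t0 / 2)
    have hs : 0 ≤ s := by linarith
    have hτ : 0 ≤ τ := hs.trans h5
    have := S.rect h2 hs h5
    have hZ : 0 ≤ ∫ x in y..z, ∫ r in s..τ, p x r * u x r := by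
      refine intervalIntegral.integral_nonneg h2 fun x hx => intervalIntegral.integral_nonneg h5 fun σ hσ => ?_
      have hσ0 := hs.trans hσ.1
      refine mul_nonneg (S.p_mem x σ hσ0).1 ?_
      have := hbox x σ (abs_le.2 ⟨by linarith [hx.1], by linarith [hx.2]⟩)
        (abs_le.2 ⟨by linarith [hσ.1], by linarith [hσ.2]⟩)
      simp only [max_eq_left hσ0] at this
      have := psi_nonneg S.hα S.hβ x σ
      linarith
    have e2 : ∫ σ in s..τ, (w z (max σ 0) - w y (max σ 0)) = ∫ σ in s..τ, (w z σ - w y σ) := by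
      refine intervalIntegral.integral_congr fun σ hσ => ?_
      rw [uIcc_of_le h5] at hσ
      simp only [max_eq_left (hs.trans hσ.1)]
    simp only [max_eq_left hs, max_eq_left hτ]
    rw [e2, this]
    linarith

lemma u_nonneg (S : Sol α β u p w) (x : ℝ) {t : ℝ} (ht : 0 ≤ t) : 0 ≤ u x t := by
  rcases ht.eq_or_lt with rfl | htpos
  · have := S.v_zero x; rw [psi_zero] at this; linarith
  obtain ⟨C, hC0, hC⟩ := S.exists_bound t
  have main : ∀ ε > 0, -u x t - ε * (x * x + 3 * t + 1) < 0 := by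
    intro ε hε
    set R := max |x| (Real.sqrt (C / ε)) with hR
    have hRx : |x| ≤ R := le_max_left _ _
    have hR0 : 0 ≤ R := (abs_nonneg x).trans hRx
    have hRC : C ≤ ε * (R * R) := by
      have h1 : Real.sqrt (C / ε) ≤ R := le_max_right _ _
      have h2 : C / ε ≤ R ^ 2 := (Real.sqrt_le_left hR0).1 h1
      rw [div_le_iff₀ hε] at h2; linarith
    have hbd : ∀ y τ, y * y = R * R → 0 ≤ τ → τ ≤ t → -u y τ - ε * (y * y + 3 * τ + 1) < 0 := by
      intro y τ hy h1 h2
      rw [hy]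
      have := (abs_le.1 (hC y τ ⟨h1, h2⟩).2.2.1).1
      have : 0 ≤ ε * τ := mul_nonneg hε.le h1
      linarith
    have hsmall : ∀ᶠ τ in nhds (0:ℝ), ∀ y ∈ Icc (-R) R, -ε < u y (max τ 0) - psi α β y (max τ 0) := by
      refine isCompact_Icc.eventually_forall_of_forall_eventually fun y hy => ?_
      have h1 : ContinuousAt (fun z : ℝ × ℝ => u z.2 (max z.1 0) - psi α β z.2 (max z.1 0)) (0, y) :=
        (S.continuous_v.comp continuous_swap).continuousAt
      refine h1.eventually (lt_mem_nhds ?_)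
      simp only [max_self, S.v_zero]; linarith
    obtain ⟨τ0, ⟨hτs, hτt⟩, hτ0⟩ := (((hsmall.filter_mono nhdsWithin_le_nhds).and
      (mem_nhdsWithin_of_mem_nhds (gt_mem_nhds htpos))).and
      (self_mem_nhdsWithin : Ioi (0:ℝ) ∈ nhdsWithin (0:ℝ) (Ioi 0))).exists
    have hτ0 : 0 < τ0 := hτ0
    refine neg_of_no_first_zero_on (D := fun x t => -u x t - ε * (x * x + 3 * t + 1))
      (l := fun _ => -R) (r := fun _ => R) (T := τ0) (T1 := t) continuous_const continuous_const
      ?_ ?_ ?_ ?_ ?_ x t hτt.le le_rfl (abs_le.1 hRx).1 (abs_le.1 hRx).2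
    · intro x t h _ _ _
      have h1 : Continuous fun z : ℝ × ℝ => ε * (z.1 * z.1 + 3 * z.2 + 1) := by fun_prop
      exact (S.continuousAt_u x (hτ0.trans_le h)).neg.sub h1.continuousAt
    · intro y hy1 hy2
      have h1 := hτs y ⟨hy1, hy2⟩
      rw [max_eq_left hτ0.le] at h1
      have := psi_nonneg S.hα S.hβ y τ0
      have : 0 ≤ ε * (y * y) := mul_nonneg hε.le (mul_self_nonneg y)
      have : 0 ≤ ε * τ0 := mul_nonneg hε.le hτ0.le
      linarith
    · intro τ h1 h2 _; exact hbd _ _ (by ring) (hτ0.le.trans h1) h2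
    · intro τ h1 h2 _; exact hbd _ _ (by ring) (hτ0.le.trans h1) h2
    · intro x0 t0 ht0 ht0T hx1 hx2 hz hle
      have ht00 : 0 < t0 := hτ0.trans ht0
      have hneg : u x0 t0 < 0 := by
        have : 0 < ε * (x0 * x0 + 3 * t0 + 1) := by have := mul_self_nonneg x0; positivity
        linarith
      have hev := eventually_backward (l := fun _ => -R) (r := fun _ => R) continuous_const continuous_const
        ht0 hx1 hx2 hle
      by_cases hk : |x0| = α * Real.sqrt t0
      · have hkink : ∀ x1, x1 = α * Real.sqrt t0 →
            (∀ᶠ x in nhds x1, -1 * u x t0 - ε * (x * x + 3 * t0 + 1) ≤ -1 * u x1 t0 - ε * (x1 * x1 + 3 * t0 + 1)) → False := by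
          intro x1 hx1 hmax
          have hB : HasDerivAt (fun x => ε * (x * x + 3 * t0 + 1)) (ε * (2 * x1)) x1 := by
            have := ((((hasDerivAt_id x1).mul (hasDerivAt_id x1)).add_const (3 * t0)).add_const 1).const_mul ε
            refine this.congr_deriv ?_
            show ε * (1 * x1 + x1 * 1) = _
            ring
          have h1 := S.kink (s := -1) ht00 hx1 hB.hasDerivWithinAt hB.hasDerivWithinAt hmax
          have h2 : 0 < α * β / (2 * Real.sqrt t0) := by
            have := S.hα; have := S.hβ; have := Real.sqrt_pos.2 ht00; positivity
          linarith
        have hsl := eventually_slice hev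
        rcases abs_choice x0 with h | h
        · refine hkink x0 (by rw [← hk, h]) (hsl.mono fun y hy => ?_)
          have := hy le_rfl
          linarith
        · refine hkink (-x0) (by rw [← hk, h]) ?_
          have hn : Tendsto (fun y : ℝ => -y) (nhds (-x0)) (nhds x0) := by
            have := (continuous_neg (G := ℝ)).tendsto (-x0); simpa using this
          refine (hn.eventually hsl).mono fun y hy => ?_
          have := hy le_rfl
          simp only [S.u_even] at this ⊢
          linarith
      · obtain ⟨r, hr, hbox⟩ := exists_box ((S.continuousAt_u x0 ht00).eventually (gt_mem_nhds hneg))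
        have := S.touch' (s := -1) (r := min r (t0 / 2)) (G := 0) ht00 hk (lt_min hr (by linarith))
          (ae_of_all _ fun y hy τ hτ => by
            have hrr := min_le_left r (t0 / 2)
            have hrt := min_le_right r (t0 / 2)
            have h1 := hbox y τ (hy.trans hrr) (abs_le.2 ⟨by linarith [hτ.1], by linarith [hτ.2]⟩)
            have h2 := (S.p_mem y τ (by linarith [hτ.1])).1
            have := mul_nonneg h2 (neg_nonneg.2 h1.le)
            simp only at this ⊢
            linarith)
          (Jet.quad ε x0 t0) (hev.mono fun z h h' => by
            have := h h'
            linarith)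
        linarith
  by_contra hcon
  push Not at hcon
  have hq : 0 < x * x + 3 * t + 1 := by have := mul_self_nonneg x; positivity
  have := main (-u x t / (x * x + 3 * t + 1)) (div_pos (by linarith) hq)
  rw [div_mul_cancel₀ _ hq.ne'] at this
  linarith

lemma v_anti (S : Sol α β u p w) (x : ℝ) {s t : ℝ} (hs : 0 ≤ s) (hst : s ≤ t) :
    u x t - psi α β x t ≤ u x s - psi α β x s := by
  set τ := t - s with hτ
  have hτ0 : 0 ≤ τ := by rw [hτ]; linarith
  obtain ⟨C, hC0, hC⟩ := S.exists_bound t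
  have hcv := S.continuous_v
  have hcw := S.continuous_w
  have := global_le_zero (f := fun x r => (u x (max (max r 0 + τ) 0) - psi α β x (max (max r 0 + τ) 0))
      - (u x (max r 0) - psi α β x (max r 0)))
    (fx := fun x r => w x (max (max r 0 + τ) 0) - w x (max r 0)) (T := s) (C := C + C)
    ((hcv.comp (by fun_prop : Continuous fun z : ℝ × ℝ => (z.1, max z.2 0 + τ))).sub hcv)
    ((hcw.comp (by fun_prop : Continuous fun z : ℝ × ℝ => (z.1, max z.2 0 + τ))).sub hcw)
    (fun x r => (S.hasDerivAt_ext x (max r 0 + τ)).sub (S.hasDerivAt_ext x r))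
    (fun x r hr => by
      have e : max (r + τ) 0 = r + τ := max_eq_left (by linarith [hr.1])
      simp only [max_eq_left hr.1, e]
      have h1 := (abs_le.1 (hC x r ⟨hr.1, hr.2.trans hst⟩).1).1
      have h2 := (abs_le.1 (hC x (r + τ) ⟨by linarith [hr.1], by linarith [hr.2]⟩).1).2
      linarith)
    (fun x => by
      have e : max (0 + τ) 0 = τ := by rw [zero_add]; exact max_eq_left hτ0
      simp only [max_self, e]
      have h1 := S.v_zero x
      have h2 := S.v_nonpos x hτ0
      linarith) ?_ x s ⟨hs, le_rfl⟩
  · have e : max (s + τ) 0 = t := by rw [hτ]; simp; linarith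
    simp only [max_eq_left hs, e] at this
    linarith
  · intro x0 t0 ht0 ht0t hpos
    obtain ⟨r, hr, hbox⟩ := exists_box (x := x0) (t := t0)
      (((hcv.comp (by fun_prop : Continuous fun z : ℝ × ℝ => (z.1, max z.2 0 + τ))).sub
        hcv).continuousAt.eventually (lt_mem_nhds hpos))
    refine ⟨min r (t0 / 2), lt_min hr (by linarith), ?_⟩
    intro y z a b h1 h2 h3 h4 h5 h6
    have hrr := min_le_left r (t0 / 2)
    have hrt := min_le_right r (t0 / 2)
    have ha : 0 ≤ a := by linarith
    have hb : 0 ≤ b := ha.trans h5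
    have haτ : max (a + τ) 0 = a + τ := max_eq_left (by linarith)
    have hbτ : max (b + τ) 0 = b + τ := max_eq_left (by linarith)
    have r1 := S.rect h2 (by linarith : 0 ≤ a + τ) (by linarith : a + τ ≤ b + τ)
    have r2 := S.rect h2 ha h5
    simp only [max_eq_left ha, max_eq_left hb, haτ, hbτ]
    have e1 : ∫ x in y..z, (u x (b + τ) - psi α β x (b + τ) - (u x b - psi α β x b) -
        (u x (a + τ) - psi α β x (a + τ) - (u x a - psi α β x a)))
        = (∫ x in y..z, (u x (b + τ) - psi α β x (b + τ) - (u x (a + τ) - psi α β x (a + τ))))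
          - ∫ x in y..z, (u x b - psi α β x b - (u x a - psi α β x a)) := by
      have c1 : Continuous fun x => u x (b + τ) - psi α β x (b + τ) - (u x (a + τ) - psi α β x (a + τ)) :=
        (S.cont_v_slice (by linarith)).sub (S.cont_v_slice (by linarith))
      have c2 : Continuous fun x => u x b - psi α β x b - (u x a - psi α β x a) :=
        (S.cont_v_slice hb).sub (S.cont_v_slice ha)
      rw [← intervalIntegral.integral_sub (c1.intervalIntegrable _ _) (c2.intervalIntegrable _ _)]
      exact intervalIntegral.integral_congr fun x _ => by ring
    have e2 : ∫ σ in a..b, (w z (max (max σ 0 + τ) 0) - w z (max σ 0) - (w y (max (max σ 0 + τ) 0) - w y (max σ 0)))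
        = (∫ σ in (a + τ)..(b + τ), (w z σ - w y σ)) - ∫ σ in a..b, (w z σ - w y σ) := by
      have c1 : IntervalIntegrable (fun σ => w z σ - w y σ) volume a b :=
        (S.intervalIntegrable_w z ha hb).sub (S.intervalIntegrable_w y ha hb)
      have c2 : IntervalIntegrable (fun σ => w z (σ + τ) - w y (σ + τ)) volume a b := by
        have := ((S.intervalIntegrable_w z (by linarith : 0 ≤ a + τ) (by linarith : 0 ≤ b + τ)).sub
          (S.intervalIntegrable_w y (by linarith : 0 ≤ a + τ) (by linarith : 0 ≤ b + τ))).comp_add_right τ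
        simpa using this
      rw [← intervalIntegral.integral_comp_add_right (fun σ => w z σ - w y σ) τ,
        ← intervalIntegral.integral_sub c2 c1]
      refine intervalIntegral.integral_congr fun σ hσ => ?_
      rw [uIcc_of_le h5] at hσ
      have hσ0 := ha.trans hσ.1
      have : max (σ + τ) 0 = σ + τ := max_eq_left (by linarith)
      simp only [max_eq_left hσ0, this]; ring
    have e3 : ∫ x in y..z, ∫ r in a..b, p x r * u x r
        ≤ ∫ x in y..z, ∫ r in (a + τ)..(b + τ), p x r * u x r := by
      refine intervalIntegral.integral_mono_on (μ := volume) h2 (S.intervalIntegrable_Z y z ha h5)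
        (S.intervalIntegrable_Z y z (by linarith) (by linarith)) fun x hx => ?_
      rw [← intervalIntegral.integral_comp_add_right (fun σ => p x σ * u x σ) τ]
      have c2 : IntervalIntegrable (fun σ => p x (σ + τ) * u x (σ + τ)) volume a b := by
        have := (S.intervalIntegrable_pu x (by linarith : 0 ≤ a + τ) (by linarith : a + τ ≤ b + τ)).comp_add_right τ
        simpa using this
      refine intervalIntegral.integral_mono_on (μ := volume) h5 (S.intervalIntegrable_pu x ha h5) c2 fun σ hσ => ?_
      have hσ0 := ha.trans hσ.1
      have := hbox x σ (abs_le.2 ⟨by linarith [hx.1], by linarith [hx.2]⟩)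
        (abs_le.2 ⟨by linarith [hσ.1], by linarith [hσ.2]⟩)
      have e : max (σ + τ) 0 = σ + τ := max_eq_left (by linarith)
      have this : 0 < (u x (max (max σ 0 + τ) 0) - psi α β x (max (max σ 0 + τ) 0)) - (u x (max σ 0) - psi α β x (max σ 0)) := this
      simp only [max_eq_left hσ0, e] at this
      have hψ := psi_mono S.hα S.hβ x (by linarith : σ ≤ σ + τ)
      exact mul_le_mul (S.p_mono x hσ0 (by simp; linarith) (by linarith)) (by linarith) (S.u_nonneg x hσ0)
        (S.p_mem x _ (by linarith)).1
    rw [e1, e2, r1, r2]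
    linarith

end Sol

/-- A weak solution satisfying condition (P), in the subcritical range, with the spatial derivative of
`u - ψ` made explicit. -/
structure HSol (α β ustar : ℝ) (u p w : ℝ → ℝ → ℝ) (pstar : ℝ → ℝ) : Prop extends Sol α β u p w where
  hu : 0 < ustar
  hsub : ustar < PsiP α β α
  p_even : ∀ x t, p (-x) t = p x t
  pcond : ∀ x : ℝ, ∀ t ∈ Set.Ici (0:ℝ),
    (sSup ((fun s => u x s) '' Set.Icc 0 t) < ustar → p x t = 0) ∧
    (sSup ((fun s => u x s) '' Set.Icc 0 t) = ustar → p x t ∈ Set.Icc (0:ℝ) 1) ∧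
    (ustar < sSup ((fun s => u x s) '' Set.Icc 0 t) → p x t = 1)
  condP : CondP α p pstar

namespace HSol
variable {α β ustar : ℝ} {u p w : ℝ → ℝ → ℝ} {pstar : ℝ → ℝ}

lemma u_le_psi (S : HSol α β ustar u p w pstar) (x : ℝ) {t : ℝ} (ht : 0 ≤ t) : u x t ≤ psi α β x t := by
  have := S.v_nonpos x ht; linarith

lemma u_le (S : HSol α β ustar u p w pstar) (x : ℝ) {t : ℝ} (ht : 0 ≤ t) : u x t ≤ PsiP α β α :=
  (S.u_le_psi x ht).trans (psi_le S.hα S.hβ x t)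

lemma abs_le_of_sq_div_le {α x t : ℝ} (hα : 0 < α) (h : x ^ 2 / α ^ 2 ≤ t) : |x| ≤ α * Real.sqrt t := by
  have h1 : (|x| / α) ^ 2 ≤ t := by rwa [div_pow, sq_abs]
  have h2 := Real.le_sqrt_of_sq_le h1
  rwa [div_le_iff₀ hα, mul_comm] at h2

lemma u_anti (S : HSol α β ustar u p w pstar) {x s t : ℝ} (hs : 0 < s) (hx : x ^ 2 / α ^ 2 ≤ s) (hst : s ≤ t) :
    u x t ≤ u x s := by
  have h1 := S.v_anti x hs.le hst
  rw [psi_eq_of_le hs (abs_le_of_sq_div_le S.hα hx),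
    psi_eq_of_le (hs.trans_le hst) (abs_le_of_sq_div_le S.hα (hx.trans hst))] at h1
  linarith

lemma p_one (S : HSol α β ustar u p w pstar) {x s t : ℝ} (hs : 0 ≤ s) (hst : s ≤ t) (h : ustar < u x s) :
    p x t = 1 := by
  refine (S.pcond x t (hs.trans hst)).2.2 (h.trans_le (le_csSup ?_ ⟨s, ⟨hs, hst⟩, rfl⟩))
  refine ⟨PsiP α β α, ?_⟩
  rintro _ ⟨r, hr, rfl⟩
  exact S.u_le x hr.1

lemma p_zero (S : HSol α β ustar u p w pstar) {x t c : ℝ} (ht : 0 ≤ t) (hc : c < ustar)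
    (h : ∀ s ∈ Icc 0 t, u x s ≤ c) : p x t = 0 := by
  refine (S.pcond x t ht).1 (lt_of_le_of_lt (csSup_le ⟨_, 0, ⟨le_rfl, ht⟩, rfl⟩ ?_) hc)
  rintro _ ⟨r, hr, rfl⟩
  exact h r hr

lemma ae_condP (S : HSol α β ustar u p w pstar) : ∀ᵐ x : ℝ, ∀ t, x ^ 2 / α ^ 2 < t → p x t = pstar |x| := by
  have h1 := (ae_restrict_iff' measurableSet_Ioi).1 S.condP.2
  have h2 : ∀ᵐ x : ℝ, -x ∈ Ioi (0:ℝ) → ∀ t, (-x) ^ 2 / α ^ 2 < t → p (-x) t = pstar (-x) :=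
    (Measure.measurePreserving_neg (volume : Measure ℝ)).quasiMeasurePreserving.ae h1
  have h3 : ∀ᵐ x : ℝ, x ≠ 0 := by simp [ae_iff]
  filter_upwards [h1, h2, h3] with x h1 h2 h3 t ht
  rcases h3.lt_or_gt with h | h
  · have := h2 (by simpa using h) t (by simpa using ht)
    rwa [S.p_even, ← abs_of_neg h] at this
  · rw [abs_of_pos h]; exact h1 h t ht

lemma pstar_mem (S : HSol α β ustar u p w pstar) : ∀ᵐ x : ℝ, pstar |x| ∈ Icc (0:ℝ) 1 := by
  filter_upwards [S.ae_condP] with x hx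
  have := S.p_mem x (x ^ 2 / α ^ 2 + 1) (by positivity)
  rwa [hx _ (by linarith)] at this

lemma p_le_pstar (S : HSol α β ustar u p w pstar) : ∀ᵐ x : ℝ, ∀ t, 0 ≤ t → p x t ≤ pstar |x| := by
  filter_upwards [S.ae_condP] with x hx t ht
  have h1 := hx (max t (x ^ 2 / α ^ 2 + 1)) (lt_max_of_lt_right (by linarith))
  rw [← h1]
  exact S.p_mono x ht (ht.trans (le_max_left _ _)) (le_max_left _ _)

lemma exists_core (S : HSol α β ustar u p w pstar) :
    ∃ a > 0, ∀ x t, |x| < a → 0 < t → x ^ 2 / α ^ 2 ≤ t → p x t = 1 := by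
  have h0 : ustar - PsiP α β α < u 0 (max 0 0) - psi α β 0 (max 0 0) := by
    rw [max_self, S.v_zero]; linarith [S.hsub]
  obtain ⟨r, hr, hbox⟩ := exists_box (x := 0) (t := 0)
    (S.continuous_v.continuousAt.eventually (lt_mem_nhds h0))
  have hα := S.hα
  set a := min r (α * Real.sqrt r) with ha
  have har : a ≤ r := min_le_left _ _
  have ha0 : 0 < a := lt_min hr (mul_pos hα (Real.sqrt_pos.2 hr))
  have ha2 : a ^ 2 / α ^ 2 ≤ r := by
    have h1 : a ≤ α * Real.sqrt r := min_le_right _ _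
    rw [div_le_iff₀ (by positivity)]
    calc a ^ 2 ≤ (α * Real.sqrt r) ^ 2 := by gcongr
      _ = _ := by rw [mul_pow, Real.sq_sqrt hr.le]; ring
  refine ⟨a, ha0, fun x t hx ht hxt => ?_⟩
  set s := min t (a ^ 2 / α ^ 2) with hs
  have hs0 : 0 < s := lt_min ht (by positivity)
  have hxs : x ^ 2 / α ^ 2 ≤ s := by
    refine le_min hxt ?_
    gcongr ?_ / _
    rw [← sq_abs]; gcongr
  refine S.p_one hs0.le (min_le_left _ _) ?_
  have h1 : ustar - PsiP α β α < u x (max s 0) - psi α β x (max s 0) :=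
    hbox x s (by rw [sub_zero]; linarith) (by
      rw [sub_zero, abs_of_pos hs0]; exact (min_le_right _ _).trans ha2)
  rw [max_eq_left hs0.le, psi_eq_of_le hs0 (abs_le_of_sq_div_le hα hxs)] at h1
  linarith

end HSol

lemma gaussTail_le {η : ℝ} (hη : 0 < η) : gaussTail η ≤ 2 / η * Real.exp (-η ^ 2 / 4) := by
  have hderiv : ∀ x ∈ Ici η, HasDerivAt (fun ζ : ℝ => -2 * Real.exp (-ζ ^ 2 / 4)) (x * Real.exp (-x ^ 2 / 4)) x := by
    intro x _
    have := ((((hasDerivAt_id x).pow 2).neg.div_const 4).exp).const_mul (-2)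
    refine this.congr_deriv ?_
    simp; ring
  have hlim : Tendsto (fun ζ : ℝ => -2 * Real.exp (-ζ ^ 2 / 4)) atTop (nhds 0) := by
    rw [show (0:ℝ) = -2 * 0 by norm_num]
    refine Tendsto.const_mul _ (Real.tendsto_exp_atBot.comp ?_)
    have h1 : Tendsto (fun ζ : ℝ => -(ζ ^ 2 / 4)) atTop atBot :=
      tendsto_neg_atTop_atBot.comp ((tendsto_pow_atTop (by norm_num)).atTop_div_const (by norm_num))
    simpa [neg_div] using h1
  have hint : IntegrableOn (fun x : ℝ => x * Real.exp (-x ^ 2 / 4)) (Ioi η) :=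
    integrableOn_Ioi_deriv_of_nonneg' hderiv (fun x hx => mul_nonneg (hη.trans hx).le (Real.exp_pos _).le) hlim
  have hval := integral_Ioi_of_hasDerivAt_of_tendsto' hderiv hint hlim
  have h1 : gaussTail η ≤ ∫ x in Ioi η, η⁻¹ * (x * Real.exp (-x ^ 2 / 4)) := by
    refine setIntegral_mono_on integrable_gauss.integrableOn (hint.const_mul _) measurableSet_Ioi fun x hx => ?_
    have h2 : 1 ≤ η⁻¹ * x := by rw [inv_mul_eq_div, one_le_div hη]; exact (mem_Ioi.1 hx).le
    calc Real.exp (-x ^ 2 / 4) = 1 * Real.exp (-x ^ 2 / 4) := (one_mul _).symm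
      _ ≤ (η⁻¹ * x) * Real.exp (-x ^ 2 / 4) := by gcongr
      _ = _ := by ring
  rw [integral_const_mul, hval] at h1
  refine h1.trans_eq ?_
  ring

lemma tendsto_id_mul_gaussTail : Tendsto (fun L => L * gaussTail L) atTop (nhds 0) := by
  have h1 : Tendsto (fun ζ : ℝ => 2 * Real.exp (-ζ ^ 2 / 4)) atTop (nhds 0) := by
    rw [show (0:ℝ) = 2 * 0 by norm_num]
    refine Tendsto.const_mul _ (Real.tendsto_exp_atBot.comp ?_)
    have h1 : Tendsto (fun ζ : ℝ => -(ζ ^ 2 / 4)) atTop atBot :=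
      tendsto_neg_atTop_atBot.comp ((tendsto_pow_atTop (by norm_num)).atTop_div_const (by norm_num))
    simpa [neg_div] using h1
  refine squeeze_zero' ?_ ?_ h1
  · filter_upwards [eventually_ge_atTop 0] with L hL
    exact mul_nonneg hL (gaussTail_nonneg _)
  · filter_upwards [eventually_gt_atTop 0] with L hL
    calc L * gaussTail L ≤ L * (2 / L * Real.exp (-L ^ 2 / 4)) := by gcongr; exact gaussTail_le hL
      _ = _ := by field_simp

lemma tendsto_gaussTail : Tendsto gaussTail atTop (nhds 0) := by
  refine squeeze_zero' (Eventually.of_forall gaussTail_nonneg) ?_ tendsto_id_mul_gaussTail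
  filter_upwards [eventually_ge_atTop 1] with L hL
  nlinarith [gaussTail_nonneg L]

namespace HSol
variable {α β ustar : ℝ} {u p w : ℝ → ℝ → ℝ} {pstar : ℝ → ℝ}

/-- Far from the origin in similarity variables the solution is small. -/
lemma exists_far (S : HSol α β ustar u p w pstar) {ε : ℝ} (hε : 0 < ε) :
    ∃ L > α, ∀ x t, 0 < t → L * Real.sqrt t ≤ x → u x t < ε := by
  have h1 : Tendsto (fun L => ampl α β * gaussTail L) atTop (nhds (ampl α β * 0)) :=
    tendsto_gaussTail.const_mul _
  rw [mul_zero] at h1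
  obtain ⟨L, hL, hLα⟩ := ((h1.eventually (gt_mem_nhds hε)).and (eventually_gt_atTop α)).exists
  refine ⟨L, hLα, fun x t ht hx => ?_⟩
  have hs := Real.sqrt_pos.2 ht
  have hα := S.hα
  have hx0 : 0 < x := lt_of_lt_of_le (mul_pos (hα.trans hLα) hs) hx
  refine (S.u_le_psi x ht.le).trans_lt (lt_of_le_of_lt ?_ hL)
  rw [psi_eq _ _ _ ht, abs_of_pos hx0]
  refine mul_le_mul_of_nonneg_left (strictAnti_gaussTail.antitone ?_) (ampl_pos S.hα S.hβ).le
  exact le_max_of_le_left ((le_div_iff₀ hs).2 hx)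

end HSol

lemma taylor2_rpow {y : ℝ} (hy : 0 < y) (m : ℝ) :
    Taylor2 (fun z => z ^ m) y (m * y ^ (m - 1)) (m * ((m - 1) * y ^ (m - 1 - 1))) := by
  refine taylor2_of_hasDerivAt (g' := fun z => m * z ^ (m - 1)) ?_ ?_
  · filter_upwards [lt_mem_nhds hy] with z hz
    exact Real.hasDerivAt_rpow_const (Or.inl hz.ne')
  · exact (Real.hasDerivAt_rpow_const (Or.inl hy.ne')).const_mul m

lemma jet_power_barrier {b m x t : ℝ} (K : ℝ) (hb : 0 < b) (ht : 0 < t) :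
    Jet (fun x t => K * ((x * x + b ^ 2) * t⁻¹) ^ m) x t
      (K * (m * ((x * x + b ^ 2) * t⁻¹) ^ (m - 1) * (2 * x * t⁻¹)))
      (K * ((x * x + b ^ 2) * t⁻¹) ^ m * (2 * m / (x * x + b ^ 2) - 4 * m * (1 - m) * x ^ 2 / (x * x + b ^ 2) ^ 2))
      (K * ((x * x + b ^ 2) * t⁻¹) ^ m * (-m / t)) := by
  have hq : 0 < x * x + b ^ 2 := by have := mul_self_nonneg x; positivity
  have hy : 0 < (x * x + b ^ 2) * t⁻¹ := by positivity
  have h1 := (((Jet.fst x t).mul (Jet.fst x t)).add (Jet.const (b ^ 2) x t)).mul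
    (Jet.of_time x (hasDerivAt_inv ht.ne'))
  have h2 := (h1.comp (taylor2_rpow hy m)).const_mul K
  have e1 : ((x * x + b ^ 2) * t⁻¹) ^ (m - 1) = ((x * x + b ^ 2) * t⁻¹) ^ m / ((x * x + b ^ 2) * t⁻¹) :=
    Real.rpow_sub_one hy.ne' m
  refine h2.congr_coeff ?_ ?_ ?_
  · ring
  · rw [Real.rpow_sub_one hy.ne' (m - 1), e1]; field_simp; ring
  · rw [e1]; field_simp; ring

namespace HSol
variable {α β ustar : ℝ} {u p w : ℝ → ℝ → ℝ} {pstar : ℝ → ℝ}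

set_option maxHeartbeats 1000000 in
/-- The solution is small near the origin in similarity variables. -/
lemma exists_near (S : HSol α β ustar u p w pstar) {ε : ℝ} (hε : 0 < ε) :
    ∃ δ > 0, δ < α ∧ ∃ T ≥ 1, ∀ x t, T ≤ t → |x| ≤ δ * Real.sqrt t → u x t ≤ ε := by
  obtain ⟨a', ha', hcore'⟩ := S.exists_core
  have hα := S.hα
  set a := min a' (1/2) with ha
  have ha0 : 0 < a := lt_min ha' (by norm_num)
  have hah : a ≤ 1/2 := min_le_right _ _
  have haa : a ≤ a' := min_le_left _ _
  set b := a / 2 with hb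
  have hb0 : 0 < b := by positivity
  have hb4 : b ^ 2 ≤ 1 / 16 := by
    have : b ≤ 1/4 := by linarith
    nlinarith
  set m := min (1/4) (b^2/8) with hm
  have hm0 : 0 < m := lt_min (by norm_num) (by positivity)
  have hm4 : m ≤ 1/4 := min_le_left _ _
  have hmb : m ≤ b^2/8 := min_le_right _ _
  set c := min (1/2) (α/2) with hc
  have hc0 : 0 < c := lt_min (by norm_num) (by positivity)
  have hc2 : c ≤ 1/2 := min_le_left _ _
  have hcα : c ≤ α/2 := min_le_right _ _
  have hP0 : 0 < PsiP α β α := PsiP_self_pos S.hα S.hβ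
  set M := min ((c^2)^m) ((b^2)^m) with hM
  have hM0 : 0 < M := lt_min (Real.rpow_pos_of_pos (by positivity) _) (Real.rpow_pos_of_pos (by positivity) _)
  set K := (PsiP α β α + 1) / M with hK
  have hK0 : 0 < K := by positivity
  have hKM : K * M = PsiP α β α + 1 := div_mul_cancel₀ _ hM0.ne'
  have hq : ∀ x : ℝ, 0 < x * x + b ^ 2 := fun x => by have := mul_self_nonneg x; positivity
  have hbig : ∀ x t y, 0 < t → 0 ≤ y → M ≤ y ^ m → y ≤ (x * x + b^2) * t⁻¹ →
      u x t - K * ((x * x + b ^ 2) * t⁻¹) ^ m < 0 := by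
    intro x t y ht hy hMy h
    have h1 : y ^ m ≤ ((x * x + b ^ 2) * t⁻¹) ^ m := Real.rpow_le_rpow hy h hm0.le
    have h2 := S.u_le x ht.le
    have h3 := mul_le_mul_of_nonneg_left (hMy.trans h1) hK0.le
    linarith
  have hcs : ∀ t x, 0 < t → |x| = c * Real.sqrt t → u x t - K * ((x * x + b ^ 2) * t⁻¹) ^ m < 0 := by
    intro t x ht hx
    refine hbig x t (c^2) ht (by positivity) (min_le_left _ _) ?_
    have : x * x = c ^ 2 * t := by rw [← abs_mul_abs_self, hx]; nlinarith [Real.sq_sqrt ht.le]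
    rw [this, ← div_eq_mul_inv, le_div_iff₀ ht]
    nlinarith [sq_nonneg b]
  have main := neg_of_no_first_zero (D := fun x t => u x t - K * ((x * x + b ^ 2) * t⁻¹) ^ m)
    (l := fun t => -(c * Real.sqrt t)) (r := fun t => c * Real.sqrt t) (T := 1)
    (by fun_prop) (by fun_prop) ?_ ?_ ?_ ?_ ?_
  · have hlim : Tendsto (fun y : ℝ => K * y ^ m) (nhds 0) (nhds (K * 0 ^ m)) :=
      (Real.continuousAt_rpow_const 0 m (Or.inr hm0.le)).tendsto.const_mul K
    rw [Real.zero_rpow hm0.ne', mul_zero] at hlim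
    obtain ⟨y0, hy0, hball⟩ := Metric.eventually_nhds_iff_ball.1 (hlim.eventually (gt_mem_nhds hε))
    refine ⟨min c (Real.sqrt (y0 / 3)), lt_min hc0 (Real.sqrt_pos.2 (by positivity)),
      (min_le_left _ _).trans_lt (by linarith), max 1 (3 * b^2/y0), le_max_left _ _, fun x t ht hx => ?_⟩
    have ht1 : 1 ≤ t := (le_max_left _ _).trans ht
    have hs : 0 < Real.sqrt t := Real.sqrt_pos.2 (by linarith)
    have hx1 : |x| ≤ c * Real.sqrt t := hx.trans (by gcongr; exact min_le_left _ _)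
    have hx2 : |x| ≤ Real.sqrt (y0/3) * Real.sqrt t := hx.trans (by gcongr; exact min_le_right _ _)
    have h1 := main x t ht1 (abs_le.1 hx1).1 (abs_le.1 hx1).2
    have hxx : x * x ≤ y0 / 3 * t := by
      rw [← abs_mul_abs_self]
      calc |x| * |x| ≤ (Real.sqrt (y0/3) * Real.sqrt t) * (Real.sqrt (y0/3) * Real.sqrt t) := by gcongr
        _ = _ := by
          rw [show Real.sqrt (y0/3) * Real.sqrt t * (Real.sqrt (y0/3) * Real.sqrt t) =
            Real.sqrt (y0/3)^2 * Real.sqrt t^2 by ring, Real.sq_sqrt (by positivity), Real.sq_sqrt (by linarith)]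
    have hbt : b ^ 2 ≤ y0 / 3 * t := by
      have := (le_max_right _ _).trans ht
      rw [div_le_iff₀ hy0] at this; linarith
    have hy : (x * x + b ^ 2) * t⁻¹ < y0 := by
      rw [← div_eq_mul_inv, div_lt_iff₀ (by linarith)]; nlinarith
    have h2 := hball ((x * x + b ^ 2) * t⁻¹) (by
      rw [Metric.mem_ball, Real.dist_eq, sub_zero, abs_of_pos (mul_pos (hq x) (inv_pos.2 (by linarith)))]
      exact hy)
    linarith
  · intro x t ht _ _
    have h1 : ContinuousAt (fun z : ℝ × ℝ => (z.1 * z.1 + b ^ 2) * z.2⁻¹) (x, t) :=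
      ContinuousAt.mul (by fun_prop) (continuousAt_snd.inv₀ (by simp; linarith))
    exact (S.continuousAt_u x (by linarith)).sub ((h1.rpow_const (Or.inl
      (mul_pos (hq x) (inv_pos.2 (by linarith))).ne')).const_mul K)
  · intro x _ _
    refine hbig x 1 (b^2) one_pos (by positivity) (min_le_right _ _) ?_
    simp [mul_self_nonneg]
  · intro t ht _
    exact hcs t _ (by linarith) (by rw [abs_neg, abs_of_nonneg]; positivity)
  · intro t ht _
    exact hcs t _ (by linarith) (by rw [abs_of_nonneg]; positivity)
  · intro x0 t0 ht0 hl hr hz hle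
    have ht00 : 0 < t0 := by linarith
    have hs := Real.sqrt_pos.2 ht00
    have hev := eventually_backward (D := fun x t => u x t - K * ((x * x + b ^ 2) * t⁻¹) ^ m)
      (l := fun t => -(c * Real.sqrt t)) (r := fun t => c * Real.sqrt t)
      (by fun_prop) (by fun_prop) ht0 hl hr hle
    have hx : |x0| < c * Real.sqrt t0 := abs_lt.2 ⟨hl, hr⟩
    have hxα : |x0| < α / 2 * Real.sqrt t0 := hx.trans_le (by gcongr)
    have hk : |x0| ≠ α * Real.sqrt t0 := by
      have : α / 2 * Real.sqrt t0 < α * Real.sqrt t0 := by gcongr; linarith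
      exact (hxα.trans this).ne
    have hjet := jet_power_barrier (m := m) (x := x0) K hb0 ht00
    have hu0 : u x0 t0 = K * ((x0 * x0 + b ^ 2) * t0⁻¹) ^ m := by linarith
    rw [← hu0] at hjet
    have hq0 := hq x0
    have hupos : 0 < u x0 t0 := by
      rw [hu0]; exact mul_pos hK0 (Real.rpow_pos_of_pos (by positivity) _)
    have hmax : ∀ᶠ z : ℝ × ℝ in nhds (x0, t0), z.2 ≤ t0 →
      1 * u z.1 z.2 - K * ((z.1 * z.1 + b ^ 2) * z.2⁻¹) ^ m ≤ 1 * u x0 t0 - K * ((x0 * x0 + b ^ 2) * t0⁻¹) ^ m := by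
      filter_upwards [hev] with z h h'
      have := h h'
      linarith
    rcases le_or_gt a |x0| with hxa | hxa
    · have := S.touch' (s := 1) (r := t0) (G := 0) ht00 hk ht00
        (ae_of_all _ fun y _ τ hτ => by
          have h1 := S.u_nonneg y (t := τ) (by linarith [hτ.1])
          have h2 := (S.p_mem y τ (by linarith [hτ.1])).1
          have := mul_nonneg h2 h1
          linarith) hjet hmax
      have hxx : a ^ 2 ≤ x0 ^ 2 := by rw [← sq_abs x0]; gcongr
      have hxt : x0 ^ 2 ≤ t0 / 4 := by
        rw [← sq_abs x0]
        calc |x0| ^ 2 ≤ (1/2 * Real.sqrt t0) ^ 2 := by gcongr; exact hx.le.trans (by gcongr)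
          _ = _ := by rw [mul_pow, Real.sq_sqrt ht00.le]; ring
      have h3 : 0 < -m / t0 - (2 * m / (x0 * x0 + b ^ 2) - 4 * m * (1 - m) * x0 ^ 2 / (x0 * x0 + b ^ 2) ^ 2) := by
        have e : -m / t0 - (2 * m / (x0 * x0 + b ^ 2) - 4 * m * (1 - m) * x0 ^ 2 / (x0 * x0 + b ^ 2) ^ 2)
            = m * (((4 * (1 - m) * x0^2 - 2 * (x0 * x0 + b^2)) * t0 - (x0 * x0 + b^2)^2)) / (t0 * (x0 * x0 + b ^ 2) ^ 2) := by
          field_simp; ring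
        rw [e]
        refine div_pos (mul_pos hm0 ?_) (by positivity)
        have hab : a ^ 2 = 4 * b ^ 2 := by rw [hb]; ring
        have h4 : x0 * x0 = x0 ^ 2 := by ring
        rw [h4]
        have h5 : x0 ^ 2 + b ^ 2 ≤ (5/16) * t0 := by linarith
        have h6 : 4 * (3/4) * x0 ^ 2 ≤ 4 * (1 - m) * x0 ^ 2 := by
          have := sq_nonneg x0; gcongr; linarith
        have h7 : (2/5) * (x0 ^ 2 + b ^ 2) ≤ 4 * (1 - m) * x0 ^ 2 - 2 * (x0 ^ 2 + b ^ 2) := by linarith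
        have h8 : (x0 ^ 2 + b ^ 2) ^ 2 ≤ (x0 ^ 2 + b ^ 2) * ((5/16) * t0) := by rw [pow_two]; gcongr
        have h9 := mul_le_mul_of_nonneg_right h7 ht00.le
        have : 0 < (x0 ^ 2 + b ^ 2) * t0 := by positivity
        linarith
      have := mul_pos hupos h3
      linarith
    · have hev1 : ∀ᶠ z : ℝ × ℝ in nhds (x0, t0), |z.1| < a ∧ z.1 ^ 2 / α ^ 2 < z.2 ∧ 3/4 * u x0 t0 < u z.1 z.2 := by
        refine ((?_ : ∀ᶠ z : ℝ × ℝ in nhds (x0, t0), |z.1| < a)).and (Eventually.and ?_ ?_)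
        · have : Continuous fun z : ℝ × ℝ => |z.1| := by fun_prop
          exact this.continuousAt.eventually (gt_mem_nhds hxa)
        · have h1 : Continuous fun z : ℝ × ℝ => z.1 ^ 2 / α ^ 2 - z.2 := by fun_prop
          have h2 : x0 ^ 2 / α ^ 2 - t0 < 0 := by
            rw [sub_neg, div_lt_iff₀ (by positivity), ← sq_abs]
            calc |x0| ^ 2 < (α / 2 * Real.sqrt t0) ^ 2 := by gcongr
              _ = t0 * α ^ 2 / 4 := by rw [mul_pow, Real.sq_sqrt ht00.le]; ring
              _ ≤ _ := by have : 0 < t0 * α^2 := by positivity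
                          linarith
          exact (h1.continuousAt.eventually (gt_mem_nhds h2)).mono fun z hz => by linarith
        · exact (S.continuousAt_u x0 ht00).eventually (lt_mem_nhds (by simp only; linarith))
      obtain ⟨r, hr0, hbox⟩ := exists_box hev1
      have := S.touch' (s := 1) (r := min r (t0 / 2)) (G := -(3/4 * u x0 t0)) ht00 hk (lt_min hr0 (by linarith))
        (ae_of_all _ fun y hy τ hτ => by
          have hrr := min_le_left r (t0 / 2)
          have hrt := min_le_right r (t0 / 2)
          obtain ⟨h1, h2, h3⟩ := hbox y τ (hy.trans hrr) (abs_le.2 ⟨by linarith [hτ.1], by linarith [hτ.2]⟩)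
          rw [hcore' y τ (h1.trans_le haa) (by linarith [hτ.1]) h2.le]
          simp only at h3
          linarith) hjet hmax
      have h3 : -(1/2) ≤ -m / t0 - (2 * m / (x0 * x0 + b ^ 2) - 4 * m * (1 - m) * x0 ^ 2 / (x0 * x0 + b ^ 2) ^ 2) := by
        have h4 : m / t0 ≤ 1/4 := by rw [div_le_iff₀ ht00]; linarith
        have h5 : 2 * m / (x0 * x0 + b ^ 2) ≤ 1/4 := by
          rw [div_le_iff₀ hq0]; linarith [mul_self_nonneg x0]
        have h6 : 0 ≤ 4 * m * (1 - m) * x0 ^ 2 / (x0 * x0 + b ^ 2) ^ 2 := by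
          have : 0 ≤ 1 - m := by linarith
          positivity
        rw [neg_div]; linarith
      have := mul_le_mul_of_nonneg_left h3 hupos.le
      linarith

end HSol

lemma taylor2_exp (y : ℝ) : Taylor2 Real.exp y (Real.exp y) (Real.exp y) :=
  taylor2_of_hasDerivAt (Eventually.of_forall Real.hasDerivAt_exp) (Real.hasDerivAt_exp y)

lemma jet_peak (α K μ x : ℝ) {t : ℝ} (ht : 0 < t) :
    Jet (fun x t => K * t⁻¹ * Real.exp (μ * (x * x - α ^ 2 * t))) x t
      (K * t⁻¹ * (2 * μ * x) * Real.exp (μ * (x * x - α ^ 2 * t)))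
      (K * t⁻¹ * (2 * μ + 4 * μ ^ 2 * x ^ 2) * Real.exp (μ * (x * x - α ^ 2 * t)))
      (K * t⁻¹ * (-t⁻¹ - μ * α ^ 2) * Real.exp (μ * (x * x - α ^ 2 * t))) := by
  have h1 := ((((Jet.fst x t).mul (Jet.fst x t)).sub
    (Jet.of_time x ((hasDerivAt_id t).const_mul (α ^ 2)))).const_mul μ).comp (taylor2_exp _)
  have h2 := ((Jet.of_time x (hasDerivAt_inv ht.ne')).const_mul K).mul h1
  refine h2.congr_coeff ?_ ?_ ?_
  · simp only [id]; ring
  · simp only [id]; ring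
  · simp only [id]; ring

lemma mul_exp_neg_le {μ : ℝ} (hμ : 0 < μ) (y : ℝ) : y * Real.exp (-(μ * y)) ≤ 1 / μ := by
  rw [Real.exp_neg, ← div_eq_mul_inv, div_le_div_iff₀ (Real.exp_pos _) hμ]
  have := Real.add_one_le_exp (μ * y)
  linarith

lemma exp_neg_le_div {B ν T t : ℝ} (hB : 0 < B) (hν : 0 < ν) (hT : 0 ≤ T) (htT : T ≤ t) (ht : 0 < t) :
    B * Real.exp (-(ν * (t - T))) ≤ B * (T + 1 / ν) / t := by
  rw [Real.exp_neg, le_div_iff₀ ht, mul_assoc]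
  refine mul_le_mul_of_nonneg_left ?_ hB.le
  rw [inv_mul_eq_div, div_le_iff₀ (Real.exp_pos _)]
  have h1 := Real.add_one_le_exp (ν * (t - T))
  have h0 : 0 ≤ ν * (t - T) := mul_nonneg hν.le (by linarith)
  calc t ≤ (T + 1 / ν) * (ν * (t - T) + 1) := by
        have : (T + 1 / ν) * (ν * (t - T) + 1) = T * (ν * (t - T)) + T + (t - T) + 1 / ν := by
          field_simp; ring
        rw [this]
        have : 0 < 1 / ν := by positivity
        have := mul_nonneg hT h0
        linarith
    _ ≤ _ := by gcongr

namespace HSol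
variable {α β ustar : ℝ} {u p w : ℝ → ℝ → ℝ} {pstar : ℝ → ℝ}

set_option maxHeartbeats 1000000 in
/-- The solution exceeds the threshold at most by `O(1/t)`. -/
lemma exists_ceiling (S : HSol α β ustar u p w pstar) :
    ∃ C > 0, ∃ T ≥ 1, ∀ x t, T ≤ t → u x t ≤ ustar + C / t := by
  have hα := S.hα
  have hβ := S.hβ
  have hu := S.hu
  obtain ⟨δ, hδ, hδα, T1, hT1, hnear⟩ := S.exists_near hu
  obtain ⟨L, hL, hfar⟩ := S.exists_far hu
  have hB : 0 < PsiP α β α := PsiP_self_pos S.hα S.hβ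
  set B := PsiP α β α with hBdef
  set μ := ustar / (4 * α ^ 2 * β) with hμ
  have hμ0 : 0 < μ := by positivity
  set K := β / (4 * μ) with hK
  have hK0 : 0 < K := by positivity
  have hKμ : K * μ = β / 4 := by rw [hK]; field_simp
  have hKμ2 : K * μ ^ 2 * α ^ 2 = ustar / 16 := by
    rw [pow_two, ← mul_assoc, hKμ, hμ]; field_simp; ring
  set ν := ustar / (4 * B) with hν
  have hν0 : 0 < ν := by positivity
  have hνB : ν * B = ustar / 4 := by rw [hν]; field_simp
  set H := K * (1 + μ * α ^ 2 + 2 * μ) + β with hH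
  have hH0 : 0 < H := by positivity
  set T := max T1 (4 * H / ustar) with hT
  have hTT1 : T1 ≤ T := le_max_left _ _
  have hT1' : 1 ≤ T := hT1.trans hTT1
  have hTH : 4 * H ≤ ustar * T := by
    have : 4 * H / ustar ≤ T := le_max_right _ _
    rw [div_le_iff₀ hu] at this; linarith
  have hbar : ∀ x t, 0 < t → ustar < ustar + B * Real.exp (-(ν * (t - T))) + K * t⁻¹ * Real.exp (-(μ * |x * x - α ^ 2 * t|)) := by
    intro x t ht
    have : 0 < B * Real.exp (-(ν * (t - T))) := by positivity
    have : 0 < K * t⁻¹ * Real.exp (-(μ * |x * x - α ^ 2 * t|)) := by positivity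
    linarith
  have main := neg_of_no_first_zero
    (D := fun x t => u x t - (ustar + B * Real.exp (-(ν * (t - T))) + K * t⁻¹ * Real.exp (-(μ * |x * x - α ^ 2 * t|))))
    (l := fun t => δ * Real.sqrt t) (r := fun t => L * Real.sqrt t) (T := T)
    (by fun_prop) (by fun_prop) ?_ ?_ ?_ ?_ ?_
  · refine ⟨B * (T + 1 / ν) + K, by positivity, T, hT1', ?_⟩
    have hpos : ∀ x t, 0 ≤ x → T ≤ t → u x t ≤ ustar + (B * (T + 1 / ν) + K) / t := by
      intro x t hx ht
      have ht0 : 0 < t := by linarith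
      have h0 : 0 ≤ (B * (T + 1 / ν) + K) / t := by positivity
      rcases le_total x (δ * Real.sqrt t) with h1 | h1
      · have := hnear x t (hTT1.trans ht) (by rwa [abs_of_nonneg hx]); linarith
      rcases le_total x (L * Real.sqrt t) with h2 | h2
      · have h3 := main x t ht h1 h2
        have h4 := exp_neg_le_div hB hν0 (by linarith) ht ht0
        have h5 : K * t⁻¹ * Real.exp (-(μ * |x * x - α ^ 2 * t|)) ≤ K / t := by
          rw [← div_eq_mul_inv]
          refine mul_le_of_le_one_right (by positivity) (Real.exp_le_one_iff.2 ?_)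
          have : 0 ≤ μ * |x * x - α ^ 2 * t| := by positivity
          linarith
        rw [add_div]
        linarith
      · have := hfar x t ht0 h2; linarith
    intro x t ht
    rcases le_total 0 x with h | h
    · exact hpos x t h ht
    · rw [← S.u_even]; exact hpos _ t (by linarith) ht
  · intro x t ht _ _
    have ht0 : t ≠ 0 := by linarith
    have h1 : ContinuousAt (fun z : ℝ × ℝ => z.2⁻¹) (x, t) := continuousAt_snd.inv₀ ht0
    refine (S.continuousAt_u x (by linarith)).sub (ContinuousAt.add (by fun_prop) ?_)
    exact (h1.const_mul K).mul (by fun_prop)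
  · intro x _ _
    have := S.u_le x (t := T) (by linarith)
    have h2 : 0 < K * T⁻¹ * Real.exp (-(μ * |x * x - α ^ 2 * T|)) := by positivity
    have h3 : Real.exp (-(ν * (T - T))) = 1 := by simp
    rw [h3]; linarith
  · intro t ht _
    have hs := Real.sqrt_nonneg t
    have := hnear (δ * Real.sqrt t) t (hTT1.trans ht) (by rw [abs_of_nonneg (by positivity)])
    have := hbar (δ * Real.sqrt t) t (by linarith)
    linarith
  · intro t ht _
    have := hfar (L * Real.sqrt t) t (by linarith) le_rfl
    have := hbar (L * Real.sqrt t) t (by linarith)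
    linarith
  · intro x0 t0 ht0 hl hr hz hle
    have ht00 : 0 < t0 := by linarith
    have hs := Real.sqrt_pos.2 ht00
    have hss := Real.sq_sqrt ht00.le
    have hx0 : 0 < x0 := lt_trans (by positivity) hl
    have hev := eventually_backward
      (D := fun x t => u x t - (ustar + B * Real.exp (-(ν * (t - T))) + K * t⁻¹ * Real.exp (-(μ * |x * x - α ^ 2 * t|))))
      (l := fun t => δ * Real.sqrt t) (r := fun t => L * Real.sqrt t)
      (by fun_prop) (by fun_prop) ht0 hl hr hle
    have hgt : ustar < u x0 t0 := by have := hbar x0 t0 ht00; linarith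
    have hexp : 0 < K * t0⁻¹ := by positivity
    by_cases hk : x0 = α * Real.sqrt t0
    · have hxx : x0 * x0 = α ^ 2 * t0 := by rw [hk]; nlinarith
      have hg : ∀ σ : ℝ, HasDerivAt (fun x => ustar + B * Real.exp (-(ν * (t0 - T))) + K * t0⁻¹ * Real.exp (σ * μ * (x * x - α ^ 2 * t0)))
          (K * t0⁻¹ * (2 * (σ * μ) * x0)) x0 := by
        intro σ
        have := ((((((hasDerivAt_id x0).mul (hasDerivAt_id x0)).sub_const (α ^ 2 * t0)).const_mul (σ * μ)).exp).const_mul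
          (K * t0⁻¹)).const_add (ustar + B * Real.exp (-(ν * (t0 - T))))
        refine this.congr_deriv ?_
        show K * t0⁻¹ * (Real.exp (σ * μ * (x0 * x0 - α ^ 2 * t0)) * (σ * μ * (1 * x0 + x0 * 1))) = _
        rw [hxx, sub_self, mul_zero, Real.exp_zero]; ring
      have hnhds : ∀ᶠ x in nhds x0, 0 < x := lt_mem_nhds hx0
      have hl' : HasDerivWithinAt (fun x => ustar + B * Real.exp (-(ν * (t0 - T))) + K * t0⁻¹ * Real.exp (-(μ * |x * x - α ^ 2 * t0|)))
          (K * t0⁻¹ * (2 * (1 * μ) * x0)) (Iic x0) x0 := by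
        refine (hg 1).hasDerivWithinAt.congr_of_eventuallyEq ?_ (by rw [hxx]; simp)
        filter_upwards [self_mem_nhdsWithin, mem_nhdsWithin_of_mem_nhds hnhds] with x hx hx'
        have hx : x ≤ x0 := hx
        have hx' : 0 < x := hx'
        rw [abs_of_nonpos (by nlinarith)]; ring_nf
      have hr' : HasDerivWithinAt (fun x => ustar + B * Real.exp (-(ν * (t0 - T))) + K * t0⁻¹ * Real.exp (-(μ * |x * x - α ^ 2 * t0|)))
          (K * t0⁻¹ * (2 * (-1 * μ) * x0)) (Ici x0) x0 := by
        refine (hg (-1)).hasDerivWithinAt.congr_of_eventuallyEq ?_ (by rw [hxx]; simp)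
        filter_upwards [self_mem_nhdsWithin] with x hx
        have hx : x0 ≤ x := hx
        rw [abs_of_nonneg (by nlinarith)]; ring_nf
      have h1 := S.kink (s := 1) ht00 hk hl' hr' ((eventually_slice hev).mono fun y hy => by
        have := hy le_rfl
        linarith)
      have h2 : K * t0⁻¹ * (2 * (1 * μ) * x0) - K * t0⁻¹ * (2 * (-1 * μ) * x0) = α * β / Real.sqrt t0 := by
        calc _ = (K * μ) * 4 * x0 / t0 := by ring
          _ = β * α * Real.sqrt t0 / (Real.sqrt t0 ^ 2) := by rw [hKμ, hk, hss]; ring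
          _ = _ := by field_simp
      rw [h2] at h1
      have h3 : 0 < α * β / (2 * Real.sqrt t0) := by positivity
      have h4 : α * β / Real.sqrt t0 = 2 * (α * β / (2 * Real.sqrt t0)) := by field_simp
      linarith
    · have hk' : |x0| ≠ α * Real.sqrt t0 := by rwa [abs_of_pos hx0]
      have hcont : Continuous fun z : ℝ × ℝ => z.1 * z.1 - α ^ 2 * z.2 := by fun_prop
      obtain ⟨σ, hσ1, hσ⟩ : ∃ σ : ℝ, (σ = 1 ∨ σ = -1) ∧ ∀ᶠ z : ℝ × ℝ in nhds (x0, t0),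
          -(μ * |z.1 * z.1 - α ^ 2 * z.2|) = (σ * μ) * (z.1 * z.1 - α ^ 2 * z.2) := by
        rcases lt_or_gt_of_ne hk with h | h
        · refine ⟨1, Or.inl rfl, ?_⟩
          have : x0 * x0 - α ^ 2 * t0 < 0 := by nlinarith
          filter_upwards [hcont.continuousAt.eventually (gt_mem_nhds this)] with z hz
          rw [abs_of_neg hz]; ring
        · refine ⟨-1, Or.inr rfl, ?_⟩
          have : 0 < x0 * x0 - α ^ 2 * t0 := by nlinarith [mul_pos hα hs]
          filter_upwards [hcont.continuousAt.eventually (lt_mem_nhds this)] with z hz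
          rw [abs_of_pos hz]; ring
      have hσ0 := hσ.self_of_nhds
      have hjt : HasDerivAt (fun t => ustar + B * Real.exp (-(ν * (t - T)))) (-(ν * B) * Real.exp (-(ν * (t0 - T)))) t0 := by
        have := (((((hasDerivAt_id t0).sub_const T).const_mul ν).neg.exp).const_mul B).const_add ustar
        refine this.congr_deriv ?_
        simp; ring
      have hjet := ((Jet.of_time x0 hjt).add (jet_peak α K (σ * μ) x0 ht00)).congr_eventually
        (ξ := fun x t => ustar + B * Real.exp (-(ν * (t - T))) + K * t⁻¹ * Real.exp (-(μ * |x * x - α ^ 2 * t|)))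
        (hσ.mono fun z hz => by simp only [hz])
      obtain ⟨r, hr0, hbox⟩ := exists_box ((S.continuousAt_u x0 ht00).eventually (lt_mem_nhds hgt))
      have hd := S.touch' (s := 1) (r := min r (t0 / 2)) (G := -ustar) ht00 hk' (lt_min hr0 (by linarith))
        (ae_of_all _ fun y hy τ hτ => by
          have hrr := min_le_left r (t0 / 2)
          have hrt := min_le_right r (t0 / 2)
          have h1 := hbox y τ (hy.trans hrr) (abs_le.2 ⟨by linarith [hτ.1], by linarith [hτ.2]⟩)
          simp only at h1
          rw [S.p_one (t := τ) (by linarith [hτ.1]) le_rfl h1]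
          linarith) hjet (hev.mono fun z h h' => by
            have := h h'
            linarith)
      set E := Real.exp (σ * μ * (x0 * x0 - α ^ 2 * t0)) with hE
      have hE0 : 0 < E := Real.exp_pos _
      set y := |x0 * x0 - α ^ 2 * t0| with hy
      have hEy : E = Real.exp (-(μ * y)) := by rw [hE, ← hσ0]
      have hE1 : E ≤ 1 := by
        rw [hEy, Real.exp_le_one_iff]
        have : 0 ≤ μ * y := by positivity
        linarith
      have hyE : y * E ≤ 1 / μ := by rw [hEy]; exact mul_exp_neg_le hμ0 y
      have hxy : x0 ^ 2 ≤ α ^ 2 * t0 + y := by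
        have := le_abs_self (x0 * x0 - α ^ 2 * t0); linarith [pow_two x0]
      have hF1 : Real.exp (-(ν * (t0 - T))) ≤ 1 := by
        rw [Real.exp_le_one_iff]
        have : 0 ≤ ν * (t0 - T) := mul_nonneg hν0.le (by linarith)
        linarith
      have hi : t0⁻¹ ≤ 1 := inv_le_one_of_one_le₀ (by linarith)
      have hi0 : 0 < t0⁻¹ := by positivity
      have hσ2 : σ ^ 2 = 1 := by rcases hσ1 with h | h <;> rw [h] <;> norm_num
      have hσle : σ ≤ 1 := by rcases hσ1 with h | h <;> rw [h] <;> norm_num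
      have hx2E : x0 ^ 2 * E ≤ α ^ 2 * t0 + 1 / μ := by
        have h1 := mul_le_mul_of_nonneg_right hxy hE0.le
        have h2 : α ^ 2 * t0 * E ≤ α ^ 2 * t0 := mul_le_of_le_one_right (by positivity) hE1
        linarith
      have hA : K * t0⁻¹ * (4 * μ ^ 2 * (x0 ^ 2 * E)) ≤ ustar / 4 + β * t0⁻¹ := by
        calc _ ≤ K * t0⁻¹ * (4 * μ ^ 2 * (α ^ 2 * t0 + 1 / μ)) := by gcongr
          _ = 4 * (K * μ ^ 2 * α ^ 2) * (t0⁻¹ * t0) + 4 * (K * μ) * t0⁻¹ := by field_simp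
          _ = _ := by rw [hKμ2, hKμ, inv_mul_cancel₀ ht00.ne']; ring
      have hBd : K * t0⁻¹ * ((t0⁻¹ + σ * (μ * α ^ 2 + 2 * μ)) * E) ≤ K * t0⁻¹ * (1 + μ * α ^ 2 + 2 * μ) := by
        have h1 : t0⁻¹ + σ * (μ * α ^ 2 + 2 * μ) ≤ 1 + 1 * (μ * α ^ 2 + 2 * μ) := by gcongr
        refine mul_le_mul_of_nonneg_left ?_ hexp.le
        calc _ ≤ (1 + 1 * (μ * α ^ 2 + 2 * μ)) * E := by gcongr
          _ ≤ (1 + 1 * (μ * α ^ 2 + 2 * μ)) := mul_le_of_le_one_right (by positivity) hE1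
          _ = _ := by ring
      have hHt : H * t0⁻¹ ≤ ustar / 4 := by
        rw [← div_eq_mul_inv, div_le_iff₀ ht00]; nlinarith
      have hνF : ν * B * Real.exp (-(ν * (t0 - T))) ≤ ustar / 4 := by
        rw [hνB]; exact mul_le_of_le_one_right (by positivity) hF1
      have e : (K * t0⁻¹ * (2 * (σ * μ) + 4 * (σ * μ) ^ 2 * x0 ^ 2) * E) - (K * t0⁻¹ * (-t0⁻¹ - σ * μ * α ^ 2) * E)
          = K * t0⁻¹ * ((t0⁻¹ + σ * (μ * α ^ 2 + 2 * μ)) * E) + K * t0⁻¹ * (4 * μ ^ 2 * (x0 ^ 2 * E)) := by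
        rw [mul_pow, hσ2]; ring
      have e2 : H * t0⁻¹ = K * t0⁻¹ * (1 + μ * α ^ 2 + 2 * μ) + β * t0⁻¹ := by rw [hH]; ring
      linarith

end HSol

lemma hasDerivAt_gauss (η : ℝ) : HasDerivAt (fun η : ℝ => Real.exp (-η ^ 2 / 4)) (-(η / 2) * Real.exp (-η ^ 2 / 4)) η := by
  have := (((hasDerivAt_id η).pow 2).neg.div_const 4).exp
  refine this.congr_deriv ?_
  show Real.exp (-η ^ 2 / 4) * (-(↑2 * η ^ (2 - 1) * 1) / 4) = _
  simp; ring

lemma taylor2_id_mul_gauss (η : ℝ) :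
    Taylor2 (fun η => η * Real.exp (-η ^ 2 / 4)) η ((1 - η ^ 2 / 2) * Real.exp (-η ^ 2 / 4))
      ((η ^ 3 / 4 - 3 * η / 2) * Real.exp (-η ^ 2 / 4)) := by
  refine taylor2_of_hasDerivAt (g' := fun η => (1 - η ^ 2 / 2) * Real.exp (-η ^ 2 / 4)) ?_ ?_
  · refine Eventually.of_forall fun z => ((hasDerivAt_id z).mul (hasDerivAt_gauss z)).congr_deriv ?_
    simp only [id]; ring
  · refine (((((hasDerivAt_id η).pow 2).div_const 2).const_sub 1).mul (hasDerivAt_gauss η)).congr_deriv ?_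
    simp; ring

lemma id_mul_gauss_le (η : ℝ) : η * Real.exp (-η ^ 2 / 4) ≤ 1 := by
  rw [neg_div, Real.exp_neg, ← div_eq_mul_inv, div_le_one (Real.exp_pos _)]
  have := Real.add_one_le_exp (η ^ 2 / 4)
  nlinarith [sq_nonneg (η / 2 - 1)]

lemma gaussTail_sub_ge {a b : ℝ} (ha : 0 ≤ a) (hab : a ≤ b) : (b - a) * Real.exp (-b ^ 2 / 4) ≤ gaussTail a - gaussTail b := by
  rw [gaussTail_sub]
  have h1 : ∫ _ in a..b, Real.exp (-b ^ 2 / 4) = (b - a) * Real.exp (-b ^ 2 / 4) := by simp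
  rw [← h1]
  refine intervalIntegral.integral_mono_on (μ := volume) hab intervalIntegrable_const
    (Continuous.intervalIntegrable (by fun_prop) _ _) fun x hx => ?_
  refine Real.exp_le_exp.2 ?_
  have : x ^ 2 ≤ b ^ 2 := by have := hx.1; have := hx.2; gcongr; linarith
  linarith

namespace HSol
variable {α β ustar : ℝ} {u p w : ℝ → ℝ → ℝ} {pstar : ℝ → ℝ}

set_option maxHeartbeats 1000000 in
/-- Outside the parabola the solution is controlled by its values on the parabola. -/
lemma exists_outer_bound (S : HSol α β ustar u p w pstar) {m C T : ℝ} (hm : 0 ≤ m) (hC : 0 ≤ C) (hT : 1 ≤ T)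
    (h : ∀ t, T ≤ t → u (α * Real.sqrt t) t ≤ m + C / t) :
    ∃ K > 0, ∀ x t, T ≤ t → α * Real.sqrt t ≤ x → u x t ≤
      m / gaussTail α * gaussTail (x / Real.sqrt t) +
        K * (t⁻¹ * (x / Real.sqrt t * Real.exp (-(x / Real.sqrt t) ^ 2 / 4))) := by
  have hα := S.hα
  have hA := ampl_pos S.hα S.hβ
  have hI := gaussTail_pos α
  set K := C * Real.exp (α ^ 2 / 4) / α + 2 * ampl α β * T / α ^ 2 with hK
  have hK0 : 0 < K := by positivity
  refine ⟨K, hK0, fun x t ht hx => ?_⟩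
  have main : ∀ ε > 0, u x t - (m / gaussTail α * gaussTail (x / Real.sqrt t) +
        K * (t⁻¹ * (x / Real.sqrt t * Real.exp (-(x / Real.sqrt t) ^ 2 / 4))) + ε * (1 + t - T)) < 0 := by
    intro ε hε
    obtain ⟨L0, hL0, hfar⟩ := S.exists_far hε
    set L := max L0 (x / Real.sqrt t) with hL
    have hαL : α < L := hL0.trans_le (le_max_left _ _)
    have hs := Real.sqrt_pos.2 (show 0 < t by linarith)
    have hxL : x ≤ L * Real.sqrt t := by rw [← div_le_iff₀ hs]; exact le_max_right _ _
    have hpos1 : ∀ x t : ℝ, 0 ≤ m / gaussTail α * gaussTail (x / Real.sqrt t) := fun x t =>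
      mul_nonneg (by positivity) (gaussTail_nonneg _)
    have hpos2 : ∀ x t : ℝ, 0 ≤ x → 0 < t → 0 ≤ K * (t⁻¹ * (x / Real.sqrt t * Real.exp (-(x / Real.sqrt t) ^ 2 / 4))) :=
      fun x t hx ht => by positivity
    refine neg_of_no_first_zero (D := fun x t => u x t - (m / gaussTail α * gaussTail (x / Real.sqrt t) +
        K * (t⁻¹ * (x / Real.sqrt t * Real.exp (-(x / Real.sqrt t) ^ 2 / 4))) + ε * (1 + t - T)))
      (l := fun t => α * Real.sqrt t) (r := fun t => L * Real.sqrt t) (T := T) (by fun_prop) (by fun_prop)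
      ?_ ?_ ?_ ?_ ?_ x t ht hx hxL
    · intro x t ht _ _
      have ht0 : 0 < t := by linarith
      have h1 : ContinuousAt (fun z : ℝ × ℝ => z.1 / Real.sqrt z.2) (x, t) :=
        ContinuousAt.div (by fun_prop) (by fun_prop) (Real.sqrt_pos.2 ht0).ne'
      have h2 : ContinuousAt (fun z : ℝ × ℝ => gaussTail (z.1 / Real.sqrt z.2)) (x, t) :=
        ContinuousAt.comp (f := fun z : ℝ × ℝ => z.1 / Real.sqrt z.2) (g := gaussTail) continuous_gaussTail.continuousAt h1
      have h3 : ContinuousAt (fun z : ℝ × ℝ => z.2⁻¹) (x, t) := continuousAt_snd.inv₀ ht0.ne'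
      exact (S.continuousAt_u x ht0).sub (((h2.const_mul _).add ((h3.mul (h1.mul
        ((h1.pow 2).neg.div_const 4).rexp)).const_mul K)).add (by fun_prop))
    · intro x hx1 _
      have hT0 : 0 < T := by linarith
      have hs := Real.sqrt_pos.2 hT0
      have hη : α ≤ x / Real.sqrt T := by rwa [le_div_iff₀ hs]
      have hη0 : 0 < x / Real.sqrt T := hα.trans_le hη
      have hx0 : 0 < x := lt_of_lt_of_le (by positivity) hx1
      have h1 := S.u_le_psi x hT0.le
      rw [psi_eq _ _ _ hT0, abs_of_pos hx0, max_eq_left hη] at h1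
      have h2 : ampl α β * gaussTail (x / Real.sqrt T) ≤
          K * (T⁻¹ * (x / Real.sqrt T * Real.exp (-(x / Real.sqrt T) ^ 2 / 4))) := by
        set η := x / Real.sqrt T
        have h4 : 2 * ampl α β * T / α ^ 2 ≤ K := by
          rw [hK]; have : 0 ≤ C * Real.exp (α ^ 2 / 4) / α := by positivity
          linarith
        calc _ ≤ ampl α β * (2 / η * Real.exp (-η ^ 2 / 4)) := by gcongr; exact gaussTail_le hη0
          _ = (2 * ampl α β * T / η ^ 2) * (T⁻¹ * (η * Real.exp (-η ^ 2 / 4))) := by field_simp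
          _ ≤ (2 * ampl α β * T / α ^ 2) * (T⁻¹ * (η * Real.exp (-η ^ 2 / 4))) := by gcongr
          _ ≤ _ := by gcongr
      have := hpos1 x T
      linarith
    · intro t ht _
      have ht0 : 0 < t := by linarith
      have hs := Real.sqrt_pos.2 ht0
      have h1 := h t ht
      have e : α * Real.sqrt t / Real.sqrt t = α := by field_simp
      rw [e, div_mul_cancel₀ _ hI.ne']
      have h2 : C / t ≤ K * (t⁻¹ * (α * Real.exp (-α ^ 2 / 4))) := by
        have h4 : C * Real.exp (α ^ 2 / 4) / α ≤ K := by
          rw [hK]; have : 0 ≤ 2 * ampl α β * T / α ^ 2 := by positivity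
          linarith
        calc C / t = (C * Real.exp (α ^ 2 / 4) / α) * (t⁻¹ * (α * Real.exp (-α ^ 2 / 4))) := by
              have : Real.exp (-α ^ 2 / 4) = (Real.exp (α ^ 2 / 4))⁻¹ := by rw [neg_div, Real.exp_neg]
              rw [this]; field_simp
          _ ≤ _ := by gcongr
      have : 0 < ε * (1 + t - T) := mul_pos hε (by linarith)
      linarith
    · intro t ht _
      have ht0 : 0 < t := by linarith
      have hs := Real.sqrt_pos.2 ht0
      have hLp : 0 < L := hα.trans hαL
      have h1 := hfar (L * Real.sqrt t) t ht0 (by gcongr; exact le_max_left _ _)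
      have h2 := hpos1 (L * Real.sqrt t) t
      have h3 := hpos2 (L * Real.sqrt t) t (by positivity) ht0
      have : ε * 1 ≤ ε * (1 + t - T) := by gcongr; linarith
      linarith
    · intro x0 t0 ht0 hl hr hz hle
      have ht00 : 0 < t0 := by linarith
      have hs := Real.sqrt_pos.2 ht00
      have hx0 : 0 < x0 := lt_trans (by positivity) hl
      have hk : |x0| ≠ α * Real.sqrt t0 := by rw [abs_of_pos hx0]; exact hl.ne'
      have hev := eventually_backward (D := fun x t => u x t - (m / gaussTail α * gaussTail (x / Real.sqrt t) +
        K * (t⁻¹ * (x / Real.sqrt t * Real.exp (-(x / Real.sqrt t) ^ 2 / 4))) + ε * (1 + t - T)))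
        (l := fun t => α * Real.sqrt t) (r := fun t => L * Real.sqrt t) (by fun_prop) (by fun_prop) ht0 hl hr hle
      have hj1 := (Jet.similarity ht00 (taylor2_gaussTail (x0 / Real.sqrt t0))).const_mul (m / gaussTail α)
      have hj2 := ((Jet.of_time x0 (hasDerivAt_inv ht00.ne')).mul
        (Jet.similarity ht00 (taylor2_id_mul_gauss (x0 / Real.sqrt t0)))).const_mul K
      have hj3 : Jet (fun _ t => ε * (1 + t - T)) x0 t0 0 0 ε := Jet.of_time x0 (by
        simpa using (((hasDerivAt_id t0).const_add 1).sub_const T).const_mul ε)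
      have := S.touch' (s := 1) (r := t0) (G := 0) ht00 hk ht00
        (ae_of_all _ fun y _ τ hτ => by
          have h1 := S.u_nonneg y (t := τ) (by linarith [hτ.1])
          have h2 := (S.p_mem y τ (by linarith [hτ.1])).1
          have := mul_nonneg h2 h1
          linarith) ((hj1.add hj2).add hj3) (hev.mono fun z h h' => by
            have := h h'
            linarith)
      set η := x0 / Real.sqrt t0
      have e : ∀ E : ℝ, (m / gaussTail α * (-(-E * η / (2 * t0))) + K * (-(t0 ^ 2)⁻¹ * (η * E) + t0⁻¹ * (-((1 - η ^ 2 / 2) * E * η / (2 * t0)))) + ε)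
          - (m / gaussTail α * ((η / 2 * E) / t0) + K * (0 * (η * E) + 2 * (0 * ((1 - η ^ 2 / 2) * E / Real.sqrt t0)) + t0⁻¹ * ((η ^ 3 / 4 - 3 * η / 2) * E / t0)) + 0) = ε := by
        intro E; field_simp; ring
      have h5 := e (Real.exp (-η ^ 2 / 4))
      linarith
  refine le_of_forall_pos_lt_add fun ε hε => ?_
  have h1 : 0 < 1 + t - T := by linarith
  have := main (ε / (1 + t - T)) (div_pos hε h1)
  rw [div_mul_cancel₀ _ h1.ne'] at this
  linarith

lemma outer_le (S : HSol α β ustar u p w pstar) {m C T : ℝ} (hm : 0 ≤ m) (hC : 0 ≤ C) (hT : 1 ≤ T)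
    (h : ∀ t, T ≤ t → u (α * Real.sqrt t) t ≤ m + C / t) :
    ∃ K > 0, ∀ α' x t, α ≤ α' → T ≤ t → α' * Real.sqrt t ≤ x → u x t ≤ m / gaussTail α * gaussTail α' + K / t := by
  obtain ⟨K, hK, hb⟩ := S.exists_outer_bound hm hC hT h
  refine ⟨K, hK, fun α' x t hα' ht hx => ?_⟩
  have ht0 : 0 < t := by linarith
  have hs := Real.sqrt_pos.2 ht0
  have h1 := hb x t ht ((mul_le_mul_of_nonneg_right hα' hs.le).trans hx)
  have h2 : gaussTail (x / Real.sqrt t) ≤ gaussTail α' := strictAnti_gaussTail.antitone ((le_div_iff₀ hs).2 hx)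
  have h3 := mul_le_mul_of_nonneg_left h2 (div_nonneg hm (gaussTail_nonneg α))
  have h4 : K * (t⁻¹ * (x / Real.sqrt t * Real.exp (-(x / Real.sqrt t) ^ 2 / 4))) ≤ K * (t⁻¹ * 1) := by
    gcongr; exact id_mul_gauss_le _
  rw [mul_one, ← div_eq_mul_inv] at h4
  linarith

lemma u_zero (S : HSol α β ustar u p w pstar) (x : ℝ) : u x 0 = 0 := by
  have := S.v_zero x; rwa [psi_zero, sub_zero] at this

/-- If the values of `u` on and beyond `{x = α'√t}` stay below the threshold for large times, no
precipitation starts there. -/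
lemma eventually_p_eq_zero (S : HSol α β ustar u p w pstar) {α' c T : ℝ} (hα' : 0 < α') (hc0 : 0 < c) (hc : c < ustar)
    (h : ∀ x t, T ≤ t → α' * Real.sqrt t ≤ x → u x t ≤ c) :
    ∃ X > 0, ∀ x t, X ≤ x → 0 ≤ t → α' * Real.sqrt t ≤ x → p x t = 0 := by
  obtain ⟨L, hL, hfar⟩ := S.exists_far hc0
  have hL0 : 0 < L := S.hα.trans hL
  refine ⟨max 1 (L * Real.sqrt T), lt_max_of_lt_left one_pos, fun x t hX ht hx => ?_⟩
  refine S.p_zero ht hc fun s hs => ?_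
  rcases hs.1.eq_or_lt with rfl | hs0
  · rw [S.u_zero]; exact hc0.le
  rcases le_total T s with h1 | h1
  · refine h x s h1 (le_trans ?_ hx)
    gcongr; exact hs.2
  · refine (hfar x s hs0 (le_trans ?_ ((le_max_right _ _).trans hX))).le
    gcongr

lemma eventually_p_eq_zero_outer (S : HSol α β ustar u p w pstar) {α' : ℝ} (hα' : α < α') :
    ∃ X > 0, ∀ x t, X ≤ x → 0 ≤ t → α' * Real.sqrt t ≤ x → p x t = 0 := by
  obtain ⟨C, hC, T, hT, hceil⟩ := S.exists_ceiling
  obtain ⟨K, hK, hb⟩ := S.outer_le S.hu.le hC.le hT (fun t ht => hceil _ t ht)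
  have hu := S.hu
  have hlt : ustar / gaussTail α * gaussTail α' < ustar := by
    rw [div_mul_eq_mul_div, div_lt_iff₀ (gaussTail_pos α)]
    have := strictAnti_gaussTail hα'
    gcongr
  have h0 : 0 < ustar / gaussTail α * gaussTail α' := by have := gaussTail_pos α; have := gaussTail_pos α'; positivity
  set q := ustar / gaussTail α * gaussTail α' with hq
  refine S.eventually_p_eq_zero (S.hα.trans hα') (c := (q + ustar) / 2)
    (T := max T (2 * K / (ustar - q))) (by linarith) (by linarith) fun x t ht hx => ?_
  have ht1 := (le_max_left _ _).trans ht
  have ht2 := (le_max_right _ _).trans ht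
  have h1 := hb α' x t hα'.le ht1 hx
  have h2 : K / t ≤ (ustar - q) / 2 := by
    rw [div_le_iff₀ (by linarith : 0 < ustar - q)] at ht2
    rw [div_le_iff₀ (by linarith)]; linarith
  linarith

/-- Points where the threshold is reached lie within `O(1/√s)` of the parabola. -/
lemma exists_active_le (S : HSol α β ustar u p w pstar) :
    ∃ C > 0, ∃ T ≥ 1, ∀ y s, T ≤ s → α * Real.sqrt s ≤ y → ustar ≤ u y s → y ≤ α * Real.sqrt s + C / Real.sqrt s := by
  obtain ⟨C, hC, T, hT, hceil⟩ := S.exists_ceiling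
  obtain ⟨K, hK, hb⟩ := S.exists_outer_bound S.hu.le hC.le hT (fun t ht => hceil _ t ht)
  have hu := S.hu
  have hα := S.hα
  have hI := gaussTail_pos α
  set C0 := K * gaussTail α / ustar with hC0
  have hC00 : 0 < C0 := by positivity
  refine ⟨2 * α * C0, by positivity, max T (2 * C0), hT.trans (le_max_left _ _), fun y s hs hy hus => ?_⟩
  have hs1 : T ≤ s := (le_max_left _ _).trans hs
  have hs2 : 2 * C0 ≤ s := (le_max_right _ _).trans hs
  have hs0 : 0 < s := by linarith
  have hr := Real.sqrt_pos.2 hs0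
  have h1 := hb y s hs1 hy
  have hη : α ≤ y / Real.sqrt s := (le_div_iff₀ hr).2 hy
  have hyη : y = y / Real.sqrt s * Real.sqrt s := by field_simp
  set η := y / Real.sqrt s with hηdef
  have h2 := gaussTail_sub_ge hα.le hη
  have hE := Real.exp_pos (-η ^ 2 / 4)
  set E := Real.exp (-η ^ 2 / 4)
  have h3 : ustar * ((η - α) * E) ≤ K * gaussTail α * (s⁻¹ * η) * E := by
    have e1 : ustar * gaussTail α ≤ ustar * gaussTail η + K * gaussTail α * (s⁻¹ * η) * E := by
      have := mul_le_mul_of_nonneg_right (hus.trans h1) hI.le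
      have e2 : (ustar / gaussTail α * gaussTail η + K * (s⁻¹ * (η * E))) * gaussTail α
        = ustar * gaussTail η + K * gaussTail α * (s⁻¹ * η) * E := by field_simp
      linarith
    have := mul_le_mul_of_nonneg_left h2 hu.le
    linarith
  have h4 : η - α ≤ C0 / s * η := by
    rw [← mul_assoc, mul_le_mul_iff_left₀ hE] at h3
    have : K * gaussTail α * (s⁻¹ * η) = ustar * (C0 / s * η) := by rw [hC0]; field_simp
    rw [this] at h3
    exact le_of_mul_le_mul_left h3 hu
  have h5 : C0 / s ≤ 1 / 2 := by rw [div_le_iff₀ hs0]; linarith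
  have hη0 : 0 ≤ η := hα.le.trans hη
  have h6 : η ≤ 2 * α := by nlinarith
  have h7 : η - α ≤ C0 / s * (2 * α) := h4.trans (by gcongr)
  have h8 : y - α * Real.sqrt s ≤ C0 / s * (2 * α) * Real.sqrt s := by
    rw [hyη]
    have := mul_le_mul_of_nonneg_right h7 hr.le
    linarith
  have h9 : C0 / s * (2 * α) * Real.sqrt s = 2 * α * C0 / Real.sqrt s := by
    have : s = Real.sqrt s ^ 2 := (Real.sq_sqrt hs0.le).symm
    rw [show C0 / s = C0 / Real.sqrt s ^ 2 by rw [← this]]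
    field_simp
  linarith

/-- Points with precipitation are active at some time before crossing the parabola. -/
lemma exists_active (S : HSol α β ustar u p w pstar) :
    ∃ C > 0, ∃ L > α, ∃ Y > 0, ∀ y t, Y ≤ y → 0 ≤ t → p y t ≠ 0 →
      ∃ s > 0, ustar ≤ u y s ∧ α * Real.sqrt s ≤ y ∧ y ≤ L * Real.sqrt s ∧ y ≤ α * Real.sqrt s + C / Real.sqrt s := by
  obtain ⟨C, hC, T, hT, hact⟩ := S.exists_active_le
  have hu := S.hu
  have hα := S.hα
  obtain ⟨L, hL, hfar⟩ := S.exists_far (half_pos hu)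
  have hL0 : 0 < L := hα.trans hL
  refine ⟨C, hC, L, hL, max 1 (L * Real.sqrt T), lt_max_of_lt_left one_pos, fun y t hY ht hp => ?_⟩
  have hy0 : 0 < y := one_pos.trans_le ((le_max_left _ _).trans hY)
  have hYT : L * Real.sqrt T ≤ y := (le_max_right _ _).trans hY
  have hsq : ∀ k s, 0 < k → 0 < s → (y ≤ k * Real.sqrt s ↔ y ^ 2 / k ^ 2 ≤ s) := by
    intro k s hk hs
    rw [← div_le_iff₀' hk, Real.le_sqrt' (by positivity), div_pow]
  have key : ∃ s ∈ Icc (y ^ 2 / L ^ 2) (y ^ 2 / α ^ 2), ustar ≤ u y s := by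
    by_contra hcon
    push Not at hcon
    have hle : y ^ 2 / L ^ 2 ≤ y ^ 2 / α ^ 2 := by gcongr
    have hcont : ContinuousOn (fun s => u y s) (Icc (y ^ 2 / L ^ 2) (y ^ 2 / α ^ 2)) := by
      intro s hs
      have hs0 : 0 < s := lt_of_lt_of_le (by positivity) hs.1
      exact (ContinuousAt.comp (f := fun s : ℝ => (y, s)) (g := fun q : ℝ × ℝ => u q.1 q.2)
        (S.continuousAt_u y hs0) (by fun_prop)).continuousWithinAt
    obtain ⟨s0, hs0, hmax⟩ := isCompact_Icc.exists_isMaxOn ⟨_, ⟨le_rfl, hle⟩⟩ hcont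
    refine hp (S.p_zero (c := max (ustar / 2) (u y s0)) ht (max_lt (by linarith) (hcon s0 hs0)) fun s hs => ?_)
    rcases hs.1.eq_or_lt with rfl | hsp
    · rw [S.u_zero]; exact le_max_of_le_left (by linarith)
    rcases le_total s (y ^ 2 / L ^ 2) with h1 | h1
    · refine le_max_of_le_left (hfar y s hsp ?_).le
      rw [← le_div_iff₀' hL0]
      refine Real.sqrt_le_iff.2 ⟨by positivity, by rwa [div_pow]⟩
    rcases le_total s (y ^ 2 / α ^ 2) with h2 | h2
    · exact le_max_of_le_right (hmax ⟨h1, h2⟩)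
    · exact le_max_of_le_right ((S.u_anti (by positivity) le_rfl h2).trans (hmax ⟨hle, le_rfl⟩))
  obtain ⟨s, hs, hus⟩ := key
  have hs0 : 0 < s := lt_of_lt_of_le (by positivity) hs.1
  have h1 : α * Real.sqrt s ≤ y := by
    rw [← le_div_iff₀' hα]
    exact Real.sqrt_le_iff.2 ⟨by positivity, by rw [div_pow]; exact hs.2⟩
  have h2 : y ≤ L * Real.sqrt s := (hsq L s hL0 hs0).2 hs.1
  have hTs : T ≤ s := by
    have := hYT.trans h2
    rw [mul_le_mul_iff_right₀ hL0] at this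
    exact (Real.sqrt_le_sqrt_iff hs0.le).1 this
  exact ⟨s, hs0, hus, h1, h2, hact y s hTs h1 hus⟩

end HSol

/-- A solution whose precipitation profile `pstar` takes values in `[0,1]` everywhere. -/
structure CSol (α β ustar : ℝ) (u p w : ℝ → ℝ → ℝ) (pstar : ℝ → ℝ) : Prop
    extends HSol α β ustar u p w pstar where
  h01 : ∀ x, pstar x ∈ Icc (0:ℝ) 1

namespace HSol
variable {α β ustar : ℝ} {u p w : ℝ → ℝ → ℝ} {pstar : ℝ → ℝ}

lemma ae_clamp (S : HSol α β ustar u p w pstar) :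
    ∀ᵐ x ∂(volume.restrict (Ioi (0:ℝ))), max 0 (min 1 (pstar x)) = pstar x := by
  rw [ae_restrict_iff' measurableSet_Ioi]
  filter_upwards [S.pstar_mem] with x hx hx0
  rw [abs_of_pos hx0] at hx
  rw [min_eq_right hx.2, max_eq_right hx.1]

lemma clamp (S : HSol α β ustar u p w pstar) :
    CSol α β ustar u p w (fun x => max 0 (min 1 (pstar x))) where
  toHSol := { S with
    condP := ⟨measurable_const.max (measurable_const.min S.condP.1), by
      filter_upwards [S.condP.2, S.ae_clamp] with x h1 h2 t ht
      rw [h2]; exact h1 t ht⟩ }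
  h01 := fun x => ⟨le_max_left _ _, max_le zero_le_one (min_le_left _ _)⟩

end HSol

namespace Sol
variable {α β : ℝ} {u p w : ℝ → ℝ → ℝ}

lemma hasDerivAt_timeIntegral (S : Sol α β u p w) {s t : ℝ} (hs : 0 ≤ s) (hst : s ≤ t) (x : ℝ) :
    HasDerivAt (fun y => ∫ r in s..t, (u y r - psi α β y r)) (∫ r in s..t, w x r) x := by
  have h := hasDerivAt_integral_of_continuous S.continuous_v S.continuous_w S.hasDerivAt_ext s t x
  have e : ∀ r ∈ uIcc s t, max r 0 = r := fun r hr => by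
    rw [uIcc_of_le hst] at hr; exact max_eq_left (hs.trans hr.1)
  have e1 : (fun y => ∫ r in s..t, (u y (max r 0) - psi α β y (max r 0)))
      = fun y => ∫ r in s..t, (u y r - psi α β y r) := by
    funext y
    exact intervalIntegral.integral_congr fun r hr => by simp only [e r hr]
  have e2 : ∫ r in s..t, w x (max r 0) = ∫ r in s..t, w x r :=
    intervalIntegral.integral_congr fun r hr => by simp only [e r hr]
  rwa [e1, e2] at h

/-- The net source over a time interval. -/
lemma timeIntegral_w_sub (S : Sol α β u p w) {a b s t : ℝ} (hab : a ≤ b) (hs : 0 ≤ s) (hst : s ≤ t) :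
    (∫ r in s..t, w b r) - ∫ r in s..t, w a r
      = ∫ x in a..b, (((u x t - psi α β x t) - (u x s - psi α β x s)) + ∫ r in s..t, p x r * u x r) := by
  have h := S.rect hab hs hst
  have ht := hs.trans hst
  rw [intervalIntegral.integral_sub (S.intervalIntegrable_w b hs ht) (S.intervalIntegrable_w a hs ht)] at h
  rw [intervalIntegral.integral_add
    (((S.cont_v_slice ht).intervalIntegrable _ _).sub ((S.cont_v_slice hs).intervalIntegrable _ _))
    (S.intervalIntegrable_Z a b hs hst), h]
  ring

lemma intervalIntegrable_net (S : Sol α β u p w) (a b : ℝ) {s t : ℝ} (hs : 0 ≤ s) (hst : s ≤ t) :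
    IntervalIntegrable (fun x => ((u x t - psi α β x t) - (u x s - psi α β x s))
      + ∫ r in s..t, p x r * u x r) volume a b :=
  (((S.cont_v_slice (hs.trans hst)).intervalIntegrable _ _).sub
    ((S.cont_v_slice hs).intervalIntegrable _ _)).add (S.intervalIntegrable_Z a b hs hst)

lemma intervalIntegrable_v (S : Sol α β u p w) (x : ℝ) {s t : ℝ} (hs : 0 ≤ s) (ht : 0 ≤ t) :
    IntervalIntegrable (fun r => u x r - psi α β x r) volume s t :=
  ((S.contOn_v_time x).mono fun _ hr => (le_min hs ht).trans hr.1).intervalIntegrable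

lemma intervalIntegrable_u (S : Sol α β u p w) (x : ℝ) {s t : ℝ} (hs : 0 ≤ s) (hst : s ≤ t) :
    IntervalIntegrable (fun r => u x r) volume s t := by
  obtain ⟨C, -, hC⟩ := S.exists_bound t
  have hm : Measurable fun r => u x (max r 0) :=
    (S.measurable_u.comp (measurable_prodMk_left (x := x)))
  rw [intervalIntegrable_iff_integrableOn_Ioc_of_le hst]
  have h1 : IntegrableOn (fun r => u x (max r 0)) (Ioc s t) := by
    refine Measure.integrableOn_of_bounded (M := C) (by simp) hm.aestronglyMeasurable ?_
    rw [ae_restrict_iff' measurableSet_Ioc]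
    refine Eventually.of_forall fun r hr => ?_
    have hr0 : 0 ≤ r := hs.trans hr.1.le
    rw [max_eq_left hr0]
    exact (hC x r ⟨hr0, hr.2⟩).2.2.1
  exact h1.congr_fun (fun r hr => by simp only [max_eq_left (hs.trans hr.1.le)]) measurableSet_Ioc

end Sol

namespace CSol
variable {α β ustar : ℝ} {u p w : ℝ → ℝ → ℝ} {pstar : ℝ → ℝ}

lemma pstar_intervalIntegrable (S : CSol α β ustar u p w pstar) (a b : ℝ) :
    IntervalIntegrable pstar volume a b := by
  rw [intervalIntegrable_iff]
  refine Measure.integrableOn_of_bounded (M := 1) (by simp) S.condP.1.aestronglyMeasurable ?_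
  exact Eventually.of_forall fun r => abs_le.2 ⟨by linarith [(S.h01 r).1], (S.h01 r).2⟩

lemma net_ge (S : CSol α β ustar u p w pstar) (x : ℝ) {s t : ℝ} (hs : 0 ≤ s) (hst : s ≤ t) :
    -PsiP α β α ≤ ((u x t - psi α β x t) - (u x s - psi α β x s)) + ∫ r in s..t, p x r * u x r := by
  have h1 := S.u_nonneg x (hs.trans hst)
  have h2 := S.v_nonpos x hs
  have h3 := psi_le S.hα S.hβ x t
  have h4 : 0 ≤ ∫ r in s..t, p x r * u x r := intervalIntegral.integral_nonneg hst fun r hr =>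
    mul_nonneg (S.p_mem x r (hs.trans hr.1)).1 (S.u_nonneg x (hs.trans hr.1))
  linarith

lemma timeIntegral_w_sub_ge (S : CSol α β ustar u p w pstar) {a b s t : ℝ} (hab : a ≤ b) (hs : 0 ≤ s)
    (hst : s ≤ t) : -PsiP α β α * (b - a) ≤ (∫ r in s..t, w b r) - ∫ r in s..t, w a r := by
  rw [S.timeIntegral_w_sub hab hs hst]
  have : ∫ x in a..b, (-PsiP α β α) ≤ ∫ x in a..b, (((u x t - psi α β x t) - (u x s - psi α β x s))
      + ∫ r in s..t, p x r * u x r) :=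
    intervalIntegral.integral_mono_on (μ := volume) hab intervalIntegrable_const
      (S.intervalIntegrable_net a b hs hst) fun x _ => S.net_ge x hs hst
  rw [intervalIntegral.integral_const, smul_eq_mul] at this
  linarith

/-- On the region swept by the parabola, the source is at least `pstar` times a lower bound for `∫ u`. -/
lemma mul_integral_pstar_le (S : CSol α β ustar u p w pstar) {a b s t m : ℝ} (hab : a ≤ b) (hs : 0 ≤ s)
    (hst : s ≤ t) (ha : 0 ≤ a) (hm : ∀ x ∈ Icc a b, m ≤ ∫ r in s..t, u x r)
    (hp : ∀ x ∈ Icc a b, x ^ 2 / α ^ 2 ≤ s) :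
    m * (∫ x in a..b, pstar x) ≤ (∫ r in s..t, w b r) - (∫ r in s..t, w a r) + PsiP α β α * (b - a) := by
  rw [S.timeIntegral_w_sub hab hs hst]
  have h := intervalIntegral.integral_mono_ae_restrict (μ := volume) hab
    (((S.pstar_intervalIntegrable a b).const_mul m).add (intervalIntegrable_const (c := -PsiP α β α)))
    (S.intervalIntegrable_net a b hs hst) ?_
  · rw [intervalIntegral.integral_add ((S.pstar_intervalIntegrable a b).const_mul m) intervalIntegrable_const,
      intervalIntegral.integral_const_mul, intervalIntegral.integral_const, smul_eq_mul] at h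
    linarith
  · refine (ae_restrict_iff' measurableSet_Icc).2 ?_
    filter_upwards [S.ae_condP] with x hx hxI
    have h1 : ∫ r in s..t, p x r * u x r = pstar x * ∫ r in s..t, u x r := by
      rw [← intervalIntegral.integral_const_mul]
      refine intervalIntegral.integral_congr_ae (Eventually.of_forall fun r hr => ?_)
      rw [uIoc_of_le hst] at hr
      rw [hx r ((hp x hxI).trans_lt hr.1), abs_of_nonneg (ha.trans hxI.1)]
    have h2 := S.u_nonneg x (hs.trans hst)
    have h3 := S.v_nonpos x hs
    have h4 := psi_le S.hα S.hβ x t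
    have h5 := mul_le_mul_of_nonneg_left (hm x hxI) (S.h01 x).1
    show m * pstar x + -PsiP α β α ≤ _
    rw [h1]; linarith

/-- Semiconvexity of time integrals in `x`. -/
lemma timeIntegral_semiconvex (S : CSol α β ustar u p w pstar) {s t d : ℝ} (y : ℝ) (hs : 0 ≤ s)
    (hst : s ≤ t) (hd : 0 ≤ d) :
    2 * (∫ r in s..t, (u y r - psi α β y r)) - PsiP α β α * d ^ 2 ≤
      (∫ r in s..t, (u (y + d) r - psi α β (y + d) r)) + ∫ r in s..t, (u (y - d) r - psi α β (y - d) r) := by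
  set V : ℝ → ℝ := fun x => ∫ r in s..t, (u x r - psi α β x r) with hV
  set W : ℝ → ℝ := fun x => ∫ r in s..t, w x r with hW
  have hVd : ∀ x, HasDerivAt V (W x) x := S.hasDerivAt_timeIntegral hs hst
  have hfd : ∀ r, HasDerivAt (fun r => V (y + r) + V (y - r) + PsiP α β α * r ^ 2)
      (W (y + r) - W (y - r) + PsiP α β α * (2 * r)) r := fun r => by
    have h1 := (hVd (y + r)).comp_const_add y r
    have h2 := (hVd (y - r)).comp_const_sub y r
    have h3 := (hasDerivAt_pow 2 r).const_mul (PsiP α β α)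
    refine ((h1.add h2).add h3).congr_deriv ?_
    simp; ring
  have hmono : MonotoneOn (fun r => V (y + r) + V (y - r) + PsiP α β α * r ^ 2) (Icc 0 d) := by
    refine monotoneOn_of_deriv_nonneg (convex_Icc _ _)
      (fun r _ => (hfd r).continuousAt.continuousWithinAt)
      (fun r _ => (hfd r).differentiableAt.differentiableWithinAt) fun r hr => ?_
    rw [interior_Icc] at hr
    rw [(hfd r).deriv]
    have := S.timeIntegral_w_sub_ge (a := y - r) (b := y + r) (by linarith [hr.1]) hs hst
    simp only [hW]
    linarith
  have := hmono ⟨le_rfl, hd⟩ ⟨hd, le_rfl⟩ hd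
  simp only [add_zero, sub_zero] at this
  simp only [hV] at this ⊢
  linarith

/-- Finite-difference bound for the increment of the time-integrated flux. -/
lemma mul_timeIntegral_w_sub_le (S : CSol α β ustar u p w pstar) {a b s t ρ : ℝ} (hs : 0 ≤ s)
    (hst : s ≤ t) (hρ : 0 ≤ ρ) :
    ρ * ((∫ r in s..t, w b r) - ∫ r in s..t, w a r) ≤
      (∫ r in s..t, (u (b + ρ) r - psi α β (b + ρ) r)) - (∫ r in s..t, (u b r - psi α β b r))
      - (∫ r in s..t, (u a r - psi α β a r)) + (∫ r in s..t, (u (a - ρ) r - psi α β (a - ρ) r))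
      + 2 * PsiP α β α * ρ ^ 2 := by
  set V : ℝ → ℝ := fun x => ∫ r in s..t, (u x r - psi α β x r) with hV
  set W : ℝ → ℝ := fun x => ∫ r in s..t, w x r with hW
  have hVd : ∀ x, HasDerivAt V (W x) x := S.hasDerivAt_timeIntegral hs hst
  have hΨ : 0 ≤ PsiP α β α := (PsiP_self_pos S.hα S.hβ).le
  have hfd : ∀ r, HasDerivAt (fun r => V (b + r) + V (a - r) - (W b - W a) * r + PsiP α β α * r ^ 2)
      (W (b + r) - W (a - r) - (W b - W a) + PsiP α β α * (2 * r)) r := fun r => by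
    have h1 := (hVd (b + r)).comp_const_add b r
    have h2 := (hVd (a - r)).comp_const_sub a r
    have h3 := (hasDerivAt_pow 2 r).const_mul (PsiP α β α)
    have h4 := (hasDerivAt_id r).const_mul (W b - W a)
    refine (((h1.add h2).sub h4).add h3).congr_deriv ?_
    simp; ring
  have hmono : MonotoneOn (fun r => V (b + r) + V (a - r) - (W b - W a) * r + PsiP α β α * r ^ 2)
      (Icc 0 ρ) := by
    refine monotoneOn_of_deriv_nonneg (convex_Icc _ _)
      (fun r _ => (hfd r).continuousAt.continuousWithinAt)
      (fun r _ => (hfd r).differentiableAt.differentiableWithinAt) fun r hr => ?_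
    rw [interior_Icc] at hr
    rw [(hfd r).deriv]
    have h1 := S.timeIntegral_w_sub_ge (a := a - r) (b := a) (by linarith [hr.1]) hs hst
    have h2 := S.timeIntegral_w_sub_ge (a := b) (b := b + r) (by linarith [hr.1]) hs hst
    simp only [hW]
    linarith
  have := hmono ⟨le_rfl, hρ⟩ ⟨hρ, le_rfl⟩ hρ
  simp only [add_zero, sub_zero] at this
  have h9 : 0 ≤ PsiP α β α * ρ ^ 2 := by positivity
  simp only [hV, hW] at this h9 ⊢
  linarith

end CSol

lemma gaussTail_sub_le {a b : ℝ} (hab : a ≤ b) : gaussTail a - gaussTail b ≤ b - a := by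
  rw [gaussTail_sub]
  have h : ∫ ζ in a..b, Real.exp (-ζ ^ 2 / 4) ≤ ∫ _ in a..b, (1:ℝ) :=
    intervalIntegral.integral_mono_on (μ := volume) hab
      integrable_gauss.intervalIntegrable intervalIntegrable_const fun x _ => by
        rw [← Real.exp_zero]
        exact Real.exp_le_exp.2 (by nlinarith [sq_nonneg x])
  simpa using h

lemma psi_ge_sub {α β x t e : ℝ} (hα : 0 < α) (hβ : 0 < β) (ht : 0 < t) (he : 0 ≤ e)
    (h : |x| ≤ (α + e) * Real.sqrt t) : PsiP α β α - ampl α β * e ≤ psi α β x t := by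
  rw [psi_eq _ _ _ ht, PsiP_self]
  have hm : max (|x| / Real.sqrt t) α ≤ α + e :=
    max_le ((div_le_iff₀ (Real.sqrt_pos.2 ht)).2 h) (by linarith)
  have h1 := strictAnti_gaussTail.antitone hm
  have h2 := gaussTail_sub_le (a := α) (b := α + e) (by linarith)
  have h3 := mul_le_mul_of_nonneg_left (show gaussTail α - e ≤ gaussTail (max (|x| / Real.sqrt t) α) by linarith)
    (ampl_pos hα hβ).le
  linarith

lemma mul_one_sub_le_sqrt {q θ : ℝ} (hθ : 0 ≤ θ) (hθ1 : θ ≤ 1) :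
    q * (1 - θ) ≤ Real.sqrt (q ^ 2 - θ * q ^ 2) := by
  refine Real.le_sqrt_of_sq_le ?_
  have : (1 - θ) ^ 2 ≤ 1 - θ := by nlinarith
  nlinarith [mul_le_mul_of_nonneg_left this (sq_nonneg q)]

namespace CSol
variable {α β ustar : ℝ} {u p w : ℝ → ℝ → ℝ} {pstar : ℝ → ℝ}

set_option maxHeartbeats 1000000 in
/-- Just inside an active point the time integral of `u` is bounded below. -/
lemma exists_inner_lower (S : CSol α β ustar u p w pstar) {C : ℝ} (hC : 0 < C) :
    ∃ K > 0, ∃ Q ≥ 1, ∀ y q r d, Q ≤ q → α * q ≤ y → y ≤ α * q + C / q → ustar ≤ u y (q ^ 2) →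
      2 * C / q ≤ r → 2 * r ≤ α * q → r ≤ d → d ≤ 2 * r →
      0 ≤ y - d ∧ (y - d) ^ 2 / α ^ 2 ≤ q ^ 2 - r * q / (2 * α) ∧
      r * q / (2 * α) * (ustar - K * (r / q) - K / q ^ 2) ≤
        ∫ t in (q ^ 2 - r * q / (2 * α))..(q ^ 2), u (y - d) t := by
  obtain ⟨C', hC', T, hT, hceil⟩ := S.exists_ceiling
  have hα := S.hα
  have hβ := S.hβ
  have hu := S.hu
  have hA := ampl_pos hα hβ
  have hΨ := PsiP_self_pos hα hβ
  refine ⟨6 * ampl α β + 8 * α * PsiP α β α + 2 * C', by positivity, 2 * T, by linarith, ?_⟩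
  intro y q r d hq hy1 hy2 hact hr1 hr2 hd1 hd2
  have hq1 : 1 ≤ q := by linarith
  have hq0 : 0 < q := by linarith
  have hr0 : 0 < r := lt_of_lt_of_le (by positivity) hr1
  set θ := r / (2 * α * q) with hθ
  have hθ0 : 0 < θ := by positivity
  have hθ4 : θ ≤ 1 / 4 := by rw [hθ, div_le_iff₀ (by positivity)]; linarith
  have hh : r * q / (2 * α) = θ * q ^ 2 := by rw [hθ]; field_simp
  have hαθ : α * θ * q = r / 2 := by rw [hθ]; field_simp
  rw [hh]
  set s := q ^ 2 - θ * q ^ 2 with hs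
  have hs2 : q ^ 2 / 2 ≤ s := by rw [hs]; nlinarith [sq_nonneg q]
  have hs0 : 0 < s := lt_of_lt_of_le (by positivity) hs2
  have hst : s ≤ q ^ 2 := by rw [hs]; nlinarith [sq_nonneg q]
  have hsT : T ≤ s := by nlinarith
  have hsq : q * (1 - θ) ≤ Real.sqrt s := mul_one_sub_le_sqrt hθ0.le (by linarith)
  have hCq : C / q ≤ r / 2 := by rw [mul_div_assoc] at hr1; linarith
  have hy0 : 0 ≤ y - d := by linarith
  have hyd : y - d ≤ α * Real.sqrt s := by nlinarith [mul_le_mul_of_nonneg_left hsq hα.le]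
  have hsqs := Real.sq_sqrt hs0.le
  refine ⟨hy0, ?_, ?_⟩
  · rw [div_le_iff₀ (by positivity)]
    calc (y - d) ^ 2 ≤ (α * Real.sqrt s) ^ 2 := by gcongr
      _ = s * α ^ 2 := by rw [mul_pow, hsqs]; ring
  have hlen : q ^ 2 - s = θ * q ^ 2 := by rw [hs]; ring
  have hsemi := S.timeIntegral_semiconvex y hs0.le hst (d := d) (by linarith)
  -- centre
  have hmid : (q ^ 2 - s) * (ustar - PsiP α β α) ≤ ∫ t in s..q ^ 2, (u y t - psi α β y t) := by
    rw [← smul_eq_mul, ← intervalIntegral.integral_const]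
    refine intervalIntegral.integral_mono_on (μ := volume) hst intervalIntegrable_const
      (S.intervalIntegrable_v y hs0.le (by positivity)) fun t ht => ?_
    have h1 := S.v_anti y (hs0.le.trans ht.1) ht.2
    have h2 := psi_le hα hβ y (q ^ 2)
    linarith
  -- outer point
  set e := 6 * (r / q) with he
  have he0 : 0 < e := by positivity
  have hrq : r / q * q = r := by field_simp
  have houter : ∫ t in s..q ^ 2, (u (y + d) t - psi α β (y + d) t)
      ≤ (q ^ 2 - s) * (ustar + 2 * C' / q ^ 2 - PsiP α β α + ampl α β * e) := by
    rw [← smul_eq_mul, ← intervalIntegral.integral_const]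
    refine intervalIntegral.integral_mono_on (μ := volume) hst
      (S.intervalIntegrable_v _ hs0.le (by positivity)) intervalIntegrable_const fun t ht => ?_
    have ht0 : 0 < t := hs0.trans_le ht.1
    have h1 := hceil (y + d) t (hsT.trans ht.1)
    have h2 : C' / t ≤ 2 * C' / q ^ 2 := by
      rw [div_le_div_iff₀ ht0 (by positivity)]
      nlinarith [hs2, ht.1, hC']
    have h3 : |y + d| ≤ (α + e) * Real.sqrt t := by
      rw [abs_of_nonneg (by linarith)]
      have h4 : (α + e) * (q * (1 - θ)) ≤ (α + e) * Real.sqrt t := by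
        gcongr; exact hsq.trans (Real.sqrt_le_sqrt ht.1)
      refine le_trans ?_ h4
      have h5 : e * q = 6 * r := by rw [he]; linarith
      have h6 : e * q * θ ≤ 6 * r * (1 / 4) := by rw [h5]; gcongr
      have : (α + e) * (q * (1 - θ)) = α * q - α * θ * q + e * q - e * q * θ := by ring
      rw [this, hαθ, h5] at *
      linarith
    have h7 := psi_ge_sub hα hβ ht0 he0.le h3
    linarith
  have hin : ∫ t in s..q ^ 2, (u (y - d) t - psi α β (y - d) t)
      = (∫ t in s..q ^ 2, u (y - d) t) - (q ^ 2 - s) * PsiP α β α := by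
    rw [← smul_eq_mul, ← intervalIntegral.integral_const,
      ← intervalIntegral.integral_sub (S.intervalIntegrable_u _ hs0.le hst) intervalIntegrable_const]
    refine intervalIntegral.integral_congr fun t ht => ?_
    rw [uIcc_of_le hst] at ht
    have ht0 : 0 < t := hs0.trans_le ht.1
    show _ - _ = _ - _
    rw [psi_eq_of_le ht0]
    rw [abs_of_nonneg hy0]
    exact hyd.trans (by gcongr; exact ht.1)
  rw [hin] at hsemi
  have hd3 : PsiP α β α * d ^ 2 ≤ (q ^ 2 - s) * (8 * α * PsiP α β α * (r / q)) := by
    have : (q ^ 2 - s) * (8 * α * PsiP α β α * (r / q)) = PsiP α β α * (2 * r) ^ 2 := by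
      rw [hlen, hθ]; field_simp; ring
    rw [this]; gcongr
    linarith
  have hpos : 0 < q ^ 2 - s := by rw [hlen]; positivity
  have hfin : θ * q ^ 2 * (ustar - (6 * ampl α β + 8 * α * PsiP α β α + 2 * C') * (r / q)
      - (6 * ampl α β + 8 * α * PsiP α β α + 2 * C') / q ^ 2)
      ≤ (q ^ 2 - s) * (ustar - 2 * C' / q ^ 2 - ampl α β * e - 8 * α * PsiP α β α * (r / q)) := by
    rw [← hlen]
    refine mul_le_mul_of_nonneg_left ?_ hpos.le
    have h1 : 2 * C' / q ^ 2 ≤ (6 * ampl α β + 8 * α * PsiP α β α + 2 * C') / q ^ 2 := by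
      gcongr; nlinarith [mul_pos hα hΨ]
    have h2 : 0 ≤ 2 * C' * (r / q) := by positivity
    rw [he]; linarith
  refine hfin.trans ?_
  linarith

/-- Bound for the amount of precipitate at distance `r` behind an active point. -/
lemma exists_layer_bound (S : CSol α β ustar u p w pstar) {C : ℝ} (hC : 0 < C) :
    ∃ K > 0, ∃ c > 0, ∃ Q ≥ 1, ∀ y q r, Q ≤ q → α * q ≤ y → y ≤ α * q + C / q → ustar ≤ u y (q ^ 2) →
      2 * C / q ≤ r → r ≤ c * q → 2 * r ≤ y ∧ ∫ x in (y - 2 * r)..(y - r), pstar x ≤ K / Real.sqrt (r * q) := by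
  obtain ⟨K, hK, Q, hQ, hlow⟩ := S.exists_inner_lower hC
  have hα := S.hα
  have hu := S.hu
  have hΨ := PsiP_self_pos hα S.hβ
  set c := min (α / 2) (ustar / (4 * K)) with hc
  have hc0 : 0 < c := lt_min (by positivity) (by positivity)
  set P := PsiP α β α with hP
  set K' := 2 * P / ustar * (2 * α * Real.sqrt c + 4 * Real.sqrt (2 * α)) with hK'
  refine ⟨K', by positivity, c, hc0, max Q (4 * K / ustar), le_max_of_le_left hQ, ?_⟩
  intro y q r hq hy1 hy2 hact hr1 hr2
  have hqQ : Q ≤ q := (le_max_left _ _).trans hq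
  have hq1 : 1 ≤ q := hQ.trans hqQ
  have hq0 : 0 < q := by linarith
  have hr0 : 0 < r := lt_of_lt_of_le (by positivity) hr1
  have hrα : 2 * r ≤ α * q := by
    have : c * q ≤ α / 2 * q := by gcongr; exact min_le_left _ _
    linarith
  refine ⟨hrα.trans hy1, ?_⟩
  have hin := fun d => hlow y q r d hqQ hy1 hy2 hact hr1 hrα
  set h := r * q / (2 * α) with hh
  have hh0 : 0 < h := by positivity
  have hs0 : 0 ≤ q ^ 2 - h := by
    have := (hin r le_rfl (by linarith)).2.1
    exact le_trans (by positivity) this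
  have hst : q ^ 2 - h ≤ q ^ 2 := by linarith
  have hhalf : h * (ustar / 2) ≤ h * (ustar - K * (r / q) - K / q ^ 2) := by
    refine mul_le_mul_of_nonneg_left ?_ hh0.le
    have h1 : K * (r / q) ≤ ustar / 4 := by
      have : r / q ≤ ustar / (4 * K) := by
        rw [div_le_iff₀ hq0]; exact hr2.trans (by gcongr; exact min_le_right _ _)
      calc K * (r / q) ≤ K * (ustar / (4 * K)) := by gcongr
        _ = ustar / 4 := by field_simp
    have h2 : K / q ^ 2 ≤ ustar / 4 := by
      rw [div_le_iff₀ (by positivity)]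
      have h3 : 4 * K / ustar ≤ q := (le_max_right _ _).trans hq
      rw [div_le_iff₀ hu] at h3
      nlinarith
    linarith
  have hI := S.mul_integral_pstar_le (a := y - 2 * r) (b := y - r) (m := h * (ustar / 2))
    (by linarith) hs0 hst (by linarith)
    (fun x hx => by
      obtain ⟨-, -, h3⟩ := hin (y - x) (by linarith [hx.2]) (by linarith [hx.1])
      rw [sub_sub_cancel] at h3
      exact hhalf.trans h3)
    (fun x hx => by
      obtain ⟨-, h3, -⟩ := hin (y - x) (by linarith [hx.2]) (by linarith [hx.1])
      rwa [sub_sub_cancel] at h3)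
  have hρ := S.mul_timeIntegral_w_sub_le (a := y - 2 * r) (b := y - r) hs0 hst (Real.sqrt_nonneg h)
  have hV : ∀ x, -(h * P) ≤ (∫ t in (q ^ 2 - h)..(q ^ 2), (u x t - psi α β x t)) ∧
      (∫ t in (q ^ 2 - h)..(q ^ 2), (u x t - psi α β x t)) ≤ 0 := fun x => by
    have h1 : ∫ t in (q ^ 2 - h)..(q ^ 2), (-P) ≤ ∫ t in (q ^ 2 - h)..(q ^ 2), (u x t - psi α β x t) :=
      intervalIntegral.integral_mono_on (μ := volume) hst intervalIntegrable_const
        (S.intervalIntegrable_v _ hs0 (by positivity)) fun t ht => by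
          have h1 := S.u_nonneg x (hs0.trans ht.1)
          have h2 := psi_le hα S.hβ x t
          rw [hP]; linarith
    have h2 : ∫ t in (q ^ 2 - h)..(q ^ 2), (u x t - psi α β x t) ≤ ∫ t in (q ^ 2 - h)..(q ^ 2), (0:ℝ) :=
      intervalIntegral.integral_mono_on (μ := volume) hst
        (S.intervalIntegrable_v _ hs0 (by positivity)) intervalIntegrable_const fun t ht =>
          S.v_nonpos x (hs0.trans ht.1)
    rw [intervalIntegral.integral_const, smul_eq_mul] at h1
    simp only [intervalIntegral.integral_zero] at h2
    exact ⟨by linarith, h2⟩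
  set ρ := Real.sqrt h with hρd
  have hρ0 : 0 < ρ := Real.sqrt_pos.2 hh0
  have hρρ : ρ ^ 2 = h := Real.sq_sqrt hh0.le
  have hb := hV (y - r + ρ)
  have hb' := hV (y - r)
  have ha := hV (y - 2 * r)
  have ha' := hV (y - 2 * r - ρ)
  set I := ∫ x in (y - 2 * r)..(y - r), pstar x with hId
  set DW := (∫ t in (q ^ 2 - h)..(q ^ 2), w (y - r) t) - ∫ t in (q ^ 2 - h)..(q ^ 2), w (y - 2 * r) t with hDW
  have h1 : ρ * DW ≤ 4 * P * h := by rw [hρρ] at hρ; linarith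
  have h2 : DW ≤ 4 * P * ρ := by
    have : ρ * DW ≤ ρ * (4 * P * ρ) := by rw [← hρρ] at h1; linarith
    exact le_of_mul_le_mul_left this hρ0
  have h3 : h * (ustar / 2) * I ≤ 4 * P * ρ + P * r := by linarith
  have h4 : I ≤ 2 * P / ustar * (4 / ρ + r / h) := by
    have e : 2 * P / ustar * (4 / ρ + r / h) = (4 * P * ρ + P * r) / (h * (ustar / 2)) := by
      rw [← hρρ]; field_simp
    rw [e, le_div_iff₀ (by positivity)]; linarith
  refine h4.trans ?_
  rw [hK', mul_div_assoc (2 * P / ustar)]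
  refine mul_le_mul_of_nonneg_left ?_ (show 0 ≤ 2 * P / ustar by positivity)
  have hrq : 0 < r * q := by positivity
  rw [add_div, add_comm]
  refine add_le_add ?_ (le_of_eq ?_)
  · rw [hh]
    have e : r / (r * q / (2 * α)) = 2 * α / q := by field_simp
    rw [e, mul_div_assoc, mul_assoc, mul_div_assoc]
    refine mul_le_mul_of_nonneg_left ?_ (by norm_num : (0:ℝ) ≤ 2)
    rw [div_le_div_iff₀ hq0 (Real.sqrt_pos.2 hrq), mul_assoc]
    refine mul_le_mul_of_nonneg_left ?_ hα.le
    calc Real.sqrt (r * q) ≤ Real.sqrt (c * q ^ 2) := Real.sqrt_le_sqrt (by nlinarith)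
      _ = Real.sqrt c * q := by rw [Real.sqrt_mul hc0.le, Real.sqrt_sq hq0.le]
  · rw [hρd, hh, Real.sqrt_div hrq.le]
    field_simp

end CSol

namespace CSol
variable {α β ustar : ℝ} {u p w : ℝ → ℝ → ℝ} {pstar : ℝ → ℝ}

lemma integral_pstar_le (S : CSol α β ustar u p w pstar) {a b : ℝ} (hab : a ≤ b) :
    ∫ x in a..b, pstar x ≤ b - a := by
  have h : ∫ x in a..b, pstar x ≤ ∫ _ in a..b, (1:ℝ) :=
    intervalIntegral.integral_mono_on (μ := volume) hab (S.pstar_intervalIntegrable a b)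
      intervalIntegrable_const fun x _ => (S.h01 x).2
  simpa using h

lemma integral_pstar_nonneg (S : CSol α β ustar u p w pstar) {a b : ℝ} (hab : a ≤ b) :
    0 ≤ ∫ x in a..b, pstar x :=
  intervalIntegral.integral_nonneg hab fun x _ => (S.h01 x).1

lemma integral_pstar_mono (S : CSol α β ustar u p w pstar) {a b c d : ℝ} (hab : a ≤ b)
    (hcd : c ≤ d) : ∫ x in b..c, pstar x ≤ ∫ x in a..d, pstar x := by
  have h1 := intervalIntegral.integral_add_adjacent_intervals (S.pstar_intervalIntegrable a b)
    (S.pstar_intervalIntegrable b c)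
  have h2 := intervalIntegral.integral_add_adjacent_intervals (S.pstar_intervalIntegrable a c)
    (S.pstar_intervalIntegrable c d)
  linarith [S.integral_pstar_nonneg hab, S.integral_pstar_nonneg hcd]

/-- `pstar` vanishes almost everywhere on sets without active points. -/
lemma integral_pstar_eq_zero (S : CSol α β ustar u p w pstar) {a b : ℝ} (ha : 0 ≤ a) (hab : a ≤ b)
    (h : ∀ y t, a < y → y ≤ b → 0 ≤ t → p y t = 0) : ∫ x in a..b, pstar x = 0 := by
  refine intervalIntegral.integral_zero_ae ?_
  filter_upwards [S.ae_condP] with x hx hxI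
  rw [uIoc_of_le hab] at hxI
  have h1 := hx (x ^ 2 / α ^ 2 + 1) (by linarith)
  rw [abs_of_pos (ha.trans_lt hxI.1)] at h1
  rw [← h1]
  exact h x _ hxI.1 hxI.2 (by positivity)

lemma exists_backward_bound (S : CSol α β ustar u p w pstar) :
    ∃ K > 0, ∃ κ > 0, κ < 1 ∧ ∃ X > 0, ∀ y t, X ≤ y → 0 ≤ t → p y t ≠ 0 →
      ∫ x in ((1 - κ) * y)..y, pstar x ≤ K / Real.sqrt (Real.sqrt y) := by
  obtain ⟨C, hC, L, hL, Y, hY, hact⟩ := S.exists_active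
  obtain ⟨K, hK, c, hc, Q, hQ, hlay⟩ := S.exists_layer_bound hC
  have hα := S.hα
  have hL0 : 0 < L := hα.trans hL
  refine ⟨(1 + 4 * K) * Real.sqrt (Real.sqrt L), by positivity, min (c / L) (1 / 2), by positivity,
    (min_le_right _ _).trans_lt (by norm_num), max Y (L * max Q (max (4 * C ^ 2) (1 / c))),
    lt_max_of_lt_left hY, ?_⟩
  intro y t hy ht hp
  obtain ⟨s, hs, hus, hs1, hs2, hs3⟩ := hact y t ((le_max_left _ _).trans hy) ht hp
  set q := Real.sqrt s with hq
  have hq0 : 0 < q := Real.sqrt_pos.2 hs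
  have hqs : s = q ^ 2 := (Real.sq_sqrt hs.le).symm
  rw [hqs] at hus
  have hqM : max Q (max (4 * C ^ 2) (1 / c)) ≤ q := by
    have h1 := ((le_max_right _ _).trans hy).trans hs2
    exact le_of_mul_le_mul_left h1 hL0
  have hqQ : Q ≤ q := (le_max_left _ _).trans hqM
  have hqC : 4 * C ^ 2 ≤ q := (le_max_left _ _).trans ((le_max_right _ _).trans hqM)
  have hqc : 1 ≤ c * q := by
    have := (le_max_right _ _).trans ((le_max_right _ _).trans hqM)
    rwa [div_le_iff₀ hc, mul_comm] at this
  have hq1 : 1 ≤ q := hQ.trans hqQ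
  set z := Real.sqrt q with hz
  have hz0 : 0 < z := Real.sqrt_pos.2 hq0
  have hzz : z ^ 2 = q := Real.sq_sqrt hq0.le
  have hz1 : 1 ≤ z := Real.one_le_sqrt.2 hq1
  have hzC : 2 * C ≤ z := by
    refine Real.le_sqrt_of_sq_le ?_
    linarith
  set r1 := 1 / z with hr1
  have hr10 : 0 < r1 := by positivity
  have hr1q : r1 * q = z := by rw [hr1, ← hzz]; field_simp
  have hr1C : 2 * C / q ≤ r1 := by
    rw [div_le_iff₀ hq0, hr1q]; exact hzC
  have hr1c : r1 ≤ c * q := by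
    refine le_trans ?_ hqc
    rw [hr1, div_le_one hz0]; exact hz1
  have key : ∀ n : ℕ, 2 ^ n * r1 ≤ 2 * (c * q) →
      ∫ x in (y - 2 ^ n * r1)..y, pstar x ≤ r1 + K / Real.sqrt z * (4 * (1 - (3 / 4) ^ n)) := by
    intro n
    induction n with
    | zero =>
      intro _
      have := S.integral_pstar_le (a := y - 2 ^ 0 * r1) (b := y) (by simp [hr10.le])
      simpa using this
    | succ n ih =>
      intro hn
      have h2n : (0:ℝ) < 2 ^ n := by positivity
      rw [pow_succ] at hn
      have h1 := ih (by nlinarith [mul_pos h2n hr10])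
      have h2 := (hlay y q (2 ^ n * r1) hqQ hs1 hs3 hus
        (hr1C.trans (le_mul_of_one_le_left hr10.le (one_le_pow₀ (by norm_num)))) (by linarith)).2
      have h3 := intervalIntegral.integral_add_adjacent_intervals
        (S.pstar_intervalIntegrable (y - 2 * (2 ^ n * r1)) (y - 2 ^ n * r1))
        (S.pstar_intervalIntegrable (y - 2 ^ n * r1) y)
      have h4 : K / Real.sqrt (2 ^ n * r1 * q) ≤ K / Real.sqrt z * (3 / 4) ^ n := by
        rw [mul_assoc, hr1q, Real.sqrt_mul h2n.le, div_mul_eq_mul_div, div_le_div_iff₀ (by positivity)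
          (by positivity)]
        have h5 : 1 ≤ Real.sqrt (2 ^ n) * (3 / 4) ^ n := by
          have h6 : ((4:ℝ) / 3) ^ n ≤ Real.sqrt (2 ^ n) := by
            refine Real.le_sqrt_of_sq_le ?_
            rw [← pow_mul, mul_comm, pow_mul]
            gcongr; norm_num
          calc (1:ℝ) = (4 / 3) ^ n * (3 / 4) ^ n := by rw [← mul_pow]; norm_num
            _ ≤ _ := by gcongr
        have h7 : 0 ≤ K * Real.sqrt z := by positivity
        nlinarith
      have e : y - 2 ^ (n + 1) * r1 = y - 2 * (2 ^ n * r1) := by ring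
      rw [e, ← h3]
      have e2 : (1 - (3 / 4 : ℝ) ^ (n + 1)) * 4 = 4 * (1 - (3 / 4) ^ n) + (3 / 4) ^ n := by ring
      have e3 : K / Real.sqrt z * (4 * (1 - (3 / 4) ^ (n + 1)))
        = K / Real.sqrt z * (4 * (1 - (3 / 4) ^ n)) + K / Real.sqrt z * (3 / 4) ^ n := by
        rw [mul_comm 4 (1 - (3 / 4 : ℝ) ^ (n + 1)), e2]; ring
      rw [e3]; linarith
  obtain ⟨n, hn1, hn2⟩ := exists_nat_pow_near (x := c * q / r1) (y := (2:ℝ)) ((one_le_div hr10).2 hr1c)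
    one_lt_two
  rw [le_div_iff₀ hr10] at hn1
  rw [div_lt_iff₀ hr10] at hn2
  have h1 := key (n + 1) (by rw [pow_succ]; linarith)
  have h2 : min (c / L) (1 / 2) * y ≤ c * q := by
    calc min (c / L) (1 / 2) * y ≤ c / L * (L * q) := by
          gcongr
          · exact hY.le.trans ((le_max_left _ _).trans hy)
          · exact min_le_left _ _
      _ = c * q := by field_simp
  have h0 : 0 ≤ min (c / L) (1 / 2) * y :=
    mul_nonneg (by positivity) (hY.le.trans ((le_max_left _ _).trans hy))
  refine (S.integral_pstar_mono (a := y - 2 ^ (n + 1) * r1) (by linarith) le_rfl).trans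
    (h1.trans ?_)
  have hsz : 0 < Real.sqrt z := Real.sqrt_pos.2 hz0
  have h3 : r1 ≤ 1 / Real.sqrt z := by
    rw [hr1]
    refine one_div_le_one_div_of_le hsz ?_
    exact Real.sqrt_le_iff.2 ⟨hz0.le, by nlinarith⟩
  have h4 : K / Real.sqrt z * (4 * (1 - (3 / 4) ^ (n + 1))) ≤ K / Real.sqrt z * 4 := by
    refine mul_le_mul_of_nonneg_left ?_ (by positivity)
    have : (0:ℝ) ≤ (3 / 4) ^ (n + 1) := by positivity
    linarith
  have hy0 : 0 < y := hY.trans_le ((le_max_left _ _).trans hy)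
  calc r1 + K / Real.sqrt z * (4 * (1 - (3 / 4) ^ (n + 1))) ≤ 1 / Real.sqrt z + K / Real.sqrt z * 4 :=
        add_le_add h3 h4
    _ = (1 + 4 * K) / Real.sqrt z := by ring
    _ ≤ (1 + 4 * K) * Real.sqrt (Real.sqrt L) / Real.sqrt (Real.sqrt y) := by
        rw [div_le_div_iff₀ hsz (Real.sqrt_pos.2 (Real.sqrt_pos.2 hy0)), mul_assoc]
        refine mul_le_mul_of_nonneg_left ?_ (by positivity)
        rw [hz, ← Real.sqrt_mul (Real.sqrt_nonneg _), ← Real.sqrt_mul hL0.le]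
        exact Real.sqrt_le_sqrt (Real.sqrt_le_sqrt hs2)

lemma exists_forward_bound (S : CSol α β ustar u p w pstar) :
    ∃ K > 0, ∃ κ > 0, ∃ X > 0, ∀ x, X ≤ x →
      ∫ ξ in x..((1 + κ) * x), pstar ξ ≤ K / Real.sqrt (Real.sqrt x) := by
  obtain ⟨K, hK, κ, hκ, hκ1, X, hX, hb⟩ := S.exists_backward_bound
  refine ⟨K, hK, κ, hκ, X, hX, fun x hx => ?_⟩
  have hx0 : 0 < x := hX.trans_le hx
  have hx1 : x ≤ (1 + κ) * x := by nlinarith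
  have hR : 0 ≤ K / Real.sqrt (Real.sqrt x) := by positivity
  set A : Set ℝ := {y | x ≤ y ∧ y ≤ (1 + κ) * x ∧ ∃ t, 0 ≤ t ∧ p y t ≠ 0} with hA
  rcases A.eq_empty_or_nonempty with hE | hN
  · rw [S.integral_pstar_eq_zero hx0.le hx1 fun y t h1 h2 h3 => ?_]
    · exact hR
    · by_contra h4
      have : y ∈ A := ⟨h1.le, h2, t, h3, h4⟩
      rw [hE] at this; exact this
  have hbdd : BddAbove A := ⟨(1 + κ) * x, fun y hy => hy.2.1⟩
  set y0 := sSup A with hy0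
  have hy0le : y0 ≤ (1 + κ) * x := csSup_le hN fun y hy => hy.2.1
  have hy0ge : x ≤ y0 := by
    obtain ⟨y, hy⟩ := hN
    exact hy.1.trans (le_csSup hbdd hy)
  have htail : ∫ ξ in y0..((1 + κ) * x), pstar ξ = 0 :=
    S.integral_pstar_eq_zero (hx0.le.trans hy0ge) hy0le fun y t h1 h2 h3 => by
      by_contra h4
      exact absurd (le_csSup hbdd (show y ∈ A from ⟨hy0ge.trans h1.le, h2, t, h3, h4⟩)) (not_le.2 h1)
  rw [← intervalIntegral.integral_add_adjacent_intervals (S.pstar_intervalIntegrable x y0)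
    (S.pstar_intervalIntegrable y0 _), htail, add_zero]
  refine le_of_forall_pos_le_add fun τ hτ => ?_
  obtain ⟨y, hyA, hy⟩ := exists_lt_of_lt_csSup hN (show y0 - τ < sSup A by linarith)
  obtain ⟨h1, h2, t, h3, h4⟩ := hyA
  have hyy0 : y ≤ y0 := le_csSup hbdd ⟨h1, h2, t, h3, h4⟩
  have h5 := hb y t (hx.trans h1) h3 h4
  have h6 := S.integral_pstar_mono (a := (1 - κ) * y) (b := x) (c := y) (d := y) (by nlinarith) le_rfl
  have h7 := S.integral_pstar_le hyy0
  have h8 : K / Real.sqrt (Real.sqrt y) ≤ K / Real.sqrt (Real.sqrt x) := by gcongr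
  rw [← intervalIntegral.integral_add_adjacent_intervals (S.pstar_intervalIntegrable x y)
    (S.pstar_intervalIntegrable y y0)]
  linarith

theorem integrableOn_pstar (S : CSol α β ustar u p w pstar) : IntegrableOn pstar (Ioi 0) := by
  obtain ⟨K, hK, κ, hκ, X, hX, hb⟩ := S.exists_forward_bound
  set θ := 1 / Real.sqrt (Real.sqrt (1 + κ)) with hθ
  have h1κ : 1 < Real.sqrt (Real.sqrt (1 + κ)) := by
    rw [Real.lt_sqrt zero_le_one, Real.lt_sqrt (by norm_num)]; linarith
  have hθ0 : 0 < θ := by positivity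
  have hθ1 : θ < 1 := by rw [hθ, div_lt_one (by linarith)]; exact h1κ
  have key : ∀ n : ℕ, ∫ x in (0:ℝ)..((1 + κ) ^ n * X), pstar x
      ≤ X + K / Real.sqrt (Real.sqrt X) * ((1 - θ ^ n) / (1 - θ)) := by
    intro n
    induction n with
    | zero => simpa using S.integral_pstar_le hX.le
    | succ n ih =>
      have h1 := hb ((1 + κ) ^ n * X) (le_mul_of_one_le_left hX.le (one_le_pow₀ (by linarith)))
      have e : (1 + κ) ^ (n + 1) * X = (1 + κ) * ((1 + κ) ^ n * X) := by ring
      rw [e, ← intervalIntegral.integral_add_adjacent_intervals (S.pstar_intervalIntegrable 0 _)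
        (S.pstar_intervalIntegrable _ _)]
      have e2 : K / Real.sqrt (Real.sqrt ((1 + κ) ^ n * X)) = K / Real.sqrt (Real.sqrt X) * θ ^ n := by
        have e3 : Real.sqrt ((1 + κ) ^ n) = Real.sqrt (1 + κ) ^ n := by
          rw [Real.sqrt_eq_iff_eq_sq (by positivity) (by positivity), ← pow_mul, mul_comm, pow_mul,
            Real.sq_sqrt (by linarith)]
        have e4 : Real.sqrt (Real.sqrt (1 + κ) ^ n) = Real.sqrt (Real.sqrt (1 + κ)) ^ n := by
          rw [Real.sqrt_eq_iff_eq_sq (by positivity) (by positivity), ← pow_mul, mul_comm n, pow_mul,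
            Real.sq_sqrt (by positivity)]
        rw [Real.sqrt_mul (by positivity), e3, Real.sqrt_mul (by positivity), e4, hθ, div_pow, one_pow]
        field_simp
      have e5 : (1 - θ ^ (n + 1)) / (1 - θ) = (1 - θ ^ n) / (1 - θ) + θ ^ n := by
        have : 1 - θ ≠ 0 := by linarith
        field_simp; ring
      rw [e2] at h1
      rw [e5, mul_add, ← add_assoc]
      exact add_le_add ih h1
  refine integrableOn_Ioi_of_intervalIntegral_norm_bounded (l := atTop)
    (b := fun n : ℕ => (1 + κ) ^ n * X) (X + K / Real.sqrt (Real.sqrt X) * (1 / (1 - θ))) 0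
    (fun n => ?_) ?_ (Eventually.of_forall fun n => ?_)
  · have hn : (0:ℝ) ≤ (1 + κ) ^ n * X := by positivity
    exact (intervalIntegrable_iff_integrableOn_Ioc_of_le hn).1 (S.pstar_intervalIntegrable _ _)
  · exact (tendsto_pow_atTop_atTop_of_one_lt (by linarith)).atTop_mul_const hX
  · have e : ∀ x, ‖pstar x‖ = pstar x := fun x => by rw [Real.norm_eq_abs, abs_of_nonneg (S.h01 x).1]
    simp only [e]
    refine (key n).trans ?_
    have h1 : 0 < 1 - θ := by linarith
    have h2 : (1 - θ ^ n) / (1 - θ) ≤ 1 / (1 - θ) := by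
      gcongr
      have : 0 ≤ θ ^ n := by positivity
      linarith
    gcongr

end CSol

/-- Almost every ray `η = const` is a ray of convergence. -/
def RayConv (u : ℝ → ℝ → ℝ) (V : ℝ → ℝ) : Prop :=
  ∀ᵐ η ∂(volume.restrict (Ici (0:ℝ))), Tendsto (fun t => u (η * Real.sqrt t) t) atTop (nhds (V η))

namespace RayConv
variable {u : ℝ → ℝ → ℝ} {V : ℝ → ℝ}

lemma tendsto_scale {ξ σ : ℝ} (hσ : 0 < σ)
    (h : Tendsto (fun t => u (ξ / Real.sqrt σ * Real.sqrt t) t) atTop (nhds (V (ξ / Real.sqrt σ)))) :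
    Tendsto (fun l : ℝ => u (ξ * l) (σ * l ^ 2)) atTop (nhds (V (ξ / Real.sqrt σ))) := by
  have h1 : Tendsto (fun l : ℝ => σ * l ^ 2) atTop atTop :=
    (tendsto_pow_atTop two_ne_zero).const_mul_atTop hσ
  refine (h.comp h1).congr' ?_
  filter_upwards [eventually_ge_atTop 0] with l hl
  have h2 : 0 < Real.sqrt σ := Real.sqrt_pos.2 hσ
  simp only [Function.comp]
  rw [Real.sqrt_mul hσ.le, Real.sqrt_sq hl]
  congr 1
  field_simp

/-- The exceptional set is negligible along smooth reparametrisations. -/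
lemma ae_of_image (h : RayConv u V) {f g : ℝ → ℝ} (hf : DifferentiableOn ℝ f (Ioi 0)) {s : Set ℝ}
    (hg : ∀ x ∈ s, 0 < g x ∧ f (g x) = x) :
    ∀ᵐ x : ℝ, x ∈ s → Tendsto (fun t => u (g x * Real.sqrt t) t) atTop (nhds (V (g x))) := by
  unfold RayConv at h
  rw [ae_restrict_iff' measurableSet_Ici] at h
  set N : Set ℝ := {η | ¬(η ∈ Ici (0:ℝ) → Tendsto (fun t => u (η * Real.sqrt t) t) atTop (nhds (V η)))}
    with hN
  have hN0 : volume (N ∩ Ioi 0) = 0 := measure_mono_null inter_subset_left (ae_iff.1 h)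
  have h1 := addHaar_image_eq_zero_of_differentiableOn_of_addHaar_eq_zero (μ := (volume : Measure ℝ))
    (hf.mono (inter_subset_right (s := N))) hN0
  refine ae_iff.2 (measure_mono_null (fun x hx => ?_) h1)
  simp only [mem_ofPred_eq, Classical.not_imp] at hx
  exact ⟨g x, ⟨fun hh => hx.2 (hh (hg x hx.1).1.le), (hg x hx.1).1⟩, (hg x hx.1).2⟩

end RayConv

namespace CSol
variable {α β ustar : ℝ} {u p w : ℝ → ℝ → ℝ} {pstar : ℝ → ℝ} {V : ℝ → ℝ}

lemma tendsto_timeIntegral (S : CSol α β ustar u p w pstar) (h : RayConv u V) {ξ a b : ℝ} (hξ : 0 < ξ)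
    (ha : 0 ≤ a) (hab : a ≤ b) :
    ∃ c, Tendsto (fun l : ℝ => ∫ σ in a..b, u (ξ * l) (σ * l ^ 2)) atTop (nhds c) := by
  refine ⟨∫ σ in a..b, V (ξ / Real.sqrt σ),
    intervalIntegral.tendsto_integral_filter_of_dominated_convergence (fun _ => PsiP α β α) ?_ ?_
      intervalIntegrable_const ?_⟩
  · refine Eventually.of_forall fun l => ?_
    have hm : Measurable fun σ => u (ξ * l) (max (σ * l ^ 2) 0) :=
      S.measurable_u.comp (f := fun σ : ℝ => (ξ * l, σ * l ^ 2)) (by fun_prop)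
    refine (hm.aestronglyMeasurable).congr ?_
    refine (ae_restrict_iff' measurableSet_uIoc).2 (Eventually.of_forall fun σ hσ => ?_)
    rw [uIoc_of_le hab] at hσ
    have : 0 ≤ σ := ha.trans hσ.1.le
    simp only [max_eq_left (show 0 ≤ σ * l ^ 2 by positivity)]
  · refine Eventually.of_forall fun l => Eventually.of_forall fun σ hσ => ?_
    rw [uIoc_of_le hab] at hσ
    have : 0 ≤ σ * l ^ 2 := mul_nonneg (ha.trans hσ.1.le) (sq_nonneg _)
    rw [Real.norm_eq_abs, abs_of_nonneg (S.u_nonneg _ this)]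
    exact S.u_le _ this
  · have h1 := h.ae_of_image (f := fun η => ξ ^ 2 / η ^ 2) (g := fun σ => ξ / Real.sqrt σ) (s := Ioi 0)
      (fun η hη => ((differentiableAt_const _).div (by fun_prop)
        (pow_ne_zero 2 (ne_of_gt hη))).differentiableWithinAt) (fun σ hσ => by
        have h2 : 0 < Real.sqrt σ := Real.sqrt_pos.2 hσ
        refine ⟨by positivity, ?_⟩
        rw [div_pow, Real.sq_sqrt (le_of_lt hσ)]
        field_simp)
    filter_upwards [h1] with σ hσ hσI
    rw [uIoc_of_le hab] at hσI
    have hσ0 : 0 < σ := ha.trans_lt hσI.1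
    exact RayConv.tendsto_scale hσ0 (hσ hσ0)

lemma cont_slice_u (S : CSol α β ustar u p w pstar) {t : ℝ} (ht : 0 < t) : Continuous fun x => u x t :=
  continuous_iff_continuousAt.2 fun x =>
    (S.continuousAt_u x ht).comp (f := fun x : ℝ => (x, t)) (by fun_prop)

lemma tendsto_spaceIntegral (S : CSol α β ustar u p w pstar) (h : RayConv u V) {σ a b : ℝ} (hσ : 0 < σ)
    (ha : 0 ≤ a) (hab : a ≤ b) :
    Tendsto (fun l : ℝ => ∫ z in a..b, u (z * l) (σ * l ^ 2)) atTop
      (nhds (∫ z in a..b, V (z / Real.sqrt σ))) := by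
  refine intervalIntegral.tendsto_integral_filter_of_dominated_convergence (fun _ => PsiP α β α) ?_ ?_
      intervalIntegrable_const ?_
  · filter_upwards [eventually_gt_atTop 0] with l hl
    exact ((S.cont_slice_u (show 0 < σ * l ^ 2 by positivity)).comp
      (continuous_id.mul continuous_const)).aestronglyMeasurable
  · refine Eventually.of_forall fun l => Eventually.of_forall fun z _ => ?_
    have : 0 ≤ σ * l ^ 2 := by positivity
    rw [Real.norm_eq_abs, abs_of_nonneg (S.u_nonneg _ this)]
    exact S.u_le _ this
  · have h2 : 0 < Real.sqrt σ := Real.sqrt_pos.2 hσ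
    have h1 := h.ae_of_image (f := fun η => η * Real.sqrt σ) (g := fun z => z / Real.sqrt σ) (s := Ioi 0)
      (by fun_prop) (fun z hz => by
        refine ⟨div_pos hz h2, ?_⟩
        field_simp)
    filter_upwards [h1] with z hz hzI
    rw [uIoc_of_le hab] at hzI
    exact RayConv.tendsto_scale hσ (hz (ha.trans_lt hzI.1))

lemma tendsto_doubleIntegral (S : CSol α β ustar u p w pstar) (h : RayConv u V) {σ x q : ℝ} (hσ : 0 < σ)
    (hx : 0 ≤ x) (hq : 1 ≤ q) :
    ∃ c, Tendsto (fun l : ℝ => ∫ y in x..(q * x), ∫ z in y..(q * y), u (z * l) (σ * l ^ 2)) atTop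
      (nhds c) := by
  have hxq : x ≤ q * x := le_mul_of_one_le_left hx hq
  refine ⟨∫ y in x..(q * x), ∫ z in y..(q * y), V (z / Real.sqrt σ),
    intervalIntegral.tendsto_integral_filter_of_dominated_convergence
      (fun _ => PsiP α β α * ((q - 1) * (q * x))) ?_ ?_ intervalIntegrable_const ?_⟩
  · filter_upwards [eventually_gt_atTop 0] with l hl
    have hc : Continuous fun z => u (z * l) (σ * l ^ 2) :=
      (S.cont_slice_u (show 0 < σ * l ^ 2 by positivity)).comp (continuous_id.mul continuous_const)
    have e : (fun y => ∫ z in y..(q * y), u (z * l) (σ * l ^ 2))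
        = fun y => (∫ z in (0:ℝ)..(q * y), u (z * l) (σ * l ^ 2)) - ∫ z in (0:ℝ)..y, u (z * l) (σ * l ^ 2) := by
      funext y
      rw [intervalIntegral.integral_interval_sub_left (hc.intervalIntegrable _ _) (hc.intervalIntegrable _ _)]
    rw [e]
    have hp := intervalIntegral.continuous_primitive (fun a b => hc.intervalIntegrable (μ := volume) a b) 0
    exact ((hp.comp (continuous_const.mul continuous_id)).sub hp).aestronglyMeasurable
  · refine Eventually.of_forall fun l => Eventually.of_forall fun y hy => ?_
    rw [uIoc_of_le hxq] at hy
    have hy0 : 0 ≤ y := hx.trans hy.1.le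
    have h1 : ‖∫ z in y..(q * y), u (z * l) (σ * l ^ 2)‖ ≤ PsiP α β α * |q * y - y| :=
      intervalIntegral.norm_integral_le_of_norm_le_const fun z _ => by
        have : 0 ≤ σ * l ^ 2 := by positivity
        rw [Real.norm_eq_abs, abs_of_nonneg (S.u_nonneg _ this)]
        exact S.u_le _ this
    refine h1.trans ?_
    have e : q * y - y = (q - 1) * y := by ring
    rw [e, abs_of_nonneg (mul_nonneg (by linarith) hy0)]
    have := PsiP_self_pos S.hα S.hβ
    have hq' : 0 ≤ q - 1 := by linarith
    gcongr
    exact hy.2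
  · refine Eventually.of_forall fun y hy => ?_
    rw [uIoc_of_le hxq] at hy
    have hy0 : 0 ≤ y := hx.trans hy.1.le
    exact S.tendsto_spaceIntegral h hσ hy0 (le_mul_of_one_le_left hy0 hq)

end CSol

lemma scaled_mean_bounds {F : ℝ → ℝ} (hF : Antitone F) {q y : ℝ} (hq : 1 ≤ q) (hy : 0 ≤ y) :
    (q - 1) * y * F (q * y) ≤ ∫ x in y..(q * y), F x ∧ ∫ x in y..(q * y), F x ≤ (q - 1) * y * F y := by
  have hyq : y ≤ q * y := le_mul_of_one_le_left hy hq
  constructor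
  · have h := intervalIntegral.integral_mono_on (μ := volume) hyq intervalIntegrable_const
      (hF.intervalIntegrable) fun x hx => hF hx.2
    rw [intervalIntegral.integral_const, smul_eq_mul] at h
    linarith
  · have h := intervalIntegral.integral_mono_on (μ := volume) hyq (hF.intervalIntegrable)
      intervalIntegrable_const fun x hx => hF hx.1
    rw [intervalIntegral.integral_const, smul_eq_mul] at h
    linarith

/-- If `E y ≤ E (q y) / q` and `E (qⁿ y) / qⁿ → 0`, then `E ≤ 0`. -/
lemma nonpos_of_le_scaled {E : ℝ → ℝ} {q X0 : ℝ} (hq : 1 < q) (hX : 0 < X0)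
    (h : ∀ y, X0 ≤ y → E y ≤ E (q * y) / q) {y : ℝ} (hy : X0 ≤ y)
    (h0 : Tendsto (fun n : ℕ => E (q ^ n * y) / q ^ n) atTop (nhds 0)) : E y ≤ 0 := by
  have hq0 : 0 < q := by linarith
  refine ge_of_tendsto' h0 fun n => ?_
  induction n with
  | zero => simp
  | succ n ih =>
    refine ih.trans ?_
    have h1 : X0 ≤ q ^ n * y := hy.trans (le_mul_of_one_le_left (hX.le.trans hy) (one_le_pow₀ hq.le))
    have h2 := h _ h1
    rw [pow_succ, div_le_div_iff₀ (by positivity) (by positivity)]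
    rw [le_div_iff₀ hq0] at h2
    have e : q * (q ^ n * y) = q ^ n * q * y := by ring
    rw [e] at h2
    nlinarith [pow_pos hq0 n]

lemma tail_bounds {F : ℝ → ℝ} (hF : Antitone F) (h0 : Tendsto F atTop (nhds 0)) {q X0 τ1 τ2 : ℝ}
    (hq : 1 < q) (hX : 0 < X0)
    (hT : ∀ y, X0 ≤ y → τ1 ≤ (∫ x in y..(q * y), F x) - (∫ x in (q * y)..(q * (q * y)), F x) / q ∧
      (∫ x in y..(q * y), F x) - (∫ x in (q * y)..(q * (q * y)), F x) / q ≤ τ2) {y : ℝ} (hy : X0 ≤ y) :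
    τ1 * q / (q - 1) ^ 2 ≤ y * F y ∧ q * y * F (q * y) ≤ τ2 * q ^ 2 / (q - 1) ^ 2 := by
  have hq0 : 0 < q := by linarith
  have hq1 : 0 < q - 1 := by linarith
  have hy0 : 0 < y := hX.trans_le hy
  have hnn : ∀ x, 0 ≤ F x := fun x => hF.le_of_tendsto h0 x
  have hpow : Tendsto (fun n : ℕ => q ^ n) atTop atTop := tendsto_pow_atTop_atTop_of_one_lt hq
  have hDlim : Tendsto (fun n : ℕ => (∫ x in (q ^ n * y)..(q * (q ^ n * y)), F x) / q ^ n) atTop (nhds 0) := by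
    have h1 : Tendsto (fun n : ℕ => (q - 1) * y * F (q ^ n * y)) atTop (nhds 0) := by
      simpa using (h0.comp (hpow.atTop_mul_const hy0)).const_mul ((q - 1) * y)
    refine tendsto_of_tendsto_of_tendsto_of_le_of_le tendsto_const_nhds h1 (fun n => ?_) fun n => ?_
    · have := scaled_mean_bounds hF hq.le (show 0 ≤ q ^ n * y by positivity)
      have h2 : 0 ≤ (q - 1) * (q ^ n * y) * F (q * (q ^ n * y)) := mul_nonneg (by positivity) (hnn _)
      exact div_nonneg (h2.trans this.1) (by positivity)
    · have := (scaled_mean_bounds hF hq.le (show 0 ≤ q ^ n * y by positivity)).2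
      simp only
      rw [div_le_iff₀ (by positivity)]
      linarith
  have hclim : ∀ c : ℝ, Tendsto (fun n : ℕ => c / q ^ n) atTop (nhds 0) := fun c =>
    tendsto_const_nhds.div_atTop hpow
  have hup : (∫ x in y..(q * y), F x) - τ2 * q / (q - 1) ≤ 0 := by
    refine nonpos_of_le_scaled (E := fun y => (∫ x in y..(q * y), F x) - τ2 * q / (q - 1)) hq hX
      (fun z hz => ?_) hy ?_
    · have := (hT z hz).2
      rw [sub_div]
      have e : τ2 * q / (q - 1) / q = τ2 * q / (q - 1) - τ2 := by field_simp; ring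
      rw [e]; linarith
    · have := hDlim.sub (hclim (τ2 * q / (q - 1)))
      simp only [sub_zero] at this
      exact this.congr fun n => by rw [sub_div]
  have hlo : τ1 * q / (q - 1) - (∫ x in y..(q * y), F x) ≤ 0 := by
    refine nonpos_of_le_scaled (E := fun y => τ1 * q / (q - 1) - (∫ x in y..(q * y), F x)) hq hX
      (fun z hz => ?_) hy ?_
    · have := (hT z hz).1
      rw [sub_div]
      have e : τ1 * q / (q - 1) / q = τ1 * q / (q - 1) - τ1 := by field_simp; ring
      rw [e]; linarith
    · have := (hclim (τ1 * q / (q - 1))).sub hDlim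
      simp only [sub_zero] at this
      exact this.congr fun n => by rw [sub_div]
  obtain ⟨h1, h2⟩ := scaled_mean_bounds hF hq.le hy0.le
  constructor
  · have h3 : τ1 * q / (q - 1) ≤ (q - 1) * y * F y := by linarith
    rw [div_le_iff₀ hq1] at h3
    rw [div_le_iff₀ (by positivity)]
    linarith
  · have h3 : (q - 1) * y * F (q * y) ≤ τ2 * q / (q - 1) := by linarith
    rw [le_div_iff₀ hq1] at h3
    rw [le_div_iff₀ (by positivity)]
    nlinarith

lemma exists_tendsto_of_squeeze {g : ℝ → ℝ}
    (h : ∀ ε > 0, ∃ lo hi, hi - lo ≤ ε ∧ ∀ᶠ y in atTop, lo ≤ g y ∧ g y ≤ hi) :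
    ∃ c, Tendsto g atTop (nhds c) := by
  refine cauchySeq_tendsto_of_complete (Metric.cauchySeq_iff.2 fun ε hε => ?_)
  obtain ⟨lo, hi, h1, h2⟩ := h (ε / 2) (by linarith)
  obtain ⟨N, hN⟩ := eventually_atTop.1 h2
  refine ⟨N, fun m hm n hn => ?_⟩
  rw [Real.dist_eq, abs_lt]
  constructor <;> linarith [hN m hm, hN n hn]

/-- Asymptotics of the tail from approximate constancy of its scaled second differences. -/
lemma exists_tail_limit {F : ℝ → ℝ} (hF : Antitone F) (h0 : Tendsto F atTop (nhds 0)) {m C h0' : ℝ}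
    (hm : 0 < m) (hC : 0 < C) (hh0 : 0 < h0')
    (H : ∀ h, 0 < h → h ≤ h0' → ∃ A, 0 ≤ A ∧ ∀ δ > 0, ∀ᶠ y in atTop,
      (m - C * h) * ((∫ x in y..((1 + h / 2) * y), F x)
        - (∫ x in ((1 + h / 2) * y)..((1 + h / 2) * ((1 + h / 2) * y)), F x) / (1 + h / 2)) ≤ A + δ ∧
      A - δ ≤ (m + h) * ((∫ x in y..((1 + h / 2) * y), F x)
        - (∫ x in ((1 + h / 2) * y)..((1 + h / 2) * ((1 + h / 2) * y)), F x) / (1 + h / 2))) :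
    ∃ γ, 0 ≤ γ ∧ Tendsto (fun y => y * F y) atTop (nhds γ) := by
  have hnn : ∀ x, 0 ≤ F x := fun x => hF.le_of_tendsto h0 x
  -- the two-sided bound at scale `h`
  have key : ∀ h, 0 < h → h ≤ h0' → h ≤ 1 → C * h ≤ m / 2 → ∀ δ > 0, ∃ lo, 
      ∀ᶠ y in atTop, lo ≤ y * F y ∧
        y * F y ≤ (1 + h / 2) * (m + h) / (m - C * h) * lo + δ := by
    intro h hh hh1 hh2 hCh δ hδ
    obtain ⟨A, hA, hAe⟩ := H h hh hh1
    set q := 1 + h / 2 with hq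
    have hq1 : 1 < q := by linarith
    have hq0 : 0 < q := by linarith
    have hmC : 0 < m - C * h := by linarith
    set η := δ * (q - 1) ^ 2 * (m - C * h) / (2 * q ^ 2) with hη
    have hqq : 0 < (q - 1) ^ 2 := by have : 0 < q - 1 := by linarith
                                     positivity
    have hη0 : 0 < η := by positivity
    obtain ⟨X, hX⟩ := eventually_atTop.1 (hAe η hη0)
    have hb := fun y (hy : max X 1 ≤ y) => tail_bounds hF h0 hq1 (X0 := max X 1)
      (τ1 := (A - η) / (m + h)) (τ2 := (A + η) / (m - C * h)) (by positivity) (fun y hy => by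
        obtain ⟨a, b⟩ := hX y ((le_max_left _ _).trans hy)
        constructor
        · rw [div_le_iff₀ (by positivity)]; linarith
        · rw [le_div_iff₀ hmC]; linarith) hy
    refine ⟨(A - η) / (m + h) * q / (q - 1) ^ 2, ?_⟩
    filter_upwards [eventually_ge_atTop (q * max X 1)] with y hy
    have hM : 0 < max X 1 := by positivity
    refine ⟨(hb y (le_trans (le_mul_of_one_le_left hM.le hq1.le) hy)).1, ?_⟩
    have h2 := (hb (y / q) (by rw [le_div_iff₀ hq0]; linarith)).2
    rw [mul_div_cancel₀ _ hq0.ne'] at h2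
    refine h2.trans (le_of_eq ?_)
    have hmh : 0 < m + h := by linarith
    rw [hη]
    generalize hr : q - 1 = r at *
    generalize m - C * h = n at *
    generalize m + h = k at *
    have : r ≠ 0 := by rintro rfl; simp at hqq
    field_simp
    ring
  -- boundedness
  obtain ⟨B, hB0, hB⟩ : ∃ B, 0 ≤ B ∧ ∀ᶠ y in atTop, y * F y ≤ B := by
    set h := min (min h0' 1) (m / (2 * C)) with hh
    have hpos : 0 < h := by positivity
    have h3 : C * h ≤ m / 2 := by
      have : h ≤ m / (2 * C) := min_le_right _ _
      rw [le_div_iff₀ (by positivity)] at this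
      linarith
    obtain ⟨lo, hlo⟩ := key h hpos ((min_le_left _ _).trans (min_le_left _ _))
      ((min_le_left _ _).trans (min_le_right _ _)) h3 1 one_pos
    refine ⟨max 0 ((1 + h / 2) * (m + h) / (m - C * h) * lo + 1), le_max_left _ _, hlo.mono fun y hy => hy.2.trans (le_max_right _ _)⟩
  have hlim : ∃ c, Tendsto (fun y => y * F y) atTop (nhds c) := by
    refine exists_tendsto_of_squeeze fun ε hε => ?_
    have hρ : Tendsto (fun h : ℝ => ((1 + h / 2) * (m + h) / (m - C * h) - 1) * B) (nhdsWithin 0 (Ioi 0))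
        (nhds 0) := by
      have : ContinuousAt (fun h : ℝ => ((1 + h / 2) * (m + h) / (m - C * h) - 1) * B) 0 := by
        refine ContinuousAt.mul (ContinuousAt.sub (ContinuousAt.div (by fun_prop) (by fun_prop) ?_)
          (by fun_prop)) (by fun_prop)
        simp [hm.ne']
      have h2 := this.tendsto.mono_left (nhdsWithin_le_nhds (s := Ioi 0))
      simpa [hm.ne'] using h2
    have hev := hρ.eventually_lt_const (show (0:ℝ) < ε / 2 by linarith)
    have e1 : ∀ᶠ h : ℝ in nhdsWithin 0 (Ioi 0), h ≤ min (min h0' 1) (m / (2 * C)) :=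
      nhdsWithin_le_nhds (Iic_mem_nhds (by positivity))
    obtain ⟨h, ⟨hlt, hle⟩, hpos⟩ := ((hev.and e1).and self_mem_nhdsWithin).exists
    have hpos : 0 < h := hpos
    have h3 : C * h ≤ m / 2 := by
      have : h ≤ m / (2 * C) := hle.trans (min_le_right _ _)
      rw [le_div_iff₀ (by positivity)] at this
      linarith
    obtain ⟨lo, hlo⟩ := key h hpos (hle.trans ((min_le_left _ _).trans (min_le_left _ _)))
      (hle.trans ((min_le_left _ _).trans (min_le_right _ _))) h3 (ε / 2) (by linarith)
    have hloB : lo ≤ B := by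
      obtain ⟨y, h1, h2⟩ := (hlo.and hB).exists
      exact h1.1.trans h2
    refine ⟨lo, lo + ε, by linarith, hlo.mono fun y hy => ⟨hy.1, hy.2.trans ?_⟩⟩
    have hρ1 : 0 ≤ (1 + h / 2) * (m + h) / (m - C * h) - 1 := by
      have : 0 < m - C * h := by linarith
      rw [sub_nonneg, le_div_iff₀ this]
      nlinarith [mul_pos hC hpos, mul_pos hm hpos, mul_pos hpos hpos]
    have := mul_le_mul_of_nonneg_left hloB hρ1
    linarith
  obtain ⟨γ, hγ⟩ := hlim
  refine ⟨γ, ge_of_tendsto hγ ?_, hγ⟩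
  filter_upwards [eventually_ge_atTop 0] with y hy
  exact mul_nonneg hy (hnn y)

namespace CSol
variable {α β ustar : ℝ} {u p w : ℝ → ℝ → ℝ} {pstar : ℝ → ℝ} {V : ℝ → ℝ}

lemma inner_limit_ge (S : CSol α β ustar u p w pstar)
    (hunb : ∀ X, ∃ y t, X ≤ y ∧ 0 ≤ t ∧ p y t ≠ 0) :
    ∃ K > 0, ∀ h, 0 < h → h ≤ 1 / 4 → ∀ c, Tendsto
      (fun l : ℝ => ∫ σ in (1 - h)..1, u (α * (1 - 3 * h) * l) (σ * l ^ 2)) atTop (nhds c) →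
      h * (ustar - K * h) ≤ c := by
  obtain ⟨C, hC, L, hL, Y, hY, hact⟩ := S.exists_active
  obtain ⟨K, hK, Q, hQ, hlow⟩ := S.exists_inner_lower hC
  have hα := S.hα
  have hL0 : 0 < L := hα.trans hL
  refine ⟨3 * α * K, by positivity, fun h hh hh4 c hc => ?_⟩
  refine ge_of_tendsto_of_frequently hc (frequently_atTop.2 fun N => ?_)
  set q0 := max N (max Q (1 + (C + 1) / (α * h))) with hq0
  obtain ⟨y, t, hy, ht, hp⟩ := hunb (max Y (L * q0))
  obtain ⟨s, hs, hus, h1, h2, h3⟩ := hact y t ((le_max_left _ _).trans hy) ht hp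
  set q := Real.sqrt s with hq
  have hq2 : q ^ 2 = s := Real.sq_sqrt hs.le
  have hqq : q0 ≤ q := by
    have := (le_max_right _ _).trans (hy.trans h2)
    exact le_of_mul_le_mul_left this hL0
  have hqN : N ≤ q := (le_max_left _ _).trans hqq
  have hqQ : Q ≤ q := ((le_max_left _ _).trans (le_max_right _ _)).trans hqq
  have hq3 : 1 + (C + 1) / (α * h) ≤ q := ((le_max_right _ _).trans (le_max_right _ _)).trans hqq
  have hq1 : 1 ≤ q := hQ.trans hqQ
  have hq0' : 0 < q := by linarith
  have hCq : C + 1 ≤ α * h * q ^ 2 := by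
    have : (C + 1) / (α * h) ≤ q := by linarith
    rw [div_le_iff₀ (by positivity)] at this
    have h5 : q ≤ q ^ 2 := by nlinarith
    nlinarith [mul_pos hα hh]
  have hCq' : C / q ≤ α * h * q := by
    rw [div_le_iff₀ hq0']; nlinarith
  have hmain := hlow y q (2 * α * h * q) (y - α * (1 - 3 * h) * q) hqQ h1 h3 (by rw [hq2]; exact hus)
    (by rw [mul_div_assoc]; linarith) (by nlinarith [mul_pos hα hq0'])
    (by nlinarith [mul_pos (mul_pos hα hh) hq0']) (by nlinarith [mul_pos (mul_pos hα hh) hq0'])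
  obtain ⟨-, -, hmain⟩ := hmain
  have e1 : 2 * α * h * q * q / (2 * α) = h * q ^ 2 := by field_simp
  have e2 : 2 * α * h * q / q = 2 * α * h := by field_simp
  have e3 : y - (y - α * (1 - 3 * h) * q) = α * (1 - 3 * h) * q := by ring
  rw [e1, e2, e3] at hmain
  refine ⟨q, hqN, ?_⟩
  have e4 := intervalIntegral.mul_integral_comp_mul_right (f := fun t => u (α * (1 - 3 * h) * q) t)
    (a := 1 - h) (b := 1) (c := q ^ 2)
  rw [one_mul, show (1 - h) * q ^ 2 = q ^ 2 - h * q ^ 2 by ring] at e4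
  rw [← e4] at hmain
  have hKq : K / q ^ 2 ≤ α * K * h := by
    rw [div_le_iff₀ (by positivity)]
    nlinarith
  have h6 : q ^ 2 * (h * (ustar - 3 * α * K * h)) ≤ h * q ^ 2 * (ustar - K * (2 * α * h) - K / q ^ 2) := by
    have : 0 < h * q ^ 2 := by positivity
    nlinarith
  exact le_of_mul_le_mul_left (h6.trans hmain) (by positivity)

lemma psi_eq_of_abs_le_mul (hα : 0 < α) {h l z r : ℝ} (hh : 0 < h) (hh1 : h < 1) (hl : 0 < l)
    (hz : |z| ≤ α * (1 - h) * l) (hr : (1 - h) * l ^ 2 ≤ r) : psi α β z r = PsiP α β α := by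
  have h1 : 0 < 1 - h := by linarith
  have h2 : 0 < (1 - h) * l ^ 2 := by positivity
  refine psi_eq_of_le (h2.trans_le hr) (hz.trans ?_)
  have h3 : (1 - h) * l ≤ Real.sqrt r := Real.le_sqrt_of_sq_le (by nlinarith [mul_pos h1 (pow_pos hl 2)])
  calc α * (1 - h) * l = α * ((1 - h) * l) := by ring
    _ ≤ _ := mul_le_mul_of_nonneg_left h3 hα.le

lemma timeIntegral_v_eq (S : CSol α β ustar u p w pstar) {h l z : ℝ} (hh : 0 < h) (hh1 : h < 1) (hl : 0 < l)
    (hz : |z| ≤ α * (1 - h) * l) :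
    ∫ r in ((1 - h) * l ^ 2)..(l ^ 2), (u z r - psi α β z r)
      = (∫ r in ((1 - h) * l ^ 2)..(l ^ 2), u z r) - PsiP α β α * (h * l ^ 2) := by
  have h1 : 0 < 1 - h := by linarith
  have h2 : (1 - h) * l ^ 2 ≤ l ^ 2 := by nlinarith [pow_pos hl 2]
  have e : ∫ r in ((1 - h) * l ^ 2)..(l ^ 2), (u z r - psi α β z r)
      = ∫ r in ((1 - h) * l ^ 2)..(l ^ 2), (u z r - PsiP α β α) :=
    intervalIntegral.integral_congr fun r hr => by
      rw [uIcc_of_le h2] at hr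
      simp only [psi_eq_of_abs_le_mul S.hα hh hh1 hl hz hr.1]
  rw [e, intervalIntegral.integral_sub (S.intervalIntegrable_u z (by positivity) h2) intervalIntegrable_const,
    intervalIntegral.integral_const, smul_eq_mul]
  ring

lemma exists_timeIntegral_bounds (S : CSol α β ustar u p w pstar) (hV : RayConv u V)
    (hunb : ∀ X, ∃ y t, X ≤ y ∧ 0 ≤ t ∧ p y t ≠ 0) :
    ∃ K > 0, ∀ h, 0 < h → h ≤ 1 / 4 → ∀ᶠ l : ℝ in atTop, ∀ z, α * (1 - 3 * h) * l ≤ z →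
      z ≤ (1 + h / 2) * ((1 + h / 2) * (α * (1 - 3 * h) * l)) →
      h * (ustar - K * h) * l ^ 2 ≤ ∫ r in ((1 - h) * l ^ 2)..(l ^ 2), u z r ∧
      ∫ r in ((1 - h) * l ^ 2)..(l ^ 2), u z r ≤ h * (ustar + h) * l ^ 2 := by
  obtain ⟨K, hK, hlow⟩ := S.inner_limit_ge hunb
  obtain ⟨C, hC, T, hT, hceil⟩ := S.exists_ceiling
  have hα := S.hα
  have hΨ := PsiP_self_pos hα S.hβ
  refine ⟨2 * K + PsiP α β α * α ^ 2 + 3, by positivity, fun h hh hh4 => ?_⟩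
  obtain ⟨c, hc⟩ := S.tendsto_timeIntegral hV (ξ := α * (1 - 3 * h)) (a := 1 - h) (b := 1)
    (mul_pos hα (by linarith)) (by linarith) (by linarith)
  have hcl := hlow h hh hh4 c hc
  have hh2 : 0 < h ^ 2 := by positivity
  have hev := hc.eventually_const_lt (show c - h ^ 2 < c by linarith)
  have hsq : Tendsto (fun l : ℝ => l ^ 2) atTop atTop := tendsto_pow_atTop two_ne_zero
  filter_upwards [hev, eventually_ge_atTop 1, hsq.eventually_ge_atTop (2 * T + 2 * C / h)] with l hl hl1 hlT z hz1 hz2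
  have hl0 : 0 < l := by linarith
  have h1 : 0 < 1 - h := by linarith
  have h13 : 0 < 1 - 3 * h := by linarith
  have hl2 : 0 < l ^ 2 := by positivity
  have hst : (1 - h) * l ^ 2 ≤ l ^ 2 := by nlinarith
  have hs0 : 0 < (1 - h) * l ^ 2 := by positivity
  have hCh : 0 < C / h := by positivity
  have hTs : T ≤ (1 - h) * l ^ 2 := by
    have e : 2 * C / h = 2 * (C / h) := by ring
    nlinarith
  have hupper : ∀ y, ∫ r in ((1 - h) * l ^ 2)..(l ^ 2), u y r ≤ h * (ustar + h) * l ^ 2 := fun y => by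
    have h3 := intervalIntegral.integral_mono_on (μ := volume) hst
      (S.intervalIntegrable_u y hs0.le hst) (intervalIntegrable_const (c := ustar + h)) fun r hr => by
        have h4 := hceil y r (hTs.trans hr.1)
        have h5 : C / r ≤ h := by
          rw [div_le_iff₀ (hs0.trans_le hr.1)]
          have : 2 * C / h ≤ l ^ 2 := by linarith
          rw [div_le_iff₀ hh] at this
          have h7 := hr.1
          nlinarith
        linarith
    rw [intervalIntegral.integral_const, smul_eq_mul] at h3
    linarith
  refine ⟨?_, hupper z⟩
  set x := α * (1 - 3 * h) * l with hx
  have hx0 : 0 < x := by positivity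
  have hxq : (1 + h / 2) * ((1 + h / 2) * x) ≤ α * (1 - h) * l := by
    have e : (1 + h / 2) * ((1 + h / 2) * (1 - 3 * h)) ≤ 1 - h := by nlinarith [mul_pos hh hh2]
    calc (1 + h / 2) * ((1 + h / 2) * x) = (1 + h / 2) * ((1 + h / 2) * (1 - 3 * h)) * (α * l) := by rw [hx]; ring
      _ ≤ (1 - h) * (α * l) := mul_le_mul_of_nonneg_right e (by positivity)
      _ = _ := by ring
  have hd : z - x ≤ α * h * l := by
    have e : (1 + h / 2) * ((1 + h / 2) * (1 - 3 * h)) - (1 - 3 * h) ≤ h := by nlinarith [mul_pos hh hh2]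
    have := mul_le_mul_of_nonneg_right e (show 0 ≤ α * l by positivity)
    have e2 : (1 + h / 2) * ((1 + h / 2) * x) - x
      = ((1 + h / 2) * ((1 + h / 2) * (1 - 3 * h)) - (1 - 3 * h)) * (α * l) := by rw [hx]; ring
    linarith
  have hsc := S.timeIntegral_semiconvex (d := z - x) x hs0.le hst (by linarith)
  have hx2 : α * h * l ≤ x := by
    rw [hx]
    have : α * h * l = h * (α * l) := by ring
    rw [this, show α * (1 - 3 * h) * l = (1 - 3 * h) * (α * l) by ring]
    exact mul_le_mul_of_nonneg_right (by linarith) (by positivity)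
  have ez : x + (z - x) = z := by ring
  rw [ez, S.timeIntegral_v_eq hh (by linarith) hl0 (z := x) (by rw [abs_of_pos hx0]; linarith),
    S.timeIntegral_v_eq hh (by linarith) hl0 (z := z) (by rw [abs_of_pos (by linarith)]; linarith),
    S.timeIntegral_v_eq hh (by linarith) hl0 (z := x - (z - x)) (by
      rw [abs_of_nonneg (by linarith)]; linarith)] at hsc
  have hup2 := hupper (x - (z - x))
  have hxx : (h * (ustar - K * h) - h ^ 2) * l ^ 2 ≤ ∫ r in ((1 - h) * l ^ 2)..(l ^ 2), u x r := by
    have e4 := intervalIntegral.mul_integral_comp_mul_right (f := fun t => u x t)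
      (a := 1 - h) (b := 1) (c := l ^ 2)
    rw [one_mul] at e4
    rw [← e4, mul_comm]
    exact mul_le_mul_of_nonneg_left (by linarith) hl2.le
  have hd2 : PsiP α β α * (z - x) ^ 2 ≤ PsiP α β α * (α * h * l) ^ 2 :=
    mul_le_mul_of_nonneg_left (pow_le_pow_left₀ (by linarith) hd 2) hΨ.le
  nlinarith

end CSol

lemma continuous_scaled_integral {f : ℝ → ℝ} (hf : ∀ a b, IntervalIntegrable f volume a b) (q : ℝ) :
    Continuous fun z => ∫ x in z..(q * z), f x := by
  have e : (fun z => ∫ x in z..(q * z), f x)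
      = fun z => (∫ x in (0:ℝ)..(q * z), f x) - ∫ x in (0:ℝ)..z, f x := by
    funext z
    rw [intervalIntegral.integral_interval_sub_left (hf _ _) (hf _ _)]
  rw [e]
  have hp := intervalIntegral.continuous_primitive (μ := volume) hf 0
  exact (hp.comp (continuous_const.mul continuous_id)).sub hp

namespace CSol
variable {α β ustar : ℝ} {u p w : ℝ → ℝ → ℝ} {pstar : ℝ → ℝ} {V : ℝ → ℝ}

lemma net_eq (S : CSol α β ustar u p w pstar) {h l : ℝ} (hh : 0 < h) (hh1 : h < 1) (hl : 0 < l) :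
    ∀ᵐ x, 0 < x → x ≤ α * (1 - h) * l →
      ((u x (l ^ 2) - psi α β x (l ^ 2)) - (u x ((1 - h) * l ^ 2) - psi α β x ((1 - h) * l ^ 2)))
        + ∫ r in ((1 - h) * l ^ 2)..(l ^ 2), p x r * u x r
      = (u x (l ^ 2) - u x ((1 - h) * l ^ 2)) + pstar x * ∫ r in ((1 - h) * l ^ 2)..(l ^ 2), u x r := by
  filter_upwards [S.ae_condP] with x hx hx0 hxl
  have hα := S.hα
  have h1 : 0 < 1 - h := by linarith
  have hst : (1 - h) * l ^ 2 ≤ l ^ 2 := by nlinarith [pow_pos hl 2]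
  have hxa : |x| ≤ α * (1 - h) * l := by rwa [abs_of_pos hx0]
  rw [psi_eq_of_abs_le_mul hα hh hh1 hl hxa hst, psi_eq_of_abs_le_mul hα hh hh1 hl hxa le_rfl,
    ← intervalIntegral.integral_const_mul]
  congr 1
  · ring
  · refine intervalIntegral.integral_congr_ae (Eventually.of_forall fun r hr => ?_)
    rw [uIoc_of_le hst] at hr
    rw [hx r ?_, abs_of_pos hx0]
    refine lt_of_le_of_lt ?_ hr.1
    rw [div_le_iff₀ (by positivity)]
    calc x ^ 2 ≤ (α * (1 - h) * l) ^ 2 := pow_le_pow_left₀ hx0.le hxl 2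
      _ = (1 - h) * ((1 - h) * l ^ 2 * α ^ 2) := by ring
      _ ≤ 1 * ((1 - h) * l ^ 2 * α ^ 2) := mul_le_mul_of_nonneg_right (by linarith) (by positivity)
      _ = _ := one_mul _

/-- Scaled second difference of the time-integrated equation. -/
lemma double_integral_source (S : CSol α β ustar u p w pstar) {h l q X : ℝ} (hh : 0 < h) (hh1 : h < 1)
    (hl : 0 < l) (hq : 1 ≤ q) (hX : 0 < X) (hqX : q * (q * X) ≤ α * (1 - h) * l) :
    ∫ z in X..(q * X), ∫ x in z..(q * z), pstar x *
        ((∫ r in ((1 - h) * l ^ 2)..(l ^ 2), (u x r - psi α β x r)) + PsiP α β α * (h * l ^ 2))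
      = (∫ r in ((1 - h) * l ^ 2)..(l ^ 2), u (q * (q * X)) r) / q
        - (∫ r in ((1 - h) * l ^ 2)..(l ^ 2), u (q * X) r)
        - (∫ r in ((1 - h) * l ^ 2)..(l ^ 2), u (q * X) r) / q
        + (∫ r in ((1 - h) * l ^ 2)..(l ^ 2), u X r)
        - (∫ z in X..(q * X), ∫ x in z..(q * z), u x (l ^ 2))
        + ∫ z in X..(q * X), ∫ x in z..(q * z), u x ((1 - h) * l ^ 2) := by
  have hα := S.hα
  have hq0 : 0 < q := by linarith
  have h1 : 0 < 1 - h := by linarith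
  have hst : (1 - h) * l ^ 2 ≤ l ^ 2 := by nlinarith [pow_pos hl 2]
  have hs0 : 0 < (1 - h) * l ^ 2 := by positivity
  have hXq : X ≤ q * X := le_mul_of_one_le_left hX.le hq
  have hXqq : q * X ≤ q * (q * X) := le_mul_of_one_le_left (hX.le.trans hXq) hq
  set s := (1 - h) * l ^ 2 with hs
  set c := PsiP α β α * (h * l ^ 2) with hc
  set U : ℝ → ℝ := fun x => ∫ r in s..(l ^ 2), (u x r - psi α β x r) with hU
  set W : ℝ → ℝ := fun x => ∫ r in s..(l ^ 2), w x r with hW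
  set net : ℝ → ℝ := fun x => ((u x (l ^ 2) - psi α β x (l ^ 2)) - (u x s - psi α β x s))
    + ∫ r in s..(l ^ 2), p x r * u x r with hnet
  have hUd : ∀ x, HasDerivAt U (W x) x := S.hasDerivAt_timeIntegral hs0.le hst
  have hUc : Continuous U := continuous_iff_continuousAt.2 fun x => (hUd x).continuousAt
  have hnetI : ∀ a b, IntervalIntegrable net volume a b := fun a b => S.intervalIntegrable_net a b hs0.le hst
  have hGd : ∀ z, HasDerivAt (fun z => U (q * z) / q - U z) (W (q * z) - W z) z := fun z => by
    have h2 := ((hUd (q * z)).comp z ((hasDerivAt_id z).const_mul q)).div_const q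
    refine (h2.sub (hUd z)).congr_deriv ?_
    field_simp
  have hW2 : ∀ z, 0 ≤ z → W (q * z) - W z = ∫ x in z..(q * z), net x := fun z hz =>
    S.timeIntegral_w_sub (le_mul_of_one_le_left hz hq) hs0.le hst
  have hcnet := continuous_scaled_integral hnetI q
  have hFTC : ∫ z in X..(q * X), ∫ x in z..(q * z), net x
      = (U (q * (q * X)) / q - U (q * X)) - (U (q * X) / q - U X) := by
    rw [← intervalIntegral.integral_eq_sub_of_hasDerivAt (fun z _ => hGd z)]
    · refine intervalIntegral.integral_congr fun z hz => ?_
      rw [uIcc_of_le hXq] at hz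
      exact (hW2 z (hX.le.trans hz.1)).symm
    · refine (hcnet.intervalIntegrable X (q * X)).congr fun z hz => ?_
      rw [uIoc_of_le hXq] at hz
      exact (hW2 z (hX.le.trans hz.1.le)).symm
  have hcu : ∀ t, 0 < t → ∀ a b, IntervalIntegrable (fun x => u x t) volume a b := fun t ht a b =>
    (S.cont_slice_u ht).intervalIntegrable a b
  have hcp : ∀ a b, IntervalIntegrable (fun x => pstar x * (U x + c)) volume a b := fun a b =>
    (S.pstar_intervalIntegrable a b).mul_continuousOn (hUc.add continuous_const).continuousOn
  have hreg : ∀ x, 0 < x → x ≤ α * (1 - h) * l → U x = (∫ r in s..(l ^ 2), u x r) - c := fun x hx0 hx =>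
    S.timeIntegral_v_eq hh hh1 hl (by rwa [abs_of_pos hx0])
  have hsplit : ∀ z, X ≤ z → z ≤ q * X → ∫ x in z..(q * z), net x
      = (∫ x in z..(q * z), u x (l ^ 2)) - (∫ x in z..(q * z), u x s) + ∫ x in z..(q * z), pstar x * (U x + c) := by
    intro z hz1 hz2
    have hz0 : 0 < z := hX.trans_le hz1
    have hzq : z ≤ q * z := le_mul_of_one_le_left hz0.le hq
    have hzq2 : q * z ≤ q * (q * X) := mul_le_mul_of_nonneg_left hz2 hq0.le
    rw [← intervalIntegral.integral_sub (hcu _ (by positivity) _ _) (hcu _ hs0 _ _),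
      ← intervalIntegral.integral_add ((hcu _ (by positivity) _ _).sub (hcu _ hs0 _ _)) (hcp _ _)]
    refine intervalIntegral.integral_congr_ae ?_
    filter_upwards [S.net_eq hh hh1 hl] with x hx hxI
    rw [uIoc_of_le hzq] at hxI
    have hx0 : 0 < x := hz0.trans hxI.1
    have hxl : x ≤ α * (1 - h) * l := hxI.2.trans (hzq2.trans hqX)
    have := hx hx0 hxl
    simp only [hnet]
    rw [this, hreg x hx0 hxl]
    ring
  have hsplit2 : ∫ z in X..(q * X), ∫ x in z..(q * z), net x
      = (∫ z in X..(q * X), ∫ x in z..(q * z), u x (l ^ 2)) - (∫ z in X..(q * X), ∫ x in z..(q * z), u x s)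
        + ∫ z in X..(q * X), ∫ x in z..(q * z), pstar x * (U x + c) := by
    have c1 := (continuous_scaled_integral (hcu (l ^ 2) (by positivity)) q).intervalIntegrable (μ := volume) X (q * X)
    have c2 := (continuous_scaled_integral (hcu s hs0) q).intervalIntegrable (μ := volume) X (q * X)
    have c3 := (continuous_scaled_integral hcp q).intervalIntegrable (μ := volume) X (q * X)
    rw [← intervalIntegral.integral_sub c1 c2, ← intervalIntegral.integral_add (c1.sub c2) c3]
    refine intervalIntegral.integral_congr fun z hz => ?_
    rw [uIcc_of_le hXq] at hz
    exact hsplit z hz.1 hz.2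
  rw [hFTC] at hsplit2
  rw [hreg _ hX (hXq.trans (hXqq.trans hqX)), hreg _ (hX.trans_le hXq) (hXqq.trans hqX),
    hreg _ (hX.trans_le (hXq.trans hXqq)) hqX] at hsplit2
  have e : ∀ a b d : ℝ, (a - c) / q - (b - c) - ((b - c) / q - (d - c)) = a / q - b - b / q + d := fun a b d => by
    field_simp; ring
  rw [e] at hsplit2
  linarith

end CSol

namespace CSol
variable {α β ustar : ℝ} {u p w : ℝ → ℝ → ℝ} {pstar : ℝ → ℝ} {V : ℝ → ℝ}

lemma integrableOn_Ioi (S : CSol α β ustar u p w pstar) (x : ℝ) : IntegrableOn pstar (Ioi x) := by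
  refine ((S.integrableOn_pstar).union (t := Ioc x 0) ?_).mono_set fun y hy => ?_
  · rcases le_total x 0 with h | h
    · exact (intervalIntegrable_iff_integrableOn_Ioc_of_le h).1 (S.pstar_intervalIntegrable x 0)
    · simp [Ioc_eq_empty_of_le h]
  · rcases lt_or_ge 0 y with h | h
    · exact Or.inl h
    · exact Or.inr ⟨hy, h⟩

lemma tail_sub (S : CSol α β ustar u p w pstar) (a b : ℝ) :
    (∫ x in Ioi a, pstar x) - ∫ x in Ioi b, pstar x = ∫ x in a..b, pstar x :=
  intervalIntegral.integral_Ioi_sub_Ioi' (S.integrableOn_Ioi a) (S.integrableOn_Ioi b)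

lemma tail_antitone (S : CSol α β ustar u p w pstar) : Antitone fun x => ∫ ξ in Ioi x, pstar ξ :=
  fun a b hab => by
    have := S.tail_sub a b
    have h := S.integral_pstar_nonneg hab
    simp only
    linarith

lemma tendsto_tail (S : CSol α β ustar u p w pstar) :
    Tendsto (fun x => ∫ ξ in Ioi x, pstar ξ) atTop (nhds 0) := by
  have h := intervalIntegral_tendsto_integral_Ioi 0 (S.integrableOn_Ioi 0) tendsto_id
  have h2 := (tendsto_const_nhds (x := ∫ ξ in Ioi 0, pstar ξ)).sub h
  rw [sub_self] at h2
  refine h2.congr fun x => ?_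
  rw [id, ← S.tail_sub 0 x]; ring

lemma tail_eq_zero (S : CSol α β ustar u p w pstar) {X x : ℝ} (hx : max X 0 ≤ x)
    (h : ∀ y t, X ≤ y → 0 ≤ t → p y t = 0) : ∫ ξ in Ioi x, pstar ξ = 0 := by
  refine tendsto_nhds_unique ?_ S.tendsto_tail
  refine tendsto_const_nhds.congr' ?_
  filter_upwards [eventually_ge_atTop x] with z hz
  have h1 := S.tail_sub x z
  rw [S.integral_pstar_eq_zero ((le_max_right _ _).trans hx) hz fun y t h1 _ ht =>
    h y t ((le_max_left _ _).trans (hx.trans h1.le)) ht] at h1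
  linarith

lemma scaled_second_difference (S : CSol α β ustar u p w pstar) {q : ℝ} (hq : 0 < q) (y : ℝ) :
    ∫ z in y..(q * y), ∫ x in z..(q * z), pstar x
      = (∫ x in y..(q * y), ∫ ξ in Ioi x, pstar ξ)
        - (∫ x in (q * y)..(q * (q * y)), ∫ ξ in Ioi x, pstar ξ) / q := by
  have hF := S.tail_antitone
  have h1 : ∫ z in y..(q * y), ∫ x in z..(q * z), pstar x
      = ∫ z in y..(q * y), ((∫ ξ in Ioi z, pstar ξ) - ∫ ξ in Ioi (q * z), pstar ξ) :=
    intervalIntegral.integral_congr fun z _ => (S.tail_sub z (q * z)).symm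
  have hF2 : Antitone fun z => ∫ ξ in Ioi (q * z), pstar ξ := fun a b hab =>
    hF (mul_le_mul_of_nonneg_left hab hq.le)
  rw [h1, intervalIntegral.integral_sub hF.intervalIntegrable hF2.intervalIntegrable]
  have h2 := intervalIntegral.mul_integral_comp_mul_left (f := fun x => ∫ ξ in Ioi x, pstar ξ) (a := y)
    (b := q * y) (c := q)
  rw [← h2]
  field_simp

lemma scaled_difference_bounds (S : CSol α β ustar u p w pstar) (hV : RayConv u V)
    (hunb : ∀ X, ∃ y t, X ≤ y ∧ 0 ≤ t ∧ p y t ≠ 0) :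
    ∃ K > 0, ∀ h, 0 < h → h ≤ 1 / 4 → ∃ A, 0 ≤ A ∧ ∀ δ > 0, ∀ᶠ y in atTop,
      (ustar - K * h) * (∫ z in y..((1 + h / 2) * y), ∫ x in z..((1 + h / 2) * z), pstar x) ≤ A + δ ∧
      A - δ ≤ (ustar + h) * ∫ z in y..((1 + h / 2) * y), ∫ x in z..((1 + h / 2) * z), pstar x := by
  obtain ⟨K, hK, hbd⟩ := S.exists_timeIntegral_bounds hV hunb
  have hα := S.hα
  refine ⟨K, hK, fun h hh hh4 => ?_⟩
  have hb := hbd h hh hh4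
  have h1 : 0 < 1 - h := by linarith
  have h13 : 0 < 1 - 3 * h := by linarith
  set q := 1 + h / 2 with hq
  have hq1 : 1 ≤ q := by linarith
  have hq0 : 0 < q := by linarith
  set x := α * (1 - 3 * h) with hx
  have hx0 : 0 < x := by positivity
  have hxq : x ≤ q * x := le_mul_of_one_le_left hx0.le hq1
  obtain ⟨c1, hc1⟩ := S.tendsto_timeIntegral hV (ξ := x) (a := 1 - h) (b := 1) hx0 h1.le (by linarith)
  obtain ⟨c2, hc2⟩ := S.tendsto_timeIntegral hV (ξ := q * x) (a := 1 - h) (b := 1) (by positivity) h1.le (by linarith)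
  obtain ⟨c3, hc3⟩ := S.tendsto_timeIntegral hV (ξ := q * (q * x)) (a := 1 - h) (b := 1) (by positivity) h1.le
    (by linarith)
  obtain ⟨d1, hd1⟩ := S.tendsto_doubleIntegral hV (σ := 1) (x := x) (q := q) one_pos hx0.le hq1
  obtain ⟨d2, hd2⟩ := S.tendsto_doubleIntegral hV (σ := 1 - h) (x := x) (q := q) h1 hx0.le hq1
  have hA := ((((hc3.div_const q).sub hc2).sub (hc2.div_const q)).add hc1).sub hd1 |>.add hd2
  set Ainf := c3 / q - c2 - c2 / q + c1 - d1 + d2 with hAinf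
  set src : ℝ → ℝ := fun l => ∫ z in (x * l)..(q * (x * l)), ∫ y in z..(q * z), pstar y *
        ((∫ r in ((1 - h) * l ^ 2)..(l ^ 2), (u y r - psi α β y r)) + PsiP α β α * (h * l ^ 2)) with hsrc
  have hxe : q * (q * x) ≤ α * (1 - h) := by
    have e : q * (q * (1 - 3 * h)) ≤ 1 - h := by rw [hq]; nlinarith [mul_pos hh (mul_pos hh hh), mul_pos hh hh]
    calc q * (q * x) = α * (q * (q * (1 - 3 * h))) := by rw [hx]; ring
      _ ≤ _ := mul_le_mul_of_nonneg_left e hα.le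
  have hscale : ∀ a b ξ l : ℝ, ∫ r in (a * l ^ 2)..(b * l ^ 2), u ξ r = l ^ 2 * ∫ σ in a..b, u ξ (σ * l ^ 2) :=
    fun a b ξ l => (intervalIntegral.mul_integral_comp_mul_right (f := fun t => u ξ t) (a := a) (b := b)
      (c := l ^ 2)).symm
  have hscale2 : ∀ t l : ℝ, ∫ z in (x * l)..(q * (x * l)), ∫ y in z..(q * z), u y t
      = l ^ 2 * ∫ z in x..(q * x), ∫ y in z..(q * z), u (y * l) t := fun t l => by
    have e1 := intervalIntegral.mul_integral_comp_mul_right (f := fun z => ∫ y in z..(q * z), u y t) (a := x)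
      (b := q * x) (c := l)
    have e3 : ∫ z in x..(q * x), ∫ y in (z * l)..(q * (z * l)), u y t
        = ∫ z in x..(q * x), l * ∫ y in z..(q * z), u (y * l) t :=
      intervalIntegral.integral_congr fun z _ => by
        have e2 := intervalIntegral.mul_integral_comp_mul_right (f := fun y => u y t) (a := z) (b := q * z) (c := l)
        rw [mul_assoc] at e2
        exact e2.symm
    rw [e3, intervalIntegral.integral_const_mul, mul_assoc q x l] at e1
    rw [← e1]
    ring
  have hlim : Tendsto (fun l => src l / l ^ 2) atTop (nhds Ainf) := by
    refine hA.congr' ?_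
    filter_upwards [eventually_gt_atTop 0] with l hl
    have hid := S.double_integral_source (q := q) (X := x * l) hh (by linarith) hl hq1 (by positivity)
      (by have := mul_le_mul_of_nonneg_right hxe hl.le; linarith)
    rw [hsrc]
    simp only
    rw [hid]
    have e1 := fun ξ => hscale (1 - h) 1 ξ l
    simp only [one_mul] at e1
    rw [e1, e1, e1, hscale2, hscale2]
    have hl2 : l ^ 2 ≠ 0 := by positivity
    simp only [one_mul]
    rw [show q * (q * (x * l)) = q * (q * x) * l by ring, show q * (x * l) = q * x * l by ring]
    field_simp
  have hUc : ∀ l, 0 < l → Continuous fun y => (∫ r in ((1 - h) * l ^ 2)..(l ^ 2), (u y r - psi α β y r))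
      + PsiP α β α * (h * l ^ 2) := fun l hl => by
    have hst : (1 - h) * l ^ 2 ≤ l ^ 2 := by nlinarith [pow_pos hl 2]
    exact (continuous_iff_continuousAt.2 fun y =>
      (S.hasDerivAt_timeIntegral (by positivity) hst y).continuousAt).add continuous_const
  -- comparison of `src` with the scaled second difference of the tail
  have hcmp : ∀ᶠ l : ℝ in atTop,
      h * (ustar - K * h) * (∫ z in (x * l)..(q * (x * l)), ∫ y in z..(q * z), pstar y) ≤ src l / l ^ 2 ∧
      src l / l ^ 2 ≤ h * (ustar + h) * (∫ z in (x * l)..(q * (x * l)), ∫ y in z..(q * z), pstar y) ∧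
      0 ≤ src l / l ^ 2 := by
    filter_upwards [hb, eventually_gt_atTop 0] with l hl hl0
    have hl2 : 0 < l ^ 2 := by positivity
    have hXq : x * l ≤ q * (x * l) := le_mul_of_one_le_left (by positivity) hq1
    have hst : (1 - h) * l ^ 2 ≤ l ^ 2 := by nlinarith [pow_pos hl0 2]
    have hpI : ∀ a b, IntervalIntegrable (fun y => pstar y *
        ((∫ r in ((1 - h) * l ^ 2)..(l ^ 2), (u y r - psi α β y r)) + PsiP α β α * (h * l ^ 2))) volume a b :=
      fun a b => (S.pstar_intervalIntegrable a b).mul_continuousOn (hUc l hl0).continuousOn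
    have hreg : ∀ z y, x * l ≤ z → z ≤ q * (x * l) → z ≤ y → y ≤ q * z →
        (∫ r in ((1 - h) * l ^ 2)..(l ^ 2), (u y r - psi α β y r)) + PsiP α β α * (h * l ^ 2)
          = ∫ r in ((1 - h) * l ^ 2)..(l ^ 2), u y r := by
      intro z y hz1 hz2 hy1 hy2
      have hy0 : 0 < y := (show 0 < x * l by positivity).trans_le (hz1.trans hy1)
      have : y ≤ α * (1 - h) * l := by
        have e1 := mul_le_mul_of_nonneg_left hz2 hq0.le
        have e2 := mul_le_mul_of_nonneg_right hxe hl0.le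
        linarith
      rw [S.timeIntegral_v_eq hh (by linarith) hl0 (by rwa [abs_of_pos hy0])]
      ring
    have hcont := fun c : ℝ => (continuous_scaled_integral
      (fun a b => (S.pstar_intervalIntegrable a b).const_mul c) q).intervalIntegrable (μ := volume) (x * l) (q * (x * l))
    have hcs := (continuous_scaled_integral hpI q).intervalIntegrable (μ := volume) (x * l) (q * (x * l))
    have hmul : ∀ c : ℝ, ∫ z in (x * l)..(q * (x * l)), ∫ y in z..(q * z), c * pstar y
        = c * ∫ z in (x * l)..(q * (x * l)), ∫ y in z..(q * z), pstar y := fun c => by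
      rw [← intervalIntegral.integral_const_mul]
      exact intervalIntegral.integral_congr fun z _ => intervalIntegral.integral_const_mul _ _
    have hzq : ∀ z, x * l ≤ z → z ≤ q * z := fun z hz =>
      le_mul_of_one_le_left ((show 0 ≤ x * l by positivity).trans hz) hq1
    have hzU : ∀ z y, x * l ≤ z → z ≤ q * (x * l) → z ≤ y → y ≤ q * z → y ≤ q * (q * (x * l)) :=
      fun z y _ hz2 _ hy2 => hy2.trans (mul_le_mul_of_nonneg_left hz2 hq0.le)
    refine ⟨?_, ?_, ?_⟩
    · rw [le_div_iff₀ hl2]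
      have := intervalIntegral.integral_mono_on (μ := volume) hXq (hcont (h * (ustar - K * h) * l ^ 2)) hcs
        fun z hz => intervalIntegral.integral_mono_on (μ := volume) (hzq z hz.1)
          ((S.pstar_intervalIntegrable _ _).const_mul _) (hpI _ _) fun y hy => by
            rw [hreg z y hz.1 hz.2 hy.1 hy.2, mul_comm]
            exact mul_le_mul_of_nonneg_left (hl y (hz.1.trans hy.1) (hzU z y hz.1 hz.2 hy.1 hy.2)).1 (S.h01 y).1
      rw [hmul] at this
      linarith
    · rw [div_le_iff₀ hl2]
      have := intervalIntegral.integral_mono_on (μ := volume) hXq hcs (hcont (h * (ustar + h) * l ^ 2))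
        fun z hz => intervalIntegral.integral_mono_on (μ := volume) (hzq z hz.1) (hpI _ _)
          ((S.pstar_intervalIntegrable _ _).const_mul _) fun y hy => by
            rw [hreg z y hz.1 hz.2 hy.1 hy.2, mul_comm _ (pstar y)]
            exact mul_le_mul_of_nonneg_left (hl y (hz.1.trans hy.1) (hzU z y hz.1 hz.2 hy.1 hy.2)).2 (S.h01 y).1
      rw [hmul] at this
      linarith
    · refine div_nonneg (intervalIntegral.integral_nonneg hXq fun z hz =>
        intervalIntegral.integral_nonneg (hzq z hz.1) fun y hy => ?_) hl2.le
      rw [hreg z y hz.1 hz.2 hy.1 hy.2]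
      exact mul_nonneg (S.h01 y).1 (intervalIntegral.integral_nonneg hst fun r hr =>
        S.u_nonneg y ((show 0 ≤ (1 - h) * l ^ 2 by positivity).trans hr.1))
  have hA0 : 0 ≤ Ainf := ge_of_tendsto hlim (hcmp.mono fun l hl => hl.2.2)
  refine ⟨Ainf / h, by positivity, fun δ hδ => ?_⟩
  have hhδ : 0 < h * δ := by positivity
  have e1 := hlim.eventually_lt_const (show Ainf < Ainf + h * δ by linarith)
  have e2 := hlim.eventually_const_lt (show Ainf - h * δ < Ainf by linarith)
  have hscl : Tendsto (fun y : ℝ => y / x) atTop atTop := tendsto_id.atTop_div_const hx0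
  filter_upwards [hscl.eventually hcmp, hscl.eventually e1, hscl.eventually e2] with y hy hy1 hy2
  rw [mul_div_cancel₀ _ hx0.ne'] at hy
  have e3 : Ainf / h + δ = (Ainf + h * δ) / h := by field_simp
  have e4 : Ainf / h - δ = (Ainf - h * δ) / h := by field_simp
  rw [e3, e4, le_div_iff₀ hh, div_le_iff₀ hh]
  constructor
  · linarith [hy.1]
  · linarith [hy.2.1]

theorem exists_tail_limit_of_rayConv (S : CSol α β ustar u p w pstar) (hV : RayConv u V) :
    ∃ γ, 0 ≤ γ ∧ Tendsto (fun x => x * ∫ ξ in Ioi x, pstar ξ) atTop (nhds γ) := by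
  by_cases hunb : ∀ X, ∃ y t, X ≤ y ∧ 0 ≤ t ∧ p y t ≠ 0
  · obtain ⟨K, hK, hb⟩ := S.scaled_difference_bounds hV hunb
    refine exists_tail_limit S.tail_antitone S.tendsto_tail S.hu hK (show (0:ℝ) < 1 / 4 by norm_num)
      fun h hh hh4 => ?_
    obtain ⟨A, hA, hAe⟩ := hb h hh hh4
    refine ⟨A, hA, fun δ hδ => ?_⟩
    filter_upwards [hAe δ hδ] with y hy
    rwa [S.scaled_second_difference (by linarith)] at hy
  · push Not at hunb
    obtain ⟨X, hX⟩ := hunb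
    refine ⟨0, le_rfl, tendsto_const_nhds.congr' ?_⟩
    filter_upwards [eventually_ge_atTop (max X 0)] with x hx
    rw [S.tail_eq_zero hx hX, mul_zero]

end CSol

/-- The Taylor coefficients of Kummer's function. -/
def kummerCoeff (a b : ℝ) (n : ℕ) : ℝ :=
  Polynomial.eval a (ascPochhammer ℝ n) / Polynomial.eval b (ascPochhammer ℝ n) / (n.factorial : ℝ)

lemma kummerM_eq (a b z : ℝ) : kummerM a b z = ∑' n : ℕ, kummerCoeff a b n * z ^ n := by
  unfold kummerM kummerCoeff
  congr 1; ext n; ring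

lemma ascPochhammer_eval_mono {a b : ℝ} (ha : 0 < a) (hab : a ≤ b) (n : ℕ) :
    Polynomial.eval a (ascPochhammer ℝ n) ≤ Polynomial.eval b (ascPochhammer ℝ n) := by
  induction n with
  | zero => simp
  | succ n ih =>
    rw [ascPochhammer_succ_eval, ascPochhammer_succ_eval]
    have h := ascPochhammer_pos n a ha
    have h' := ascPochhammer_pos n b (ha.trans_le hab)
    gcongr

lemma kummerCoeff_nonneg {a b : ℝ} (ha : 0 < a) (hab : a ≤ b) (n : ℕ) :
    0 ≤ kummerCoeff a b n := by
  have h := ascPochhammer_pos n a ha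
  have h' := ascPochhammer_pos n b (ha.trans_le hab)
  unfold kummerCoeff
  positivity

lemma kummerCoeff_le {a b : ℝ} (ha : 0 < a) (hab : a ≤ b) (n : ℕ) :
    kummerCoeff a b n ≤ 1 / (n.factorial : ℝ) := by
  have h' := ascPochhammer_pos n b (ha.trans_le hab)
  unfold kummerCoeff
  gcongr
  exact (div_le_one h').2 (ascPochhammer_eval_mono ha hab n)

lemma kummerCoeff_zero (a b : ℝ) : kummerCoeff a b 0 = 1 := by simp [kummerCoeff]

lemma kummerCoeff_abs_le {a b : ℝ} (ha : 0 < a) (hab : a ≤ b) (n : ℕ) (z : ℝ) :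
    ‖kummerCoeff a b n * z ^ n‖ ≤ |z| ^ n / (n.factorial : ℝ) := by
  rw [norm_mul, norm_pow, Real.norm_eq_abs, Real.norm_eq_abs,
    abs_of_nonneg (kummerCoeff_nonneg ha hab n)]
  calc _ ≤ 1 / (n.factorial : ℝ) * |z| ^ n := by
        gcongr; exact kummerCoeff_le ha hab n
    _ = _ := by ring

lemma kummer_summable {a b : ℝ} (ha : 0 < a) (hab : a ≤ b) (z : ℝ) :
    Summable fun n => kummerCoeff a b n * z ^ n :=
  .of_norm_bounded (Real.summable_pow_div_factorial |z|) (fun n => kummerCoeff_abs_le ha hab n z)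

lemma kummer_deriv_bound {a b : ℝ} (ha : 0 < a) (hab : a ≤ b) {R z : ℝ} (hz : |z| ≤ R) (n : ℕ) :
    ‖kummerCoeff a b n * (n * z ^ (n - 1))‖ ≤ (n * R ^ (n - 1)) / (n.factorial : ℝ) := by
  rw [norm_mul, norm_mul, norm_pow, Real.norm_eq_abs, Real.norm_eq_abs, Real.norm_eq_abs,
    abs_of_nonneg (kummerCoeff_nonneg ha hab n), abs_of_nonneg (Nat.cast_nonneg n)]
  calc _ ≤ 1 / (n.factorial : ℝ) * (n * R ^ (n - 1)) := by
        gcongr; exact kummerCoeff_le ha hab n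
    _ = _ := by ring

lemma summable_deriv_bound (R : ℝ) :
    Summable fun n : ℕ => (n * R ^ (n - 1)) / (n.factorial : ℝ) := by
  rw [← summable_nat_add_iff 1]
  refine (Real.summable_pow_div_factorial R).congr (fun n => ?_)
  rw [Nat.factorial_succ]
  have : (n.factorial : ℝ) ≠ 0 := by positivity
  push_cast
  have h2 : (n:ℝ) + 1 ≠ 0 := by positivity
  field_simp

lemma kummer_deriv_summable {a b : ℝ} (ha : 0 < a) (hab : a ≤ b) (z : ℝ) :
    Summable fun n : ℕ => kummerCoeff a b n * (n * z ^ (n - 1)) :=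
  .of_norm_bounded (summable_deriv_bound |z|) (fun n => kummer_deriv_bound ha hab le_rfl n)

lemma kummerM_hasDerivAt {a b : ℝ} (ha : 0 < a) (hab : a ≤ b) (z : ℝ) :
    HasDerivAt (kummerM a b) (∑' n : ℕ, kummerCoeff a b n * (n * z ^ (n - 1))) z := by
  have e : kummerM a b = fun z => ∑' n : ℕ, kummerCoeff a b n * z ^ n := by
    ext z; exact kummerM_eq a b z
  rw [e]
  have hz : z ∈ Metric.ball (0:ℝ) (|z| + 1) := by simp
  refine hasDerivAt_tsum_of_isPreconnected (g := fun (n : ℕ) (z : ℝ) => kummerCoeff a b n * z ^ n)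
    (g' := fun (n : ℕ) (z : ℝ) => kummerCoeff a b n * (n * z ^ (n - 1))) (y₀ := z)
    (summable_deriv_bound (|z| + 1)) Metric.isOpen_ball
    (convex_ball (0:ℝ) (|z| + 1)).isPreconnected (fun n y _ => ?_) (fun n y hy => ?_) hz
    (kummer_summable ha hab z) hz
  · exact (hasDerivAt_pow n y).const_mul _
  · exact kummer_deriv_bound ha hab (by simpa using (mem_ball_zero_iff.1 hy).le) n

lemma kummerM_zero (a b : ℝ) : kummerM a b 0 = 1 := by
  rw [kummerM_eq, tsum_eq_single 0]
  · simp [kummerCoeff_zero]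
  · intro n hn; simp [hn]

lemma kummer_mul_deriv (a b z : ℝ) :
    z * ∑' n : ℕ, kummerCoeff a b n * (n * z ^ (n - 1)) = ∑' n : ℕ, n * kummerCoeff a b n * z ^ n := by
  rw [← tsum_mul_left]
  congr 1; ext n
  cases n with
  | zero => simp
  | succ n => simp only [Nat.add_sub_cancel, pow_succ]; ring

lemma kummer_summable' {a b : ℝ} (ha : 0 < a) (hab : a ≤ b) (z : ℝ) :
    Summable fun n : ℕ => n * kummerCoeff a b n * z ^ n := by
  refine ((kummer_deriv_summable ha hab z).mul_left z).congr (fun n => ?_)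
  cases n with
  | zero => simp
  | succ n => simp only [Nat.add_sub_cancel, pow_succ]; ring

lemma ascPochhammer_shift (a : ℝ) (n : ℕ) :
    Polynomial.eval a (ascPochhammer ℝ n) * (a + n) =
      a * Polynomial.eval (a + 1) (ascPochhammer ℝ n) := by
  rw [← ascPochhammer_succ_eval, ascPochhammer_succ_left]
  simp [Polynomial.eval_comp]

lemma kummerCoeff_shift (a b : ℝ) (n : ℕ) :
    kummerCoeff a b n * (a + n) = a * kummerCoeff (a + 1) b n := by
  unfold kummerCoeff
  rw [div_mul_eq_mul_div, div_mul_eq_mul_div, ascPochhammer_shift]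
  ring

lemma kummerCoeff_succ {a b : ℝ} (hb : 0 < b) (n : ℕ) :
    kummerCoeff a b (n + 1) * ((b + n) * (n + 1)) = kummerCoeff a b n * (a + n) := by
  unfold kummerCoeff
  rw [ascPochhammer_succ_eval, ascPochhammer_succ_eval, Nat.factorial_succ]
  have h := (ascPochhammer_pos n b hb).ne'
  have h1 : b + n ≠ 0 := by positivity
  have h2 : (n:ℝ) + 1 ≠ 0 := by positivity
  have h3 : (n.factorial : ℝ) ≠ 0 := by positivity
  push_cast
  field_simp

lemma kummer_contiguous_deriv {a b : ℝ} (ha : 0 < a) (hab : a + 1 ≤ b) (z : ℝ) :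
    a * kummerM a b z + z * ∑' n : ℕ, kummerCoeff a b n * (n * z ^ (n - 1)) =
      a * kummerM (a + 1) b z := by
  have hab' : a ≤ b := by linarith
  rw [kummer_mul_deriv, kummerM_eq, kummerM_eq, ← tsum_mul_left, ← tsum_mul_left,
    ← ((kummer_summable ha hab' z).mul_left a).tsum_add (kummer_summable' ha hab' z)]
  congr 1; ext n
  rw [← mul_assoc, ← mul_assoc, ← kummerCoeff_shift]; ring

lemma kummer_contiguous {a b : ℝ} (ha : 0 < a) (hab : a + 1 ≤ b) (z : ℝ) :
    (b - a - 1) * kummerM (a + 1) b z +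
      z * ∑' n : ℕ, kummerCoeff (a + 1) b n * (n * z ^ (n - 1)) - z * kummerM (a + 1) b z =
      (b - a - 1) * kummerM a b z := by
  have hab' : a ≤ b := by linarith
  have ha1 : 0 < a + 1 := by linarith
  have hb : 0 < b := by linarith
  have s1 := (kummer_summable ha1 hab z).mul_left (b - a - 1)
  have s2 := kummer_summable' ha1 hab z
  have s3 := (kummer_summable ha hab' z).mul_left (b - a - 1)
  have key : (b - a - 1) * kummerM (a + 1) b z +
      z * (∑' n : ℕ, kummerCoeff (a + 1) b n * (n * z ^ (n - 1))) - (b - a - 1) * kummerM a b z =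
      z * kummerM (a + 1) b z := by
    rw [kummer_mul_deriv, kummerM_eq, kummerM_eq, ← tsum_mul_left, ← tsum_mul_left,
      ← tsum_mul_left, ← s1.tsum_add s2, ← (s1.add s2).tsum_sub s3,
      ((s1.add s2).sub s3).tsum_eq_zero_add]
    simp only [kummerCoeff_zero]
    rw [show (b - a - 1) * (1 * z ^ 0) + ((0:ℕ):ℝ) * 1 * z ^ 0 - (b - a - 1) * (1 * z ^ 0) = 0 by
      simp, zero_add]
    congr 1; ext n
    have e1 := kummerCoeff_shift a b (n + 1)
    have e2 := kummerCoeff_succ (a := a + 1) hb n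
    have e3 := kummerCoeff_shift a b n
    have h1 : a + 1 + n ≠ 0 := by positivity
    have h2 : (b - a - 1 + (n + 1)) * kummerCoeff (a + 1) b (n + 1) -
        (b - a - 1) * kummerCoeff a b (n + 1) = kummerCoeff (a + 1) b n := by
      push_cast at e1
      have h3 : kummerCoeff a b (n + 1) = a * kummerCoeff (a + 1) b (n + 1) / (a + 1 + n) := by
        rw [eq_div_iff h1, ← e1]; ring
      have h4 : kummerCoeff (a + 1) b n =
          kummerCoeff (a + 1) b (n + 1) * ((b + n) * (n + 1)) / (a + 1 + n) := by
        rw [eq_div_iff h1, e2]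
      rw [h3, h4]
      field_simp
      ring
    rw [← h2]
    push_cast
    ring
  linarith

/-- The inner branch of the self-similar profile. -/
def innerProfile (κ η : ℝ) : ℝ := η ^ κ * kummerM (κ / 2) (κ + 1 / 2) (-η ^ 2 / 4)

/-- The derivative of the inner branch of the self-similar profile. -/
def innerProfileDeriv (κ η : ℝ) : ℝ :=
  κ * η ^ (κ - 1) * kummerM (κ / 2 + 1) (κ + 1 / 2) (-η ^ 2 / 4)

lemma hasDerivAt_neg_sq_div (η : ℝ) : HasDerivAt (fun y : ℝ => -y ^ 2 / 4) (-η / 2) η := by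
  have h := ((hasDerivAt_pow 2 η).neg).div_const 4
  refine h.congr_deriv ?_
  simp; ring

lemma continuous_kummerM_sq {a b : ℝ} (ha : 0 < a) (hab : a ≤ b) :
    Continuous fun η : ℝ => kummerM a b (-η ^ 2 / 4) := by
  have h : Continuous (kummerM a b) :=
    continuous_iff_continuousAt.2 fun z => (kummerM_hasDerivAt ha hab z).continuousAt
  exact h.comp (by fun_prop)

lemma innerProfile_hasDerivAt {κ η : ℝ} (hκ : 1 ≤ κ) (hη : 0 < η) :
    HasDerivAt (innerProfile κ) (innerProfileDeriv κ η) η := by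
  have ha : 0 < κ / 2 := by linarith
  have hab : κ / 2 + 1 ≤ κ + 1 / 2 := by linarith
  have h1 := Real.hasDerivAt_rpow_const (x := η) (p := κ) (Or.inl hη.ne')
  have h2 := (kummerM_hasDerivAt ha (by linarith : κ / 2 ≤ κ + 1 / 2) (-η ^ 2 / 4)).comp η
    (hasDerivAt_neg_sq_div η)
  have h3 := h1.mul h2
  refine h3.congr_deriv ?_
  have hc := kummer_contiguous_deriv ha hab (-η ^ 2 / 4)
  have hp : η ^ κ = η ^ (κ - 1) * η := by
    rw [← Real.rpow_add_one hη.ne']; congr 1; ring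
  unfold innerProfileDeriv
  simp only [Function.comp]
  generalize (∑' n : ℕ, kummerCoeff (κ / 2) (κ + 1 / 2) n * (n * (-η ^ 2 / 4) ^ (n - 1))) = S at *
  rw [hp]
  generalize η ^ (κ - 1) = r
  linear_combination 2 * r * hc

lemma innerProfileDeriv_hasDerivAt {κ η : ℝ} (hκ : 1 ≤ κ) (hη : 0 < η) :
    HasDerivAt (innerProfileDeriv κ)
      (κ * (κ - 1) * innerProfile κ η / η ^ 2 - η / 2 * innerProfileDeriv κ η) η := by
  have ha : 0 < κ / 2 := by linarith
  have hab : κ / 2 + 1 ≤ κ + 1 / 2 := by linarith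
  have h1 := (Real.hasDerivAt_rpow_const (x := η) (p := κ - 1) (Or.inl hη.ne')).const_mul κ
  have h2 := (kummerM_hasDerivAt (by linarith : 0 < κ / 2 + 1) hab (-η ^ 2 / 4)).comp η
    (hasDerivAt_neg_sq_div η)
  have h3 := h1.mul h2
  refine h3.congr_deriv ?_
  have hc := kummer_contiguous ha hab (-η ^ 2 / 4)
  have hp : η ^ κ = η ^ (κ - 1 - 1) * η ^ 2 := by
    rw [← Real.rpow_natCast, ← Real.rpow_add hη]; congr 1; push_cast; ring
  have hp' : η ^ (κ - 1) = η ^ (κ - 1 - 1) * η := by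
    rw [← Real.rpow_add_one hη.ne']; congr 1; ring
  unfold innerProfileDeriv innerProfile
  simp only [Function.comp]
  generalize (∑' n : ℕ, kummerCoeff (κ / 2 + 1) (κ + 1 / 2) n * (n * (-η ^ 2 / 4) ^ (n - 1))) = S at *
  rw [hp, hp']
  generalize η ^ (κ - 1 - 1) = r
  generalize kummerM (κ / 2 + 1) (κ + 1 / 2) (-η ^ 2 / 4) = N at *
  generalize kummerM (κ / 2) (κ + 1 / 2) (-η ^ 2 / 4) = M at *
  field_simp
  linear_combination 4 * r * hc

lemma innerProfile_eventually_pos (κ : ℝ) (hκ : 1 ≤ κ) :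
    ∃ δ > 0, ∀ η, 0 < η → η < δ → 0 < innerProfile κ η ∧ 0 < innerProfileDeriv κ η := by
  have ha : 0 < κ / 2 := by linarith
  have hab : κ / 2 + 1 ≤ κ + 1 / 2 := by linarith
  have h1 : ContinuousAt (fun η : ℝ => kummerM (κ / 2) (κ + 1 / 2) (-η ^ 2 / 4)) 0 :=
    (continuous_kummerM_sq ha (by linarith : κ / 2 ≤ κ + 1 / 2)).continuousAt
  have h2 : ContinuousAt (fun η : ℝ => kummerM (κ / 2 + 1) (κ + 1 / 2) (-η ^ 2 / 4)) 0 :=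
    (continuous_kummerM_sq (by linarith : 0 < κ / 2 + 1) hab).continuousAt
  have e1 := h1.eventually (lt_mem_nhds (a := 0) (by simp [kummerM_zero]))
  have e2 := h2.eventually (lt_mem_nhds (a := 0) (by simp [kummerM_zero]))
  obtain ⟨δ, hδ, h⟩ := Metric.eventually_nhds_iff.1 (e1.and e2)
  refine ⟨δ, hδ, fun η h0 hlt => ?_⟩
  have h3 := @h η (by rw [Real.dist_eq, sub_zero, abs_of_pos h0]; exact hlt)
  have h4 : 0 < η ^ κ := Real.rpow_pos_of_pos h0 _
  have h5 : 0 < η ^ (κ - 1) := Real.rpow_pos_of_pos h0 _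
  unfold innerProfile innerProfileDeriv
  exact ⟨mul_pos h4 h3.1, mul_pos (by positivity) h3.2⟩

lemma hasDerivAt_exp_sq (η : ℝ) :
    HasDerivAt (fun y : ℝ => Real.exp (y ^ 2 / 4)) (η / 2 * Real.exp (η ^ 2 / 4)) η := by
  have := ((hasDerivAt_pow 2 η).div_const 4).exp
  refine this.congr_deriv ?_
  simp; ring

lemma innerProfile_mul_deriv_pos {κ η : ℝ} (hκ : 1 ≤ κ) (hη : 0 < η) :
    0 < innerProfile κ η * innerProfileDeriv κ η := by
  obtain ⟨δ, hδ, h⟩ := innerProfile_eventually_pos κ hκ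
  set y := min η (δ / 2)
  have hy0 : 0 < y := by positivity
  have hy := h y hy0 (by have := min_le_right η (δ / 2); linarith)
  let g : ℝ → ℝ := fun y => innerProfile κ y * innerProfileDeriv κ y * Real.exp (y ^ 2 / 4)
  have hd : ∀ z, 0 < z → HasDerivAt g ((innerProfileDeriv κ z ^ 2 +
      κ * (κ - 1) * innerProfile κ z ^ 2 / z ^ 2) * Real.exp (z ^ 2 / 4)) z := by
    intro z hz
    have := ((innerProfile_hasDerivAt hκ hz).mul (innerProfileDeriv_hasDerivAt hκ hz)).mul
      (hasDerivAt_exp_sq z)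
    refine this.congr_deriv ?_
    simp only [Pi.mul_apply]
    ring
  have hm : MonotoneOn g (Ioi 0) := by
    refine monotoneOn_of_deriv_nonneg (convex_Ioi 0) (fun z hz => (hd z hz).continuousAt.continuousWithinAt)
      (fun z hz => ?_) (fun z hz => ?_)
    · rw [interior_Ioi] at hz; exact (hd z hz).differentiableAt.differentiableWithinAt
    · rw [interior_Ioi] at hz
      rw [(hd z hz).deriv]
      have : 0 ≤ κ - 1 := by linarith
      positivity
  have h1 : g y ≤ g η := hm hy0 hη (min_le_left _ _)
  have h2 : 0 < g y := mul_pos (mul_pos hy.1 hy.2) (Real.exp_pos _)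
  exact pos_of_mul_pos_left (h2.trans_le h1) (Real.exp_pos _).le

lemma innerProfile_pos {κ η : ℝ} (hκ : 1 ≤ κ) (hη : 0 < η) : 0 < innerProfile κ η := by
  by_contra hn
  push Not at hn
  obtain ⟨δ, hδ, h⟩ := innerProfile_eventually_pos κ hκ
  set y := min η (δ / 2)
  have hy0 : 0 < y := by positivity
  have hy := h y hy0 (by have := min_le_right η (δ / 2); linarith)
  have hc : ContinuousOn (innerProfile κ) (Icc y η) := fun z hz =>
    (innerProfile_hasDerivAt hκ (hy0.trans_le hz.1)).continuousAt.continuousWithinAt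
  obtain ⟨z, hz, hz0⟩ := intermediate_value_Icc' (min_le_left _ _) hc ⟨hn, hy.1.le⟩
  have := innerProfile_mul_deriv_pos hκ (hy0.trans_le hz.1)
  rw [hz0] at this
  simp at this

lemma innerProfileDeriv_pos {κ η : ℝ} (hκ : 1 ≤ κ) (hη : 0 < η) : 0 < innerProfileDeriv κ η :=
  pos_of_mul_pos_right (innerProfile_mul_deriv_pos hκ hη) (innerProfile_pos hκ hη).le

lemma innerProfile_strictMono {κ : ℝ} (hκ : 1 ≤ κ) : StrictMonoOn (innerProfile κ) (Ioi 0) := by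
  refine strictMonoOn_of_deriv_pos (convex_Ioi 0)
    (fun z hz => (innerProfile_hasDerivAt hκ hz).continuousAt.continuousWithinAt) (fun z hz => ?_)
  rw [interior_Ioi] at hz
  rw [(innerProfile_hasDerivAt hκ hz).deriv]
  exact innerProfileDeriv_pos hκ hz

lemma innerProfile_zero {κ : ℝ} (hκ : 1 ≤ κ) : innerProfile κ 0 = 0 := by
  simp [innerProfile, Real.zero_rpow (by linarith : κ ≠ 0)]

lemma innerProfile_tendsto {κ : ℝ} (hκ : 1 ≤ κ) :
    Tendsto (innerProfile κ) (nhdsWithin 0 (Ioi 0)) (nhds 0) := by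
  have ha : 0 < κ / 2 := by linarith
  have h1 : ContinuousAt (fun η : ℝ => kummerM (κ / 2) (κ + 1 / 2) (-η ^ 2 / 4)) 0 :=
    (continuous_kummerM_sq ha (by linarith : κ / 2 ≤ κ + 1 / 2)).continuousAt
  have h2 : ContinuousAt (fun η : ℝ => η ^ κ) 0 :=
    Real.continuousAt_rpow_const _ _ (Or.inr (by linarith))
  have h3 : ContinuousAt (innerProfile κ) 0 := h2.mul h1
  have := h3.tendsto
  rw [innerProfile_zero hκ] at this
  exact this.mono_left nhdsWithin_le_nhds

lemma kappaOf_ge {γ : ℝ} (hγ : 0 ≤ γ) : 1 ≤ kappaOf γ := by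
  unfold kappaOf
  have : 1 ≤ Real.sqrt (4 * γ + 1) := Real.one_le_sqrt.2 (by linarith)
  linarith

lemma kappaOf_mul {γ : ℝ} (hγ : 0 ≤ γ) : kappaOf γ * (kappaOf γ - 1) = γ := by
  unfold kappaOf
  have := Real.sq_sqrt (by linarith : 0 ≤ 4 * γ + 1)
  linear_combination this / 4

lemma sqrt_pi_mul_erfc (η : ℝ) : Real.sqrt Real.pi * erfc (η / 2) = gaussTail η := by
  have h := integral_comp_mul_left_Ioi (fun s : ℝ => Real.exp (-s ^ 2)) η
    (by norm_num : (0:ℝ) < 1 / 2)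
  have h2 : gaussTail η = ∫ x in Ioi η, Real.exp (-(1 / 2 * x) ^ 2) := by
    unfold gaussTail
    congr 1; ext x; congr 1; ring
  rw [h2, h]
  unfold erfc
  have hp : 0 < Real.sqrt Real.pi := Real.sqrt_pos.2 Real.pi_pos
  rw [show (1:ℝ) / 2 * η = η / 2 by ring]
  simp only [smul_eq_mul]
  field_simp

/-- The derivative of the self-similar profile away from `α`. -/
def PhiDeriv (α β γ η : ℝ) : ℝ :=
  if η < α then
    ustarGamma α β γ * innerProfileDeriv (kappaOf γ) η / innerProfile (kappaOf γ) α
  else -(ustarGamma α β γ * Real.exp (-η ^ 2 / 4) / gaussTail α)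

lemma Phi_of_lt (β γ : ℝ) {α η : ℝ} (h : η < α) : Phi α β γ η =
    ustarGamma α β γ * innerProfile (kappaOf γ) η / innerProfile (kappaOf γ) α := by
  unfold Phi innerProfile
  rw [if_pos h]; ring

lemma Phi_of_ge (β γ : ℝ) {α η : ℝ} (h : α ≤ η) : Phi α β γ η =
    ustarGamma α β γ * gaussTail η / gaussTail α := by
  unfold Phi
  rw [if_neg (not_lt.2 h), ← sqrt_pi_mul_erfc, ← sqrt_pi_mul_erfc]
  have hp : Real.sqrt Real.pi ≠ 0 := (Real.sqrt_pos.2 Real.pi_pos).ne'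
  rw [mul_left_comm, mul_div_mul_left _ _ hp]

lemma Phi_self (α β γ : ℝ) : Phi α β γ α = ustarGamma α β γ := by
  rw [Phi_of_ge β γ le_rfl, mul_div_cancel_right₀ _ (gaussTail_pos α).ne']

lemma ustarGamma_eq (β γ : ℝ) {α : ℝ} (hα : 0 < α) : ustarGamma α β γ = (α * β / 2) *
    (innerProfileDeriv (kappaOf γ) α / innerProfile (kappaOf γ) α +
      Real.exp (-α ^ 2 / 4) / gaussTail α)⁻¹ := by
  unfold ustarGamma
  rw [sqrt_pi_mul_erfc]
  congr 3
  unfold innerProfile innerProfileDeriv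
  rw [show α ^ kappaOf γ = α ^ (kappaOf γ - 1) * α by
    rw [← Real.rpow_add_one hα.ne']; congr 1; ring]
  have := (Real.rpow_pos_of_pos hα (kappaOf γ - 1)).ne'
  rw [mul_comm (kappaOf γ) (α ^ _), mul_assoc, mul_assoc, mul_div_mul_left _ _ this]

lemma ustarGamma_mul {α β γ : ℝ} (hα : 0 < α) (hγ : 0 ≤ γ) : ustarGamma α β γ *
    (innerProfileDeriv (kappaOf γ) α / innerProfile (kappaOf γ) α +
      Real.exp (-α ^ 2 / 4) / gaussTail α) = α * β / 2 := by
  rw [ustarGamma_eq β γ hα]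
  have h1 := innerProfile_pos (kappaOf_ge hγ) hα
  have h2 := innerProfileDeriv_pos (kappaOf_ge hγ) hα
  have h3 := gaussTail_pos α
  rw [inv_mul_cancel_right₀]
  positivity

lemma ustarGamma_pos {α β γ : ℝ} (hα : 0 < α) (hβ : 0 < β) (hγ : 0 ≤ γ) :
    0 < ustarGamma α β γ := by
  rw [ustarGamma_eq β γ hα]
  have h1 := innerProfile_pos (kappaOf_ge hγ) hα
  have h2 := innerProfileDeriv_pos (kappaOf_ge hγ) hα
  have h3 := gaussTail_pos α
  positivity

lemma Phi_hasDerivAt {α β γ η : ℝ} (hγ : 0 ≤ γ) (h0 : 0 < η) (h : η ≠ α) :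
    HasDerivAt (Phi α β γ) (PhiDeriv α β γ η) η := by
  rcases lt_or_gt_of_ne h with h | h
  · have h1 := ((innerProfile_hasDerivAt (kappaOf_ge hγ) h0).const_mul
      (ustarGamma α β γ)).div_const (innerProfile (kappaOf γ) α)
    unfold PhiDeriv
    rw [if_pos h]
    refine h1.congr_of_eventuallyEq ?_
    filter_upwards [Iio_mem_nhds h] with y hy using Phi_of_lt β γ hy
  · have h1 := ((hasDerivAt_gaussTail η).const_mul (ustarGamma α β γ)).div_const (gaussTail α)
    unfold PhiDeriv
    rw [if_neg (not_lt.2 h.le)]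
    refine (h1.congr_of_eventuallyEq ?_).congr_deriv (by ring)
    filter_upwards [Ioi_mem_nhds h] with y hy using Phi_of_ge β γ (le_of_lt hy)

lemma PhiDeriv_hasDerivAt {α β γ η : ℝ} (hγ : 0 ≤ γ) (h0 : 0 < η) (h : η ≠ α) :
    HasDerivAt (PhiDeriv α β γ)
      ((if η < α then γ * Phi α β γ η / η ^ 2 else 0) - η / 2 * PhiDeriv α β γ η) η := by
  rcases lt_or_gt_of_ne h with h | h
  · have h1 := ((innerProfileDeriv_hasDerivAt (kappaOf_ge hγ) h0).const_mul
      (ustarGamma α β γ)).div_const (innerProfile (kappaOf γ) α)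
    refine (h1.congr_of_eventuallyEq ?_).congr_deriv ?_
    · filter_upwards [Iio_mem_nhds h] with y hy
      unfold PhiDeriv; rw [if_pos (mem_Iio.1 hy)]
    · rw [if_pos h, Phi_of_lt β γ h, kappaOf_mul hγ]
      unfold PhiDeriv; rw [if_pos h]; ring
  · have h1 := (((hasDerivAt_gauss η).const_mul (ustarGamma α β γ)).div_const (gaussTail α)).neg
    refine (h1.congr_of_eventuallyEq ?_).congr_deriv ?_
    · filter_upwards [Ioi_mem_nhds h] with y hy
      unfold PhiDeriv; rw [if_neg (not_lt.2 (le_of_lt hy))]; rfl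
    · rw [if_neg (not_lt.2 h.le)]
      unfold PhiDeriv; rw [if_neg (not_lt.2 h.le)]; ring

lemma Phi_taylor2 {α β γ η : ℝ} (hγ : 0 ≤ γ) (h0 : 0 < η) (h : η ≠ α) :
    Taylor2 (Phi α β γ) η (PhiDeriv α β γ η)
      ((if η < α then γ * Phi α β γ η / η ^ 2 else 0) - η / 2 * PhiDeriv α β γ η) := by
  refine taylor2_of_hasDerivAt ?_ (PhiDeriv_hasDerivAt hγ h0 h)
  filter_upwards [Ioi_mem_nhds h0, isOpen_ne.mem_nhds h] with y hy hy'
  exact Phi_hasDerivAt hγ hy hy'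

lemma Phi_left_deriv {α β γ : ℝ} (hα : 0 < α) (hγ : 0 ≤ γ) :
    HasDerivWithinAt (Phi α β γ) (ustarGamma α β γ *
      innerProfileDeriv (kappaOf γ) α / innerProfile (kappaOf γ) α) (Iic α) α := by
  have h1 := ((innerProfile_hasDerivAt (kappaOf_ge hγ) hα).const_mul
      (ustarGamma α β γ)).div_const (innerProfile (kappaOf γ) α)
  refine h1.hasDerivWithinAt.congr (fun y hy => ?_) ?_
  · rcases (mem_Iic.1 hy).lt_or_eq with h | h
    · exact Phi_of_lt β γ h
    · rw [h, Phi_self, mul_div_cancel_right₀ _ (innerProfile_pos (kappaOf_ge hγ) hα).ne']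
  · rw [Phi_self, mul_div_cancel_right₀ _ (innerProfile_pos (kappaOf_ge hγ) hα).ne']

lemma Phi_right_deriv (α β γ : ℝ) :
    HasDerivWithinAt (Phi α β γ) (-(ustarGamma α β γ * Real.exp (-α ^ 2 / 4) / gaussTail α))
      (Ici α) α := by
  have h1 := ((hasDerivAt_gaussTail α).const_mul (ustarGamma α β γ)).div_const (gaussTail α)
  refine (h1.hasDerivWithinAt.congr (fun y hy => ?_) ?_).congr_deriv (by ring)
  · exact Phi_of_ge β γ hy
  · exact Phi_of_ge β γ le_rfl

lemma Phi_jump {α β γ : ℝ} (hα : 0 < α) (hγ : 0 ≤ γ) : ∃ l r : ℝ,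
    HasDerivWithinAt (Phi α β γ) l (Iic α) α ∧ HasDerivWithinAt (Phi α β γ) r (Ici α) α ∧
      l - r = α * β / 2 := by
  refine ⟨_, _, Phi_left_deriv hα hγ, Phi_right_deriv α β γ, ?_⟩
  rw [← ustarGamma_mul hα hγ]
  ring

lemma Phi_continuousAt {α β γ η : ℝ} (hγ : 0 ≤ γ) (h0 : 0 < η) :
    ContinuousAt (Phi α β γ) η := by
  by_cases h : η = α
  · subst h
    exact continuousAt_iff_continuous_left_right.2
      ⟨(Phi_left_deriv h0 hγ).continuousWithinAt, (Phi_right_deriv η β γ).continuousWithinAt⟩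
  · exact (Phi_hasDerivAt hγ h0 h).continuousAt

lemma Phi_nonneg {α β γ η : ℝ} (hα : 0 < α) (hβ : 0 < β) (hγ : 0 ≤ γ) (h : 0 ≤ η) :
    0 ≤ Phi α β γ η := by
  have hm := ustarGamma_pos hα hβ hγ
  rcases lt_or_ge η α with h1 | h1
  · rw [Phi_of_lt β γ h1]
    rcases h.eq_or_lt with h2 | h2
    · rw [← h2, innerProfile_zero (kappaOf_ge hγ)]; simp
    · have := innerProfile_pos (kappaOf_ge hγ) h2
      have := innerProfile_pos (kappaOf_ge hγ) hα
      positivity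
  · rw [Phi_of_ge β γ h1]
    have := gaussTail_pos η
    have := gaussTail_pos α
    positivity

lemma Phi_pos {α β γ η : ℝ} (hα : 0 < α) (hβ : 0 < β) (hγ : 0 ≤ γ) (h2 : 0 < η) :
    0 < Phi α β γ η := by
  have hm := ustarGamma_pos hα hβ hγ
  rcases lt_or_ge η α with h1 | h1
  · rw [Phi_of_lt β γ h1]
    have := innerProfile_pos (kappaOf_ge hγ) h2
    have := innerProfile_pos (kappaOf_ge hγ) hα
    positivity
  · rw [Phi_of_ge β γ h1]
    have := gaussTail_pos η
    have := gaussTail_pos α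
    positivity

lemma Phi_le {α β γ η : ℝ} (hα : 0 < α) (hβ : 0 < β) (hγ : 0 ≤ γ) (h : 0 ≤ η) :
    Phi α β γ η ≤ ustarGamma α β γ := by
  have hm := ustarGamma_pos hα hβ hγ
  rcases lt_or_ge η α with h1 | h1
  · rw [Phi_of_lt β γ h1, div_le_iff₀ (innerProfile_pos (kappaOf_ge hγ) hα)]
    gcongr
    rcases h.eq_or_lt with h2 | h2
    · rw [← h2, innerProfile_zero (kappaOf_ge hγ)]; exact (innerProfile_pos (kappaOf_ge hγ) hα).le
    · exact (innerProfile_strictMono (kappaOf_ge hγ) h2 hα h1).le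
  · rw [Phi_of_ge β γ h1, div_le_iff₀ (gaussTail_pos α)]
    gcongr
    exact strictAnti_gaussTail.antitone h1

lemma Phi_zero {α β γ : ℝ} (hα : 0 < α) (hγ : 0 ≤ γ) : Phi α β γ 0 = 0 := by
  rw [Phi_of_lt β γ hα, innerProfile_zero (kappaOf_ge hγ)]; simp

lemma Phi_small_near {α β γ ε : ℝ} (hα : 0 < α) (hγ : 0 ≤ γ) (hε : 0 < ε) :
    ∃ δ > 0, ∀ η, 0 ≤ η → η ≤ δ → Phi α β γ η ≤ ε := by
  have h := (innerProfile_tendsto (kappaOf_ge hγ)).const_mul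
    (ustarGamma α β γ) |>.div_const (innerProfile (kappaOf γ) α)
  simp only [mul_zero, zero_div] at h
  have h1 := h.eventually (ge_mem_nhds hε)
  rw [eventually_nhdsWithin_iff, Metric.eventually_nhds_iff] at h1
  obtain ⟨δ, hδ, h2⟩ := h1
  refine ⟨min (δ / 2) (α / 2), by positivity, fun η h0 hη => ?_⟩
  have ha : η ≤ δ / 2 := hη.trans (min_le_left _ _)
  have hb : η ≤ α / 2 := hη.trans (min_le_right _ _)
  rcases h0.eq_or_lt with h3 | h3
  · rw [← h3, Phi_zero hα hγ]; exact hε.le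
  · rw [Phi_of_lt β γ (by linarith)]
    refine h2 ?_ h3
    rw [Real.dist_eq, sub_zero, abs_of_pos h3]; linarith

lemma Phi_small_far {α β γ ε : ℝ} (hε : 0 < ε) :
    ∃ L > 0, ∀ η, L ≤ η → Phi α β γ η ≤ ε := by
  have h := tendsto_gaussTail.const_mul (ustarGamma α β γ) |>.div_const (gaussTail α)
  simp only [mul_zero, zero_div] at h
  obtain ⟨L, hL⟩ := eventually_atTop.1 (h.eventually (ge_mem_nhds hε))
  refine ⟨max 1 (max L α), by positivity, fun η hη => ?_⟩
  have h1 : L ≤ η := (le_max_left _ _).trans ((le_max_right _ _).trans hη)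
  have h2 : α ≤ η := (le_max_right _ _).trans ((le_max_right _ _).trans hη)
  rw [Phi_of_ge β γ h2]
  exact hL η h1

lemma PhiDeriv_bound {α β γ δ : ℝ} (hα : 0 < α) (hβ : 0 < β) (hγ : 0 ≤ γ) (hδ : 0 < δ) :
    ∃ K > 0, ∀ η, δ ≤ η → |PhiDeriv α β γ η| ≤ K := by
  have hm := ustarGamma_pos hα hβ hγ
  have hc : ContinuousOn (innerProfileDeriv (kappaOf γ)) (Icc δ α) := fun z hz =>
    (innerProfileDeriv_hasDerivAt (kappaOf_ge hγ)
      (hδ.trans_le hz.1)).continuousAt.continuousWithinAt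
  obtain ⟨K, hK⟩ := isCompact_Icc.exists_bound_of_continuousOn hc
  have hK0 : 0 ≤ |K| := abs_nonneg K
  have hg := gaussTail_pos α
  have hi := innerProfile_pos (kappaOf_ge hγ) hα
  refine ⟨ustarGamma α β γ * |K| / innerProfile (kappaOf γ) α +
    ustarGamma α β γ / gaussTail α, by positivity, fun η hη => ?_⟩
  unfold PhiDeriv
  split_ifs with h
  · have h1 := (hK η ⟨hη, h.le⟩).trans (le_abs_self K)
    rw [Real.norm_eq_abs] at h1
    rw [abs_div, abs_mul, abs_of_pos hm, abs_of_pos hi]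
    have : ustarGamma α β γ * |innerProfileDeriv (kappaOf γ) η| / innerProfile (kappaOf γ) α ≤
      ustarGamma α β γ * |K| / innerProfile (kappaOf γ) α := by gcongr
    have h2 : 0 ≤ ustarGamma α β γ / gaussTail α := by positivity
    linarith
  · rw [abs_neg, abs_of_nonneg (by positivity)]
    have h1 : Real.exp (-η ^ 2 / 4) ≤ 1 := Real.exp_le_one_iff.2 (by nlinarith [sq_nonneg η])
    have : ustarGamma α β γ * Real.exp (-η ^ 2 / 4) / gaussTail α ≤
      ustarGamma α β γ * 1 / gaussTail α := by gcongr
    have h2 : 0 ≤ ustarGamma α β γ * |K| / innerProfile (kappaOf γ) α := by positivity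
    rw [mul_one] at this
    linarith

lemma Phi_injective {α β γ γ' : ℝ} (hα : 0 < α) (hβ : 0 < β) (hγ : 0 ≤ γ) (hγ' : 0 ≤ γ')
    (h : ∀ η, 0 ≤ η → Phi α β γ η = Phi α β γ' η) : γ = γ' := by
  have e0 : ∀ η ∈ Ioi (0:ℝ), Phi α β γ =ᶠ[nhds η] Phi α β γ' := fun η hη => by
    filter_upwards [Ioi_mem_nhds hη] with y hy using h y (le_of_lt hy)
  have e1 : ∀ η, 0 < η → η < α → PhiDeriv α β γ η = PhiDeriv α β γ' η := fun η h0 h1 =>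
    (Phi_hasDerivAt hγ h0 h1.ne).unique
      ((Phi_hasDerivAt hγ' h0 h1.ne).congr_of_eventuallyEq (e0 η h0))
  have h2 : α / 2 < α := by linarith
  have h0 : 0 < α / 2 := by linarith
  have e2 : PhiDeriv α β γ =ᶠ[nhds (α / 2)] PhiDeriv α β γ' := by
    filter_upwards [Ioo_mem_nhds h0 h2] with y hy using e1 y hy.1 hy.2
  have e3 := (PhiDeriv_hasDerivAt (β := β) hγ h0 h2.ne).unique
    ((PhiDeriv_hasDerivAt hγ' h0 h2.ne).congr_of_eventuallyEq e2)
  rw [if_pos h2, if_pos h2, e1 _ h0 h2, h _ h0.le] at e3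
  have e4 := (div_left_inj' (by positivity : (α / 2) ^ 2 ≠ 0)).1 (sub_left_injective e3)
  exact mul_right_cancel₀ (Phi_pos hα hβ hγ' h0).ne' e4

lemma taylor_remainder_le {P P' : ℝ → ℝ} {x0 r K : ℝ} (hK : 0 ≤ K)
    (hP : ∀ x, HasDerivAt P (P' x) x) (hb : ∀ x, |x - x0| ≤ r → |P' x - P' x0| ≤ K * |x - x0|)
    {x : ℝ} (hx : |x - x0| ≤ r) :
    |P x - P x0 - P' x0 * (x - x0)| ≤ K * (x - x0) ^ 2 := by
  have h := (convex_uIcc x0 x).norm_image_sub_le_of_norm_hasDerivWithin_le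
    (f := fun y => P y - P' x0 * y) (f' := fun y => P' y - P' x0) (C := K * |x - x0|)
    (fun y _ => ((hP y).sub (by simpa using (hasDerivAt_id y).const_mul (P' x0))).hasDerivWithinAt)
    (fun y hy => ?_) left_mem_uIcc right_mem_uIcc
  · rw [Real.norm_eq_abs, Real.norm_eq_abs] at h
    rw [← sq_abs (x - x0)]
    calc _ = |P x - P' x0 * x - (P x0 - P' x0 * x0)| := by congr 1; ring
      _ ≤ _ := h.trans (by ring_nf; exact le_rfl)
  · have h1 : |y - x0| ≤ |x - x0| := by
      have := abs_sub_left_of_mem_uIcc hy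
      simpa [abs_sub_comm] using this
    rw [Real.norm_eq_abs]
    exact (hb y (h1.trans hx)).trans (by gcongr)

lemma Sol.profile_touch {α β : ℝ} {u p w : ℝ → ℝ → ℝ} (S : Sol α β u p w)
    {s x0 t0 r0 G K c1 φ1 φ2 bb bc bd : ℝ} {P P' θ φ c : ℝ → ℝ} {b : ℝ → ℝ → ℝ}
    (ht0 : 0 < t0) (hx0 : |x0| ≠ α * Real.sqrt t0) (hs : |s| ≤ 1) (hr0 : 0 < r0) (hK : 0 ≤ K)
    (hP : ∀ x, HasDerivAt P (P' x) x) (hPc : Continuous P')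
    (hθ : ∀ y z, x0 - r0 ≤ y → y ≤ z → z ≤ x0 + r0 → P' z - P' y = ∫ x in y..z, θ x)
    (hθi : IntervalIntegrable θ volume (x0 - r0) (x0 + r0))
    (hθb : ∀ x, |x - x0| ≤ r0 → |θ x| ≤ K)
    (hφ : Taylor2 φ (x0 / Real.sqrt t0) φ1 φ2) (hφc : ContinuousAt φ (x0 / Real.sqrt t0))
    (hc : HasDerivAt c c1 t0) (hb : Jet b x0 t0 bb bc bd)
    (hsrc : ∀ κ > 0, ∃ r > 0, ∀ᵐ x, |x - x0| ≤ r → ∀ t ∈ Icc (t0 - r) t0,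
      -s * (p x t * u x t) + s * φ (x0 / Real.sqrt t0) * θ x ≤ G + κ)
    (hle : ∀ᶠ z : ℝ × ℝ in nhds (x0, t0), z.2 ≤ t0 →
      s * u z.1 z.2 - s * ((1 + P z.1 - c z.2) * φ (z.1 / Real.sqrt z.2)) - b z.1 z.2 ≤ 0)
    (h0 : s * u x0 t0 - s * ((1 + P x0 - c t0) * φ (x0 / Real.sqrt t0)) - b x0 t0 = 0) :
    bd - bc + s * (-c1 * φ (x0 / Real.sqrt t0) - (1 + P x0 - c t0) *
      (φ2 + x0 / Real.sqrt t0 * φ1 / 2) / t0 - 2 * P' x0 * φ1 / Real.sqrt t0) ≤ G := by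
  have hrem : ∀ x, |x - x0| ≤ r0 → |P x - P x0 - P' x0 * (x - x0)| ≤ K * (x - x0) ^ 2 := by
    refine fun x hx => taylor_remainder_le hK hP (fun y hy => ?_) hx
    have hy' := abs_le.1 hy
    have key : ∀ a e, x0 - r0 ≤ a → a ≤ e → e ≤ x0 + r0 → |P' e - P' a| ≤ K * |e - a| := by
      intro a e h1 h2 h3
      rw [hθ a e h1 h2 h3, ← Real.norm_eq_abs]
      refine intervalIntegral.norm_integral_le_of_norm_le_const fun z hz => ?_
      rw [uIoc_of_le h2] at hz
      exact hθb z (abs_le.2 ⟨by linarith [hz.1], by linarith [hz.2]⟩)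
    rcases le_total x0 y with h | h
    · exact key x0 y (by linarith) h (by linarith)
    · rw [abs_sub_comm, abs_sub_comm y]
      exact key y x0 (by linarith) h (by linarith)
  set φ0 := φ (x0 / Real.sqrt t0) with hφ0
  refine le_of_forall_pos_le_add fun ε hε => ?_
  set κ := ε / 3 with hκ
  have hκ0 : 0 < κ := by positivity
  obtain ⟨r1, hr1, hsrc1⟩ := hsrc κ hκ0
  set r := min r0 r1
  have hr : 0 < r := lt_min hr0 hr1
  have hrr0 : r ≤ r0 := min_le_left _ _
  have hrr1 : r ≤ r1 := min_le_right _ _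
  have J1 := (((Jet.fst x0 t0).sub (Jet.const x0 x0 t0)).const_mul (P' x0)).add
    (Jet.const (1 + P x0) x0 t0)
  have J2 := J1.sub (Jet.of_time x0 hc)
  have J3 := ((J2.mul (Jet.similarity ht0 hφ)).const_mul s).add hb
  have J4 := ((Jet.fst x0 t0).sub (Jet.const x0 x0 t0)).mul
    ((Jet.fst x0 t0).sub (Jet.const x0 x0 t0))
  have J := J3.add (J4.const_mul κ)
  have hfin := S.touch (s := s) (r := r) (G := G + κ)
    (Θ := fun x => s * φ0 * (P x - P x0 - P' x0 * (x - x0)))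
    (Θ' := fun x => s * φ0 * (P' x - P' x0)) (θ := fun x => s * φ0 * θ x) ht0 hx0 hr
    (fun x => ?_) (by fun_prop) (fun y z h1 h2 h3 => ?_) ?_ ?_ J ?_
  · have hs0 : Real.sqrt t0 ≠ 0 := (Real.sqrt_pos.2 ht0).ne'
    refine le_trans (le_of_eq ?_) (add_le_add hfin (le_refl (2 * κ))) |>.trans (by linarith)
    simp only [sub_self, ← hφ0]
    field_simp
    ring
  · have h1 := ((hP x).sub_const (P x0)).sub
      (((hasDerivAt_id x).sub_const x0).const_mul (P' x0))
    simpa using h1.const_mul (s * φ0)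
  · rw [intervalIntegral.integral_const_mul, ← hθ y z (by linarith) h2 (by linarith)]
    ring
  · refine (hθi.mono_set ?_).const_mul _
    rw [uIcc_of_le (by linarith), uIcc_of_le (by linarith)]
    exact Icc_subset_Icc (by linarith) (by linarith)
  · filter_upwards [hsrc1] with x hx h1 t ht
    exact hx (h1.trans hrr1) t ⟨by linarith [ht.1], ht.2⟩
  · have hcont : ContinuousAt (fun z : ℝ × ℝ => φ (z.1 / Real.sqrt z.2)) (x0, t0) := by
      have : ContinuousAt (fun z : ℝ × ℝ => z.1 / Real.sqrt z.2) (x0, t0) :=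
        continuousAt_fst.div (Real.continuous_sqrt.continuousAt.comp continuousAt_snd)
          (Real.sqrt_pos.2 ht0).ne'
      exact ContinuousAt.comp (f := fun z : ℝ × ℝ => z.1 / Real.sqrt z.2) (g := φ) hφc this
    have e1 : ∀ᶠ z : ℝ × ℝ in nhds (x0, t0), |φ (z.1 / Real.sqrt z.2) - φ0| < κ / (K + 1) :=
      Metric.continuousAt_iff'.1 hcont _ (by positivity)
    have e2 : ∀ᶠ z : ℝ × ℝ in nhds (x0, t0), |z.1 - x0| < r0 :=
      (Metric.continuousAt_iff'.1 continuousAt_fst) _ hr0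
    filter_upwards [hle, e1, e2] with z hz h1 h2 hzt
    have h3 := hrem z.1 h2.le
    set P2 := P z.1 - P x0 - P' x0 * (z.1 - x0) with hP2
    have h4 : |s * (P2 * (φ (z.1 / Real.sqrt z.2) - φ0))| ≤ κ * (z.1 - x0) ^ 2 := by
      rw [abs_mul, abs_mul]
      calc _ ≤ 1 * ((K * (z.1 - x0) ^ 2) * (κ / (K + 1))) := by gcongr
        _ = (K / (K + 1)) * (κ * (z.1 - x0) ^ 2) := by field_simp
        _ ≤ 1 * (κ * (z.1 - x0) ^ 2) := by
          gcongr; exact (div_le_one (by linarith)).2 (by linarith)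
        _ = _ := one_mul _
    have h5 := (abs_le.1 h4).2
    have h6 := hz hzt
    have h7 : P z.1 = P2 + P x0 + P' x0 * (z.1 - x0) := by rw [hP2]; ring
    rw [h7] at h6
    simp only [sub_self, mul_zero, add_zero, zero_add]
    linarith

lemma hasDerivAt_posPart {k η : ℝ} (h : η ≠ k) :
    ∀ᶠ z in nhds η, HasDerivAt (fun y => max (y - k) 0) (if k < η then 1 else 0) z := by
  rcases lt_or_gt_of_ne h with h | h
  · rw [if_neg (not_lt.2 h.le)]
    filter_upwards [Iio_mem_nhds h] with z hz
    refine (hasDerivAt_const z (0:ℝ)).congr_of_eventuallyEq ?_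
    filter_upwards [Iio_mem_nhds (mem_Iio.1 hz)] with y hy
    exact max_eq_right (by linarith [mem_Iio.1 hy])
  · rw [if_pos h]
    filter_upwards [Ioi_mem_nhds h] with z hz
    refine ((hasDerivAt_id z).sub_const k).congr_of_eventuallyEq ?_
    filter_upwards [Ioi_mem_nhds (mem_Ioi.1 hz)] with y hy
    exact max_eq_left (by linarith [mem_Ioi.1 hy])

lemma posPart_one_sided (k η : ℝ) : ∃ l r : ℝ,
    HasDerivWithinAt (fun y => max (y - k) 0) l (Iic η) η ∧
    HasDerivWithinAt (fun y => max (y - k) 0) r (Ici η) η ∧ l ≤ r ∧ (η = k → r - l = 1) := by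
  by_cases h : η = k
  · subst h
    refine ⟨0, 1, ?_, ?_, by norm_num, by norm_num⟩
    · refine (hasDerivWithinAt_const η _ (0:ℝ)).congr (fun y hy => ?_) (by simp)
      exact max_eq_right (by linarith [mem_Iic.1 hy])
    · refine ((hasDerivAt_id η).sub_const η).hasDerivWithinAt.congr (fun y hy => ?_) (by simp)
      exact max_eq_left (by linarith [mem_Ici.1 hy])
  · have := (hasDerivAt_posPart h).self_of_nhds
    exact ⟨_, _, this.hasDerivWithinAt, this.hasDerivWithinAt, le_rfl, fun h' => absurd h' h⟩

lemma hasDerivAt_posPart_sq (k η : ℝ) :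
    HasDerivAt (fun y => max (y - k) 0 ^ 2) (2 * max (η - k) 0) η := by
  by_cases h : η = k
  · subst h
    obtain ⟨l, r, hl, hr, -⟩ := posPart_one_sided η η
    have h1 := hl.pow 2
    have h2 := hr.pow 2
    simp only [sub_self, max_self] at h1 h2
    have h3 := (h1.congr_deriv (g' := 0) (by simp)).union (h2.congr_deriv (g' := 0) (by simp))
    rw [Iic_union_Ici, hasDerivWithinAt_univ] at h3
    exact h3.congr_deriv (by simp)
  · have h1 := (hasDerivAt_posPart h).self_of_nhds.pow 2
    refine h1.congr_deriv ?_
    split_ifs with h2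
    · simp
    · rw [max_eq_right (by linarith [lt_of_le_of_ne (not_lt.1 h2) h])]; simp

/-- A decreasing concave barrier with kinks at `α` and `α1`. -/
def kinkBarrier (L α α1 η : ℝ) : ℝ := (6 * L - η - max (η - α) 0 - max (η - α1) 0) / L

/-- A barrier which is concave on `(α, α1)`. -/
def stripBarrier (N L α α1 η : ℝ) : ℝ :=
  N * (2 * L * (α1 - α) - (max (η - α) 0 ^ 2 - max (η - α1) 0 ^ 2))

lemma kinkBarrier_bounds {L α α1 η : ℝ} (hL : 0 < L) (hα : 0 ≤ α) (h1 : 0 ≤ α1) (h0 : 0 ≤ η)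
    (hη : η ≤ L) : 3 ≤ kinkBarrier L α α1 η ∧ kinkBarrier L α α1 η ≤ 6 := by
  unfold kinkBarrier
  have a1 : max (η - α) 0 ≤ L := max_le (by linarith) hL.le
  have a2 : max (η - α1) 0 ≤ L := max_le (by linarith) hL.le
  have b1 := le_max_right (η - α) 0
  have b2 := le_max_right (η - α1) 0
  constructor
  · rw [le_div_iff₀ hL]; linarith
  · rw [div_le_iff₀ hL]; linarith

lemma stripBarrier_bounds {N L α α1 η : ℝ} (hN : 0 ≤ N) (hα : 0 ≤ α) (h1 : α ≤ α1)
    (hL : α1 ≤ L) (hη : η ≤ L) :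
    0 ≤ stripBarrier N L α α1 η ∧ stripBarrier N L α α1 η ≤ N * (2 * L * (α1 - α)) := by
  unfold stripBarrier
  have b2 := le_max_right (η - α1) 0
  have b3 : max (η - α1) 0 ≤ max (η - α) 0 := max_le_max (by linarith) le_rfl
  constructor
  · refine mul_nonneg hN (sub_nonneg.2 ?_)
    have h2 : max (η - α) 0 - max (η - α1) 0 ≤ α1 - α := by
      rcases le_total η α with h | h
      · rw [max_eq_right (by linarith), max_eq_right (by linarith)]; linarith
      · rw [max_eq_left (by linarith)]
        linarith [le_max_left (η - α1) 0]
    have h3 : max (η - α) 0 ≤ L := max_le (by linarith) (by linarith)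
    have h4 : max (η - α1) 0 ≤ L := max_le (by linarith) (by linarith)
    nlinarith
  · refine mul_le_mul_of_nonneg_left ?_ hN
    nlinarith

lemma kinkBarrier_taylor2 {L α α1 η : ℝ} (hL : 0 < L) (h : η ≠ α) (h1 : η ≠ α1) :
    ∃ d, d ≤ -(1 / L) ∧ Taylor2 (kinkBarrier L α α1) η d 0 := by
  refine ⟨(0 - 1 - (if α < η then 1 else 0) - (if α1 < η then 1 else 0)) / L, ?_,
    taylor2_of_hasDerivAt (g' := fun _ =>
      (0 - 1 - (if α < η then 1 else 0) - (if α1 < η then 1 else 0)) / L) ?_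
      (hasDerivAt_const _ _)⟩
  · rw [← neg_div]
    gcongr
    split_ifs <;> norm_num
  · filter_upwards [hasDerivAt_posPart h, hasDerivAt_posPart h1] with z hz hz1
    exact ((((hasDerivAt_const z (6 * L)).sub (hasDerivAt_id z)).sub hz).sub hz1).div_const L

lemma kinkBarrier_one_sided {L α α1 η : ℝ} (hL : 0 < L) (h : η = α ∨ η = α1) : ∃ l r : ℝ,
    HasDerivWithinAt (kinkBarrier L α α1) l (Iic η) η ∧
    HasDerivWithinAt (kinkBarrier L α α1) r (Ici η) η ∧ 1 / L ≤ l - r := by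
  obtain ⟨l, r, hl, hr, hlr, he⟩ := posPart_one_sided α η
  obtain ⟨l1, r1, hl1, hr1, hlr1, he1⟩ := posPart_one_sided α1 η
  refine ⟨(0 - 1 - l - l1) / L, (0 - 1 - r - r1) / L,
    ((((hasDerivWithinAt_const η _ (6 * L)).sub (hasDerivWithinAt_id η _)).sub hl).sub
      hl1).div_const L,
    ((((hasDerivWithinAt_const η _ (6 * L)).sub (hasDerivWithinAt_id η _)).sub hr).sub
      hr1).div_const L, ?_⟩
  rw [← sub_div]
  gcongr
  rcases h with h | h
  · linarith [he h]
  · linarith [he1 h]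

lemma stripBarrier_hasDerivAt (N L α α1 η : ℝ) : HasDerivAt (stripBarrier N L α α1)
    (-(2 * N) * (max (η - α) 0 - max (η - α1) 0)) η := by
  have := ((hasDerivAt_const η (2 * L * (α1 - α))).sub
    ((hasDerivAt_posPart_sq α η).sub (hasDerivAt_posPart_sq α1 η))).const_mul N
  exact this.congr_deriv (by ring)

lemma stripBarrier_taylor2 {N L α α1 η : ℝ} (hN : 0 ≤ N) (hα1 : α ≤ α1) (h : η ≠ α)
    (h1 : η ≠ α1) : ∃ d e, d ≤ 0 ∧ e ≤ 0 ∧ (α < η → η < α1 → e = -(2 * N)) ∧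
      Taylor2 (stripBarrier N L α α1) η d e := by
  refine ⟨_, _, ?_, ?_, ?_, taylor2_of_hasDerivAt
    (Eventually.of_forall (stripBarrier_hasDerivAt N L α α1))
    (((hasDerivAt_posPart h).self_of_nhds.sub
      (hasDerivAt_posPart h1).self_of_nhds).const_mul (-(2 * N)))⟩
  · have b3 : max (η - α1) 0 ≤ max (η - α) 0 := max_le_max (by linarith) le_rfl
    nlinarith
  · have : (0:ℝ) ≤ (if α < η then 1 else 0) - (if α1 < η then 1 else 0) := by
      split_ifs <;> first | exact absurd ‹α1 < η› (by linarith) | norm_num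
    nlinarith
  · intro h2 h3
    rw [if_pos h2, if_neg (not_lt.2 h3.le)]; ring

lemma continuous_kinkBarrier (L α α1 : ℝ) : Continuous (kinkBarrier L α α1) := by
  unfold kinkBarrier; fun_prop

lemma continuous_stripBarrier (N L α α1 : ℝ) : Continuous (stripBarrier N L α α1) := by
  unfold stripBarrier; fun_prop

/-- Data for comparing `u` with the perturbed profile `(1 + P(min x (α₁√t)) - P(α₁√t)) Φ_γ(x/√t)`
by means of a barrier; `s = 1` bounds `u` from above and `s = -1` from below. -/
structure Comparison (α β ustar γ : ℝ) (u p w : ℝ → ℝ → ℝ) (pstar : ℝ → ℝ)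
    (s α1 δ L N T e ε K : ℝ) (P P' a a1 : ℝ → ℝ) : Prop where
  S : CSol α β ustar u p w pstar
  hγ : 0 ≤ γ
  hs : (s = 1 ∧ α1 = α) ∨ (s = -1 ∧ α < α1 ∧ ∀ x t, T ≤ t → α1 * √t ≤ x → p x t = 0)
  hδ : 0 < δ
  hδα : δ < α
  hL : α1 < L
  hT : 1 ≤ T
  he : 0 < e
  hN : γ * ustarGamma α β γ / α ^ 2 ≤ 2 * N
  hP : ∀ x, HasDerivAt P (P' x) x
  hPc : Continuous P'
  hθ : ∀ y z, δ * √T / 2 ≤ y → y ≤ z → P' z - P' y = ∫ x in y..z, (pstar x - γ / x ^ 2)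
  hP' : ∀ x, δ * √T ≤ x → |P' x| ≤ ε / x
  hK : ∀ η, δ ≤ η → |PhiDeriv α β γ η| ≤ K
  ha : ∀ t, T ≤ t → HasDerivAt a (a1 t) t
  hae : ∀ t, T ≤ t → e ≤ a t
  ha1 : ∀ t, T ≤ t → -(δ / (24 * L)) * (a t / t) ≤ a1 t
  small1 : ε * (α1 / δ) ≤ 1
  small2 : ε * (α1 / δ) * ustarGamma α β γ < e
  small3 : ε * (ustarGamma α β γ / 2 + 2 * K / δ + α1 / δ * γ * ustarGamma α β γ / δ ^ 2) <
    e * δ / (4 * L)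
  small4 : ε * ustarGamma α β γ / α < e / L
  small5 : ε * (α1 / δ) * (α * β / 2) < e / L
  initial : PsiP α β α + 2 * ustarGamma α β γ < 3 * a T
  left : ∀ t, T ≤ t → |u (δ * √t) t - Phi α β γ δ| ≤ e
  right : ∀ t, T ≤ t → |u (L * √t) t - Phi α β γ L| ≤ e

namespace Comparison
variable {α β ustar γ : ℝ} {u p w : ℝ → ℝ → ℝ} {pstar : ℝ → ℝ}
  {s α1 δ L N T e ε K : ℝ} {P P' a a1 : ℝ → ℝ}

/-- The relative perturbation of the profile. -/
def pert (P : ℝ → ℝ) (α1 x t : ℝ) : ℝ := P (min x (α1 * √t)) - P (α1 * √t)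

/-- The barrier. -/
def bar (a : ℝ → ℝ) (N L α α1 x t : ℝ) : ℝ :=
  a t * kinkBarrier L α α1 (x / √t) + stripBarrier N L α α1 (x / √t)

lemma α_le (H : Comparison α β ustar γ u p w pstar s α1 δ L N T e ε K P P' a a1) : α ≤ α1 := by
  rcases H.hs with h | h
  · exact h.2.ge
  · exact h.2.1.le

lemma α_pos (H : Comparison α β ustar γ u p w pstar s α1 δ L N T e ε K P P' a a1) : 0 < α := H.S.hα
lemma α1_pos (H : Comparison α β ustar γ u p w pstar s α1 δ L N T e ε K P P' a a1) : 0 < α1 := H.α_pos.trans_le H.α_le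
lemma L_pos (H : Comparison α β ustar γ u p w pstar s α1 δ L N T e ε K P P' a a1) : 0 < L := H.α1_pos.trans H.hL
lemma T_pos (H : Comparison α β ustar γ u p w pstar s α1 δ L N T e ε K P P' a a1) : 0 < T := one_pos.trans_le H.hT
lemma m_pos (H : Comparison α β ustar γ u p w pstar s α1 δ L N T e ε K P P' a a1) : 0 < ustarGamma α β γ := ustarGamma_pos H.S.hα H.S.hβ H.hγ
lemma s_abs (H : Comparison α β ustar γ u p w pstar s α1 δ L N T e ε K P P' a a1) : |s| = 1 := by
  rcases H.hs with h | h
  · simp [h.1]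
  · simp [h.1]
lemma N_nonneg (H : Comparison α β ustar γ u p w pstar s α1 δ L N T e ε K P P' a a1) : 0 ≤ N := by
  have := H.hN
  have h2 : 0 ≤ γ * ustarGamma α β γ / α ^ 2 := by
    have := H.hγ; have := H.m_pos; have := H.α_pos; positivity
  linarith
lemma sqrt_pos (H : Comparison α β ustar γ u p w pstar s α1 δ L N T e ε K P P' a a1)
    {t : ℝ} (ht : T ≤ t) : 0 < √t := Real.sqrt_pos.2 (H.T_pos.trans_le ht)
lemma ε_nonneg (H : Comparison α β ustar γ u p w pstar s α1 δ L N T e ε K P P' a a1) : 0 ≤ ε := by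
  have h1 : 0 < δ * √T := mul_pos H.hδ (H.sqrt_pos le_rfl)
  have h2 := (abs_nonneg _).trans (H.hP' _ le_rfl)
  have := mul_nonneg h2 h1.le
  rwa [div_mul_cancel₀ _ h1.ne'] at this

lemma abs_pert (H : Comparison α β ustar γ u p w pstar s α1 δ L N T e ε K P P' a a1)
    {x t : ℝ} (ht : T ≤ t) (hx : δ * √t ≤ x) :
    |pert P α1 x t| ≤ ε * (α1 / δ) := by
  have hst := H.sqrt_pos ht
  have hlow : δ * √t ≤ α1 * √t := by
    have := H.α_le; have := H.hδα; gcongr; linarith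
  have hmin : δ * √t ≤ min x (α1 * √t) := le_min hx hlow
  have hpos : 0 < δ * √t := mul_pos H.hδ hst
  have key : |P (min x (α1 * √t)) - P (α1 * √t)| ≤
      ε / (δ * √t) * |min x (α1 * √t) - α1 * √t| := by
    have := (convex_Ici (δ * √t)).norm_image_sub_le_of_norm_hasDerivWithin_le (f := P) (f' := P')
      (C := ε / (δ * √t)) (x := α1 * √t) (y := min x (α1 * √t))
      (fun y _ => (H.hP y).hasDerivWithinAt) (fun y hy => ?_) (mem_Ici.2 hlow) (mem_Ici.2 hmin)
    · simpa [Real.norm_eq_abs] using this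
    · rw [Real.norm_eq_abs]
      have h0 : δ * √T ≤ δ * √t := by have := H.hδ; gcongr
      refine (H.hP' y (h0.trans hy)).trans ?_
      have := H.ε_nonneg
      have := mem_Ici.1 hy
      gcongr
  refine key.trans ?_
  have h1 : |min x (α1 * √t) - α1 * √t| ≤ α1 * √t := by
    rw [abs_sub_comm, abs_of_nonneg (sub_nonneg.2 (min_le_right _ _))]
    linarith
  have := H.ε_nonneg
  calc ε / (δ * √t) * |min x (α1 * √t) - α1 * √t| ≤ ε / (δ * √t) * (α1 * √t) := by gcongr
    _ = ε * (α1 / δ) := by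
      have := H.hδ.ne'; field_simp

lemma bar_ge (H : Comparison α β ustar γ u p w pstar s α1 δ L N T e ε K P P' a a1)
    {x t : ℝ} (ht : T ≤ t) (hx : 0 ≤ x) (hx' : x ≤ L * √t) :
    3 * a t ≤ bar a N L α α1 x t := by
  have hst := H.sqrt_pos ht
  have h1 : 0 ≤ x / √t := by positivity
  have h2 : x / √t ≤ L := (div_le_iff₀ hst).2 hx'
  have h3 := (kinkBarrier_bounds H.L_pos H.α_pos.le H.α1_pos.le h1 h2).1
  have h4 := (stripBarrier_bounds H.N_nonneg H.α_pos.le H.α_le H.hL.le h2).1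
  have h5 := H.he.le.trans (H.hae t ht)
  unfold bar
  nlinarith

lemma exists_jet (H : Comparison α β ustar γ u p w pstar s α1 δ L N T e ε K P P' a a1)
    {x0 t0 : ℝ} (ht : T < t0) (hx : δ * √t0 ≤ x0) (hx' : x0 ≤ L * √t0)
    (hα : x0 / √t0 ≠ α) (hα1 : x0 / √t0 ≠ α1) :
    ∃ bb bc bd, Jet (bar a N L α α1) x0 t0 bb bc bd ∧ e * δ / (4 * L) / t0 ≤ bd - bc ∧
      (α < x0 / √t0 → x0 / √t0 < α1 → e * δ / (4 * L) / t0 + 2 * N / t0 ≤ bd - bc) := by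
  have hst := H.sqrt_pos ht.le
  have ht0 : 0 < t0 := H.T_pos.trans ht
  obtain ⟨d, hd, hT2⟩ := kinkBarrier_taylor2 H.L_pos hα hα1
  obtain ⟨d', f, hd', hf, hstrip, hS2⟩ := stripBarrier_taylor2 (L := L) H.N_nonneg H.α_le hα hα1
  have hη : δ ≤ x0 / √t0 := (le_div_iff₀ hst).2 hx
  have hη' : x0 / √t0 ≤ L := (div_le_iff₀ hst).2 hx'
  have hb := (kinkBarrier_bounds H.L_pos H.α_pos.le H.α1_pos.le (H.hδ.le.trans hη) hη')
  have hjet := ((Jet.of_time x0 (H.ha t0 ht.le)).mul (Jet.similarity ht0 hT2)).add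
    (Jet.similarity ht0 hS2)
  refine ⟨_, _, _, hjet, ?_, ?_⟩
  all_goals
    clear hjet
    generalize hη0 : x0 / √t0 = η at *
    have hae := H.hae t0 ht.le
    have ha1 := H.ha1 t0 ht.le
    have hL := H.L_pos
    have hδ := H.hδ
    have he := H.he
    have hmain : e * δ / (4 * L) / t0 ≤
        a1 t0 * kinkBarrier L α α1 η + a t0 * (-(d * η / (2 * t0))) := by
      have h1 : -(δ / (4 * L)) * (a t0 / t0) ≤ a1 t0 * kinkBarrier L α α1 η := by
        have h2 : 0 ≤ δ / (24 * L) * (a t0 / t0) := by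
          have : 0 < a t0 := he.trans_le hae
          positivity
        have h3 : -(δ / (4 * L)) * (a t0 / t0) = 6 * (-(δ / (24 * L)) * (a t0 / t0)) := by
          field_simp; ring
        rw [h3]
        nlinarith
      have h4 : a t0 * (δ / (2 * L) / t0) ≤ a t0 * (-(d * η / (2 * t0))) := by
        refine mul_le_mul_of_nonneg_left ?_ (he.le.trans hae)
        rw [← neg_div, div_div, div_le_div_iff₀ (by positivity) (by positivity)]
        have h6 : δ * (1 / L) ≤ -d * η := by
          have : 0 < 1 / L := by positivity
          nlinarith
        have h7 : δ ≤ -d * η * L := by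
          have := mul_le_mul_of_nonneg_right h6 hL.le
          have h8 : δ * (1 / L) * L = δ := by field_simp
          linarith
        nlinarith
      have h5 : e * δ / (4 * L) / t0 ≤ a t0 * (δ / (4 * L) / t0) := by
        rw [mul_div_assoc, mul_div_assoc]
        gcongr
      have h6 : a t0 * (δ / (2 * L) / t0) =
          a t0 * (δ / (4 * L) / t0) + δ / (4 * L) * (a t0 / t0) := by
        field_simp; ring
      linarith
    have hs1 : 0 ≤ -(d' * η / (2 * t0)) := by
      rw [← neg_div]
      refine div_nonneg ?_ (by positivity)
      nlinarith
    have hs2 : f / t0 ≤ 0 := div_nonpos_of_nonpos_of_nonneg hf ht0.le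
  · simp only [zero_mul, mul_zero, zero_div, zero_add]
    linarith
  · intro h1 h2
    have h3 := hstrip h1 h2
    have h4 : f / t0 = -(2 * N / t0) := by rw [h3]; ring
    simp only [zero_mul, mul_zero, zero_div, zero_add]
    linarith
end Comparison

namespace Comparison
variable {α β ustar γ : ℝ} {u p w : ℝ → ℝ → ℝ} {pstar : ℝ → ℝ}
  {s α1 δ L N T e ε K : ℝ} {P P' a a1 : ℝ → ℝ}

/-- The signed difference between `u` and the perturbed profile, less the barrier. -/
def gap (α β γ s : ℝ) (u : ℝ → ℝ → ℝ) (P a : ℝ → ℝ) (N L α1 x t : ℝ) : ℝ :=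
  s * u x t - s * ((1 + pert P α1 x t) * Phi α β γ (x / √t)) - bar a N L α α1 x t

lemma eventually_u_nonneg (H : Comparison α β ustar γ u p w pstar s α1 δ L N T e ε K P P' a a1)
    {x0 t0 : ℝ} (ht : T < t0) :
    ∃ r > 0, ∀ x, |x - x0| ≤ r → ∀ t ∈ Icc (t0 - r) t0, T < t ∧ 0 ≤ u x t := by
  refine ⟨(t0 - T) / 2, by linarith, fun x _ t h => ?_⟩
  have h1 : T < t := by linarith [h.1]
  exact ⟨h1, H.S.u_nonneg x (H.T_pos.trans h1).le⟩

lemma div_sqrt_ne (H : Comparison α β ustar γ u p w pstar s α1 δ L N T e ε K P P' a a1)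
    {x0 t0 : ℝ} (ht : T < t0) (hx : δ * √t0 < x0) (h : x0 / √t0 ≠ α) :
    |x0| ≠ α * √t0 := by
  have hst := H.sqrt_pos ht.le
  rw [abs_of_pos ((mul_pos H.hδ hst).trans hx)]
  intro h2
  exact h (by rw [h2]; field_simp)

lemma no_touch_outer (H : Comparison α β ustar γ u p w pstar s α1 δ L N T e ε K P P' a a1)
    {x0 t0 : ℝ} (ht : T < t0) (hx : δ * √t0 < x0) (hx' : x0 < L * √t0)
    (hα : α1 < x0 / √t0) (h0 : gap α β γ s u P a N L α1 x0 t0 = 0)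
    (hle : ∀ᶠ z : ℝ × ℝ in nhds (x0, t0), z.2 ≤ t0 → gap α β γ s u P a N L α1 z.1 z.2 ≤ 0) :
    False := by
  have hst := H.sqrt_pos ht.le
  have ht0 : 0 < t0 := H.T_pos.trans ht
  have hαα := H.α_le
  have hne : x0 / √t0 ≠ α := by linarith [hα] |> fun h : α < x0 / √t0 => h.ne'
  have hη : 0 < x0 / √t0 := H.α1_pos.trans hα
  obtain ⟨bb, bc, bd, hjet, hbd, -⟩ := H.exists_jet ht hx.le hx'.le hne hα.ne'
  have hnear : ∀ᶠ z : ℝ × ℝ in nhds (x0, t0), α1 * √z.2 < z.1 := by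
    refine ContinuousAt.eventually_lt (f := fun z : ℝ × ℝ => α1 * √z.2) (g := fun z => z.1)
      (by fun_prop) (by fun_prop) ?_
    exact (lt_div_iff₀ hst).1 hα
  have hpert : ∀ x t, α1 * √t < x → pert P α1 x t = 0 := fun x t h => by
    unfold pert; rw [min_eq_right h.le, sub_self]
  have key := H.S.profile_touch (s := s) (x0 := x0) (t0 := t0) (r0 := 1) (G := 0) (K := 0)
    (P := fun _ => 0) (P' := fun _ => 0) (θ := fun _ => 0) (φ := Phi α β γ) (c := fun _ => 0) ht0
    (H.div_sqrt_ne ht hx hne) H.s_abs.le one_pos le_rfl (fun x => hasDerivAt_const x _)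
    continuous_const (by simp) (by simp) (by simp) (Phi_taylor2 H.hγ hη hne)
    (Phi_continuousAt H.hγ hη) (hasDerivAt_const _ _) hjet ?_ ?_ ?_
  · rw [if_neg (by linarith)] at key
    have h1 : 0 < e * δ / (4 * L) / t0 := by
      have := H.he; have := H.hδ; have := H.L_pos; positivity
    have h2 : (1 + 0 - 0) * (0 - x0 / √t0 / 2 * PhiDeriv α β γ (x0 / √t0) +
        x0 / √t0 * PhiDeriv α β γ (x0 / √t0) / 2) / t0 = 0 := by ring
    rw [h2] at key
    simp only [neg_zero, zero_mul, mul_zero, zero_div, sub_zero, add_zero] at key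
    linarith
  · intro κ hκ
    obtain ⟨r, hr, h⟩ := H.eventually_u_nonneg (x0 := x0) ht
    obtain ⟨r', hr', h'⟩ := exists_box hnear
    refine ⟨min r r', lt_min hr hr', ae_of_all _ fun x hx t htt => ?_⟩
    have hr1 := min_le_left r r'
    have hr2 := min_le_right r r'
    have h1 := h x (hx.trans hr1) t ⟨by linarith [htt.1], htt.2⟩
    have h2 : α1 * √t < x := h' x t (hx.trans hr2)
      (abs_le.2 ⟨by linarith [htt.1], by linarith [htt.2]⟩)
    have h3 := (H.S.p_mem x t (H.T_pos.trans h1.1).le).1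
    rcases H.hs with hs | hs
    · rw [hs.1]; nlinarith [mul_nonneg h3 h1.2]
    · rw [hs.2.2 x t h1.1.le h2.le]; linarith
  · filter_upwards [hle, hnear] with z hz hz' hzt
    have := hz hzt
    unfold gap at this
    rw [hpert _ _ hz'] at this
    simpa using this
  · have := h0
    unfold gap at this
    rw [hpert _ _ ((lt_div_iff₀ hst).1 hα)] at this
    simpa using this
end Comparison

namespace Comparison
variable {α β ustar γ : ℝ} {u p w : ℝ → ℝ → ℝ} {pstar : ℝ → ℝ}
  {s α1 δ L N T e ε K : ℝ} {P P' a a1 : ℝ → ℝ}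

lemma pert_mul_Phi_le (H : Comparison α β ustar γ u p w pstar s α1 δ L N T e ε K P P' a a1)
    {x t : ℝ} (ht : T ≤ t) (hx : δ * √t ≤ x) :
    |pert P α1 x t * Phi α β γ (x / √t)| ≤ ε * (α1 / δ) * ustarGamma α β γ := by
  have hη : 0 ≤ x / √t := (H.hδ.le.trans ((le_div_iff₀ (H.sqrt_pos ht)).2 hx))
  rw [abs_mul, abs_of_nonneg (Phi_nonneg H.α_pos H.S.hβ H.hγ hη)]
  exact mul_le_mul (H.abs_pert ht hx) (Phi_le H.α_pos H.S.hβ H.hγ hη)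
    (Phi_nonneg H.α_pos H.S.hβ H.hγ hη) ((abs_nonneg _).trans (H.abs_pert ht hx))

lemma sign_pos (H : Comparison α β ustar γ u p w pstar s α1 δ L N T e ε K P P' a a1)
    {x t : ℝ} (ht : T ≤ t) (hx : δ * √t ≤ x) (hx' : x ≤ L * √t)
    (h0 : gap α β γ s u P a N L α1 x t = 0) : 0 < s * (u x t - Phi α β γ (x / √t)) := by
  have h1 := H.bar_ge ht ((mul_pos H.hδ (H.sqrt_pos ht)).le.trans hx) hx'
  have h2 : |s * (pert P α1 x t * Phi α β γ (x / √t))| < e := by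
    rw [abs_mul, H.s_abs, one_mul]
    exact (H.pert_mul_Phi_le ht hx).trans_lt H.small2
  have h3 := (abs_lt.1 h2).1
  have := H.hae t ht
  have := H.he
  unfold gap at h0
  nlinarith

lemma source_le (H : Comparison α β ustar γ u p w pstar s α1 δ L N T e ε K P P' a a1)
    {x0 t0 : ℝ} (ht : T < t0) (hx : δ * √t0 < x0) (hα : x0 / √t0 < α1)
    (h0 : gap α β γ s u P a N L α1 x0 t0 = 0) :
    ∀ κ > 0, ∃ r > 0, ∀ᵐ x, |x - x0| ≤ r → ∀ t ∈ Icc (t0 - r) t0,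
      -s * (p x t * u x t) + s * Phi α β γ (x0 / √t0) * (pstar x - γ / x ^ 2) ≤
        -s * (γ * Phi α β γ (x0 / √t0) / x0 ^ 2) + κ := by
  intro κ hκ
  have hst := H.sqrt_pos ht.le
  have ht0 : 0 < t0 := H.T_pos.trans ht
  have hx0 : 0 < x0 := (mul_pos H.hδ hst).trans hx
  have hxL : x0 ≤ L * √t0 := by
    have := (div_lt_iff₀ hst).1 hα
    have := H.hL
    nlinarith
  have hsign := H.sign_pos ht.le hx.le hxL h0
  set Φ0 := Phi α β γ (x0 / √t0) with hΦ0
  have e1 : ∀ᶠ z : ℝ × ℝ in nhds (x0, t0), 0 < s * (u z.1 z.2 - Φ0) :=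
    (continuousAt_const.mul ((H.S.continuousAt_u x0 ht0).sub continuousAt_const)).eventually
      (lt_mem_nhds hsign)
  have e2 : ∀ᶠ z : ℝ × ℝ in nhds (x0, t0),
      -s * (γ * Φ0 / z.1 ^ 2) < -s * (γ * Φ0 / x0 ^ 2) + κ := by
    have : ContinuousAt (fun z : ℝ × ℝ => -s * (γ * Φ0 / z.1 ^ 2)) (x0, t0) := by
      refine continuousAt_const.mul (continuousAt_const.div (by fun_prop) ?_)
      exact (pow_pos hx0 2).ne'
    exact this.eventually (gt_mem_nhds (by simpa using hκ))
  have e3 : ∀ᶠ z : ℝ × ℝ in nhds (x0, t0), 0 < z.1 :=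
    continuousAt_fst.eventually (lt_mem_nhds hx0)
  have e4 : ∀ᶠ z : ℝ × ℝ in nhds (x0, t0), T < z.2 :=
    continuousAt_snd.eventually (lt_mem_nhds ht)
  have e5 : ∀ᶠ z : ℝ × ℝ in nhds (x0, t0), s = 1 → z.1 ^ 2 / α ^ 2 < z.2 := by
    rcases H.hs with hs | hs
    · have hlt : x0 ^ 2 / α ^ 2 < t0 := by
        have h1 : x0 < α * √t0 := by rw [← hs.2]; exact (div_lt_iff₀ hst).1 hα
        rw [div_lt_iff₀ (pow_pos H.α_pos 2)]
        calc x0 ^ 2 < (α * √t0) ^ 2 := by gcongr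
          _ = t0 * α ^ 2 := by rw [mul_pow, Real.sq_sqrt ht0.le]; ring
      have : ContinuousAt (fun z : ℝ × ℝ => z.1 ^ 2 / α ^ 2) (x0, t0) := by fun_prop
      exact (this.eventually_lt continuousAt_snd hlt).mono fun z hz _ => hz
    · exact Eventually.of_forall fun z h => by rw [hs.1] at h; norm_num at h
  obtain ⟨r, hr, hbox⟩ := exists_box (e1.and (e2.and (e3.and (e4.and e5))))
  refine ⟨r, hr, ?_⟩
  filter_upwards [H.S.ae_condP, H.S.p_le_pstar] with x hx1 hx2 hxr t htr
  obtain ⟨h1, h2, h3, h4, h5⟩ := hbox x t hxr (abs_le.2 ⟨by linarith [htr.1], by linarith [htr.2]⟩)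
  simp only at h1 h2 h3 h4 h5
  have htpos : 0 < t := H.T_pos.trans h4
  have hu0 := H.S.u_nonneg x htpos.le
  have hps := (H.S.h01 x).1
  have hkey : -s * (p x t * u x t) ≤ -s * (pstar x * u x t) := by
    rcases H.hs with hs | hs
    · have := hx1 t (h5 hs.1)
      rw [abs_of_pos h3] at this
      rw [this]
    · have := hx2 t htpos.le
      rw [abs_of_pos h3] at this
      rw [hs.1]
      have := mul_le_mul_of_nonneg_right this hu0
      linarith
  have h6 : 0 ≤ pstar x * (s * (u x t - Φ0)) := mul_nonneg hps h1.le
  have h7 : s * Φ0 * (pstar x - γ / x ^ 2) = s * Φ0 * pstar x + -s * (γ * Φ0 / x ^ 2) := by ring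
  rw [h7]
  nlinarith
end Comparison

namespace Comparison
variable {α β ustar γ : ℝ} {u p w : ℝ → ℝ → ℝ} {pstar : ℝ → ℝ}
  {s α1 δ L N T e ε K : ℝ} {P P' a a1 : ℝ → ℝ}

lemma intervalIntegrable_source (H : Comparison α β ustar γ u p w pstar s α1 δ L N T e ε K P P' a a1)
    {y z : ℝ} (hy : 0 < y) (hz : 0 < z) :
    IntervalIntegrable (fun x => pstar x - γ / x ^ 2) volume y z := by
  refine (H.S.pstar_intervalIntegrable y z).sub (ContinuousOn.intervalIntegrable ?_)
  refine continuousOn_const.div (by fun_prop) fun x hx => ?_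
  have := uIcc_subset_uIcc (left_mem_uIcc (a := y) (b := z)) right_mem_uIcc hx
  have h : 0 < x := (lt_min hy hz).trans_le this.1
  positivity

lemma errors_small (H : Comparison α β ustar γ u p w pstar s α1 δ L N T e ε K P P' a a1)
    {x0 t0 : ℝ} (ht : T < t0) (hx : δ * √t0 < x0) :
    |s * (P' (α1 * √t0) * (α1 * (1 / (2 * √t0))) * Phi α β γ (x0 / √t0))| +
      |s * (2 * P' x0 * PhiDeriv α β γ (x0 / √t0) / √t0)| +
      |s * (pert P α1 x0 t0 * (γ * Phi α β γ (x0 / √t0) / x0 ^ 2))| < e * δ / (4 * L) / t0 := by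
  have hst := H.sqrt_pos ht.le
  have ht0 : 0 < t0 := H.T_pos.trans ht
  have hsq : √t0 * √t0 = t0 := Real.mul_self_sqrt ht0.le
  have hδ := H.hδ
  have hα1 := H.α1_pos
  have hε := H.ε_nonneg
  have hγ := H.hγ
  have hm := H.m_pos
  have hδT : δ * √T ≤ δ * √t0 := by gcongr
  have hη : δ ≤ x0 / √t0 := (le_div_iff₀ hst).2 hx.le
  have hΦ := Phi_le H.α_pos H.S.hβ H.hγ (hδ.le.trans hη)
  have hΦ0 := Phi_nonneg H.α_pos H.S.hβ H.hγ (hδ.le.trans hη)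
  have hK := H.hK _ hη
  have hK0 := (abs_nonneg _).trans hK
  have hx0 : 0 < x0 := (mul_pos hδ hst).trans hx
  have hP1 := H.hP' (α1 * √t0) (hδT.trans (by
    have := H.hδα; have := H.α_le; gcongr; linarith))
  have hP2 : |P' x0| ≤ ε / (δ * √t0) := (H.hP' x0 (hδT.trans hx.le)).trans (by gcongr)
  have hQ := H.abs_pert ht.le hx.le
  generalize Phi α β γ (x0 / √t0) = φ0 at *
  generalize PhiDeriv α β γ (x0 / √t0) = φ1 at *
  generalize P' (α1 * √t0) = q1 at *
  generalize P' x0 = q2 at *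
  generalize pert P α1 x0 t0 = Q at *
  have b1 : |s * (q1 * (α1 * (1 / (2 * √t0))) * φ0)| ≤
      ε * (ustarGamma α β γ / 2) / t0 := by
    rw [abs_mul, abs_mul, abs_mul, H.s_abs, one_mul, abs_of_nonneg hΦ0,
      abs_of_nonneg (show 0 ≤ α1 * (1 / (2 * √t0)) by positivity)]
    calc |q1| * (α1 * (1 / (2 * √t0))) * φ0 ≤
        ε / (α1 * √t0) * (α1 * (1 / (2 * √t0))) * ustarGamma α β γ := by gcongr
      _ = ε * (ustarGamma α β γ / 2) / (√t0 * √t0) := by field_simp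
      _ = _ := by rw [hsq]
  have b2 : |s * (2 * q2 * φ1 / √t0)| ≤ ε * (2 * K / δ) / t0 := by
    rw [abs_mul, abs_div, abs_mul, abs_mul, H.s_abs, one_mul, abs_of_pos hst,
      abs_of_pos (two_pos : (0:ℝ) < 2)]
    calc 2 * |q2| * |φ1| / √t0 ≤ 2 * (ε / (δ * √t0)) * K / √t0 := by gcongr
      _ = ε * (2 * K / δ) / (√t0 * √t0) := by field_simp
      _ = _ := by rw [hsq]
  have b3 : |s * (Q * (γ * φ0 / x0 ^ 2))| ≤
      ε * (α1 / δ * γ * ustarGamma α β γ / δ ^ 2) / t0 := by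
    rw [abs_mul, abs_mul, H.s_abs, one_mul, abs_of_nonneg (show 0 ≤ γ * φ0 / x0 ^ 2 by positivity)]
    calc |Q| * (γ * φ0 / x0 ^ 2) ≤
        ε * (α1 / δ) * (γ * ustarGamma α β γ / (δ * √t0) ^ 2) := by gcongr
      _ = ε * (α1 / δ * γ * ustarGamma α β γ / δ ^ 2) / (√t0 * √t0) := by field_simp
      _ = _ := by rw [hsq]
  have h3 := div_lt_div_of_pos_right H.small3 ht0
  rw [mul_add, mul_add, add_div, add_div] at h3
  linarith

lemma no_touch_inner (H : Comparison α β ustar γ u p w pstar s α1 δ L N T e ε K P P' a a1)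
    {x0 t0 : ℝ} (ht : T < t0) (hx : δ * √t0 < x0) (hα : x0 / √t0 < α1)
    (hne : x0 / √t0 ≠ α) (h0 : gap α β γ s u P a N L α1 x0 t0 = 0)
    (hle : ∀ᶠ z : ℝ × ℝ in nhds (x0, t0), z.2 ≤ t0 → gap α β γ s u P a N L α1 z.1 z.2 ≤ 0) :
    False := by
  have hst := H.sqrt_pos ht.le
  have ht0 : 0 < t0 := H.T_pos.trans ht
  have hδ := H.hδ
  have hx0 : 0 < x0 := (mul_pos hδ hst).trans hx
  have hη : 0 < x0 / √t0 := by positivity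
  have hxα : x0 < α1 * √t0 := (div_lt_iff₀ hst).1 hα
  have hxL : x0 ≤ L * √t0 := by have := H.hL; nlinarith
  have hδT : δ * √T ≤ δ * √t0 := by gcongr
  have hr0 : 0 < δ * √T / 2 := by have := H.sqrt_pos le_rfl; positivity
  obtain ⟨bb, bc, bd, hjet, hbd, hbd'⟩ := H.exists_jet ht hx.le hxL hne hα.ne
  have hnear : ∀ᶠ z : ℝ × ℝ in nhds (x0, t0), z.1 < α1 * √z.2 := by
    refine ContinuousAt.eventually_lt (f := fun z : ℝ × ℝ => z.1) (g := fun z => α1 * √z.2)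
      (by fun_prop) (by fun_prop) hxα
  have hpert : ∀ x t, x < α1 * √t → pert P α1 x t = P x - P (α1 * √t) := fun x t h => by
    unfold pert; rw [min_eq_left h.le]
  have hc : HasDerivAt (fun t => P (α1 * √t)) (P' (α1 * √t0) * (α1 * (1 / (2 * √t0)))) t0 :=
    HasDerivAt.comp t0 (H.hP _) ((Real.hasDerivAt_sqrt ht0.ne').const_mul α1)
  have key := H.S.profile_touch (s := s) (x0 := x0) (t0 := t0) (r0 := δ * √T / 2)
    (G := -s * (γ * Phi α β γ (x0 / √t0) / x0 ^ 2)) (K := 1 + γ / (δ * √T / 2) ^ 2)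
    (P := P) (P' := P') (θ := fun x => pstar x - γ / x ^ 2) (φ := Phi α β γ)
    (c := fun t => P (α1 * √t)) ht0
    (H.div_sqrt_ne ht hx hne) H.s_abs.le hr0 (by have := H.hγ; positivity) H.hP
    H.hPc (fun y z h1 h2 _ => H.hθ y z (by linarith) h2)
    (H.intervalIntegrable_source (by linarith) (by linarith)) ?_ (Phi_taylor2 H.hγ hη hne)
    (Phi_continuousAt H.hγ hη) hc hjet (H.source_le ht hx hα h0) ?_ ?_
  · have herr := H.errors_small ht hx
    have hQ := hpert x0 t0 hxα
    have hΦ0 := Phi_nonneg H.α_pos H.S.hβ H.hγ hη.le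
    have hΦm := Phi_le H.α_pos H.S.hβ H.hγ hη.le
    have hx2 : (x0 / √t0) ^ 2 * t0 = x0 ^ 2 := by
      rw [div_pow, Real.sq_sqrt ht0.le]; field_simp
    have hN := H.hN
    have hαpos := H.α_pos
    have hγ := H.hγ
    have hm := H.m_pos
    rw [add_sub_assoc, ← hQ] at key
    rcases lt_or_gt_of_ne hne with h1 | h1
    · rw [if_pos h1] at key
      generalize pert P α1 x0 t0 = Q at *
      have h2 : (1 + Q) * (γ * Phi α β γ (x0 / √t0) / (x0 / √t0) ^ 2 -
          x0 / √t0 / 2 * PhiDeriv α β γ (x0 / √t0) +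
          x0 / √t0 * PhiDeriv α β γ (x0 / √t0) / 2) / t0 =
          (1 + Q) * (γ * Phi α β γ (x0 / √t0) / x0 ^ 2) := by
        rw [← hx2]
        field_simp
        ring
      rw [h2] at key
      have c1 := neg_abs_le (s * (P' (α1 * √t0) * (α1 * (1 / (2 * √t0))) * Phi α β γ (x0 / √t0)))
      have c1' := le_abs_self (s * (P' (α1 * √t0) * (α1 * (1 / (2 * √t0))) *
        Phi α β γ (x0 / √t0)))
      have c2 := le_abs_self (s * (2 * P' x0 * PhiDeriv α β γ (x0 / √t0) / √t0))
      have c3 := le_abs_self (s * (Q * (γ * Phi α β γ (x0 / √t0) / x0 ^ 2)))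
      linarith
    · rw [if_neg (not_lt.2 h1.le)] at key
      have hb := hbd' h1 hα
      have hs : s = -1 := by
        rcases H.hs with hs | hs
        · linarith [hs.2]
        · exact hs.1
      have h2 : (1 + pert P α1 x0 t0) * (0 - x0 / √t0 / 2 * PhiDeriv α β γ (x0 / √t0) +
          x0 / √t0 * PhiDeriv α β γ (x0 / √t0) / 2) / t0 = 0 := by ring
      rw [h2] at key
      have h4 : γ * Phi α β γ (x0 / √t0) / x0 ^ 2 ≤ 2 * N / t0 := by
        calc γ * Phi α β γ (x0 / √t0) / x0 ^ 2 = γ * Phi α β γ (x0 / √t0) / (x0 / √t0) ^ 2 / t0 := by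
              rw [div_div, hx2]
          _ ≤ γ * ustarGamma α β γ / α ^ 2 / t0 := by gcongr
          _ ≤ 2 * N / t0 := by gcongr
      have c1' := le_abs_self (s * (P' (α1 * √t0) * (α1 * (1 / (2 * √t0))) *
        Phi α β γ (x0 / √t0)))
      have c2 := le_abs_self (s * (2 * P' x0 * PhiDeriv α β γ (x0 / √t0) / √t0))
      have c3 := abs_nonneg (s * (pert P α1 x0 t0 * (γ * Phi α β γ (x0 / √t0) / x0 ^ 2)))
      have h5 : -s * (γ * Phi α β γ (x0 / √t0) / x0 ^ 2) = γ * Phi α β γ (x0 / √t0) / x0 ^ 2 := by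
        rw [hs]; ring
      linarith
  · intro x hx'
    have h1 := (abs_le.1 hx').1
    have h2 : δ * √T / 2 ≤ x := by linarith
    have h3 := H.S.h01 x
    have hγ := H.hγ
    have h4 : γ / x ^ 2 ≤ γ / (δ * √T / 2) ^ 2 := by gcongr
    have h5 : 0 ≤ γ / x ^ 2 := by positivity
    exact abs_le.2 ⟨by linarith [h3.1], by linarith [h3.2]⟩
  · filter_upwards [hle, hnear] with z hz hz' hzt
    have := hz hzt
    unfold gap at this
    rw [hpert _ _ hz', ← add_sub_assoc] at this
    exact this
  · have := h0
    unfold gap at this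
    rw [hpert _ _ hxα, ← add_sub_assoc] at this
    exact this
end Comparison

lemma HasDerivWithinAt.comp_div_Iic {f : ℝ → ℝ} {l x c : ℝ} (hc : 0 < c)
    (h : HasDerivWithinAt f l (Iic (x / c)) (x / c)) :
    HasDerivWithinAt (fun y => f (y / c)) (l / c) (Iic x) x := by
  have h1 : HasDerivWithinAt (fun y : ℝ => y / c) (1 / c) (Iic x) x :=
    (hasDerivWithinAt_id x _).div_const c
  have := HasDerivWithinAt.comp (h₂ := f) x h h1 fun y hy =>
    mem_Iic.2 (div_le_div_of_nonneg_right (mem_Iic.1 hy) hc.le)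
  exact this.congr_deriv (by ring)

lemma HasDerivWithinAt.comp_div_Ici {f : ℝ → ℝ} {l x c : ℝ} (hc : 0 < c)
    (h : HasDerivWithinAt f l (Ici (x / c)) (x / c)) :
    HasDerivWithinAt (fun y => f (y / c)) (l / c) (Ici x) x := by
  have h1 : HasDerivWithinAt (fun y : ℝ => y / c) (1 / c) (Ici x) x :=
    (hasDerivWithinAt_id x _).div_const c
  have := HasDerivWithinAt.comp (h₂ := f) x h h1 fun y hy =>
    mem_Ici.2 (div_le_div_of_nonneg_right (mem_Ici.1 hy) hc.le)
  exact this.congr_deriv (by ring)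

namespace Comparison
variable {α β ustar γ : ℝ} {u p w : ℝ → ℝ → ℝ} {pstar : ℝ → ℝ}
  {s α1 δ L N T e ε K : ℝ} {P P' a a1 : ℝ → ℝ}

lemma pert_one_sided (H : Comparison α β ustar γ u p w pstar s α1 δ L N T e ε K P P' a a1)
    {x t : ℝ} (hx : x ≤ α1 * √t) : ∃ r,
    HasDerivWithinAt (fun y => pert P α1 y t) (P' x) (Iic x) x ∧
    HasDerivWithinAt (fun y => pert P α1 y t) r (Ici x) x ∧
    (x < α1 * √t → r = P' x) ∧ (x = α1 * √t → r = 0) := by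
  have hl : HasDerivWithinAt (fun y => pert P α1 y t) (P' x) (Iic x) x := by
    refine ((H.hP x).sub_const (P (α1 * √t))).hasDerivWithinAt.congr (fun y hy => ?_) ?_
    · unfold pert; rw [min_eq_left ((mem_Iic.1 hy).trans hx)]
    · unfold pert; rw [min_eq_left hx]
  rcases hx.lt_or_eq with h | h
  · refine ⟨P' x, hl, ?_, fun _ => rfl, fun h' => absurd h' h.ne⟩
    refine (((H.hP x).sub_const (P (α1 * √t))).congr_of_eventuallyEq ?_).hasDerivWithinAt
    filter_upwards [Iio_mem_nhds h] with y hy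
    unfold pert; rw [min_eq_left (mem_Iio.1 hy).le]
  · refine ⟨0, hl, ?_, fun h' => absurd h h'.ne, fun _ => rfl⟩
    refine (hasDerivWithinAt_const x _ (0:ℝ)).congr (fun y hy => ?_) ?_
    · unfold pert; rw [min_eq_right (h ▸ mem_Ici.1 hy), sub_self]
    · unfold pert; rw [min_eq_right h.ge, sub_self]

lemma no_touch_kink (H : Comparison α β ustar γ u p w pstar s α1 δ L N T e ε K P P' a a1)
    {x0 t0 : ℝ} (ht : T < t0) (hx : δ * √t0 < x0)
    (hα : x0 / √t0 = α ∨ x0 / √t0 = α1) (h0 : gap α β γ s u P a N L α1 x0 t0 = 0)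
    (hle : ∀ᶠ z : ℝ × ℝ in nhds (x0, t0), z.2 ≤ t0 → gap α β γ s u P a N L α1 z.1 z.2 ≤ 0) :
    False := by
  have hst := H.sqrt_pos ht.le
  have ht0 : 0 < t0 := H.T_pos.trans ht
  have hδ := H.hδ
  have hαpos := H.α_pos
  have hαα := H.α_le
  have hx0 : 0 < x0 := (mul_pos hδ hst).trans hx
  have hη : 0 < x0 / √t0 := by positivity
  have hδT : δ * √T ≤ δ * √t0 := by gcongr
  have hηα : α ≤ x0 / √t0 ∧ x0 / √t0 ≤ α1 := by
    rcases hα with h | h <;> rw [h] <;> simp [hαα]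
  have hxα : x0 ≤ α1 * √t0 := (div_le_iff₀ hst).1 hηα.2
  have hxα' : α * √t0 ≤ x0 := (le_div_iff₀ hst).1 hηα.1
  obtain ⟨q, hQl, hQr, hq, hq'⟩ := H.pert_one_sided hxα
  obtain ⟨kl, kr, hkl, hkr, hk⟩ := kinkBarrier_one_sided H.L_pos hα
  obtain ⟨J, l, r, hl, hr, hlr, hJ⟩ : ∃ J l r, HasDerivWithinAt (Phi α β γ) l (Iic (x0 / √t0)) (x0 / √t0) ∧
      HasDerivWithinAt (Phi α β γ) r (Ici (x0 / √t0)) (x0 / √t0) ∧ l - r = J ∧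
      ((x0 / √t0 = α ∧ J = α * β / 2) ∨ (x0 / √t0 ≠ α ∧ J = 0)) := by
    by_cases h : x0 / √t0 = α
    · obtain ⟨l, r, hl, hr, hlr⟩ := Phi_jump (β := β) H.α_pos H.hγ
      exact ⟨_, l, r, by rwa [h], by rwa [h], hlr, Or.inl ⟨h, rfl⟩⟩
    · have := Phi_hasDerivAt (β := β) H.hγ hη h
      exact ⟨0, _, _, this.hasDerivWithinAt, this.hasDerivWithinAt, sub_self _, Or.inr ⟨h, rfl⟩⟩
  have hstrip := stripBarrier_hasDerivAt N L α α1 (x0 / √t0)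
  have hBl := ((((hQl.const_add 1).mul (hl.comp_div_Iic hst)).const_mul s).add
    (((hkl.comp_div_Iic hst).const_mul (a t0)).add
      (hstrip.hasDerivWithinAt.comp_div_Iic hst)))
  have hBr := ((((hQr.const_add 1).mul (hr.comp_div_Ici hst)).const_mul s).add
    (((hkr.comp_div_Ici hst).const_mul (a t0)).add
      (hstrip.hasDerivWithinAt.comp_div_Ici hst)))
  have hmax : ∀ᶠ x in nhds x0,
      s * u x t0 - (s * ((1 + pert P α1 x t0) * Phi α β γ (x / √t0)) + bar a N L α α1 x t0) ≤
      s * u x0 t0 - (s * ((1 + pert P α1 x0 t0) * Phi α β γ (x0 / √t0)) +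
        bar a N L α α1 x0 t0) := by
    filter_upwards [eventually_slice hle] with x hx
    have h1 := hx le_rfl
    unfold gap at h1 h0
    linarith
  have hmain : s * ((P' x0 - q) * Phi α β γ (x0 / √t0)) + s * (pert P α1 x0 t0 * J / √t0) +
      a t0 * (1 / L) / √t0 ≤ 0 := by
    have hk' : a t0 * (1 / L) / √t0 ≤ a t0 * (kl - kr) / √t0 := by
      have := H.he.le.trans (H.hae t0 ht.le)
      gcongr
    rcases hJ with ⟨h1, h2⟩ | ⟨h1, h2⟩
    · have := H.S.kink (s := s) ht0 ((div_eq_iff hst.ne').1 h1) hBl hBr hmax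
      have e1 : s * (α * β / (2 * √t0)) = s * J / √t0 := by rw [h2]; field_simp
      rw [e1, ← hlr] at this
      rw [← hlr]
      refine le_trans (b := _) ?_ (sub_nonpos.2 this)
      refine (add_le_add_right hk' _).trans (le_of_eq ?_)
      field_simp
      ring
    · have := H.S.kink' (s := s) ht0 (H.div_sqrt_ne ht hx h1) hBl hBr hmax
      refine le_trans (b := _) ?_ this
      refine (add_le_add_right hk' _).trans (le_of_eq ?_)
      rw [h2]
      rw [h2, sub_eq_zero] at hlr
      rw [hlr]
      field_simp
      ring
  have hgap : e / L / √t0 ≤ a t0 * (1 / L) / √t0 := by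
    have := H.hae t0 ht.le
    have := H.L_pos
    rw [mul_one_div]
    gcongr
  rcases hxα.lt_or_eq with h | h
  · have h1 : x0 / √t0 = α := hα.resolve_right fun h' => h.ne ((div_eq_iff hst.ne').1 h')
    rw [hq h] at hmain
    have hJ' : J = α * β / 2 := by
      rcases hJ with h | h
      · exact h.2
      · exact absurd h1 h.1
    have hβ := H.S.hβ
    have hJ0 : 0 ≤ J := by rw [hJ']; positivity
    have h2 : |s * (pert P α1 x0 t0 * J / √t0)| ≤ ε * (α1 / δ) * (α * β / 2) / √t0 := by
      rw [abs_mul, H.s_abs, one_mul, abs_div, abs_mul, abs_of_pos hst, abs_of_nonneg hJ0, hJ']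
      have := H.abs_pert ht.le hx.le
      gcongr
    have h3 := (neg_abs_le _).trans' (neg_le_neg h2)
    have h4 := div_lt_div_of_pos_right H.small5 hst
    simp only [sub_self, zero_mul, mul_zero, zero_add] at hmain
    linarith
  · have hQ0 : pert P α1 x0 t0 = 0 := by unfold pert; rw [min_eq_left h.le, h, sub_self]
    rw [hq' h, hQ0] at hmain
    have hε := H.ε_nonneg
    have hP : |P' x0| ≤ ε / (α * √t0) := (H.hP' x0 (hδT.trans hx.le)).trans (by gcongr)
    have hΦ0 := Phi_nonneg H.α_pos H.S.hβ H.hγ hη.le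
    have hm := H.m_pos
    have h2 : |s * ((P' x0 - 0) * Phi α β γ (x0 / √t0))| ≤ ε * ustarGamma α β γ / α / √t0 := by
      rw [abs_mul, H.s_abs, one_mul, sub_zero, abs_mul,
        abs_of_nonneg hΦ0]
      have := Phi_le H.α_pos H.S.hβ H.hγ hη.le
      calc |P' x0| * Phi α β γ (x0 / √t0) ≤ ε / (α * √t0) * ustarGamma α β γ := by
            gcongr
        _ = _ := by field_simp
    have h3 := (neg_abs_le _).trans' (neg_le_neg h2)
    have h4 := div_lt_div_of_pos_right H.small4 hst
    simp only [zero_mul, zero_div, mul_zero, add_zero] at hmain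
    linarith

lemma continuousAt_gap (H : Comparison α β ustar γ u p w pstar s α1 δ L N T e ε K P P' a a1)
    {x t : ℝ} (ht : T ≤ t) (hx : δ * √t ≤ x) :
    ContinuousAt (fun q : ℝ × ℝ => gap α β γ s u P a N L α1 q.1 q.2) (x, t) := by
  have hst := H.sqrt_pos ht
  have ht0 : 0 < t := H.T_pos.trans_le ht
  have hη : 0 < x / √t := H.hδ.trans_le ((le_div_iff₀ hst).2 hx)
  have hdiv : ContinuousAt (fun q : ℝ × ℝ => q.1 / √q.2) (x, t) :=
    ContinuousAt.div (by fun_prop) (by fun_prop) hst.ne'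
  have hP : Continuous P := continuous_iff_continuousAt.2 fun x => (H.hP x).continuousAt
  have hu := H.S.continuousAt_u x ht0
  have hΦ : ContinuousAt (fun q : ℝ × ℝ => Phi α β γ (q.1 / √q.2)) (x, t) :=
    ContinuousAt.comp (f := fun q : ℝ × ℝ => q.1 / √q.2) (g := Phi α β γ)
      (Phi_continuousAt H.hγ hη) hdiv
  have hk : ContinuousAt (fun q : ℝ × ℝ => kinkBarrier L α α1 (q.1 / √q.2)) (x, t) :=
    ContinuousAt.comp (f := fun q : ℝ × ℝ => q.1 / √q.2) (g := kinkBarrier L α α1)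
      (continuous_kinkBarrier L α α1).continuousAt hdiv
  have hs : ContinuousAt (fun q : ℝ × ℝ => stripBarrier N L α α1 (q.1 / √q.2)) (x, t) :=
    ContinuousAt.comp (f := fun q : ℝ × ℝ => q.1 / √q.2) (g := stripBarrier N L α α1)
      (continuous_stripBarrier N L α α1).continuousAt hdiv
  have ha : ContinuousAt (fun q : ℝ × ℝ => a q.2) (x, t) :=
    ContinuousAt.comp (f := fun q : ℝ × ℝ => q.2) (g := a) (H.ha t ht).continuousAt
      continuousAt_snd
  have hpt : ContinuousAt (fun q : ℝ × ℝ => pert P α1 q.1 q.2) (x, t) := by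
    have : Continuous fun q : ℝ × ℝ => pert P α1 q.1 q.2 := by unfold pert; fun_prop
    exact this.continuousAt
  unfold gap bar
  exact (((hu.const_mul s).sub (((hpt.const_add 1).mul hΦ).const_mul s)).sub
    ((ha.mul hk).add hs))

lemma gap_neg_of_close (H : Comparison α β ustar γ u p w pstar s α1 δ L N T e ε K P P' a a1)
    {x t : ℝ} (ht : T ≤ t) (hx : δ * √t ≤ x) (hx' : x ≤ L * √t)
    (h : |u x t - Phi α β γ (x / √t)| ≤ e) : gap α β γ s u P a N L α1 x t < 0 := by
  have h1 := H.bar_ge ht ((mul_pos H.hδ (H.sqrt_pos ht)).le.trans hx) hx'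
  have h2 : |s * (pert P α1 x t * Phi α β γ (x / √t))| < e := by
    rw [abs_mul, H.s_abs, one_mul]
    exact (H.pert_mul_Phi_le ht hx).trans_lt H.small2
  have h3 : |s * (u x t - Phi α β γ (x / √t))| ≤ e := by rwa [abs_mul, H.s_abs, one_mul]
  have h4 := (abs_lt.1 h2).1
  have h5 := (abs_le.1 h3).2
  have := H.hae t ht
  have := H.he
  unfold gap
  nlinarith

theorem gap_neg (H : Comparison α β ustar γ u p w pstar s α1 δ L N T e ε K P P' a a1) : ∀ x t, T ≤ t → δ * √t ≤ x → x ≤ L * √t →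
    gap α β γ s u P a N L α1 x t < 0 := by
  have hδL : ∀ t, δ * √t ≤ L * √t := fun t => by
    have := H.hδα; have := H.α_le; have := H.hL; gcongr; linarith
  refine neg_of_no_first_zero (l := fun t => δ * √t) (r := fun t => L * √t)
    (by fun_prop) (by fun_prop) (fun x t ht hx _ => H.continuousAt_gap ht hx) ?_ ?_ ?_ ?_
  · intro x hx hx'
    have hst := H.sqrt_pos le_rfl
    have h1 := H.bar_ge le_rfl ((mul_pos H.hδ hst).le.trans hx) hx'
    have h2 := H.initial
    have hη : 0 ≤ x / √T := (H.hδ.le.trans ((le_div_iff₀ hst).2 hx))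
    have h3 := Phi_nonneg H.α_pos H.S.hβ H.hγ hη
    have h4 := Phi_le H.α_pos H.S.hβ H.hγ hη
    have h5 := H.S.u_nonneg x H.T_pos.le
    have h6 := (H.S.u_le_psi x H.T_pos.le).trans (psi_le H.α_pos H.S.hβ x T)
    have h7 : |pert P α1 x T| ≤ 1 := (H.abs_pert le_rfl hx).trans H.small1
    have h8 : |s * u x T| ≤ PsiP α β α := by
      rw [abs_mul, H.s_abs, one_mul, abs_of_nonneg h5]; exact h6
    have h9 : |s * ((1 + pert P α1 x T) * Phi α β γ (x / √T))| ≤ 2 * ustarGamma α β γ := by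
      rw [abs_mul, H.s_abs, one_mul, abs_mul, abs_of_nonneg h3]
      refine mul_le_mul ?_ h4 h3 two_pos.le
      exact (abs_add_le _ _).trans (by rw [abs_one]; linarith)
    have h10 := (abs_le.1 h8).2
    have h11 := (abs_le.1 h9).1
    unfold gap
    linarith
  · intro t ht _
    have hst := H.sqrt_pos ht
    refine H.gap_neg_of_close ht le_rfl (hδL t) ?_
    rw [mul_div_cancel_right₀ _ hst.ne']
    exact H.left t ht
  · intro t ht _
    have hst := H.sqrt_pos ht
    refine H.gap_neg_of_close ht (hδL t) le_rfl ?_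
    rw [mul_div_cancel_right₀ _ hst.ne']
    exact H.right t ht
  · intro x t ht hx hx' h0 hle
    have hev := eventually_backward (l := fun t => δ * √t) (r := fun t => L * √t)
      (by fun_prop) (by fun_prop) ht hx hx' hle
    by_cases hα : x / √t = α ∨ x / √t = α1
    · exact H.no_touch_kink ht hx hα h0 hev
    push Not at hα
    rcases lt_or_gt_of_ne hα.2 with h | h
    · exact H.no_touch_inner ht hx h hα.1 h0 hev
    · exact H.no_touch_outer ht hx hx' h h0 hev

/-- The resulting one-sided estimate. -/
theorem estimate (H : Comparison α β ustar γ u p w pstar s α1 δ L N T e ε K P P' a a1)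
    {x t : ℝ} (ht : T ≤ t) (hx : δ * √t ≤ x) (hx' : x ≤ L * √t) :
    s * (u x t - Phi α β γ (x / √t)) ≤ e + 6 * a t + N * (2 * L * (α1 - α)) := by
  have hst := H.sqrt_pos ht
  have h1 := H.gap_neg x t ht hx hx'
  have h2 : |s * (pert P α1 x t * Phi α β γ (x / √t))| < e := by
    rw [abs_mul, H.s_abs, one_mul]
    exact (H.pert_mul_Phi_le ht hx).trans_lt H.small2
  have h3 := (abs_lt.1 h2).2
  have hη : 0 ≤ x / √t := (H.hδ.le.trans ((le_div_iff₀ hst).2 hx))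
  have hη' : x / √t ≤ L := (div_le_iff₀ hst).2 hx'
  have h4 := (kinkBarrier_bounds H.L_pos H.α_pos.le H.α1_pos.le hη hη').2
  have h5 := (stripBarrier_bounds H.N_nonneg H.α_pos.le H.α_le H.hL.le hη').2
  have h6 := H.he.le.trans (H.hae t ht)
  unfold gap bar at h1
  nlinarith
end Comparison

lemma integral_const_div_sq (γ : ℝ) {y z : ℝ} (hy : 0 < y) (hyz : y ≤ z) :
    ∫ x in y..z, γ / x ^ 2 = γ / y - γ / z := by
  have hpos : ∀ x ∈ uIcc y z, 0 < x := fun x hx => by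
    rw [uIcc_of_le hyz] at hx; exact hy.trans_le hx.1
  have h : ∀ x ∈ uIcc y z, HasDerivAt (fun x : ℝ => -(γ / x)) (γ / x ^ 2) x := fun x hx => by
    have hx0 := (hpos x hx).ne'
    have := ((hasDerivAt_inv hx0).const_mul γ).neg
    refine (this.congr_deriv (by field_simp)).congr_of_eventuallyEq (Eventually.of_forall fun y => ?_)
    simp [div_eq_mul_inv]
  rw [intervalIntegral.integral_eq_sub_of_hasDerivAt h]
  · ring
  · refine ContinuousOn.intervalIntegrable (continuousOn_const.div (by fun_prop) fun x hx => ?_)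
    have := hpos x hx
    positivity

lemma eventually_mul_lt {c d : ℝ} (hd : 0 < d) : ∀ᶠ ε : ℝ in nhdsWithin 0 (Ioi 0), ε * c < d := by
  have h : ContinuousAt (fun ε : ℝ => ε * c) 0 := by fun_prop
  exact (h.eventually (gt_mem_nhds (by simpa using hd))).filter_mono nhdsWithin_le_nhds

namespace CSol
variable {α β ustar γ : ℝ} {u p w : ℝ → ℝ → ℝ} {pstar : ℝ → ℝ}

/-- The potential whose second derivative is `pstar x - γ / x ^ 2` away from the origin. -/
lemma exists_potential (S : CSol α β ustar u p w pstar) (γ : ℝ) {δ0 : ℝ} (hδ0 : 0 < δ0) :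
    ∃ P P' : ℝ → ℝ, (∀ x, HasDerivAt P (P' x) x) ∧ Continuous P' ∧
      (∀ y z, δ0 ≤ y → y ≤ z → P' z - P' y = ∫ x in y..z, (pstar x - γ / x ^ 2)) ∧
      ∀ x, δ0 ≤ x → P' x = γ / x - ∫ ξ in Ioi x, pstar ξ := by
  have hF : Continuous fun x => ∫ ξ in Ioi x, pstar ξ := by
    have h1 : (fun x => ∫ ξ in Ioi x, pstar ξ) =
        fun x => (∫ ξ in Ioi (0:ℝ), pstar ξ) - ∫ ξ in (0:ℝ)..x, pstar ξ := by
      funext x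
      have := S.tail_sub 0 x
      linarith
    rw [h1]
    exact continuous_const.sub
      (intervalIntegral.continuous_primitive (fun a b => S.pstar_intervalIntegrable a b) 0)
  have hmax : ∀ x, 0 < max x δ0 := fun x => lt_max_of_lt_right hδ0
  have hmx : Continuous fun x => max x δ0 := by fun_prop
  have hc : Continuous fun x => γ / max x δ0 - ∫ ξ in Ioi (max x δ0), pstar ξ :=
    (continuous_const.div hmx fun x => (hmax x).ne').sub (hF.comp hmx)
  refine ⟨fun x => ∫ y in (0:ℝ)..x, (γ / max y δ0 - ∫ ξ in Ioi (max y δ0), pstar ξ), _,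
    fun x => (hc.integral_hasStrictDerivAt 0 x).hasDerivAt, hc, fun y z hy hyz => ?_,
    fun x hx => by rw [max_eq_left hx]⟩
  have hy0 := hδ0.trans_le hy
  rw [max_eq_left hy, max_eq_left (hy.trans hyz), intervalIntegral.integral_sub
    (S.pstar_intervalIntegrable y z), integral_const_div_sq γ hy0 hyz, ← S.tail_sub]
  · ring
  · refine ContinuousOn.intervalIntegrable (continuousOn_const.div (by fun_prop) fun x hx => ?_)
    rw [uIcc_of_le hyz] at hx
    have := hy0.trans_le hx.1
    positivity

set_option maxHeartbeats 1000000 in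
lemma one_sided_estimate (S : CSol α β ustar u p w pstar) (hγ : 0 ≤ γ)
    (htail : Tendsto (fun x => x * ∫ ξ in Ioi x, pstar ξ) atTop (nhds γ)) {s α1 δ L e T0 : ℝ}
    (hs : (s = 1 ∧ α1 = α) ∨ (s = -1 ∧ α < α1)) (hδ : 0 < δ) (hδα : δ < α) (hL : α1 < L)
    (he : 0 < e) (hl : ∀ t, T0 ≤ t → |u (δ * √t) t - Phi α β γ δ| ≤ e)
    (hr : ∀ t, T0 ≤ t → |u (L * √t) t - Phi α β γ L| ≤ e) :
    ∃ T, ∀ x t, T ≤ t → δ * √t ≤ x → x ≤ L * √t → s * (u x t - Phi α β γ (x / √t)) ≤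
      13 * e + γ * ustarGamma α β γ / α ^ 2 / 2 * (2 * L * (α1 - α)) := by
  have hα := S.hα
  have hαα : α ≤ α1 := by
    rcases hs with h | h
    · exact h.2.ge
    · exact h.2.le
  have hα1 : 0 < α1 := hα.trans_le hαα
  have hL0 : 0 < L := hα1.trans hL
  have hm := ustarGamma_pos hα S.hβ hγ
  obtain ⟨K, -, hK⟩ := PhiDeriv_bound hα S.hβ hγ hδ
  obtain ⟨ε, hε1, hε2, hε3, hε4, hε5, hε⟩ := ((eventually_mul_lt (c := α1 / δ) one_pos).and
    ((eventually_mul_lt (c := α1 / δ * ustarGamma α β γ) he).and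
    ((eventually_mul_lt (c := ustarGamma α β γ / 2 + 2 * K / δ +
      α1 / δ * γ * ustarGamma α β γ / δ ^ 2) (d := e * δ / (4 * L)) (by positivity)).and
    ((eventually_mul_lt (c := ustarGamma α β γ / α) (d := e / L) (by positivity)).and
    ((eventually_mul_lt (c := α1 / δ * (α * β / 2)) (d := e / L) (by positivity)).and
      self_mem_nhdsWithin))))).exists
  obtain ⟨X0, hX0⟩ := eventually_atTop.1 (Metric.tendsto_nhds.1 htail ε hε)
  obtain ⟨X1, hX1⟩ : ∃ X, s = -1 → ∀ x t, X ≤ x → 0 ≤ t → α1 * √t ≤ x → p x t = 0 := by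
    rcases hs with h | h
    · exact ⟨0, fun h' => by rw [h.1] at h'; norm_num at h'⟩
    · obtain ⟨X, -, hX⟩ := S.eventually_p_eq_zero_outer h.2
      exact ⟨X, fun _ => hX⟩
  obtain ⟨T, hT1, hT2, hT3, hT4⟩ := ((eventually_ge_atTop (1:ℝ)).and
    ((eventually_ge_atTop T0).and
    (((Real.tendsto_sqrt_atTop.const_mul_atTop hδ).eventually_ge_atTop X0).and
    ((Real.tendsto_sqrt_atTop.const_mul_atTop hα1).eventually_ge_atTop X1)))).exists
  have hT : 0 < T := one_pos.trans_le hT1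
  have hsT : 0 < √T := Real.sqrt_pos.2 hT
  obtain ⟨P, P', hP, hPc, hθ, hP'⟩ := S.exists_potential γ (δ0 := δ * √T / 2) (by positivity)
  set M := (PsiP α β α + 2 * ustarGamma α β γ) / (3 * e) with hM
  have hM0 : 0 < M := by
    have := PsiP_self_pos hα S.hβ
    positivity
  set ν := δ / (24 * L) with hν
  have hν0 : 0 < ν := by positivity
  set a : ℝ → ℝ := fun t => e * (1 + M * T ^ ν * t ^ (-ν)) with ha
  have H : Comparison α β ustar γ u p w pstar s α1 δ L (γ * ustarGamma α β γ / α ^ 2 / 2) T e ε K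
      P P' a (fun t => e * (M * T ^ ν * (-ν * t ^ (-ν - 1)))) :=
    { S := S
      hγ := hγ
      hs := by
        rcases hs with h | h
        · exact Or.inl h
        · refine Or.inr ⟨h.1, h.2, fun x t ht hx => hX1 h.1 x t ?_ (hT.le.trans ht) hx⟩
          refine hT4.trans (le_trans ?_ hx)
          gcongr
      hδ := hδ
      hδα := hδα
      hL := hL
      hT := hT1
      he := he
      hN := by linarith
      hP := hP
      hPc := hPc
      hθ := hθ
      hP' := fun x hx => by
        have hx0 : 0 < x := (mul_pos hδ hsT).trans_le hx
        have h1 := (hX0 x (hT3.trans hx)).le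
        rw [Real.dist_eq] at h1
        rw [hP' x (by have := mul_pos hδ hsT; linarith), le_div_iff₀ hx0]
        calc |γ / x - ∫ ξ in Ioi x, pstar ξ| * x = |(γ / x - ∫ ξ in Ioi x, pstar ξ) * x| := by
              rw [abs_mul, abs_of_pos hx0]
          _ = |x * (∫ ξ in Ioi x, pstar ξ) - γ| := by
              rw [abs_sub_comm, sub_mul, div_mul_cancel₀ _ hx0.ne', mul_comm x]
          _ ≤ ε := h1
      hK := hK
      ha := fun t ht => by
        have := (Real.hasDerivAt_rpow_const (p := -ν) (Or.inl (hT.trans_le ht).ne')).const_mul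
          (M * T ^ ν)
        exact (this.const_add 1).const_mul e
      hae := fun t ht => by
        have : 0 < T ^ ν := Real.rpow_pos_of_pos hT _
        have : 0 < t ^ (-ν) := Real.rpow_pos_of_pos (hT.trans_le ht) _
        have : 0 ≤ M * T ^ ν * t ^ (-ν) := by positivity
        rw [ha]
        nlinarith
      ha1 := fun t ht => by
        have ht0 : 0 < t := hT.trans_le ht
        rw [Real.rpow_sub_one ht0.ne', ha]
        have : 0 ≤ ν * e / t := by positivity
        have h2 : -ν * (e * (1 + M * T ^ ν * t ^ (-ν)) / t) =
          e * (M * T ^ ν * (-ν * (t ^ (-ν) / t))) - ν * e / t := by field_simp; ring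
        rw [h2]
        linarith
      small1 := hε1.le
      small2 := by rwa [mul_assoc]
      small3 := hε3
      small4 := by rwa [mul_div_assoc]
      small5 := by rwa [mul_assoc]
      initial := by
        have h1 : T ^ ν * T ^ (-ν) = 1 := by
          rw [← Real.rpow_add hT, add_neg_cancel, Real.rpow_zero]
        have h2 : a T = e * (1 + M) := by
          simp only [ha]; rw [mul_assoc M, h1, mul_one]
        have h3 : M * (3 * e) = PsiP α β α + 2 * ustarGamma α β γ :=
          div_mul_cancel₀ _ (by positivity)
        rw [h2]
        nlinarith
      left := fun t ht => hl t (hT2.trans ht)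
      right := fun t ht => hr t (hT2.trans ht) }
  have hlim : ∀ᶠ t : ℝ in atTop, M * T ^ ν * t ^ (-ν) < 1 := by
    have := (tendsto_rpow_neg_atTop hν0).const_mul (M * T ^ ν)
    rw [mul_zero] at this
    exact this.eventually (gt_mem_nhds one_pos)
  obtain ⟨T2, hT2'⟩ := eventually_atTop.1 hlim
  refine ⟨max T T2, fun x t ht hx hx' => (H.estimate ((le_max_left _ _).trans ht) hx hx').trans ?_⟩
  have h1 : a t ≤ 2 * e := by
    have := hT2' t ((le_max_right _ _).trans ht)
    simp only [ha]
    nlinarith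
  linarith

/-- Decay of the tail of `pstar` determines the limit profile. -/
theorem convUnif (S : CSol α β ustar u p w pstar) (hγ : 0 ≤ γ)
    (htail : Tendsto (fun x => x * ∫ ξ in Ioi x, pstar ξ) atTop (nhds γ)) :
    ConvUnif u (Phi α β γ) := by
  intro E hE
  have hα := S.hα
  have hm := ustarGamma_pos hα S.hβ hγ
  set e := E / 100 with he'
  have he : 0 < e := by positivity
  obtain ⟨L1, hL1, hfar⟩ := S.exists_far he
  obtain ⟨L2, hL2, hfar'⟩ := Phi_small_far (α := α) (β := β) (γ := γ) he
  obtain ⟨δ1, hδ1, hδ1α, T1, hT1, hnear⟩ := S.exists_near he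
  obtain ⟨δ2, hδ2, hnear'⟩ := Phi_small_near (α := α) (β := β) hα hγ he
  set L := max L1 L2 with hL
  set δ := min δ1 δ2 with hδ
  have hLα : α < L := hL1.trans_le (le_max_left _ _)
  have hL0 : 0 < L := hα.trans hLα
  have hδ0 : 0 < δ := lt_min hδ1 hδ2
  have hδα : δ < α := (min_le_left _ _).trans_lt hδ1α
  have nearEst : ∀ η t, T1 ≤ t → 0 ≤ η → η ≤ δ → |u (η * √t) t - Phi α β γ η| ≤ e := by
    intro η t ht h0 h1
    have h2 := hnear (η * √t) t ht (by
      rw [abs_of_nonneg (by positivity)]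
      gcongr
      exact h1.trans (min_le_left _ _))
    have h3 := S.u_nonneg (η * √t) (by linarith : 0 ≤ t)
    have h4 := hnear' η h0 (h1.trans (min_le_right _ _))
    have h5 := Phi_nonneg hα S.hβ hγ h0
    exact abs_le.2 ⟨by linarith, by linarith⟩
  have farEst : ∀ η t, T1 ≤ t → L ≤ η → |u (η * √t) t - Phi α β γ η| ≤ e := by
    intro η t ht h1
    have h2 := (hfar (η * √t) t (by linarith) (by
      gcongr
      exact (le_max_left _ _).trans h1)).le
    have h3 := S.u_nonneg (η * √t) (by linarith : 0 ≤ t)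
    have h4 := hfar' η ((le_max_right _ _).trans h1)
    have h5 := Phi_nonneg hα S.hβ hγ (hL0.le.trans h1)
    exact abs_le.2 ⟨by linarith, by linarith⟩
  have hl : ∀ t, T1 ≤ t → |u (δ * √t) t - Phi α β γ δ| ≤ e :=
    fun t ht => nearEst δ t ht hδ0.le le_rfl
  have hr : ∀ t, T1 ≤ t → |u (L * √t) t - Phi α β γ L| ≤ e := fun t ht => farEst L t ht le_rfl
  set N := γ * ustarGamma α β γ / α ^ 2 / 2 with hN
  have hN0 : 0 ≤ N := by positivity
  set d := min ((L - α) / 2) (e / (2 * L * N + 1)) with hd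
  have hd0 : 0 < d := lt_min (by linarith) (by positivity)
  have hdN : N * (2 * L * d) ≤ e := by
    have h1 : d ≤ e / (2 * L * N + 1) := min_le_right _ _
    rw [le_div_iff₀ (by positivity)] at h1
    nlinarith
  obtain ⟨T2, h2⟩ := S.one_sided_estimate hγ htail (s := 1) (α1 := α) (Or.inl ⟨rfl, rfl⟩) hδ0 hδα
    hLα he hl hr
  obtain ⟨T3, h3⟩ := S.one_sided_estimate hγ htail (s := -1) (α1 := α + d)
    (Or.inr ⟨rfl, by linarith⟩) hδ0 hδα
    (by have : d ≤ (L - α) / 2 := min_le_left _ _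
        linarith) he hl hr
  refine ⟨max (max T1 T2) T3, fun t ht η hη => ?_⟩
  have ht1 : T1 ≤ t := (le_max_left _ _).trans ((le_max_left _ _).trans ht)
  have ht2 : T2 ≤ t := (le_max_right _ _).trans ((le_max_left _ _).trans ht)
  have ht3 : T3 ≤ t := (le_max_right _ _).trans ht
  have hst : 0 < √t := Real.sqrt_pos.2 (by linarith)
  have hE' : E = 100 * e := by rw [he']; ring
  rcases le_or_gt η δ with h | h
  · have := nearEst η t ht1 hη h
    linarith
  rcases le_or_gt L η with h' | h'
  · have := farEst η t ht1 h'
    linarith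
  have k2 := h2 (η * √t) t ht2 (by gcongr) (by gcongr)
  have k3 := h3 (η * √t) t ht3 (by gcongr) (by gcongr)
  rw [mul_div_cancel_right₀ _ hst.ne'] at k2 k3
  rw [add_sub_cancel_left, ← hN] at k3
  rw [sub_self, mul_zero, mul_zero] at k2
  exact abs_lt.2 ⟨by linarith, by linarith⟩

end CSol

/-- Integration by parts of a `C¹` function against a merely integrable one with primitive `H`. -/
lemma integral_mul_eq_of_primitive {f f' g H : ℝ → ℝ} {a b : ℝ} (hab : a ≤ b)
    (hf : ∀ x ∈ Icc a b, HasDerivAt f (f' x) x) (hf' : ContinuousOn f' (Icc a b))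
    (hg : IntervalIntegrable g volume a b) (hH : ∀ x ∈ Icc a b, H x = H a + ∫ y in a..x, g y) :
    IntervalIntegrable (fun x => f' x * H x) volume a b ∧
      ∫ x in a..b, f x * g x = f b * H b - f a * H a - ∫ x in a..b, f' x * H x := by
  have ha : a ∈ uIcc a b := left_mem_uIcc
  have hp : AbsolutelyContinuousOnInterval (fun x => ∫ y in a..x, g y) a b :=
    hg.absolutelyContinuousOnInterval_intervalIntegral ha
  obtain ⟨C, hC⟩ := isCompact_Icc.exists_bound_of_continuousOn hf'
  have hfL : AbsolutelyContinuousOnInterval f a b := by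
    refine LipschitzOnWith.absolutelyContinuousOnInterval (K := C.toNNReal) ?_
    rw [uIcc_of_le hab]
    refine (convex_Icc a b).lipschitzOnWith_of_nnnorm_hasDerivWithin_le
      (fun x hx => (hf x hx).hasDerivWithinAt) fun x hx => ?_
    rw [← NNReal.coe_le_coe, coe_nnnorm]
    exact (hC x hx).trans (Real.le_coe_toNNReal C)
  have hfi : IntervalIntegrable f' volume a b := by
    rw [← uIcc_of_le hab] at hf'
    exact hf'.intervalIntegrable
  have key : ∫ x in a..b, f x * g x =
      f b * (∫ y in a..b, g y) - ∫ x in a..b, f' x * ∫ y in a..x, g y := by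
    have h := hfL.integral_mul_deriv_eq_deriv_mul hp
    rw [intervalIntegral.integral_same, mul_zero, sub_zero] at h
    rw [intervalIntegral.integral_congr_ae (g := fun x => f x * deriv (fun x => ∫ y in a..x, g y) x),
      h]
    · congr 1
      refine intervalIntegral.integral_congr fun x hx => ?_
      rw [uIcc_of_le hab] at hx
      simp only [(hf x hx).deriv]
    · filter_upwards [hg.ae_hasDerivAt_integral] with x hx hxI
      rw [(hx (uIoc_subset_uIcc hxI) a ha).deriv]
  have hpI : IntervalIntegrable (fun x => f' x * ∫ y in a..x, g y) volume a b :=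
    hfi.mul_continuousOn hp.continuousOn
  have hEq : EqOn (fun x => f' x * H x) (fun x => H a * f' x + f' x * ∫ y in a..x, g y)
      (uIcc a b) := fun x hx => by
    rw [uIcc_of_le hab] at hx
    simp only [hH x hx]
    ring
  have hsum := (hfi.const_mul (H a)).add hpI
  refine ⟨hsum.congr fun x hx => (hEq (uIoc_subset_uIcc hx)).symm, ?_⟩
  rw [intervalIntegral.integral_congr hEq, intervalIntegral.integral_add (hfi.const_mul _) hpI,
    intervalIntegral.integral_const_mul, intervalIntegral.integral_eq_sub_of_hasDerivAt
      (fun x hx => hf x (by rwa [uIcc_of_le hab] at hx)) hfi, key, hH b ⟨hab, le_rfl⟩]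
  ring

section Averages
variable {g F G : ℝ → ℝ} {γ : ℝ}

lemma tendsto_average_of_tendsto_tail (hg : ∀ a b, 0 ≤ a → a ≤ b → IntervalIntegrable g volume a b)
    (hF : ∀ a b, F a - F b = ∫ x in a..b, g x)
    (hG : ∀ a b, 0 ≤ a → a ≤ b → G b - G a = ∫ x in a..b, x ^ 2 * g x)
    (h : Tendsto (fun x => x * F x) atTop (nhds γ)) :
    Tendsto (fun x => 1 / x * G x) atTop (nhds γ) := by
  rw [Metric.tendsto_atTop]
  intro ε hε
  obtain ⟨X, hX⟩ := Metric.tendsto_atTop.1 h (ε / 8) (by positivity)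
  set a := max X 1 with ha
  have ha1 : 1 ≤ a := le_max_right _ _
  have hb : ∀ x, a ≤ x → γ - ε / 8 ≤ x * F x ∧ x * F x ≤ γ + ε / 8 := fun x hx => by
    have := hX x ((le_max_left _ _).trans hx)
    rw [Real.dist_eq, abs_lt] at this
    constructor <;> linarith
  set D := G a + a ^ 2 * F a - 2 * γ * a with hD
  refine ⟨max a (4 * |D| / ε + 1), fun x hx => ?_⟩
  have hax : a ≤ x := (le_max_left _ _).trans hx
  have hx0 : 0 < x := by linarith
  have hDx : |D| ≤ ε / 4 * x := by
    have h1 : 4 * |D| / ε ≤ x := by linarith [(le_max_right a (4 * |D| / ε + 1)).trans hx]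
    rw [div_le_iff₀ hε] at h1
    linarith
  obtain ⟨hI, hE⟩ := integral_mul_eq_of_primitive (f := fun x => x ^ 2) (f' := fun x => 2 * x)
    (g := g) (H := fun x => -F x) hax (fun y _ => by simpa using hasDerivAt_pow 2 y) (by fun_prop)
    (hg a x (by linarith) hax) (fun y _ => by rw [← hF]; ring)
  rw [← hG a x (by linarith) hax] at hE
  have up : ∫ y in a..x, 2 * y * -F y ≤ ∫ y in a..x, (-(2 * γ) + ε / 4) :=
    intervalIntegral.integral_mono_on hax hI intervalIntegrable_const fun y hy => by
      have := (hb y hy.1).1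
      linarith
  have lo : ∫ y in a..x, (-(2 * γ) - ε / 4) ≤ ∫ y in a..x, 2 * y * -F y :=
    intervalIntegral.integral_mono_on hax intervalIntegrable_const hI fun y hy => by
      have := (hb y hy.1).2
      linarith
  rw [intervalIntegral.integral_const, smul_eq_mul] at up lo
  have hxb := hb x hax
  have h1 : x ^ 2 * F x ≤ x * (γ + ε / 8) := by nlinarith
  have h2 : x * (γ - ε / 8) ≤ x ^ 2 * F x := by nlinarith
  have hae : 0 ≤ a * ε := by positivity
  have hxe : 0 < x * ε := by positivity
  obtain ⟨hD1, hD2⟩ := abs_le.1 hDx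
  rw [Real.dist_eq, one_div_mul_eq_div, div_sub' hx0.ne', abs_div, abs_of_pos hx0, div_lt_iff₀ hx0,
    abs_lt]
  constructor <;> nlinarith

lemma tendsto_tail_of_tendsto_average (hg : ∀ a b, 0 ≤ a → a ≤ b → IntervalIntegrable g volume a b)
    (hF : ∀ a b, F a - F b = ∫ x in a..b, g x) (hF0 : Tendsto F atTop (nhds 0))
    (hG : ∀ a b, 0 ≤ a → a ≤ b → G b - G a = ∫ x in a..b, x ^ 2 * g x)
    (h : Tendsto (fun x => 1 / x * G x) atTop (nhds γ)) :
    Tendsto (fun x => x * F x) atTop (nhds γ) := by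
  rw [Metric.tendsto_atTop]
  intro ε hε
  obtain ⟨X, hX⟩ := Metric.tendsto_atTop.1 h (ε / 8) (by positivity)
  have hb : ∀ x, max X 1 ≤ x → (γ - ε / 8) * x ≤ G x ∧ G x ≤ (γ + ε / 8) * x := fun x hx => by
    have hx0 : 0 < x := one_pos.trans_le ((le_max_right _ _).trans hx)
    have := hX x ((le_max_left _ _).trans hx)
    rw [Real.dist_eq, abs_lt, one_div_mul_eq_div] at this
    rw [← le_div_iff₀ hx0, ← div_le_iff₀ hx0]
    constructor <;> linarith
  refine ⟨max X 1, fun a ha => ?_⟩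
  have ha0 : 0 < a := one_pos.trans_le ((le_max_right _ _).trans ha)
  have hba := hb a ha
  have bound : ∀ b, a ≤ b →
      (γ - ε / 8) / b - (γ + ε / 8) / a + 2 * ((γ - ε / 8) / a - (γ - ε / 8) / b) ≤ F a - F b ∧
      F a - F b ≤ (γ + ε / 8) / b - (γ - ε / 8) / a + 2 * ((γ + ε / 8) / a - (γ + ε / 8) / b) := by
    intro b hab
    have hb0 : 0 < b := ha0.trans_le hab
    have hne : ∀ y ∈ Icc a b, y ≠ 0 := fun y hy => (ha0.trans_le hy.1).ne'
    have hcq : ∀ c : ℝ, IntervalIntegrable (fun y => 2 * (c / y ^ 2)) volume a b := fun c => by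
      refine ContinuousOn.intervalIntegrable (continuousOn_const.mul
        (continuousOn_const.div (by fun_prop) fun y hy => ?_))
      rw [uIcc_of_le hab] at hy
      exact pow_ne_zero 2 (hne y hy)
    obtain ⟨hI, hE⟩ := integral_mul_eq_of_primitive (f := fun x => 1 / x ^ 2)
      (f' := fun x => -2 / x ^ 3) (g := fun x => x ^ 2 * g x) (H := G) hab
      (fun y hy => by
        have hy0 := hne y hy
        have := (hasDerivAt_pow 2 y).inv (pow_ne_zero 2 hy0)
        simp only [one_div]
        refine this.congr_deriv ?_
        field_simp
        simp
        ring)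
      (continuousOn_const.div (by fun_prop) fun y hy => pow_ne_zero 3 (hne y hy))
      ((hg a b ha0.le hab).continuousOn_mul (by fun_prop))
      (fun y hy => by rw [← hG a y ha0.le hy.1]; ring)
    have hEg : ∫ x in a..b, 1 / x ^ 2 * (x ^ 2 * g x) = F a - F b := by
      rw [hF]
      refine intervalIntegral.integral_congr fun y hy => ?_
      rw [uIcc_of_le hab] at hy
      have := hne y hy
      field_simp
    rw [hEg] at hE
    have hpt : ∀ y ∈ Icc a b, -(2 * ((γ + ε / 8) / y ^ 2)) ≤ -2 / y ^ 3 * G y ∧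
        -2 / y ^ 3 * G y ≤ -(2 * ((γ - ε / 8) / y ^ 2)) := fun y hy => by
      have hy0 : 0 < y := ha0.trans_le hy.1
      have h3 := hb y (ha.trans hy.1)
      have e1 : ∀ c : ℝ, -(2 * (c / y ^ 2)) = -2 / y ^ 3 * (c * y) := fun c => by field_simp
      have e2 : -2 / y ^ 3 ≤ 0 := div_nonpos_of_nonpos_of_nonneg (by norm_num) (by positivity)
      rw [e1, e1]
      exact ⟨mul_le_mul_of_nonpos_left h3.2 e2, mul_le_mul_of_nonpos_left h3.1 e2⟩
    have up := intervalIntegral.integral_mono_on (μ := volume) hab (hcq (γ + ε / 8)).neg hI fun y hy => (hpt y hy).1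
    have lo := intervalIntegral.integral_mono_on (μ := volume) hab hI (hcq (γ - ε / 8)).neg fun y hy => (hpt y hy).2
    simp only [Pi.neg_apply, intervalIntegral.integral_neg, intervalIntegral.integral_const_mul,
      integral_const_div_sq _ ha0 hab] at up lo
    have hbb := hb b (ha.trans hab)
    have q : ∀ c z : ℝ, 0 < z → 1 / z ^ 2 * (c * z) = c / z := fun c z hz => by field_simp
    have q1 : ∀ z c d : ℝ, 0 < z → c * z ≤ d → c / z ≤ 1 / z ^ 2 * d := fun z c d hz hd => by
      rw [← q c z hz]; gcongr
    have q2 : ∀ z c d : ℝ, 0 < z → d ≤ c * z → 1 / z ^ 2 * d ≤ c / z := fun z c d hz hd => by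
      rw [← q c z hz]; gcongr
    have b1 := q1 b _ _ hb0 hbb.1
    have b2 := q2 b _ _ hb0 hbb.2
    have a1 := q1 a _ _ ha0 hba.1
    have a2 := q2 a _ _ ha0 hba.2
    constructor <;> linarith
  have hlim : ∀ c : ℝ, Tendsto (fun b : ℝ => c / b) atTop (nhds 0) :=
    fun c => tendsto_const_nhds.div_atTop tendsto_id
  have hFl := (tendsto_const_nhds (x := F a)).sub hF0
  have lo := le_of_tendsto_of_tendsto (((hlim (γ - ε / 8)).sub_const ((γ + ε / 8) / a)).add
    (((hlim (γ - ε / 8)).const_sub ((γ - ε / 8) / a)).const_mul 2)) hFl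
    ((eventually_ge_atTop a).mono fun b hb' => (bound b hb').1)
  have up := le_of_tendsto_of_tendsto hFl (((hlim (γ + ε / 8)).sub_const ((γ - ε / 8) / a)).add
    (((hlim (γ + ε / 8)).const_sub ((γ + ε / 8) / a)).const_mul 2))
    ((eventually_ge_atTop a).mono fun b hb' => (bound b hb').2)
  have e1 : 0 - (γ + ε / 8) / a + 2 * ((γ - ε / 8) / a - 0) = (γ - 3 * (ε / 8)) / a := by ring
  have e2 : 0 - (γ - ε / 8) / a + 2 * ((γ + ε / 8) / a - 0) = (γ + 3 * (ε / 8)) / a := by ring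
  rw [e1, sub_zero, div_le_iff₀ ha0] at lo
  rw [e2, sub_zero, le_div_iff₀ ha0] at up
  rw [Real.dist_eq, abs_lt]
  constructor <;> linarith

end Averages

lemma ConvUnif.tendsto {u : ℝ → ℝ → ℝ} {Φ : ℝ → ℝ} (h : ConvUnif u Φ) {η : ℝ} (hη : 0 ≤ η) :
    Tendsto (fun t => u (η * √t) t) atTop (nhds (Φ η)) :=
  Metric.tendsto_atTop.2 fun ε hε => (h ε hε).imp fun _ hT t ht => hT t ht η hη

lemma ConvUnif.rayConv {u : ℝ → ℝ → ℝ} {Φ : ℝ → ℝ} (h : ConvUnif u Φ) : RayConv u Φ :=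
  (ae_restrict_iff' measurableSet_Ici).2 (Eventually.of_forall fun _ hη => h.tendsto hη)

namespace CSol
variable {α β ustar : ℝ} {u p w : ℝ → ℝ → ℝ} {pstar : ℝ → ℝ} {γ : ℝ}

lemma Phi_le_ustar (S : CSol α β ustar u p w pstar) (h : ConvUnif u (Phi α β γ)) :
    Phi α β γ α ≤ ustar := by
  obtain ⟨C, -, T, -, hc⟩ := S.exists_ceiling
  have h1 : Tendsto (fun t : ℝ => ustar + C / t) atTop (nhds (ustar + 0)) :=
    (tendsto_const_nhds.div_atTop tendsto_id).const_add _
  rw [add_zero] at h1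
  exact le_of_tendsto_of_tendsto (h.tendsto S.hα.le) h1
    ((eventually_ge_atTop T).mono fun t ht => hc _ t ht)

/-- If the limit profile stays below the threshold at the source, precipitation stops. -/
lemma eventually_p_eq_zero_of_lt (S : CSol α β ustar u p w pstar) (hγ : 0 ≤ γ)
    (h : ConvUnif u (Phi α β γ)) (hlt : Phi α β γ α < ustar) :
    ∃ X, ∀ x t, X ≤ x → 0 ≤ t → p x t = 0 := by
  have hα := S.hα
  have hm0 : 0 < Phi α β γ α := by
    rw [Phi_self]
    exact ustarGamma_pos hα S.hβ hγ
  set c := (Phi α β γ α + ustar) / 2 with hc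
  have hcu : c < ustar := by linarith
  have hc0 : 0 < c := by linarith [S.hu]
  obtain ⟨T, hT⟩ := h (c - Phi α β γ α) (by linarith)
  set T0 := max T 1 with hT0
  have hT1 : 1 ≤ T0 := le_max_right _ _
  have hin : ∀ x t, T0 ≤ t → α * √t ≤ x → u x t ≤ c := fun x t ht hx => by
    have hst : 0 < √t := Real.sqrt_pos.2 (by linarith)
    have h0 : 0 ≤ x / √t := div_nonneg (le_trans (by positivity) hx) hst.le
    have h1 := (abs_lt.1 (hT t ((le_max_left _ _).trans ht) (x / √t) h0)).2
    rw [div_mul_cancel₀ _ hst.ne', Phi_of_ge β γ ((le_div_iff₀ hst).2 hx)] at h1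
    have h2 : ustarGamma α β γ * gaussTail (x / √t) / gaussTail α ≤ Phi α β γ α := by
      rw [Phi_self, div_le_iff₀ (gaussTail_pos α)]
      have h4 : gaussTail (x / √t) ≤ gaussTail α := strictAnti_gaussTail.antitone ((le_div_iff₀ hst).2 hx)
      have := (ustarGamma_pos hα S.hβ hγ).le
      gcongr
    linarith
  obtain ⟨L, hL, hfar⟩ := S.exists_far hc0
  have hL0 : 0 < L := hα.trans hL
  refine ⟨L * √T0, fun x t hX ht => ?_⟩
  have hsT : 0 < √T0 := Real.sqrt_pos.2 (by linarith)
  have hx0 : 0 < x := lt_of_lt_of_le (by positivity) hX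
  have hq0 : 0 < x ^ 2 / α ^ 2 := by positivity
  have hsq : α * √(x ^ 2 / α ^ 2) = x := by
    rw [← div_pow, Real.sqrt_sq (by positivity)]
    field_simp
  have hbefore : ∀ s, 0 ≤ s → s ≤ x ^ 2 / α ^ 2 → u x s ≤ c := fun s hs hsx => by
    rcases hs.eq_or_lt with rfl | hs0
    · rw [S.u_zero]; exact hc0.le
    rcases le_total T0 s with h1 | h1
    · refine hin x s h1 (le_trans ?_ hsq.le)
      gcongr
    · refine (hfar x s hs0 (le_trans ?_ hX)).le
      gcongr
  refine S.p_zero ht hcu fun s hs => ?_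
  rcases le_total s (x ^ 2 / α ^ 2) with h1 | h1
  · exact hbefore s hs.1 h1
  · exact (S.u_anti hq0 le_rfl h1).trans (hbefore _ hq0.le le_rfl)

lemma Phi_self_eq_ustar (S : CSol α β ustar u p w pstar) (hγ : 0 < γ)
    (htail : Tendsto (fun x => x * ∫ ξ in Ioi x, pstar ξ) atTop (nhds γ)) :
    Phi α β γ α = ustar := by
  have h := S.convUnif hγ.le htail
  by_contra hne
  obtain ⟨X, hX⟩ := S.eventually_p_eq_zero_of_lt hγ.le h ((S.Phi_le_ustar h).lt_of_ne hne)
  refine hγ.ne (tendsto_nhds_unique (tendsto_const_nhds.congr' ?_) htail)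
  filter_upwards [eventually_ge_atTop (max X 0)] with x hx
  rw [S.tail_eq_zero hx hX, mul_zero]

lemma tendsto_tail_of_convUnif (S : CSol α β ustar u p w pstar) (hγ : 0 ≤ γ)
    (h : ConvUnif u (Phi α β γ)) :
    Tendsto (fun x => x * ∫ ξ in Ioi x, pstar ξ) atTop (nhds γ) := by
  obtain ⟨γ', hγ', ht⟩ := S.exists_tail_limit_of_rayConv h.rayConv
  have h' := S.convUnif hγ' ht
  rwa [Phi_injective S.hα S.hβ hγ hγ' fun η hη => tendsto_nhds_unique (h.tendsto hη) (h'.tendsto hη)]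

lemma tendsto_average_iff (S : CSol α β ustar u p w pstar) :
    Tendsto (fun x => 1 / x * ∫ ξ in Ioc (0:ℝ) x, ξ ^ 2 * pstar ξ) atTop (nhds γ) ↔
      Tendsto (fun x => x * ∫ ξ in Ioi x, pstar ξ) atTop (nhds γ) := by
  have hg : ∀ a b, 0 ≤ a → a ≤ b → IntervalIntegrable pstar volume a b :=
    fun a b _ _ => S.pstar_intervalIntegrable a b
  have hF := fun a b => S.tail_sub a b
  have hG : ∀ a b : ℝ, 0 ≤ a → a ≤ b → (∫ ξ in Ioc (0:ℝ) b, ξ ^ 2 * pstar ξ) -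
      (∫ ξ in Ioc (0:ℝ) a, ξ ^ 2 * pstar ξ) = ∫ x in a..b, x ^ 2 * pstar x := fun a b ha hab => by
    have hI : ∀ c d : ℝ, IntervalIntegrable (fun x => x ^ 2 * pstar x) volume c d := fun c d =>
      (S.pstar_intervalIntegrable c d).continuousOn_mul (by fun_prop)
    rw [← intervalIntegral.integral_of_le ha, ← intervalIntegral.integral_of_le (ha.trans hab)]
    exact intervalIntegral.integral_interval_sub_left (hI _ _) (hI _ _)
  exact ⟨tendsto_tail_of_tendsto_average hg hF S.tendsto_tail hG,
    tendsto_average_of_tendsto_tail hg hF hG⟩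

end CSol

/-- summary of the long-time behavior: the equivalence of the
averaged second-moment condition, the tail condition, uniform convergence to `Φ_γ`, and
pointwise a.e. convergence to some limit profile. -/
theorem hhmo_convergence_conclusion (α β ustar : ℝ) (hα : 0 < α) (hβ : 0 < β)
    (hu : 0 < ustar) (hsub : ustar < PsiP α β α)
    (u p : ℝ → ℝ → ℝ) (hsol : IsWeakSolution α β ustar u p)
    (pstar : ℝ → ℝ) (hP : CondP α p pstar) :
    (∀ γ : ℝ, 0 ≤ γ →
      (Filter.Tendsto (fun x : ℝ => (1 / x) * ∫ ξ in Set.Ioc (0:ℝ) x, ξ ^ 2 * pstar ξ)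
          Filter.atTop (nhds γ) ↔
        Filter.Tendsto (fun x : ℝ => x * ∫ ξ in Set.Ioi x, pstar ξ)
          Filter.atTop (nhds γ)) ∧
      (Filter.Tendsto (fun x : ℝ => x * ∫ ξ in Set.Ioi x, pstar ξ)
          Filter.atTop (nhds γ) ↔
        (ConvUnif u (Phi α β γ) ∧
          (0 < γ → Phi α β γ α = ustar) ∧
          (γ = 0 → 0 < Phi α β γ α ∧ Phi α β γ α ≤ ustar)))) ∧
    ((∃ γ : ℝ, 0 ≤ γ ∧
        Filter.Tendsto (fun x : ℝ => (1 / x) * ∫ ξ in Set.Ioc (0:ℝ) x, ξ ^ 2 * pstar ξ)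
          Filter.atTop (nhds γ)) ↔
      (∃ V : ℝ → ℝ, ∀ᵐ η ∂(volume.restrict (Set.Ici (0:ℝ))),
        Filter.Tendsto (fun t => u (η * Real.sqrt t) t) Filter.atTop (nhds (V η)))) := by
  obtain ⟨w, S⟩ := hsol.sol hα hβ
  have H : HSol α β ustar u p w pstar :=
    { toSol := S
      hu := hu
      hsub := hsub
      p_even := hsol.2.1
      pcond := hsol.2.2.2.1
      condP := hP }
  set q : ℝ → ℝ := fun x => max 0 (min 1 (pstar x)) with hq
  have C : CSol α β ustar u p w q := H.clamp
  have hav : (fun x : ℝ => (1 / x) * ∫ ξ in Set.Ioc (0:ℝ) x, ξ ^ 2 * pstar ξ) =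
      fun x : ℝ => (1 / x) * ∫ ξ in Set.Ioc (0:ℝ) x, ξ ^ 2 * q ξ := by
    funext x
    congr 1
    refine integral_congr_ae ?_
    filter_upwards [ae_restrict_of_ae_restrict_of_subset Ioc_subset_Ioi_self H.ae_clamp] with y hy
    rw [hq]
    simp only [hy]
  have htl : (fun x : ℝ => x * ∫ ξ in Set.Ioi x, pstar ξ) =ᶠ[atTop]
      fun x : ℝ => x * ∫ ξ in Set.Ioi x, q ξ := by
    filter_upwards [eventually_ge_atTop 0] with x hx
    congr 1
    refine integral_congr_ae ?_
    filter_upwards [ae_restrict_of_ae_restrict_of_subset (Ioi_subset_Ioi hx) H.ae_clamp] with y hy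
    rw [hq]
    simp only [hy]
  simp only [hav, tendsto_congr' htl, C.tendsto_average_iff]
  refine ⟨fun γ hγ => ⟨trivial, fun h => ?_, fun h => C.tendsto_tail_of_convUnif hγ h.1⟩, ?_, ?_⟩
  · have hc := C.convUnif hγ h
    exact ⟨hc, fun h0 => C.Phi_self_eq_ustar h0 h,
      fun _ => ⟨Phi_pos hα hβ hγ hα, C.Phi_le_ustar hc⟩⟩
  · rintro ⟨γ, hγ, h⟩
    exact ⟨_, (C.convUnif hγ h).rayConv⟩
  · rintro ⟨V, hV⟩
    exact C.exists_tail_limit_of_rayConv hV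

end
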